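/- For every integer d ≥ 3 and every θ ∈ (0,1), there exists a nonnegative measurable function f on ℝ^d with ‖f‖_{L^{p_θ}(ℝ^d)} = 1 and ‖Xf‖_{L^{q_θ}_t L^{r_θ}_y} = A_θ; that is, the restricted X-ray transform X : L^{p_θ} → L^{q_θ}_t L^{r_θ}_y possesses an extremizer. -/

import Mathlib

open MeasureTheory ENNReal Set Filter
noncomputable section

/-- Points of `ℝ^d` written as `(s, x)` with `s ∈ ℝ`, `x ∈ ℝ^(d-1)` (here `n = d-1`). -/
abbrev Pt (n : ℕ) := ℝ × (Fin n → ℝ)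

/-- The moment curve `γ(t) = (t, t², …, t^n)` in `ℝ^n`. -/
def mom (n : ℕ) (t : ℝ) : Fin n → ℝ := fun i => t ^ (i.1 + 1)

/-- The restricted X-ray transform `Xf(t,y) = ∫ f(s, y + s·γ(t)) ds` of a
nonnegative function `f` on `ℝ^d`. -/
def Xray (n : ℕ) (f : Pt n → ℝ) (z : Pt n) : ℝ≥0∞ :=
  ∫⁻ s : ℝ, ENNReal.ofReal (f (s, z.2 + s • mom n z.1))

/-- Mixed norm `‖g‖_{L^q_t L^r_y}` for an `ℝ≥0∞`-valued function on `ℝ × Y`. -/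
def mixedNormG {Y : Type*} [MeasurableSpace Y] (ν : Measure Y) (q r : ℝ)
    (g : ℝ × Y → ℝ≥0∞) : ℝ≥0∞ :=
  (∫⁻ t : ℝ, (∫⁻ y, g (t, y) ^ r ∂ν) ^ (q / r)) ^ (1 / q)

/-- Mixed norm `‖g‖_{L^q_t L^r_y}` on `ℝ^d = ℝ × ℝ^(d-1)`, `ℝ≥0∞`-valued functions. -/
def mixedNorm (n : ℕ) (q r : ℝ) (g : Pt n → ℝ≥0∞) : ℝ≥0∞ :=
  mixedNormG volume q r g

/-- Mixed norm of a real-valued function. -/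
def mixedNormR (n : ℕ) (q r : ℝ) (g : Pt n → ℝ) : ℝ≥0∞ :=
  mixedNorm n q r fun z => ENNReal.ofReal |g z|

/-- The `L^p` norm of a real-valued function on `ℝ^d`. -/
def LpN (n : ℕ) (p : ℝ) (f : Pt n → ℝ) : ℝ≥0∞ :=
  (∫⁻ z : Pt n, ENNReal.ofReal |f z| ^ p) ^ (1 / p)

/-- The `L^p` norm restricted to a set. -/
def LpNOn (n : ℕ) (p : ℝ) (f : Pt n → ℝ) (S : Set (Pt n)) : ℝ≥0∞ :=
  (∫⁻ z in S, ENNReal.ofReal |f z| ^ p) ^ (1 / p)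

/-- `p_θ`, defined by `1/p_θ = 1 - θ + θd/(d+2)`. -/
def pExp (d : ℕ) (θ : ℝ) : ℝ := (1 - θ + θ * d / (d + 2))⁻¹

/-- `q_θ`, defined by `1/q_θ = θd/(d+2)`. -/
def qExp (d : ℕ) (θ : ℝ) : ℝ := (θ * d / (d + 2))⁻¹

/-- `r_θ`, defined by `1/r_θ = 1 - θ + θ(d²-d-2)/(d²+d-2)`. -/
def rExp (d : ℕ) (θ : ℝ) : ℝ :=
  (1 - θ + θ * ((d:ℝ)^2 - d - 2) / ((d:ℝ)^2 + d - 2))⁻¹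

/-- Dual exponent `p' = p/(p-1)`. -/
def dualExp (p : ℝ) : ℝ := p / (p - 1)

/-- `θ₀ = (d²+d-2)/(d²+d)`, the exponent where `q_θ = r_θ`. -/
def theta0 (d : ℕ) : ℝ := ((d:ℝ)^2 + d - 2) / ((d:ℝ)^2 + d)

/-- The mixed norm `‖Xf‖_{L^{q_θ}_t L^{r_θ}_y}`. -/
def XNorm (d : ℕ) (θ : ℝ) (f : Pt (d-1) → ℝ) : ℝ≥0∞ :=
  mixedNorm (d-1) (qExp d θ) (rExp d θ) (Xray (d-1) f)

/-- The source norm `‖f‖_{L^{p_θ}}`. -/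
def srcNorm (d : ℕ) (θ : ℝ) (f : Pt (d-1) → ℝ) : ℝ≥0∞ := LpN (d-1) (pExp d θ) f

/-- The dual mixed norm `‖g‖_{L^{q_θ'}_t L^{r_θ'}_y}`. -/
def dualNorm (d : ℕ) (θ : ℝ) (g : Pt (d-1) → ℝ) : ℝ≥0∞ :=
  mixedNormR (d-1) (dualExp (qExp d θ)) (dualExp (rExp d θ)) g

/-- The operator norm `A_θ` of `X : L^{p_θ} → L^{q_θ}_t L^{r_θ}_y` (restricted to
nonnegative functions). -/
def Aconst (d : ℕ) (θ : ℝ) : ℝ≥0∞ :=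
  sSup { M | ∃ f : Pt (d-1) → ℝ, Measurable f ∧ 0 ≤ f ∧
    srcNorm d θ f = 1 ∧ M = XNorm d θ f }

/-- The bilinear pairing `𝒳(f,g) = ∫ Xf · g`. -/
def pairing (n : ℕ) (f g : Pt n → ℝ) : ℝ≥0∞ :=
  ∫⁻ z : Pt n, Xray n f z * ENNReal.ofReal (g z)

/-- Indicator function of a set, as a real-valued function. -/
def ind (n : ℕ) (E : Set (Pt n)) : Pt n → ℝ := E.indicator fun _ => (1:ℝ)

/-- `𝒳(E,F) = ∫ X1_E · 1_F`. -/
def pairSet (n : ℕ) (E F : Set (Pt n)) : ℝ≥0∞ := pairing n (ind n E) (ind n F)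

/-- Dyadic level set `E_j = {z : 2^j ≤ f(z) < 2^(j+1)}`. -/
def lev (n : ℕ) (f : Pt n → ℝ) (j : ℤ) : Set (Pt n) :=
  {z | (2:ℝ) ^ j ≤ f z ∧ f z < (2:ℝ) ^ (j + 1)}

/-- The measure of the slice `{y : (t,y) ∈ F}`. -/
def sliceVol (n : ℕ) (F : Set (Pt n)) (t : ℝ) : ℝ≥0∞ :=
  volume {y : Fin n → ℝ | (t, y) ∈ F}

/-- `F_k^l = F_k ∩ π⁻¹{t : 2^l ≤ |{y : (t,y) ∈ F_k}| < 2^(l+1)}` where `F_k` is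
the `k`-th level set of `g`. -/
def Fkl (n : ℕ) (g : Pt n → ℝ) (k l : ℤ) : Set (Pt n) :=
  lev n g k ∩ {z | (2:ℝ≥0∞) ^ l ≤ sliceVol n (lev n g k) z.1 ∧
    sliceVol n (lev n g k) z.1 < (2:ℝ≥0∞) ^ (l + 1)}

/-- `F_{kl}^m`: the `k`-th level set of `g`, restricted to `t` with
`2^l ≤ ∫ g(t,y)^{r'} dy < 2^(l+1)` and `2^m ≤ |{y : (t,y) ∈ F_k}| < 2^(m+1)`. -/
def Fklm (n : ℕ) (r' : ℝ) (g : Pt n → ℝ) (k l m : ℤ) : Set (Pt n) :=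
  lev n g k ∩
  {z | (2:ℝ≥0∞) ^ l ≤ (∫⁻ y, ENNReal.ofReal (g (z.1, y)) ^ r') ∧
    (∫⁻ y, ENNReal.ofReal (g (z.1, y)) ^ r') < (2:ℝ≥0∞) ^ (l + 1)} ∩
  {z | (2:ℝ≥0∞) ^ m ≤ sliceVol n (lev n g k) z.1 ∧
    sliceVol n (lev n g k) z.1 < (2:ℝ≥0∞) ^ (m + 1)}

/-- The lower-triangular matrix `G_{t₀}` with entries `C(m,i)·t₀^(m-i)`, acting on `ℝ^(d-1)`. -/
def Gmat (n : ℕ) (t₀ : ℝ) (x : Fin n → ℝ) : Fin n → ℝ := fun m =>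
  ∑ i ∈ Finset.univ.filter (fun i : Fin n => i ≤ m),
    ((Nat.choose (m.1+1) (i.1+1)) : ℝ) * t₀ ^ (m.1 - i.1) * x i

/-- The symmetry group `G_d` of the restricted X-ray transform, with the (constant)
Jacobian determinant carried along: `IsSymJ n φ J` means `φ ∈ G_d` with Jacobian `J`. -/
inductive IsSymJ (n : ℕ) : (Pt n → Pt n) → ℝ → Prop
  | translation (v : Fin n → ℝ) : IsSymJ n (fun p => (p.1, p.2 + v)) 1
  | scaling (α β : ℝ) (hα : 0 < α) (hβ : 0 < β) :
      IsSymJ n (fun p => (α * p.1, fun i => α * β ^ (i.1 + 1) * p.2 i))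
        (α ^ (n+1) * β ^ (n * (n+1) / 2))
  | shift (s₀ t₀ : ℝ) :
      IsSymJ n (fun p => (p.1 + s₀, Gmat n t₀ p.2 + (p.1 + s₀) • mom n t₀)) 1
  | comp (φ ψ : Pt n → Pt n) (J₁ J₂ : ℝ) :
      IsSymJ n φ J₁ → IsSymJ n ψ J₂ → IsSymJ n (φ ∘ ψ) (J₁ * J₂)

/-- The `L^p`-normalized action `φ*f = J^(1/p) · (f ∘ φ)` of a symmetry on functions. -/
def symAct (n : ℕ) (p : ℝ) (J : ℝ) (φ : Pt n → Pt n) (f : Pt n → ℝ) : Pt n → ℝ :=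
  fun z => J ^ (1/p) * f (φ z)

/-- Lorentz norm `‖h‖_{L^{p,s}}` (up to equivalence), via dyadic level sets. -/
def lorentzNorm {α : Type*} [MeasurableSpace α] (μ : Measure α) (p s : ℝ)
    (h : α → ℝ≥0∞) : ℝ≥0∞ :=
  (∑' j : ℤ, ((2:ℝ≥0∞) ^ j *
      μ {z | (2:ℝ≥0∞) ^ j ≤ h z ∧ h z < (2:ℝ≥0∞) ^ (j+1)} ^ (1/p)) ^ s) ^ (1/s)

/-- Weak `L^{p,∞}` norm. -/
def weakNorm {α : Type*} [MeasurableSpace α] (μ : Measure α) (p : ℝ)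
    (h : α → ℝ≥0∞) : ℝ≥0∞ :=
  ⨆ l : ℝ≥0∞, l * μ {z | l < h z} ^ (1/p)

/-- Mixed Lorentz norm `‖g‖_{L^{q,s}_t L^r_y}` (up to equivalence). -/
def mixedLorentzG {Y : Type*} [MeasurableSpace Y] (ν : Measure Y) (q s r : ℝ)
    (g : ℝ × Y → ℝ≥0∞) : ℝ≥0∞ :=
  (∑' l : ℤ, (mixedNormG ν q r
      (Set.indicator {z : ℝ × Y | (2:ℝ≥0∞) ^ l ≤ (∫⁻ y, g (z.1, y) ^ r ∂ν) ∧
        (∫⁻ y, g (z.1, y) ^ r ∂ν) < (2:ℝ≥0∞) ^ (l+1)} g)) ^ s) ^ (1/s)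

/-- Weak mixed norm `‖g‖_{L^{q,∞}_t L^r_y}`. -/
def weakMixedG {Y : Type*} [MeasurableSpace Y] (ν : Measure Y) (q r : ℝ)
    (g : ℝ × Y → ℝ≥0∞) : ℝ≥0∞ :=
  ⨆ l : ℝ≥0∞, l * (volume {t : ℝ | l < (∫⁻ y, g (t, y) ^ r ∂ν) ^ (1/r)}) ^ (1/q)

/-- The paraball `B(s₀,t₀,ȳ,α,β)`. -/
def paraball (n : ℕ) (s₀ t₀ : ℝ) (ybar : Fin n → ℝ) (α β : ℝ) : Set (Pt n) :=
  {z | |z.1 - s₀| < α ∧ ∀ m : Fin n,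
    |(∑ i ∈ Finset.univ.filter (fun i : Fin n => i ≤ m),
        ((Nat.choose (m.1+1) (i.1+1)) : ℝ) * (-t₀) ^ (m.1 - i.1) *
          (z.2 i - (ybar + s₀ • mom n t₀) i))
      + (-t₀) ^ (m.1+1) * (z.1 + s₀)| ≤ β ^ (m.1+1) * α}

/-- The dual paraball `B*(s₀,t₀,ȳ,α,β)`. -/
def dualParaball (n : ℕ) (s₀ t₀ : ℝ) (ybar : Fin n → ℝ) (α β : ℝ) : Set (Pt n) :=
  {z | |z.1 - t₀| < β ∧ ∀ m : Fin n,
    |(∑ i ∈ Finset.univ.filter (fun i : Fin n => i ≤ m),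
        ((Nat.choose (m.1+1) (i.1+1)) : ℝ) * (-t₀) ^ (m.1 - i.1) * (z.2 i - ybar i))
      + s₀ * (z.1 ^ (m.1+1) + (-t₀) ^ (m.1+1))| ≤ β ^ (m.1+1) * α}

/-- The mock-distance between two paraballs. -/
def mockDist (n : ℕ) (sa ta : ℝ) (ya : Fin n → ℝ) (aa ba : ℝ)
    (sb tb : ℝ) (yb : Fin n → ℝ) (ab bb : ℝ) : ℝ :=
  (max (aa ^ n * ba ^ (n * (n+1) / 2)) (ab ^ n * bb ^ (n * (n+1) / 2)) /
    min (aa ^ n * ba ^ (n * (n+1) / 2)) (ab ^ n * bb ^ (n * (n+1) / 2)))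
  + (aa / ab + ab / aa) + (ba / bb + bb / ba)
  + |sa - sb| * (1/aa + 1/ab) + |ta - tb| * (1/ba + 1/bb)
  + ∑ m : Fin n,
      |(∑ i ∈ Finset.univ.filter (fun i : Fin n => i ≤ m),
          ((Nat.choose (m.1+1) (i.1+1)) : ℝ) * (-ta) ^ (m.1 - i.1) *
            ((yb + sb • mom n tb) i - (ya + sa • mom n ta) i))
        + (-ta) ^ (m.1+1) * (sb + sa)| / (aa * ba ^ (m.1+1))
  + ∑ m : Fin n,
      |(∑ i ∈ Finset.univ.filter (fun i : Fin n => i ≤ m),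
          ((Nat.choose (m.1+1) (i.1+1)) : ℝ) * (-tb) ^ (m.1 - i.1) *
            ((ya + sa • mom n ta) i - (yb + sb • mom n tb) i))
        + (-tb) ^ (m.1+1) * (sa + sb)| / (ab * bb ^ (m.1+1))
  + ∑ m : Fin n,
      |(∑ i ∈ Finset.univ.filter (fun i : Fin n => i ≤ m),
          ((Nat.choose (m.1+1) (i.1+1)) : ℝ) * (-sa) ^ (m.1 - i.1) * (yb i - ya i))
        + sa * (tb ^ (m.1+1) + (-ta) ^ (m.1+1))| / (aa * ba ^ (m.1+1))
  + ∑ m : Fin n,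
      |(∑ i ∈ Finset.univ.filter (fun i : Fin n => i ≤ m),
          ((Nat.choose (m.1+1) (i.1+1)) : ℝ) * (-sb) ^ (m.1 - i.1) * (ya i - yb i))
        + sb * (ta ^ (m.1+1) + (-tb) ^ (m.1+1))| / (ab * bb ^ (m.1+1))

section

lemma ms_and {α : Type*} [MeasurableSpace α] {p q : α → Prop} (hp : MeasurableSet {a | p a})
    (hq : MeasurableSet {a | q a}) : MeasurableSet {a | p a ∧ q a} := by
  rw [Set.ofPred_and]; exact hp.inter hq

def vv (n : ℕ) (t : ℝ) : Pt n := (1, mom n t)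
def pr (n : ℕ) (t : ℝ) (z : Pt n) : Fin n → ℝ := z.2 - z.1 • mom n t
def XE (n : ℕ) (f : Pt n → ℝ≥0∞) (x : Pt n) : ℝ≥0∞ := ∫⁻ s : ℝ, f (s, x.2 + s • mom n x.1)

@[fun_prop] lemma continuous_mom (n : ℕ) : Continuous (mom n) := by
  unfold mom; fun_prop
@[fun_prop] lemma measurable_mom (n : ℕ) : Measurable (mom n) := (continuous_mom n).measurable
@[fun_prop] lemma continuous_vv (n : ℕ) : Continuous (vv n) := by
  unfold vv; fun_prop
@[fun_prop] lemma measurable_vv (n : ℕ) : Measurable (vv n) := (continuous_vv n).measurable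

@[fun_prop] lemma measurable_pr (n : ℕ) : Measurable (fun x : ℝ × Pt n => pr n x.1 x.2) := by
  unfold pr; fun_prop
@[fun_prop] lemma measurable_pr_right (n : ℕ) (t : ℝ) : Measurable (pr n t) := by
  unfold pr; fun_prop

lemma pr_add_smul (n : ℕ) (t w : ℝ) (z : Pt n) : pr n t (z + w • vv n t) = pr n t z := by
  ext i; simp [pr, vv]; ring

@[fun_prop] lemma measurable_XE {n : ℕ} {f : Pt n → ℝ≥0∞} (hf : Measurable f) :
    Measurable (XE n f) := by
  unfold XE
  apply Measurable.lintegral_prod_right' (f := fun p : Pt n × ℝ => f (p.2, p.1.2 + p.2 • mom n p.1.1))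
  fun_prop

lemma XE_pr {n : ℕ} (f : Pt n → ℝ≥0∞) (t : ℝ) (z : Pt n) :
    XE n f (t, pr n t z) = ∫⁻ w : ℝ, f (z + w • vv n t) := by
  unfold XE
  rw [← lintegral_add_left_eq_self _ z.1]
  congr 1; ext s; congr 1
  ext i <;> simp [pr, vv]; ring

lemma lintegral_lines {n : ℕ} {f : Pt n → ℝ≥0∞} (hf : Measurable f) (t : ℝ) :
    ∫⁻ z, f z = ∫⁻ y, XE n f (t, y) := by
  unfold XE
  rw [lintegral_lintegral_swap (by fun_prop), Measure.volume_eq_prod, lintegral_prod _ (by fun_prop)]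
  congr 1; ext s
  simp only
  rw [lintegral_add_right_eq_self (fun y => f (s, y))]

lemma XE_mono {n : ℕ} {f g : Pt n → ℝ≥0∞} (h : f ≤ g) : XE n f ≤ XE n g :=
  fun _ => lintegral_mono fun _ => h _

lemma XE_congr_ae {n : ℕ} {f g : Pt n → ℝ≥0∞} (hf : Measurable f) (hg : Measurable g)
    (h : f =ᵐ[volume] g) (t : ℝ) : (fun y => XE n f (t,y)) =ᵐ[volume] fun y => XE n g (t,y) := by
  have h0 : ∫⁻ z, (if f z = g z then 0 else 1 : ℝ≥0∞) = 0 := by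
    rw [lintegral_eq_zero_iff' ]
    · filter_upwards [h] with z hz; simp [hz]
    · exact (Measurable.ite (measurableSet_eq_fun hf hg) (by fun_prop) (by fun_prop)).aemeasurable
  have hm : Measurable (fun z => (if f z = g z then 0 else 1 : ℝ≥0∞)) := 
    (Measurable.ite (measurableSet_eq_fun hf hg) (by fun_prop) (by fun_prop))
  rw [lintegral_lines hm t, lintegral_eq_zero_iff (by fun_prop)] at h0
  filter_upwards [h0] with y hy
  unfold XE at hy ⊢
  simp only [Pi.zero_apply] at hy
  replace hy := (lintegral_eq_zero_iff (hm.comp (f := fun s : ℝ => ((s, y + s • mom n t) : Pt n)) (by fun_prop))).1 hy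
  apply lintegral_congr_ae
  filter_upwards [hy] with s hs
  by_contra hne
  simp [hne] at hs

/-- Fubini for `Fin (m+1) → α`. -/
lemma lintegral_fin_succ {α : Type*} [MeasureSpace α] [SigmaFinite (volume : Measure α)] {m : ℕ}
    {F : (Fin (m+1) → α) → ℝ≥0∞} (hF : Measurable F) :
    ∫⁻ u, F u = ∫⁻ a : α, ∫⁻ u : Fin m → α, F (Fin.cons a u) := by
  have h := (volume_preserving_piFinSuccAbove (fun _ : Fin (m+1) => α) 0).symm
  rw [← h.lintegral_comp hF, Measure.volume_eq_prod, lintegral_prod]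
  · simp [MeasurableEquiv.piFinSuccAbove, Fin.insertNthEquiv]
  · exact (hF.comp h.measurable).aemeasurable

@[fun_prop] lemma measurable_cons {α : Type*} [MeasurableSpace α] {m : ℕ} :
    Measurable (fun p : α × (Fin m → α) => (Fin.cons p.1 p.2 : Fin (m+1) → α)) := by
  rw [measurable_pi_iff]
  intro i
  refine Fin.cases ?_ (fun j => ?_) i
  · simpa using measurable_fst
  · simp only [Fin.cons_succ]; fun_prop

end

section

lemma oneD {A : Set ℝ} {b : ℝ} (hb : 0 < b)
    (hB : MeasurableSet {t | t ∈ A ∧ volume {t' | t + b ≤ t' ∧ t' ∈ A} < ENNReal.ofReal (3*b)}) :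
    volume {t | t ∈ A ∧ volume {t' | t + b ≤ t' ∧ t' ∈ A} < ENNReal.ofReal (3*b)}
      ≤ ENNReal.ofReal (4*b) := by
  by_contra hcon
  push Not at hcon
  obtain ⟨K, hKB, hK, hlt⟩ := hB.exists_lt_isCompact hcon
  have hne : K.Nonempty := by
    rw [nonempty_iff_ne_empty]; rintro rfl; simp at hlt
  have hm := hK.sInf_mem hne
  set t := sInf K
  have h1 := (hKB hm).2
  have hsub : K ⊆ Icc t (t+b) ∪ {t' | t + b ≤ t' ∧ t' ∈ A} := by
    intro x hx
    have : t ≤ x := csInf_le hK.bddBelow hx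
    rcases le_total x (t+b) with h | h
    · left; exact ⟨this, h⟩
    · right; exact ⟨h, (hKB hx).1⟩
  have h2 := (measure_mono hsub).trans (measure_union_le (μ := volume) _ _)
  rw [Real.volume_Icc] at h2
  have h3 : ENNReal.ofReal (4*b) = ENNReal.ofReal (t + b - t) + ENNReal.ofReal (3*b) := by
    rw [← ENNReal.ofReal_add (by linarith) (by linarith)]; congr 1; ring
  rw [h3] at hlt
  have := hlt.trans_le (h2.trans (add_le_add le_rfl h1.le))
  exact lt_irrefl _ this

def fW (n : ℕ) (I : Set (ℝ × Pt n)) (x : ℝ × Pt n) : ℝ≥0∞ :=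
  volume {w : ℝ | (x.1, x.2 + w • vv n x.1) ∈ I}
def fT (n : ℕ) (b : ℝ) (I : Set (ℝ × Pt n)) (x : ℝ × Pt n) : ℝ≥0∞ :=
  volume {t' : ℝ | x.1 + b ≤ t' ∧ (t', x.2) ∈ I}
def prn (n : ℕ) (a b : ℝ) (I : Set (ℝ × Pt n)) : Set (ℝ × Pt n) :=
  {x | x ∈ I ∧ ENNReal.ofReal a ≤ fW n I x ∧ ENNReal.ofReal (3*b) ≤ fT n b I x}

lemma measurable_fW {n : ℕ} {I : Set (ℝ × Pt n)} (hI : MeasurableSet I) : Measurable (fW n I) := by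
  have : MeasurableSet {p : (ℝ × Pt n) × ℝ | (p.1.1, p.1.2 + p.2 • vv n p.1.1) ∈ I} :=
    (show Measurable (fun p : (ℝ × Pt n) × ℝ => (p.1.1, p.1.2 + p.2 • vv n p.1.1)) by fun_prop) hI
  exact measurable_measure_prodMk_left this

lemma measurable_fT {n : ℕ} {b : ℝ} {I : Set (ℝ × Pt n)} (hI : MeasurableSet I) :
    Measurable (fT n b I) := by
  have : MeasurableSet {p : (ℝ × Pt n) × ℝ | p.1.1 + b ≤ p.2 ∧ (p.2, p.1.2) ∈ I} :=
    ms_and (measurableSet_le (by fun_prop) (by fun_prop))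
    ((show Measurable (fun p : (ℝ × Pt n) × ℝ => (p.2, p.1.2)) by fun_prop) hI)
  exact measurable_measure_prodMk_left this

lemma measurableSet_prn {n : ℕ} {a b : ℝ} {I : Set (ℝ × Pt n)} (hI : MeasurableSet I) :
    MeasurableSet (prn n a b I) :=
  hI.inter ((measurableSet_le measurable_const (measurable_fW hI)).inter
    (measurableSet_le measurable_const (measurable_fT hI)))

lemma prn_subset {n : ℕ} {a b : ℝ} {I : Set (ℝ × Pt n)} : prn n a b I ⊆ I := fun _ h => h.1

lemma vol_lines {n : ℕ} {S : Set (ℝ × Pt n)} (hS : MeasurableSet S) :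
    volume S = ∫⁻ x : Pt n, volume {s : ℝ | (x.1, ((s, x.2 + s • mom n x.1) : Pt n)) ∈ S} := by
  have hm : Measurable (fun p : Pt n × ℝ => (p.1.1, ((p.2, p.1.2 + p.2 • mom n p.1.1) : Pt n))) := by
    fun_prop
  have hm2 := measurable_measure_prodMk_left (ν := (volume : Measure ℝ)) (hm hS)
  rw [Measure.volume_eq_prod, Measure.prod_apply hS, Measure.volume_eq_prod]
  refine Eq.trans ?_ (lintegral_prod _ hm2.aemeasurable).symm
  congr 1; ext t
  have h1 : MeasurableSet (Prod.mk t ⁻¹' S) := measurable_prodMk_left hS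
  rw [← lintegral_indicator_one h1, ← Measure.volume_eq_prod, lintegral_lines (measurable_one.indicator h1) t]
  congr 1; ext y
  unfold XE
  rw [← lintegral_indicator_one]
  · rfl
  · exact (show Measurable (fun s : ℝ => (t, ((s, y + s • mom n t) : Pt n))) by fun_prop) hS

lemma vol_tfib {n : ℕ} {S : Set (ℝ × Pt n)} (hS : MeasurableSet S) :
    volume S = ∫⁻ z : Pt n, volume {t : ℝ | (t, z) ∈ S} := by
  rw [Measure.volume_eq_prod, Measure.prod_apply_symm hS]; rfl

lemma badW {n : ℕ} {a : ℝ} {I : Set (ℝ × Pt n)} (hI : MeasurableSet I) {F : Set (Pt n)}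
    (hF : MeasurableSet F) (hIF : ∀ x ∈ I, (x.1, pr n x.1 x.2) ∈ F) :
    volume {x | x ∈ I ∧ fW n I x < ENNReal.ofReal a} ≤ ENNReal.ofReal a * volume F := by
  have hS : MeasurableSet {x | x ∈ I ∧ fW n I x < ENNReal.ofReal a} :=
    hI.inter (measurableSet_lt (measurable_fW hI) measurable_const)
  rw [vol_lines hS, ← lintegral_indicator_one hF, ← lintegral_const_mul _ (measurable_one.indicator hF)]
  refine lintegral_mono fun x => ?_
  obtain ⟨t, y⟩ := x
  simp only
  rcases eq_empty_or_nonempty {s : ℝ | (t, ((s, y + s • mom n t) : Pt n)) ∈ {x | x ∈ I ∧ fW n I x < ENNReal.ofReal a}} with h | ⟨s, hs⟩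
  · rw [h]; simp
  · have h1 := hIF _ hs.1
    have h2 : pr n t ((s, y + s • mom n t) : Pt n) = y := by ext i; simp [pr]
    simp only [h2] at h1
    rw [indicator_of_mem h1]
    simp only [Pi.one_apply, mul_one]
    refine le_trans ?_ hs.2.le
    simp only [fW]
    rw [← measure_preimage_add volume s]
    apply measure_mono
    rintro w ⟨hw, -⟩
    simp only [mem_ofPred_eq] at hw ⊢
    convert hw using 2
    ext i <;> simp [vv]
    ring

lemma badT {n : ℕ} {b : ℝ} (hb : 0 < b) {I : Set (ℝ × Pt n)} (hI : MeasurableSet I) {E : Set (Pt n)}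
    (hE : MeasurableSet E) (hIE : ∀ x ∈ I, x.2 ∈ E) :
    volume {x | x ∈ I ∧ fT n b I x < ENNReal.ofReal (3*b)} ≤ ENNReal.ofReal (4*b) * volume E := by
  have hS : MeasurableSet {x | x ∈ I ∧ fT n b I x < ENNReal.ofReal (3*b)} :=
    hI.inter (measurableSet_lt (measurable_fT hI) measurable_const)
  rw [vol_tfib hS, ← lintegral_indicator_one hE, ← lintegral_const_mul _ (measurable_one.indicator hE)]
  refine lintegral_mono fun z => ?_
  by_cases hz : z ∈ E
  · rw [indicator_of_mem hz]
    simp only [Pi.one_apply, mul_one]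
    have := oneD (A := {t | (t,z) ∈ I}) hb (measurable_prodMk_right hS)
    exact this
  · have : {t : ℝ | (t, z) ∈ {x | x ∈ I ∧ fT n b I x < ENNReal.ofReal (3*b)}} = ∅ := by
      ext t; simp only [mem_ofPred_eq, mem_empty_iff_false, iff_false, not_and]
      intro h; exact absurd (hIE _ h) hz
    rw [this]; simp

lemma vol_prn {n : ℕ} {a b : ℝ} (hb : 0 < b) {I : Set (ℝ × Pt n)} (hI : MeasurableSet I)
    {E F : Set (Pt n)} (hE : MeasurableSet E) (hF : MeasurableSet F) (hIE : ∀ x ∈ I, x.2 ∈ E)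
    (hIF : ∀ x ∈ I, (x.1, pr n x.1 x.2) ∈ F) :
    volume I ≤ volume (prn n a b I) +
      (ENNReal.ofReal a * volume F + ENNReal.ofReal (4*b) * volume E) := by
  have hsub : I ⊆ prn n a b I ∪ ({x | x ∈ I ∧ fW n I x < ENNReal.ofReal a} ∪
      {x | x ∈ I ∧ fT n b I x < ENNReal.ofReal (3*b)}) := by
    intro x hx
    by_cases h1 : fW n I x < ENNReal.ofReal a
    · right; left; exact ⟨hx, h1⟩
    by_cases h2 : fT n b I x < ENNReal.ofReal (3*b)
    · right; right; exact ⟨hx, h2⟩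
    · left; exact ⟨hx, not_lt.1 h1, not_lt.1 h2⟩
  refine (measure_mono hsub).trans ((measure_union_le _ _).trans (add_le_add le_rfl ?_))
  exact (measure_union_le _ _).trans (add_le_add (badW hI hF hIF) (badT hb hI hE hIE))

lemma prnIt_subset {n : ℕ} {a b : ℝ} {I : Set (ℝ × Pt n)} (k : ℕ) : (prn n a b)^[k] I ⊆ I := by
  induction k with
  | zero => simp
  | succ k ih => rw [Function.iterate_succ_apply']; exact prn_subset.trans ih

lemma measurableSet_prnIt {n : ℕ} {a b : ℝ} {I : Set (ℝ × Pt n)} (hI : MeasurableSet I) (k : ℕ) :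
    MeasurableSet ((prn n a b)^[k] I) := by
  induction k with
  | zero => simpa
  | succ k ih => rw [Function.iterate_succ_apply']; exact measurableSet_prn ih

lemma vol_prnIt {n : ℕ} {a b : ℝ} (hb : 0 < b) {I : Set (ℝ × Pt n)} (hI : MeasurableSet I)
    {E F : Set (Pt n)} (hE : MeasurableSet E) (hF : MeasurableSet F) (hIE : ∀ x ∈ I, x.2 ∈ E)
    (hIF : ∀ x ∈ I, (x.1, pr n x.1 x.2) ∈ F) (k : ℕ) :
    volume I ≤ volume ((prn n a b)^[k] I) +
      k * (ENNReal.ofReal a * volume F + ENNReal.ofReal (4*b) * volume E) := by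
  induction k with
  | zero => simp
  | succ k ih =>
    rw [Function.iterate_succ_apply']
    have h := vol_prn (a := a) hb (measurableSet_prnIt (a := a) (b := b) hI k) hE hF
      (fun x hx => hIE x (prnIt_subset k hx)) (fun x hx => hIF x (prnIt_subset k hx))
    refine ih.trans ((add_le_add h le_rfl).trans ?_)
    rw [add_assoc]
    refine add_le_add le_rfl ?_
    push_cast
    rw [add_mul, one_mul, add_comm]

/-- nodes of a chain -/
def nodes {m : ℕ} (t : ℝ) (u : Fin m → ℝ × ℝ) : Fin (m+1) → ℝ := Fin.cons t (fun i => (u i).2)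
def endpt (n : ℕ) {m : ℕ} (t : ℝ) (z : Pt n) (u : Fin m → ℝ × ℝ) : Pt n :=
  z + ∑ i : Fin m, (u i).1 • vv n (nodes t u i.castSucc)
def SepC {m : ℕ} (b ts : ℝ) (D : Set ℝ) (t : ℝ) (u : Fin m → ℝ × ℝ) : Prop :=
  ∀ i : Fin m, nodes t u i.castSucc + b ≤ (u i).2 ∧ b ≤ |(u i).2 - ts| ∧ (u i).2 ∈ D
def chainSet (n : ℕ) (m : ℕ) (b ts : ℝ) (D : Set ℝ) (I : Set (ℝ × Pt n)) (t : ℝ) (z : Pt n) :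
    Set (Fin m → ℝ × ℝ) :=
  {u | SepC b ts D t u ∧ (nodes t u (Fin.last m), endpt n t z u) ∈ I}

lemma measurable_nodes {m : ℕ} :
    Measurable (fun p : ℝ × (Fin m → ℝ × ℝ) => nodes p.1 p.2) := by
  unfold nodes
  rw [measurable_pi_iff]
  intro i
  refine Fin.cases ?_ (fun j => ?_) i
  · simpa using measurable_fst
  · simp only [Fin.cons_succ]; fun_prop

lemma measurable_nodes_apply {m : ℕ} (i : Fin (m+1)) :
    Measurable (fun p : ℝ × (Fin m → ℝ × ℝ) => nodes p.1 p.2 i) :=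
  (measurable_pi_apply i).comp measurable_nodes

lemma measurable_endpt (n m : ℕ) :
    Measurable (fun p : (ℝ × Pt n) × (Fin m → ℝ × ℝ) => endpt n p.1.1 p.1.2 p.2) := by
  unfold endpt
  refine Measurable.add (f := fun p : (ℝ × Pt n) × (Fin m → ℝ × ℝ) => p.1.2) (by fun_prop) (Finset.measurable_sum _ fun i _ => ?_)
  have := (measurable_nodes_apply (m := m) i.castSucc).comp
    (show Measurable (fun p : (ℝ × Pt n) × (Fin m → ℝ × ℝ) => (p.1.1, p.2)) by fun_prop)
  exact Measurable.smul (f := fun p : (ℝ × Pt n) × (Fin m → ℝ × ℝ) => (p.2 i).1) (by fun_prop)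
    ((measurable_vv n).comp this)

lemma measurableSet_chain {n m : ℕ} {b ts : ℝ} {D : Set ℝ} (hD : MeasurableSet D)
    {I : Set (ℝ × Pt n)} (hI : MeasurableSet I) :
    MeasurableSet {p : (ℝ × Pt n) × (Fin m → ℝ × ℝ) | p.2 ∈ chainSet n m b ts D I p.1.1 p.1.2} := by
  have h0 : ∀ i, Measurable (fun p : (ℝ × Pt n) × (Fin m → ℝ × ℝ) => nodes p.1.1 p.2 i) := fun i =>
    (measurable_nodes_apply (m := m) i).comp
      (show Measurable (fun p : (ℝ × Pt n) × (Fin m → ℝ × ℝ) => (p.1.1, p.2)) by fun_prop)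
  unfold chainSet SepC
  refine ms_and ?_ ?_
  · rw [ofPred_forall]
    refine MeasurableSet.iInter fun i => ?_
    refine ms_and (measurableSet_le ((h0 _).add_const b) (by fun_prop))
      (ms_and (measurableSet_le (by fun_prop) (by fun_prop)) ?_)
    exact (show Measurable (fun p : (ℝ × Pt n) × (Fin m → ℝ × ℝ) => (p.2 i).2) by fun_prop) hD
  · exact ((h0 _).prodMk (measurable_endpt n m)) hI

lemma nodes_cons {m : ℕ} (t : ℝ) (p : ℝ × ℝ) (u : Fin m → ℝ × ℝ) :
    nodes t (Fin.cons p u : Fin (m+1) → ℝ × ℝ) = Fin.cons t (nodes p.2 u) := by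
  funext i
  refine Fin.cases rfl (fun j => ?_) i
  simp only [nodes, Fin.cons_succ]
  refine Fin.cases rfl (fun k => ?_) j
  simp

lemma mem_chain_cons {n m : ℕ} {b ts : ℝ} {D : Set ℝ} {I : Set (ℝ × Pt n)} {t : ℝ} {z : Pt n}
    {p : ℝ × ℝ} {u : Fin m → ℝ × ℝ} :
    (Fin.cons p u : Fin (m+1) → ℝ × ℝ) ∈ chainSet n (m+1) b ts D I t z ↔
      (t + b ≤ p.2 ∧ b ≤ |p.2 - ts| ∧ p.2 ∈ D) ∧ u ∈ chainSet n m b ts D I p.2 (z + p.1 • vv n t) := by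
  have e : endpt n t z (Fin.cons p u : Fin (m+1) → ℝ × ℝ) = endpt n p.2 (z + p.1 • vv n t) u := by
    unfold endpt
    rw [Fin.sum_univ_succ, nodes_cons]
    simp only [Fin.cons_zero, Fin.castSucc_zero, Fin.cons_succ, ← Fin.succ_castSucc, add_assoc]
  have e2 : nodes t (Fin.cons p u : Fin (m+1) → ℝ × ℝ) (Fin.last (m+1)) = nodes p.2 u (Fin.last m) := by
    rw [nodes_cons, ← Fin.succ_last, Fin.cons_succ]
  unfold chainSet SepC
  simp only [mem_ofPred_eq, e, e2]
  rw [Fin.forall_fin_succ]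
  simp only [nodes_cons, Fin.cons_zero, Fin.castSucc_zero, Fin.cons_succ, ← Fin.succ_castSucc]
  tauto

lemma chain_lower {n : ℕ} {a b ts : ℝ} (hb : 0 < b) {D : Set ℝ} (hD : MeasurableSet D)
    {I : Set (ℝ × Pt n)} (hI : MeasurableSet I) (hID : ∀ x ∈ I, x.1 ∈ D) (m : ℕ) :
    ∀ t z, (t, z) ∈ (prn n a b)^[2*m] I →
      (ENNReal.ofReal a * ENNReal.ofReal b) ^ m ≤ volume (chainSet n m b ts D I t z) := by
  induction m with
  | zero =>
    intro t z h
    simp only [mul_zero, Function.iterate_zero, id] at h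
    have : chainSet n 0 b ts D I t z = univ := by
      ext u; simp [chainSet, SepC, nodes, endpt, h]
    rw [this, volume_pi, Measure.pi_of_empty]
    simp
  | succ m ih =>
    intro t z h
    rw [show 2*(m+1) = (2*m+1)+1 by ring, Function.iterate_succ_apply', Function.iterate_succ_apply'] at h
    set K := (prn n a b)^[2*m] I with hK
    have hKm : MeasurableSet K := measurableSet_prnIt hI _
    set J := prn n a b K with hJ
    have hJm : MeasurableSet J := measurableSet_prn hKm
    have hS : MeasurableSet (chainSet n (m+1) b ts D I t z) :=
      measurable_prodMk_left (x := ((t, z) : ℝ × Pt n)) (measurableSet_chain hD hI)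
    rw [← lintegral_indicator_one hS, lintegral_fin_succ (measurable_one.indicator hS)]
    -- lower bound
    set P : Set (ℝ × ℝ) := {p | (t, z + p.1 • vv n t) ∈ J ∧
      (t + b ≤ p.2 ∧ b ≤ |p.2 - ts| ∧ (p.2, z + p.1 • vv n t) ∈ K)} with hP
    have hPm : MeasurableSet P := by
      refine ms_and ((show Measurable (fun p : ℝ × ℝ => (t, z + p.1 • vv n t)) by fun_prop) hJm) ?_
      refine ms_and (measurableSet_le (by fun_prop) (by fun_prop))
       (ms_and (measurableSet_le (by fun_prop) (by fun_prop)) ?_)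
      exact (show Measurable (fun p : ℝ × ℝ => (p.2, z + p.1 • vv n t)) by fun_prop) hKm
    have h1 : ∀ p : ℝ × ℝ, P.indicator (fun _ => (ENNReal.ofReal a * ENNReal.ofReal b)^m) p ≤
        ∫⁻ u : Fin m → ℝ × ℝ, (chainSet n (m+1) b ts D I t z).indicator 1 (Fin.cons p u : Fin (m+1) → ℝ × ℝ) := by
      intro p
      by_cases hp : p ∈ P
      · rw [indicator_of_mem hp]
        refine (ih p.2 _ hp.2.2.2).trans ?_
        have hm1 : MeasurableSet (chainSet n m b ts D I p.2 (z + p.1 • vv n t)) :=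
          measurable_prodMk_left (x := ((p.2, z + p.1 • vv n t) : ℝ × Pt n)) (measurableSet_chain hD hI)
        rw [← lintegral_indicator_one hm1]
        refine lintegral_mono fun u => ?_
        by_cases hu : u ∈ chainSet n m b ts D I p.2 (z + p.1 • vv n t)
        · rw [indicator_of_mem hu, indicator_of_mem (mem_chain_cons.2 ⟨⟨hp.2.1, hp.2.2.1, hID _ (prnIt_subset _ hp.2.2.2)⟩, hu⟩)]
          exact le_rfl
        · rw [indicator_of_notMem hu]; exact zero_le
      · rw [indicator_of_notMem hp]; exact zero_le
    refine le_trans ?_ (lintegral_mono h1)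
    rw [lintegral_indicator_const hPm, pow_succ]
    gcongr
    rw [Measure.volume_eq_prod, Measure.prod_apply hPm]
    have hW : MeasurableSet {w : ℝ | (t, z + w • vv n t) ∈ J} :=
      (show Measurable (fun w : ℝ => (t, z + w • vv n t)) by fun_prop) hJm
    have h2 : ∀ w : ℝ, {w : ℝ | (t, z + w • vv n t) ∈ J}.indicator (fun _ => ENNReal.ofReal b) w ≤
        volume (Prod.mk w ⁻¹' P) := by
      intro w
      by_cases hw : w ∈ {w : ℝ | (t, z + w • vv n t) ∈ J}
      · rw [indicator_of_mem hw]
        have h3 := hw.2.2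
        unfold fT at h3
        simp only at h3
        have hsub : {t' | t + b ≤ t' ∧ (t', z + w • vv n t) ∈ K} ⊆ Ioo (ts - b) (ts + b) ∪ (Prod.mk w ⁻¹' P) := by
          rintro t' ⟨h4, h5⟩
          by_cases h6 : b ≤ |t' - ts|
          · right; exact ⟨hw, h4, h6, h5⟩
          · left; rw [not_le, abs_lt] at h6; constructor <;> linarith
        have h4 := h3.trans ((measure_mono hsub).trans (measure_union_le _ _))
        rw [Real.volume_Ioo, show ts + b - (ts - b) = 2*b by ring, show 3*b = 2*b+b by ring,
          ENNReal.ofReal_add (by linarith) hb.le] at h4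
        exact (ENNReal.add_le_add_iff_left ENNReal.ofReal_ne_top).1 h4
      · rw [indicator_of_notMem hw]; exact zero_le
    refine le_trans ?_ (lintegral_mono h2)
    rw [lintegral_indicator_const hW, mul_comm]
    gcongr
    exact h.2.1

end

section

def VV {m : ℕ} (x : Fin m → ℝ) : ℝ := |(Matrix.vandermonde x).det|

lemma VV_eq {m : ℕ} (x : Fin m → ℝ) : VV x = ∏ i, ∏ j ∈ Finset.Ioi i, |x j - x i| := by
  unfold VV
  rw [Matrix.det_vandermonde, Finset.abs_prod]
  simp_rw [Finset.abs_prod]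

def toFin (n : ℕ) : Pt n ≃ᵐ (Fin (n+1) → ℝ) :=
  (MeasurableEquiv.piFinSuccAbove (fun _ : Fin (n+1) => ℝ) 0).symm

lemma toFin_apply {n : ℕ} (z : Pt n) : toFin n z = Fin.cons z.1 z.2 := by
  simp [toFin, MeasurableEquiv.piFinSuccAbove, Fin.insertNthEquiv]

lemma toFin_mp (n : ℕ) : MeasurePreserving (toFin n) volume volume :=
  (volume_preserving_piFinSuccAbove (fun _ : Fin (n+1) => ℝ) 0).symm

lemma toFin_comb {n m : ℕ} (z : Pt n) (x w : Fin m → ℝ) :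
    toFin n (z + ∑ i, w i • vv n (x i)) = toFin n z +
      fun k : Fin (n+1) => ∑ i, w i * x i ^ (k : ℕ) := by
  funext k
  simp only [toFin_apply, Pi.add_apply]
  refine Fin.cases ?_ (fun j => ?_) k
  · simp [vv, Prod.fst_sum]
  · simp [vv, mom, Prod.snd_sum]

/-- the basic multiplicity lemma -/
lemma MV2 {n : ℕ} (z : Pt n) (x : Fin (n+1) → ℝ) (hx : VV x ≠ 0) {A : Set (Pt n)}
    (hA : MeasurableSet A) :
    volume {w : Fin (n+1) → ℝ | z + ∑ i, w i • vv n (x i) ∈ A} =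
      ENNReal.ofReal (VV x)⁻¹ * volume A := by
  set M := (Matrix.vandermonde x).transpose with hM
  have hdet : M.det ≠ 0 := by
    rw [hM, Matrix.det_transpose]; unfold VV at hx; simpa using hx
  have hmap := Real.map_matrix_volume_pi_eq_smul_volume_pi hdet
  set A' : Set (Fin (n+1) → ℝ) := (fun c => toFin n z + c) ⁻¹' ((toFin n).symm ⁻¹' A) with hA'
  have hm1 : MeasurableSet ((toFin n).symm ⁻¹' A) := (toFin n).symm.measurable hA
  have hA'm : MeasurableSet A' := (measurable_const_add _) hm1
  have hvol : volume A' = volume A := by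
    rw [hA', measure_preimage_add]
    exact ((toFin_mp n).symm).measure_preimage hA.nullMeasurableSet
  have hpre : {w : Fin (n+1) → ℝ | z + ∑ i, w i • vv n (x i) ∈ A} = (Matrix.toLin' M) ⁻¹' A' := by
    ext w
    simp only [mem_ofPred_eq, mem_preimage, hA']
    have : toFin n z + (Matrix.toLin' M) w = toFin n (z + ∑ i, w i • vv n (x i)) := by
      rw [toFin_comb]
      congr 1
      funext k
      simp [Matrix.toLin'_apply, Matrix.mulVec, dotProduct, hM, Matrix.vandermonde, mul_comm]
    rw [this]; simp
  rw [hpre, ← Measure.map_apply (LinearMap.continuous_of_finiteDimensional _).measurable hA'm, hmap]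
  simp only [Measure.smul_apply, smul_eq_mul, hvol]
  congr 2
  rw [hM, Matrix.det_transpose, abs_inv]; rfl

lemma lintegral_fin_insertNth {α : Type*} [MeasureSpace α] [SigmaFinite (volume : Measure α)] {m : ℕ}
    (i : Fin (m+1)) {F : (Fin (m+1) → α) → ℝ≥0∞} (hF : Measurable F) :
    ∫⁻ u, F u = ∫⁻ a : α, ∫⁻ u : Fin m → α, F (i.insertNth a u) := by
  have h := (volume_preserving_piFinSuccAbove (fun _ : Fin (m+1) => α) i).symm
  rw [← h.lintegral_comp hF, Measure.volume_eq_prod, lintegral_prod]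
  · simp [MeasurableEquiv.piFinSuccAbove, Fin.insertNthEquiv]
  · exact (hF.comp h.measurable).aemeasurable

lemma lintegral_fin_insertNth' {α : Type*} [MeasureSpace α] [SigmaFinite (volume : Measure α)] {m : ℕ}
    (i : Fin (m+1)) {F : (Fin (m+1) → α) → ℝ≥0∞} (hF : Measurable F) :
    ∫⁻ u, F u = ∫⁻ u : Fin m → α, ∫⁻ a : α, F (i.insertNth a u) := by
  have h := (volume_preserving_piFinSuccAbove (fun _ : Fin (m+1) => α) i).symm
  rw [← h.lintegral_comp hF, Measure.volume_eq_prod, lintegral_prod_symm]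
  · simp [MeasurableEquiv.piFinSuccAbove, Fin.insertNthEquiv]
  · exact (hF.comp h.measurable).aemeasurable

lemma pr_add {n : ℕ} (t : ℝ) (z w : Pt n) : pr n t (z + w) = pr n t z + pr n t w := by
  ext i; simp [pr]; ring

lemma MV1 {n : ℕ} (z : Pt n) (x : Fin (n+1) → ℝ) (hx : VV x ≠ 0) {A : Set (Fin n → ℝ)}
    (hA : MeasurableSet A) :
    volume {w : Fin n → ℝ | pr n (x (Fin.last n)) (z + ∑ i, w i • vv n (x i.castSucc)) ∈ A} =
      ENNReal.ofReal (VV x)⁻¹ * volume A := by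
  set tl := x (Fin.last n) with htl
  set A' : Set (Pt n) := {p | p.1 ∈ Icc (0:ℝ) 1 ∧ pr n tl p ∈ A} with hA'
  have hA'm : MeasurableSet A' := ms_and (measurable_fst measurableSet_Icc) (measurable_pr_right n tl hA)
  have hv : volume A' = volume A := by
    rw [← lintegral_indicator_one hA'm, lintegral_lines (measurable_one.indicator hA'm) tl,
      ← lintegral_indicator_one hA]
    congr 1; ext y
    unfold XE
    have h1 : ∀ s : ℝ, A'.indicator (1 : Pt n → ℝ≥0∞) (s, (tl, y).2 + s • mom n (tl, y).1) =
        (Icc (0:ℝ) 1).indicator (fun _ => A.indicator (1 : (Fin n → ℝ) → ℝ≥0∞) y) s := by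
      intro s
      have h2 : pr n tl ((s, y + s • mom n tl) : Pt n) = y := by ext i; simp [pr]
      by_cases hs : s ∈ Icc (0:ℝ) 1 <;> by_cases hy : y ∈ A <;>
        simp [indicator, hA', h2, hs, hy, -mem_Icc]
    simp_rw [h1]
    rw [lintegral_indicator_const measurableSet_Icc]
    simp
  have h2 := MV2 z x hx hA'm
  rw [hv] at h2
  rw [← h2]
  have hm : Measurable (fun w : Fin (n+1) → ℝ => z + ∑ i, w i • vv n (x i)) := by fun_prop
  have hm' : Measurable (fun w : Fin n → ℝ => z + ∑ i : Fin n, w i • vv n (x i.castSucc)) := by fun_prop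
  have hS1 : MeasurableSet {w : Fin (n+1) → ℝ | z + ∑ i, w i • vv n (x i) ∈ A'} := hm hA'm
  have hS2 : MeasurableSet {w : Fin n → ℝ | pr n tl (z + ∑ i : Fin n, w i • vv n (x i.castSucc)) ∈ A} :=
    hm' (measurable_pr_right n tl hA)
  rw [← lintegral_indicator_one hS2, ← lintegral_indicator_one hS1,
    lintegral_fin_insertNth' (Fin.last n) (measurable_one.indicator hS1)]
  congr 1; ext w
  have h3 : ∀ a : ℝ, {w : Fin (n+1) → ℝ | z + ∑ i, w i • vv n (x i) ∈ A'}.indicator (1 : (Fin (n+1) → ℝ) → ℝ≥0∞)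
      ((Fin.last n).insertNth a w) = (Icc (0 - (z + ∑ i : Fin n, w i • vv n (x i.castSucc)).1)
        (1 - (z + ∑ i : Fin n, w i • vv n (x i.castSucc)).1)).indicator (fun _ =>
        {w : Fin n → ℝ | pr n tl (z + ∑ i : Fin n, w i • vv n (x i.castSucc)) ∈ A}.indicator
          (1 : (Fin n → ℝ) → ℝ≥0∞) w) a := by
    intro a
    have h4 : z + ∑ i, ((Fin.last n).insertNth a w : Fin (n+1) → ℝ) i • vv n (x i) =
        (z + ∑ i : Fin n, w i • vv n (x i.castSucc)) + a • vv n tl := by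
      rw [Fin.sum_univ_castSucc]
      simp [Fin.insertNth_last', add_assoc, htl]
    have h5 : ((Fin.last n).insertNth a w : Fin (n+1) → ℝ) ∈ {w : Fin (n+1) → ℝ | z + ∑ i, w i • vv n (x i) ∈ A'} ↔
       a ∈ (Icc (0 - (z + ∑ i : Fin n, w i • vv n (x i.castSucc)).1)
        (1 - (z + ∑ i : Fin n, w i • vv n (x i.castSucc)).1)) ∧ w ∈ {w : Fin n → ℝ | pr n tl (z + ∑ i : Fin n, w i • vv n (x i.castSucc)) ∈ A} := by
      simp only [mem_ofPred_eq, h4, hA', pr_add_smul, mem_Icc]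
      simp only [Prod.fst_add, Prod.smul_fst, vv, smul_eq_mul, mul_one]
      constructor
      · rintro ⟨⟨h1, h2⟩, h3⟩; exact ⟨⟨by linarith, by linarith⟩, h3⟩
      · rintro ⟨⟨h1, h2⟩, h3⟩; exact ⟨⟨by linarith, by linarith⟩, h3⟩
    classical
    simp only [indicator_apply, h5, ite_and]
    rfl
  simp_rw [h3]
  rw [lintegral_indicator_const measurableSet_Icc, Real.volume_Icc, sub_sub_sub_cancel_right]
  simp

/-! star bound -/
def kb (b s : ℝ) (x : ℝ) : ℝ≥0∞ := if b ≤ |x| then ENNReal.ofReal (|x| ^ (-s)) else 0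

@[fun_prop] lemma measurable_kb (b s : ℝ) : Measurable (kb b s) := by
  unfold kb
  exact Measurable.ite (measurableSet_le (by fun_prop) (by fun_prop)) (by fun_prop) (by fun_prop)

lemma lintegral_kb {b s : ℝ} (hb : 0 < b) (hs : 1 < s) :
    ∫⁻ x, kb b s x ≤ ENNReal.ofReal (2 / (s-1) * b ^ (1-s)) := by
  have h1 : ∀ x, kb b s x ≤ (Ici b).indicator (fun y => ENNReal.ofReal (y ^ (-s))) x +
      (Ici b).indicator (fun y => ENNReal.ofReal (y ^ (-s))) (-x) := by
    intro x
    unfold kb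
    split_ifs with h
    · rcases le_total 0 x with hx | hx
      · rw [abs_of_nonneg hx] at h ⊢
        rw [indicator_of_mem (show x ∈ Ici b from h)]; exact le_self_add
      · rw [abs_of_nonpos hx] at h ⊢
        rw [indicator_of_mem (show -x ∈ Ici b from h)]; exact le_add_self
    · exact zero_le
  have hm : Measurable ((Ici b).indicator (fun y : ℝ => ENNReal.ofReal (y ^ (-s)))) :=
    (by fun_prop : Measurable (fun y : ℝ => ENNReal.ofReal (y ^ (-s)))).indicator measurableSet_Ici
  refine (lintegral_mono h1).trans ?_
  rw [lintegral_add_left hm, lintegral_neg_eq_self, lintegral_indicator measurableSet_Ici]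
  have h2 : ∫⁻ y in Ici b, ENNReal.ofReal (y ^ (-s)) = ENNReal.ofReal (b^(1-s)/(s-1)) := by
    rw [setLIntegral_congr Ioi_ae_eq_Ici.symm, ← ofReal_integral_eq_lintegral_ofReal
      (integrableOn_Ioi_rpow_of_lt (by linarith) hb), integral_Ioi_rpow_of_lt (by linarith) hb]
    · congr 1
      rw [show -s+1 = 1-s by ring, show s - 1 = -(1-s) by ring, div_neg, neg_div]
    · filter_upwards [ae_restrict_mem measurableSet_Ioi] with y hy
      exact Real.rpow_nonneg (hb.le.trans (le_of_lt hy)) _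
  rw [h2, ← ENNReal.ofReal_add (by have := Real.rpow_nonneg hb.le (1-s); apply div_nonneg this; linarith) (by have := Real.rpow_nonneg hb.le (1-s); apply div_nonneg this; linarith)]
  apply le_of_eq; congr 1; ring

lemma lintegral_prod_fin {m : ℕ} {g : ℝ → ℝ≥0∞} (hg : Measurable g) :
    ∫⁻ τ : Fin m → ℝ, ∏ j, g (τ j) = (∫⁻ x, g x)^m := by
  induction m with
  | zero => simp [volume_pi, Measure.pi_of_empty]
  | succ m ih =>
    rw [lintegral_fin_succ (by fun_prop)]
    simp only [Fin.prod_univ_succ, Fin.cons_zero, Fin.cons_succ]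
    have : ∀ a : ℝ, ∫⁻ u : Fin m → ℝ, g a * ∏ i, g (u i) = g a * (∫⁻ x, g x)^m := by
      intro a
      rw [lintegral_const_mul _ (by fun_prop), ih]
    simp_rw [this]
    rw [lintegral_mul_const _ hg, pow_succ, mul_comm]

lemma star_ineq {m : ℕ} (x : Fin (m+1) → ℝ) {b : ℝ} (hb : 0 < b)
    (hsep : ∀ i j, i ≠ j → b ≤ |x i - x j|) :
    ENNReal.ofReal (VV x)⁻¹ ≤ ∑ c, ∏ j : Fin m, kb b ((m+1)/2) (x (c.succAbove j) - x c) := by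
  have hpos : ∀ i j, i ≠ j → 0 < |x i - x j| := fun i j h => hb.trans_le (hsep i j h)
  set st : Fin (m+1) → ℝ := fun c => ∏ j : Fin m, |x (c.succAbove j) - x c| with hst
  have hstpos : ∀ c, 0 < st c := fun c => Finset.prod_pos fun j _ => hpos _ _ (Fin.succAbove_ne c j)
  have hVpos : 0 < VV x := by
    rw [VV_eq]
    exact Finset.prod_pos fun i _ => Finset.prod_pos fun j hj => hpos _ _ (Finset.mem_Ioi.1 hj).ne'
  have hprod : ∏ c, st c = VV x ^ 2 := by
    have h := Finset.prod_prod_Ioi_mul_eq_prod_prod_off_diag (fun i j : Fin (m+1) => |x i - x j|)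
    have h2 : ∀ c, st c = ∏ j ∈ ({c}ᶜ : Finset (Fin (m+1))), |x j - x c| := by
      intro c
      simp only [hst]
      have := Fin.prod_univ_succAbove (fun j => if j = c then (1:ℝ) else |x j - x c|) c
      simp only [if_true, one_mul, Fin.succAbove_ne, if_false] at this
      rw [← this, ← Finset.prod_subset (Finset.subset_univ ({c}ᶜ : Finset (Fin (m+1))))]
      · apply Finset.prod_congr rfl; intro j hj
        rw [if_neg]; simpa using hj
      · intro j _ hj; rw [if_pos]; simpa using hj
    simp_rw [h2]
    rw [← h, VV_eq, sq, ← Finset.prod_mul_distrib]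
    apply Finset.prod_congr rfl; intro i _
    rw [← Finset.prod_mul_distrib]
    apply Finset.prod_congr rfl; intro j _
    rw [abs_sub_comm (x i)]
  obtain ⟨c, -, hc⟩ := Finset.exists_min_image Finset.univ st Finset.univ_nonempty
  have h1 : st c ^ (m+1) ≤ VV x ^ 2 := by
    rw [← hprod]
    calc st c ^ (m+1) = ∏ _i : Fin (m+1), st c := by simp
      _ ≤ _ := Finset.prod_le_prod (fun _ _ => (hstpos c).le) fun i _ => hc i (Finset.mem_univ _)
  have h2 : st c ^ (((m:ℝ)+1)/2) ≤ VV x := by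
    have := Real.rpow_le_rpow (by positivity [hstpos c]) h1 (by norm_num : (0:ℝ) ≤ 1/2)
    rw [← Real.rpow_natCast, ← Real.rpow_natCast, ← Real.rpow_mul (hstpos c).le, ← Real.rpow_mul hVpos.le] at this
    convert this using 1
    · push_cast; ring_nf
    · norm_num
  have h3 : ENNReal.ofReal (VV x)⁻¹ ≤ ∏ j : Fin m, kb b ((m+1)/2) (x (c.succAbove j) - x c) := by
    have : ∏ j : Fin m, kb b ((m+1)/2) (x (c.succAbove j) - x c) =
        ENNReal.ofReal (st c ^ (-(((m:ℝ)+1)/2))) := by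
      rw [hst]
      simp only
      rw [← Real.finsetProd_rpow _ _ (fun _ _ => abs_nonneg _), ENNReal.ofReal_prod_of_nonneg (fun _ _ => Real.rpow_nonneg (abs_nonneg _) _)]
      apply Finset.prod_congr rfl; intro j _
      unfold kb
      rw [if_pos (hsep _ _ (Fin.succAbove_ne c j))]
    rw [this]
    apply ENNReal.ofReal_le_ofReal
    rw [Real.rpow_neg (hstpos c).le]
    exact inv_anti₀ (Real.rpow_pos_of_pos (hstpos c) _) h2
  exact h3.trans (Finset.single_le_sum (f := fun c => ∏ j : Fin m, kb b ((m+1)/2) (x (c.succAbove j) - x c)) (fun _ _ => zero_le) (Finset.mem_univ c))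

lemma star_int {m : ℕ} {b s : ℝ} (t : ℝ) (c : Fin (m+1)) :
    ∫⁻ τ : Fin m → ℝ, ∏ j : Fin m, kb b s ((Fin.cons t τ : Fin (m+1) → ℝ) (c.succAbove j) -
      (Fin.cons t τ : Fin (m+1) → ℝ) c) = (∫⁻ x, kb b s x)^m := by
  have hsub : ∀ a : ℝ, ∫⁻ x, kb b s (x - a) = ∫⁻ x, kb b s x := fun a =>
    lintegral_sub_right_eq_self (kb b s) a
  refine Fin.cases ?_ (fun i => ?_) c
  · simp only [Fin.succAbove_zero, Fin.cons_succ, Fin.cons_zero]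
    rw [lintegral_prod_fin (g := fun y => kb b s (y - t)) (by fun_prop), hsub]
  · obtain ⟨m, rfl⟩ : ∃ m', m = m' + 1 := ⟨m - 1, by have := i.2; omega⟩
    have hkn : ∀ x, kb b s (-x) = kb b s x := fun x => by simp [kb]
    have h1 : ∀ τ : Fin (m+1) → ℝ, ∏ j : Fin (m+1), kb b s ((Fin.cons t τ : Fin (m+1+1) → ℝ) (i.succ.succAbove j) -
      (Fin.cons t τ : Fin (m+1+1) → ℝ) i.succ) = kb b s (τ i - t) * ∏ j : Fin m, kb b s (τ (i.succAbove j) - τ i) := by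
      intro τ
      rw [Fin.prod_univ_succ]
      simp only [Fin.succ_succAbove_zero, Fin.cons_zero, Fin.cons_succ, Fin.succ_succAbove_succ]
      rw [← hkn, neg_sub]
    simp_rw [h1]
    rw [lintegral_fin_insertNth i]
    · simp only [Fin.insertNth_apply_same, Fin.insertNth_apply_succAbove]
      have : ∀ a : ℝ, ∫⁻ u : Fin m → ℝ, kb b s (a - t) * ∏ j, kb b s (u j - a) = kb b s (a - t) * (∫⁻ x, kb b s x)^m := by
        intro a
        rw [lintegral_const_mul _ (by fun_prop), lintegral_prod_fin (g := fun y => kb b s (y - a)) (by fun_prop), hsub]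
      simp_rw [this]
      rw [lintegral_mul_const _ (by fun_prop), hsub, pow_succ, mul_comm]
    · fun_prop

end

section

def inc (n : ℕ) (E F : Set (Pt n)) : Set (ℝ × Pt n) := {x | x.2 ∈ E ∧ (x.1, pr n x.1 x.2) ∈ F}

lemma measurableSet_inc {n : ℕ} {E F : Set (Pt n)} (hE : MeasurableSet E) (hF : MeasurableSet F) :
    MeasurableSet (inc n E F) :=
  ms_and (measurable_snd hE) ((show Measurable (fun x : ℝ × Pt n => (x.1, pr n x.1 x.2)) by fun_prop) hF)

abbrev XI (n : ℕ) (E : Set (Pt n)) : Pt n → ℝ≥0∞ := XE n (E.indicator 1)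

lemma XI_eq {n : ℕ} {E : Set (Pt n)} (hE : MeasurableSet E) (x : Pt n) :
    XI n E x = volume {s : ℝ | ((s, x.2 + s • mom n x.1) : Pt n) ∈ E} := by
  unfold XI XE
  rw [← lintegral_indicator_one]
  · rfl
  · exact (show Measurable (fun s : ℝ => ((s, x.2 + s • mom n x.1) : Pt n)) by fun_prop) hE

lemma vol_inc {n : ℕ} {E F : Set (Pt n)} (hE : MeasurableSet E) (hF : MeasurableSet F) :
    volume (inc n E F) = ∫⁻ x in F, XI n E x := by
  rw [vol_lines (measurableSet_inc hE hF), ← lintegral_indicator hF]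
  congr 1; ext x
  have h2 : ∀ s : ℝ, pr n x.1 ((s, x.2 + s • mom n x.1) : Pt n) = x.2 := fun s => by ext i; simp [pr]
  by_cases hx : x ∈ F
  · rw [indicator_of_mem hx, XI_eq hE]
    congr 1; ext s
    simp only [inc, mem_ofPred_eq, h2]
    exact ⟨fun h => h.1, fun h => ⟨h, hx⟩⟩
  · rw [indicator_of_notMem hx]
    convert measure_empty (μ := (volume : Measure ℝ))
    ext s
    simp only [inc, mem_ofPred_eq, h2]
    exact ⟨fun h => hx h.2, fun h => h.elim⟩

lemma lintegral_pairs {n : ℕ} {G : (Fin n → ℝ × ℝ) → ℝ≥0∞} (hG : Measurable G) :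
    ∫⁻ u, G u = ∫⁻ τ : Fin n → ℝ, ∫⁻ w : Fin n → ℝ, G (fun i => (w i, τ i)) := by
  have h := (volume_measurePreserving_arrowProdEquivProdArrow ℝ ℝ (Fin n)).symm
  rw [← h.lintegral_comp hG, Measure.volume_eq_prod, lintegral_prod_symm]
  · rfl
  · exact (hG.comp h.measurable).aemeasurable

def upSet (n : ℕ) (b : ℝ) (F : Set (Pt n)) (t : ℝ) (z : Pt n) : Set (Fin n → ℝ × ℝ) :=
  {u | (∀ i j, i ≠ j → b ≤ |nodes t u i - nodes t u j|) ∧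
    (nodes t u (Fin.last n), pr n (nodes t u (Fin.last n)) (endpt n t z u)) ∈ F}

lemma measurableSet_upSet {n : ℕ} {b : ℝ} {F : Set (Pt n)} (hF : MeasurableSet F) (t : ℝ) (z : Pt n) :
    MeasurableSet (upSet n b F t z) := by
  have h0 : ∀ i, Measurable (fun u : (Fin n → ℝ × ℝ) => nodes t u i) := fun i =>
    (measurable_nodes_apply i).comp measurable_prodMk_left
  have h1 : Measurable (fun u : (Fin n → ℝ × ℝ) => endpt n t z u) :=
    (measurable_endpt n n).comp (measurable_prodMk_left (x := ((t,z) : ℝ × Pt n)))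
  refine ms_and ?_ ?_
  · rw [ofPred_forall]
    refine MeasurableSet.iInter fun i => ?_
    rw [ofPred_forall]
    refine MeasurableSet.iInter fun j => ?_
    rw [ofPred_forall]
    refine MeasurableSet.iInter fun _ => ?_
    exact measurableSet_le measurable_const ((h0 i).sub (h0 j)).abs
  · have h2 : Measurable (fun u : (Fin n → ℝ × ℝ) => pr n (nodes t u (Fin.last n)) (endpt n t z u)) :=
      (measurable_pr n).comp ((h0 (Fin.last n)).prodMk h1)
    have hm : Measurable (fun u : (Fin n → ℝ × ℝ) =>
      (nodes t u (Fin.last n), pr n (nodes t u (Fin.last n)) (endpt n t z u))) :=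
      (h0 (Fin.last n)).prodMk h2
    exact hm hF

lemma VV_ne_zero {m : ℕ} {x : Fin m → ℝ} {b : ℝ} (hb : 0 < b)
    (hsep : ∀ i j, i ≠ j → b ≤ |x i - x j|) : VV x ≠ 0 := by
  rw [VV_eq]
  exact (Finset.prod_pos fun i _ => Finset.prod_pos fun j hj =>
    hb.trans_le (hsep _ _ (Finset.mem_Ioi.1 hj).ne')).ne'

lemma chain_upper {n : ℕ} {b : ℝ} (hb : 0 < b) {F : Set (Pt n)} (hF : MeasurableSet F) {l : ℝ≥0∞}
    (hl : ∀ t, volume {y | (t, y) ∈ F} ≤ l) (t : ℝ) (z : Pt n) :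
    volume (upSet n b F t z) ≤ l * ((n+1) * (∫⁻ x, kb b ((n+1)/2) x)^n) := by
  have hS := measurableSet_upSet (b := b) hF t z
  rw [← lintegral_indicator_one hS, lintegral_pairs (measurable_one.indicator hS)]
  have hmcons : ∀ i, Measurable (fun τ : Fin n → ℝ => (Fin.cons t τ : Fin (n+1) → ℝ) i) := fun i =>
    (measurable_pi_apply i).comp (measurable_cons.comp (measurable_prodMk_left (x := t)))
  have hmk : ∀ c : Fin (n+1), Measurable (fun τ : Fin n → ℝ => ∏ j : Fin n, kb b (((n:ℝ)+1)/2) ((Fin.cons t τ : Fin (n+1) → ℝ) (c.succAbove j) - (Fin.cons t τ : Fin (n+1) → ℝ) c)) := by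
    intro c
    exact Finset.measurable_prod _ fun j _ => (measurable_kb _ _).comp ((hmcons _).sub (hmcons _))
  have key : ∀ τ : Fin n → ℝ, ∫⁻ w : Fin n → ℝ, (upSet n b F t z).indicator (1 : (Fin n → ℝ × ℝ) → ℝ≥0∞) (fun i => (w i, τ i)) ≤
      l * ∑ c : Fin (n+1), ∏ j : Fin n, kb b (((n:ℝ)+1)/2) ((Fin.cons t τ : Fin (n+1) → ℝ) (c.succAbove j) -
      (Fin.cons t τ : Fin (n+1) → ℝ) c) := by
    intro τ
    set x : Fin (n+1) → ℝ := Fin.cons t τ with hx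
    have hn : ∀ w : Fin n → ℝ, nodes t (fun i => (w i, τ i)) = x := fun w => rfl
    by_cases hsep : ∀ i j, i ≠ j → b ≤ |x i - x j|
    · have hV := VV_ne_zero hb hsep
      have hA : MeasurableSet {y | (x (Fin.last n), y) ∈ F} := measurable_prodMk_left hF
      have h1 := MV1 z x hV hA
      have hm' : Measurable (fun w : Fin n → ℝ => z + ∑ i : Fin n, w i • vv n (x i.castSucc)) := by fun_prop
      have hS2 : MeasurableSet {w : Fin n → ℝ | pr n (x (Fin.last n)) (z + ∑ i, w i • vv n (x i.castSucc)) ∈ {y | (x (Fin.last n), y) ∈ F}} :=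
        hm' (measurable_pr_right n _ hA)
      rw [← lintegral_indicator_one hS2] at h1
      refine le_trans (le_of_eq ?_) ((h1.le.trans (mul_le_mul' (star_ineq x hb hsep) (hl _))).trans (le_of_eq (mul_comm _ _)))
      congr 1; ext w
      classical
      simp only [indicator_apply]
      congr 1
      simp only [upSet, hn, mem_ofPred_eq, endpt, eq_iff_iff]
      exact ⟨fun h => h.2, fun h => ⟨hsep, h⟩⟩
    · have : ∀ w : Fin n → ℝ, (upSet n b F t z).indicator (1 : (Fin n → ℝ × ℝ) → ℝ≥0∞) (fun i => (w i, τ i)) = 0 := by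
        intro w
        apply indicator_of_notMem
        intro h; exact hsep h.1
      simp [this]
  refine (lintegral_mono key).trans ?_
  rw [lintegral_const_mul _ (Finset.measurable_sum _ fun c _ => hmk c), lintegral_finsetSum _ fun c _ => hmk c]
  simp_rw [star_int]
  simp

lemma nodes_sep {m : ℕ} {b ts t : ℝ} {D : Set ℝ} (hb : 0 < b) {u : Fin m → ℝ × ℝ} (h : SepC b ts D t u)
    {i j : Fin (m+1)} (hij : i ≠ j) : b ≤ |nodes t u i - nodes t u j| := by
  have hmono : Monotone (fun i : Fin (m+1) => nodes t u i - b * (i : ℕ)) := by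
    rw [Fin.monotone_iff_le_succ]
    intro i
    have := (h i).1
    simp only [Fin.val_castSucc, Fin.val_succ]
    push_cast
    have h2 : nodes t u i.succ = (u i).2 := by simp [nodes]
    rw [h2]; linarith
  have key : ∀ i j : Fin (m+1), i < j → b ≤ nodes t u j - nodes t u i := by
    intro i j hij
    have h1 := hmono hij.le
    simp only at h1
    have h2 : ((i:ℕ):ℝ) + 1 ≤ ((j:ℕ):ℝ) := by exact_mod_cast hij
    nlinarith
  rcases lt_or_gt_of_ne hij with h1 | h1
  · rw [abs_sub_comm]; exact (key _ _ h1).trans (le_abs_self _)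
  · exact (key _ _ h1).trans (le_abs_self _)

/-- Lemma L. Here the ambient `n` is `m+1`. -/
lemma lemmaL {m : ℕ} {a b : ℝ} (hb : 0 < b) {E F : Set (Pt (m+1))} (hE : MeasurableSet E)
    (hF : MeasurableSet F) {l : ℝ≥0∞} (hl : ∀ t, volume {y | (t, y) ∈ F} ≤ l) :
    ∃ E' ⊆ E, MeasurableSet E' ∧ volume (inc (m+1) E F) ≤ volume (inc (m+1) E' F) +
        (2*m+1) * (ENNReal.ofReal a * volume F + ENNReal.ofReal (4*b) * volume E) ∧
      ∀ x, XI (m+1) E' x * (ENNReal.ofReal b * (ENNReal.ofReal a * ENNReal.ofReal b)^m) ≤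
        l * ((m+2) * (∫⁻ x, kb b ((m+2)/2) x)^(m+1)) := by
  set I := inc (m+1) E F with hI
  have hIm : MeasurableSet I := measurableSet_inc hE hF
  set J := (prn (m+1) a b)^[2*m] I with hJ
  have hJm : MeasurableSet J := measurableSet_prnIt hIm _
  have hfib : Measurable (fun z : Pt (m+1) => volume {t : ℝ | (t, z) ∈ J}) :=
    measurable_measure_prodMk_right hJm
  set E' : Set (Pt (m+1)) := {z | ENNReal.ofReal (3*b) ≤ volume {t : ℝ | (t, z) ∈ J}} with hE'
  have hE'm : MeasurableSet E' := measurableSet_le measurable_const hfib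
  have hE'E : E' ⊆ E := by
    intro z hz
    have : {t : ℝ | (t, z) ∈ J}.Nonempty := by
      rw [nonempty_iff_ne_empty]; intro h
      rw [hE', mem_ofPred_eq, h] at hz
      simp at hz; linarith
    obtain ⟨t, ht⟩ := this
    exact (prnIt_subset _ ht : (t,z) ∈ I).1
  refine ⟨E', hE'E, hE'm, ?_, ?_⟩
  · have h1 := vol_prnIt (a := a) hb hIm hE hF (fun x hx => hx.1) (fun x hx => hx.2) (2*m)
    rw [← hJ] at h1
    have h2 : volume J ≤ volume (inc (m+1) E' F) + ENNReal.ofReal (4*b) * volume E := by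
      have hsub : J ⊆ inc (m+1) E' F ∪ (J ∩ {x | x.2 ∉ E'}) := by
        intro x hx
        by_cases h : x.2 ∈ E'
        · left; exact ⟨h, (prnIt_subset _ hx : x ∈ I).2⟩
        · right; exact ⟨hx, h⟩
      refine (measure_mono hsub).trans ((measure_union_le _ _).trans (add_le_add le_rfl ?_))
      have hms : MeasurableSet (J ∩ {x | x.2 ∉ E'}) := hJm.inter (measurable_snd hE'm.compl)
      rw [vol_tfib hms, ← lintegral_indicator_one hE, ← lintegral_const_mul _ (measurable_one.indicator hE)]
      refine lintegral_mono fun z => ?_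
      by_cases hz : z ∈ E' 
      · have : {t : ℝ | (t, z) ∈ J ∩ {x | x.2 ∉ E'}} = ∅ := by ext t; simp [hz]
        rw [this]; simp
      by_cases hzE : z ∈ E
      · rw [indicator_of_mem hzE]
        simp only [Pi.one_apply, mul_one]
        refine (measure_mono (fun t ht => ht.1) : _ ≤ volume {t : ℝ | (t, z) ∈ J}).trans ?_
        refine (not_le.1 hz).le.trans (ENNReal.ofReal_le_ofReal (by linarith))
      · have : {t : ℝ | (t, z) ∈ J ∩ {x | x.2 ∉ E'}} = ∅ := by
          ext t
          simp only [mem_ofPred_eq, mem_empty_iff_false, iff_false]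
          intro h
          exact hzE (prnIt_subset _ h.1 : (t,z) ∈ I).1
        rw [this]; simp
    refine h1.trans ((add_le_add h2 le_rfl).trans ?_)
    rw [add_assoc]
    refine add_le_add le_rfl ?_
    push_cast
    rw [add_mul, one_mul, add_comm]
    exact add_le_add le_rfl le_add_self
  · rintro ⟨t₀, y₀⟩
    have hup := chain_upper hb hF hl t₀ ((0, y₀) : Pt (m+1))
    push_cast at hup
    rw [show (m:ℝ)+1+1 = m+2 by ring, show (m:ℝ≥0∞)+1+1 = m+2 by rw [add_assoc]; norm_num] at hup
    refine le_trans ?_ hup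
    have hUm := measurableSet_upSet (b := b) hF t₀ ((0, y₀) : Pt (m+1))
    rw [← lintegral_indicator_one hUm, lintegral_fin_succ (measurable_one.indicator hUm)]
    set zz : ℝ → Pt (m+1) := fun w => ((0, y₀) : Pt (m+1)) + w • vv (m+1) t₀ with hzz
    have hzzm : Measurable zz := by fun_prop
    set P : Set (ℝ × ℝ) := {p | zz p.1 ∈ E' ∧ (b ≤ |p.2 - t₀| ∧ (p.2, zz p.1) ∈ J)} with hP
    have hPm : MeasurableSet P := by
      refine ms_and ((hzzm.comp measurable_fst) hE'm) ?_
      refine ms_and (measurableSet_le (by fun_prop) (by fun_prop)) ?_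
      exact (show Measurable (fun p : ℝ × ℝ => (p.2, zz p.1)) by fun_prop) hJm
    have h1 : ∀ p : ℝ × ℝ, P.indicator (fun _ => (ENNReal.ofReal a * ENNReal.ofReal b)^m) p ≤
        ∫⁻ u : Fin m → ℝ × ℝ, (upSet (m+1) b F t₀ (0, y₀)).indicator 1 (Fin.cons p u : Fin (m+1) → ℝ × ℝ) := by
      intro p
      by_cases hp : p ∈ P
      · rw [indicator_of_mem hp]
        refine (chain_lower (ts := t₀) hb MeasurableSet.univ hIm (fun _ _ => mem_univ _) m p.2 _ hp.2.2).trans ?_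
        have hm1 : MeasurableSet (chainSet (m+1) m b t₀ univ I p.2 (zz p.1)) :=
          measurable_prodMk_left (x := ((p.2, zz p.1) : ℝ × Pt (m+1))) (measurableSet_chain MeasurableSet.univ hIm)
        rw [← lintegral_indicator_one hm1]
        refine lintegral_mono fun u => ?_
        by_cases hu : u ∈ chainSet (m+1) m b t₀ univ I p.2 (zz p.1)
        · rw [indicator_of_mem hu, indicator_of_mem]
          · exact le_rfl
          have hd : ∀ i, b ≤ |nodes p.2 u i - t₀| := by
            intro i
            refine Fin.cases ?_ (fun j => ?_) i
            · simpa [nodes] using hp.2.1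
            · simpa [nodes] using (hu.1 j).2.1
          refine ⟨?_, ?_⟩
          · rw [nodes_cons]
            intro i j
            refine Fin.cases ?_ (fun i => ?_) i <;> refine Fin.cases ?_ (fun j => ?_) j
            · intro h; exact absurd rfl h
            · intro _; simp only [Fin.cons_zero, Fin.cons_succ]; rw [abs_sub_comm]; exact hd j
            · intro _; simp only [Fin.cons_zero, Fin.cons_succ]; exact hd i
            · intro h
              simp only [Fin.cons_succ]
              exact nodes_sep hb hu.1 (fun h' => h (by rw [h']))
          · have e : endpt (m+1) t₀ ((0, y₀) : Pt (m+1)) (Fin.cons p u : Fin (m+1) → ℝ × ℝ) = endpt (m+1) p.2 (zz p.1) u := by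
              unfold endpt
              rw [Fin.sum_univ_succ, nodes_cons]
              simp only [hzz, Fin.cons_zero, Fin.castSucc_zero, Fin.cons_succ, ← Fin.succ_castSucc, add_assoc]
            have e2 : nodes t₀ (Fin.cons p u : Fin (m+1) → ℝ × ℝ) (Fin.last (m+1)) = nodes p.2 u (Fin.last m) := by
              rw [nodes_cons, ← Fin.succ_last, Fin.cons_succ]
            rw [e, e2]
            exact hu.2.2
        · rw [indicator_of_notMem hu]; exact zero_le
      · rw [indicator_of_notMem hp]; exact zero_le
    refine le_trans ?_ (lintegral_mono h1)
    rw [lintegral_indicator_const hPm, mul_comm (ENNReal.ofReal b), mul_left_comm]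
    gcongr
    rw [Measure.volume_eq_prod, Measure.prod_apply hPm]
    have hW : MeasurableSet {w : ℝ | zz w ∈ E'} := hzzm hE'm
    have h2 : ∀ w : ℝ, {w : ℝ | zz w ∈ E'}.indicator (fun _ => ENNReal.ofReal b) w ≤
        volume (Prod.mk w ⁻¹' P) := by
      intro w
      by_cases hw : w ∈ {w : ℝ | zz w ∈ E'}
      · rw [indicator_of_mem hw]
        have h3 : ENNReal.ofReal (3*b) ≤ volume {t : ℝ | (t, zz w) ∈ J} := hw
        have hsub : {t' | (t', zz w) ∈ J} ⊆ Ioo (t₀ - b) (t₀ + b) ∪ (Prod.mk w ⁻¹' P) := by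
          intro t' h5
          by_cases h6 : b ≤ |t' - t₀|
          · right; exact ⟨hw, h6, h5⟩
          · left; rw [not_le, abs_lt] at h6; constructor <;> linarith
        have h4 := h3.trans ((measure_mono hsub).trans (measure_union_le _ _))
        rw [Real.volume_Ioo, show t₀ + b - (t₀ - b) = 2*b by ring, show 3*b = 2*b+b by ring,
          ENNReal.ofReal_add (by linarith) hb.le] at h4
        exact (ENNReal.add_le_add_iff_left ENNReal.ofReal_ne_top).1 h4
      · rw [indicator_of_notMem hw]; exact zero_le
    refine le_trans ?_ (lintegral_mono h2)
    rw [lintegral_indicator_const hW, mul_comm, XI_eq hE'm]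
    apply le_of_eq
    congr 2
    ext s
    simp [hzz, vv]

end

section

lemma core (n : ℕ) (hn : 2 ≤ n) : ∃ C : ℝ, 0 < C ∧ ∀ (E F : Set (Pt n)), MeasurableSet E → MeasurableSet F →
    ∀ e l A V : ℝ, 0 < e → 0 < l → 0 < A → 0 < V → volume E ≤ ENNReal.ofReal e →
    (∀ t, volume {y | (t, y) ∈ F} ≤ ENNReal.ofReal l) → volume F ≤ ENNReal.ofReal V →
    ENNReal.ofReal (A * V) ≤ volume (inc n E F) →
    ∃ E' ⊆ E, MeasurableSet E' ∧ ENNReal.ofReal (A * V / 2) ≤ volume (inc n E' F) ∧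
      ∀ x, XI n E' x ≤ ENNReal.ofReal (C * l * A ^ (-((n:ℝ) - 1)) * (A * V / e) ^ (-((n:ℝ) * (n + 1) / 2))) := by
  obtain ⟨m, rfl⟩ : ∃ m, n = m + 1 := ⟨n - 1, by omega⟩
  have hm : (1:ℝ) ≤ m := by exact_mod_cast (by omega : 1 ≤ m)
  set c : ℝ := 1 / (10 * (2 * m + 1)) with hc
  have hc0 : 0 < c := by positivity
  set N : ℝ := ((m+1:ℕ):ℝ) * (((m+1:ℕ):ℝ) + 1) / 2 with hN
  refine ⟨(m + 2) * (4 / m) ^ (m+1) * c ^ (-(m:ℝ)) * c ^ (-N), by positivity, ?_⟩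
  intro E F hE hF e l A V he hl hA hV hEe hFl hFV hI
  set b := c * (A * V / e) with hb
  have hb0 : 0 < b := by positivity
  obtain ⟨E', hE'E, hE'm, h1, h2⟩ := lemmaL (a := c * A) hb0 hE hF hFl
  refine ⟨E', hE'E, hE'm, ?_, fun x => ?_⟩
  · have herr : (2*(m:ℝ≥0∞)+1) * (ENNReal.ofReal (c * A) * volume F + ENNReal.ofReal (4*b) * volume E) ≤
        ENNReal.ofReal (A * V / 2) := by
      calc _ ≤ ENNReal.ofReal (2 * m + 1) * (ENNReal.ofReal (c * A) * ENNReal.ofReal V + ENNReal.ofReal (4*b) * ENNReal.ofReal e) := by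
            gcongr
            rw [ENNReal.ofReal_add (by positivity) (by positivity), ENNReal.ofReal_mul (by positivity)]; simp
        _ = ENNReal.ofReal ((2 * m + 1) * (c * A * V + 4 * b * e)) := by
            rw [ENNReal.ofReal_mul (p := 2 * (m:ℝ) + 1) (by positivity),
              ENNReal.ofReal_add (p := c * A * V) (by positivity) (by positivity),
              ENNReal.ofReal_mul (p := c * A) (by positivity), ENNReal.ofReal_mul (by positivity : 0 ≤ 4 * b)]
        _ = _ := by
            congr 1
            rw [hb, hc]; field_simp; ring
    have h3 : ENNReal.ofReal (A * V / 2) + ENNReal.ofReal (A * V / 2) ≤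
        volume (inc (m+1) E' F) + ENNReal.ofReal (A * V / 2) := by
      rw [← ENNReal.ofReal_add (by positivity) (by positivity), add_halves]
      exact hI.trans (h1.trans (by gcongr))
    exact (ENNReal.add_le_add_iff_right ENNReal.ofReal_ne_top).1 h3
  · have h3 := h2 x
    have hs : (1:ℝ) < ((m:ℝ)+2)/2 := by linarith
    have h4 := lintegral_kb (b := b) (s := ((m:ℝ)+2)/2) hb0 hs
    have h5 : XI (m+1) E' x * ENNReal.ofReal (b * (c * A * b)^m) ≤
        ENNReal.ofReal (l * ((m + 2) * (2 / (((m:ℝ)+2)/2 - 1) * b ^ (1 - ((m:ℝ)+2)/2))^(m+1))) := by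
      rw [ENNReal.ofReal_mul hb0.le, ENNReal.ofReal_pow (by positivity), ENNReal.ofReal_mul (by positivity : 0 ≤ c * A)]
      refine h3.trans ?_
      have : 0 < ((m:ℝ)+2)/2 - 1 := by linarith
      rw [ENNReal.ofReal_mul hl.le, ENNReal.ofReal_mul (by positivity), ENNReal.ofReal_pow (by positivity)]
      gcongr
      rw [ENNReal.ofReal_add (by positivity) (by positivity)]; simp
    have hpos : 0 < b * (c * A * b)^m := by positivity
    rw [← ENNReal.le_div_iff_mul_le (Or.inl (by simpa using hpos)) (Or.inl ENNReal.ofReal_ne_top),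
      ← ENNReal.ofReal_div_of_pos hpos] at h5
    refine h5.trans (le_of_eq ?_)
    congr 1
    have hx : 0 < A * V / e := by positivity
    have e1 : (2 / (((m:ℝ)+2)/2 - 1)) = 4 / m := by
      have : ((m:ℝ)+2)/2 - 1 = m / 2 := by ring
      rw [this]; field_simp; norm_num
    have e2 : (b ^ (1 - ((m:ℝ)+2)/2))^(m+1) = b ^ (-(m:ℝ)*(m+1)/2) := by
      rw [← Real.rpow_natCast, ← Real.rpow_mul hb0.le]; congr 1; push_cast; ring
    have e3 : b * (c * A * b)^m = c ^ (m:ℝ) * A ^ (m:ℝ) * b ^ ((m:ℝ)+1) := by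
      rw [Real.rpow_add hb0, Real.rpow_natCast, Real.rpow_natCast, Real.rpow_natCast, Real.rpow_one]; ring
    have e4 : b ^ (-N) * b ^ ((m:ℝ)+1) = b ^ (-(m:ℝ)*(m+1)/2) := by
      rw [← Real.rpow_add hb0]; congr 1; rw [hN]; push_cast; ring
    rw [e1, mul_pow, e2, e3, ← e4]
    have e5 : b ^ (-N) = c ^ (-N) * (A * V / e) ^ (-N) := by
      rw [hb, Real.mul_rpow hc0.le hx.le]
    rw [e5]
    have e6 : (A:ℝ) ^ (-(((m+1:ℕ):ℝ) - 1)) = (A ^ (m:ℝ))⁻¹ := by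
      rw [← Real.rpow_neg hA.le]; congr 1; push_cast; ring
    rw [e6, Real.rpow_neg hc0.le (m:ℝ)]
    have p1 : b ^ ((m:ℝ)+1) ≠ 0 := by positivity
    have p2 : A ^ (m:ℝ) ≠ 0 := by positivity
    have p3 : c ^ (m:ℝ) ≠ 0 := by positivity
    field_simp

end

section

def e2 (x : ℝ) : ℝ≥0∞ := ENNReal.ofReal ((2:ℝ)^x)

lemma e2_add (x y : ℝ) : e2 (x + y) = e2 x * e2 y := by
  unfold e2; rw [Real.rpow_add (by norm_num), ENNReal.ofReal_mul (by positivity)]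
lemma e2_pos (x : ℝ) : 0 < e2 x := by unfold e2; simp; positivity
lemma e2_ne_zero (x : ℝ) : e2 x ≠ 0 := (e2_pos x).ne'
lemma e2_ne_top (x : ℝ) : e2 x ≠ ∞ := ENNReal.ofReal_ne_top
lemma e2_mono {x y : ℝ} (h : x ≤ y) : e2 x ≤ e2 y :=
  ENNReal.ofReal_le_ofReal (Real.rpow_le_rpow_of_exponent_le (by norm_num) h)
lemma e2_zero : e2 0 = 1 := by simp [e2]
lemma e2_one : e2 1 = 2 := by simp [e2]
lemma e2_rpow (x r : ℝ) : e2 x ^ r = e2 (x * r) := by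
  unfold e2; rw [ENNReal.ofReal_rpow_of_pos (by positivity), ← Real.rpow_mul (by norm_num)]
lemma e2_int (a : ℤ) : e2 a = (2:ℝ≥0∞)^a := by
  have h : (2:ℝ≥0∞) = ENNReal.ofReal 2 := by simp
  rw [← ENNReal.rpow_intCast, h, ENNReal.ofReal_rpow_of_pos (by norm_num)]; rfl

lemma exists_e2 {v : ℝ≥0∞} (h0 : v ≠ 0) (h1 : v ≠ ∞) : ∃ a : ℤ, e2 a ≤ v ∧ v < e2 (a + 1) := by
  obtain ⟨a, ha⟩ := ENNReal.exists_mem_Ico_zpow h0 h1 (by norm_num : (1:ℝ≥0∞) < 2) (by norm_num)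
  refine ⟨a, ?_, ?_⟩
  · rw [e2_int]; exact ha.1
  · have := e2_int (a+1); push_cast at this; rw [this]; exact ha.2

lemma exists_e2' {v : ℝ≥0∞} {a : ℤ} (h0 : v ≠ 0) (h1 : v ≤ e2 a) :
    ∃ k : ℕ, e2 (a - k - 1) < v ∧ v ≤ e2 (a - k) := by
  obtain ⟨b, hb⟩ := ENNReal.exists_mem_Ioc_zpow h0 (h1.trans_lt (e2_ne_top _).lt_top).ne (by norm_num : (1:ℝ≥0∞) < 2) (by norm_num)
  rw [← e2_int, ← e2_int] at hb
  have hba : (b:ℝ) < a := by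
    by_contra h
    push Not at h
    exact absurd (h1.trans (e2_mono h)) (not_le.2 hb.1)
  have hba' : b + 1 ≤ a := by exact_mod_cast hba
  obtain ⟨k, hk⟩ := Int.le.dest hba'
  refine ⟨k, ?_, ?_⟩
  · have : (a:ℝ) - k - 1 = b := by rw [← hk]; push_cast; ring
    rw [this]; exact hb.1
  · have : (a:ℝ) - k = ((b+1 : ℤ):ℝ) := by rw [← hk]; push_cast; ring
    rw [this]; exact hb.2

lemma rpow_sum_le {ι : Type*} (s : Finset ι) (f : ι → ℝ≥0∞) {p : ℝ} (h0 : 0 < p) (h1 : p ≤ 1) :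
    (∑ i ∈ s, f i) ^ p ≤ ∑ i ∈ s, f i ^ p := by
  classical
  induction s using Finset.induction_on with
  | empty => simp [h0]
  | insert a s ha ih =>
    rw [Finset.sum_insert ha, Finset.sum_insert ha]
    exact (ENNReal.rpow_add_le_add_rpow _ _ h0.le h1).trans (by gcongr)

lemma rpow_tsum_le {ι : Type*} (f : ι → ℝ≥0∞) {p : ℝ} (h0 : 0 < p) (h1 : p ≤ 1) :
    (∑' i, f i) ^ p ≤ ∑' i, f i ^ p := by
  rw [← ENNReal.le_rpow_inv_iff h0, ENNReal.tsum_eq_iSup_sum]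
  refine iSup_le fun s => ?_
  rw [ENNReal.le_rpow_inv_iff h0]
  exact (rpow_sum_le s f h0 h1).trans (ENNReal.sum_le_tsum s)

variable {n : ℕ}

def Fa (n : ℕ) (E : Set (Pt n)) (a : ℤ) : Set (Pt n) := {x | e2 a ≤ XI n E x ∧ XI n E x < e2 (a + 1)}
def lam (n : ℕ) (E : Set (Pt n)) (a : ℤ) (t : ℝ) : ℝ≥0∞ := volume {y | (t, y) ∈ Fa n E a}
def Tak (n : ℕ) (E : Set (Pt n)) (a : ℤ) (k : ℕ) : Set ℝ :=
  {t | e2 (-a - k - 1) < lam n E a t ∧ lam n E a t ≤ e2 (-a - k)}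
def Pak (n : ℕ) (E : Set (Pt n)) (a : ℤ) (k : ℕ) : Set (Pt n) := Fa n E a ∩ Prod.fst ⁻¹' (Tak n E a k)

lemma measurable_XI {E : Set (Pt n)} (hE : MeasurableSet E) : Measurable (XI n E) :=
  measurable_XE (measurable_one.indicator hE)

lemma measurableSet_Fa {E : Set (Pt n)} (hE : MeasurableSet E) (a : ℤ) : MeasurableSet (Fa n E a) :=
  ms_and (measurableSet_le measurable_const (measurable_XI hE)) (measurableSet_lt (measurable_XI hE) measurable_const)

lemma measurable_lam {E : Set (Pt n)} (hE : MeasurableSet E) (a : ℤ) : Measurable (lam n E a) :=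
  measurable_measure_prodMk_left (measurableSet_Fa hE a)

lemma measurableSet_Tak {E : Set (Pt n)} (hE : MeasurableSet E) (a : ℤ) (k : ℕ) : MeasurableSet (Tak n E a k) :=
  ms_and (measurableSet_lt measurable_const (measurable_lam hE a))
    (measurableSet_le (measurable_lam hE a) measurable_const)

lemma measurableSet_Pak {E : Set (Pt n)} (hE : MeasurableSet E) (a : ℤ) (k : ℕ) : MeasurableSet (Pak n E a k) :=
  (measurableSet_Fa hE a).inter (measurable_fst (measurableSet_Tak hE a k))

lemma lintegral_XI {E : Set (Pt n)} (hE : MeasurableSet E) (t : ℝ) : ∫⁻ y, XI n E (t, y) = volume E := by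
  rw [← lintegral_indicator_one hE, lintegral_lines (measurable_one.indicator hE) t]

lemma measurable_XI_right {E : Set (Pt n)} (hE : MeasurableSet E) (t : ℝ) :
    Measurable (fun y => XI n E (t, y)) := (measurable_XI hE).comp measurable_prodMk_left

lemma measurableSet_Fa_slice {E : Set (Pt n)} (hE : MeasurableSet E) (a : ℤ) (t : ℝ) :
    MeasurableSet {y | (t, y) ∈ Fa n E a} := (measurable_prodMk_left (x := t)) (measurableSet_Fa hE a)

lemma lam_le {E : Set (Pt n)} (hE : MeasurableSet E) (hE1 : volume E ≤ 1) (a : ℤ) (t : ℝ) :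
    lam n E a t ≤ e2 (-a) := by
  have h : e2 a * lam n E a t ≤ 1 := by
    rw [lam, ← setLIntegral_const]
    calc _ ≤ ∫⁻ y in {y | (t, y) ∈ Fa n E a}, XI n E (t, y) :=
          setLIntegral_mono (measurable_XI_right hE t) fun y hy => hy.1
      _ ≤ ∫⁻ y, XI n E (t, y) := setLIntegral_le_lintegral _ _
      _ ≤ 1 := by rw [lintegral_XI hE]; exact hE1
  calc lam n E a t = e2 (-a) * (e2 a * lam n E a t) := by rw [← mul_assoc, ← e2_add]; simp [e2_zero]
    _ ≤ e2 (-a) * 1 := by gcongr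
    _ = _ := mul_one _

lemma Pak_slice_le {E : Set (Pt n)} (a : ℤ) (k : ℕ) (t : ℝ) :
    volume {y | (t, y) ∈ Pak n E a k} ≤ e2 (-a - k) := by
  by_cases ht : t ∈ Tak n E a k
  · refine le_trans (measure_mono ?_) ht.2
    intro y hy; exact hy.1
  · have : {y | (t, y) ∈ Pak n E a k} = ∅ := by
      ext y
      simp [Pak, ht]
    rw [this, measure_empty]; exact zero_le

lemma vol_Pak_ge {E : Set (Pt n)} (hE : MeasurableSet E) (a : ℤ) (k : ℕ) (S : Set ℝ) (hS : MeasurableSet S) :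
    e2 (-a - k - 1) * volume (Tak n E a k ∩ S) ≤ volume (Pak n E a k ∩ Prod.fst ⁻¹' S) := by
  rw [Measure.volume_eq_prod, Measure.prod_apply ((measurableSet_Pak hE a k).inter (measurable_fst hS)),
    ← setLIntegral_const, ← lintegral_indicator ((measurableSet_Tak hE a k).inter hS)]
  refine lintegral_mono fun t => ?_
  by_cases ht : t ∈ Tak n E a k ∩ S
  swap
  · rw [indicator_of_notMem ht]; exact zero_le
  rw [indicator_of_mem ht]
  refine ht.1.1.le.trans (measure_mono ?_)
  intro y hy
  exact ⟨⟨hy, ht.1⟩, ht.2⟩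

lemma J_le {E : Set (Pt n)} (hE : MeasurableSet E) (hE1 : volume E ≤ 1) {q r ρ : ℝ}
    (hr : 0 < r) (hρ : 0 < ρ) (hρ1 : ρ ≤ 1) (hq : q = r * ρ) :
    ∫⁻ t, (∫⁻ y, XI n E (t, y) ^ r) ^ ρ ≤
      ∑' k : ℕ, ∑' a : ℤ, e2 (q + 1) * e2 (a * (q - ρ) - k * ρ + a + k) * volume (Pak n E a k) := by
  have h1 : ∀ t, ∫⁻ y, XI n E (t, y) ^ r ≤ ∑' a : ℤ, e2 ((a+1) * r) * lam n E a t := by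
    intro t
    have hfin : ∀ᵐ y, XI n E (t, y) < ∞ := by
      apply ae_lt_top (measurable_XI_right hE t)
      rw [lintegral_XI hE]; exact (hE1.trans_lt one_lt_top).ne
    calc ∫⁻ y, XI n E (t, y) ^ r ≤ ∫⁻ y, ∑' a : ℤ, ({y | (t, y) ∈ Fa n E a}).indicator (fun _ => e2 ((a+1) * r)) y := by
          refine lintegral_mono_ae ?_
          filter_upwards [hfin] with y hy
          by_cases h0 : XI n E (t, y) = 0
          · rw [h0, ENNReal.zero_rpow_of_pos hr]; exact zero_le
          obtain ⟨a, ha⟩ := exists_e2 h0 hy.ne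
          refine le_trans ?_ (ENNReal.le_tsum a)
          rw [indicator_of_mem (by exact ha), ← e2_rpow]
          exact ENNReal.rpow_le_rpow ha.2.le hr.le
      _ = _ := by
          rw [lintegral_tsum fun a => (measurable_const.indicator (measurableSet_Fa_slice hE a t)).aemeasurable]
          congr 1; ext a
          rw [lintegral_indicator (measurableSet_Fa_slice hE a t), setLIntegral_const]; rfl
  have h2 : ∀ t, (∫⁻ y, XI n E (t, y) ^ r) ^ ρ ≤
      ∑' a : ℤ, ∑' k : ℕ, (Tak n E a k).indicator (fun _ => e2 ((a+1) * q - (a + k) * ρ)) t := by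
    intro t
    refine (ENNReal.rpow_le_rpow (h1 t) hρ.le).trans ((rpow_tsum_le _ hρ hρ1).trans ?_)
    refine ENNReal.tsum_le_tsum fun a => ?_
    by_cases h0 : lam n E a t = 0
    · rw [h0, mul_zero, ENNReal.zero_rpow_of_pos hρ]; exact zero_le
    have hl := lam_le hE hE1 a t
    obtain ⟨k, hk⟩ := exists_e2' (a := -a) h0 (by simpa using hl)
    refine le_trans ?_ (ENNReal.le_tsum k)
    have hk' : t ∈ Tak n E a k := by simpa [Tak] using hk
    rw [indicator_of_mem hk']
    rw [ENNReal.mul_rpow_of_nonneg _ _ hρ.le, e2_rpow]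
    refine (mul_le_mul_right (ENNReal.rpow_le_rpow hk'.2 hρ.le) _).trans (le_of_eq ?_)
    rw [e2_rpow, ← e2_add]; congr 1; rw [hq]; ring
  refine (lintegral_mono h2).trans ?_
  rw [lintegral_tsum fun a => (Measurable.tsum fun k => measurable_const.indicator (measurableSet_Tak hE a k)).aemeasurable]
  rw [ENNReal.tsum_comm]
  refine ENNReal.tsum_le_tsum fun a => ?_
  rw [lintegral_tsum fun k => (measurable_const.indicator (measurableSet_Tak hE a k)).aemeasurable]
  refine ENNReal.tsum_le_tsum fun k => ?_
  rw [lintegral_indicator (measurableSet_Tak hE a k), setLIntegral_const]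
  have h3 := vol_Pak_ge hE a k univ MeasurableSet.univ
  simp only [inter_univ, preimage_univ] at h3
  calc _ = e2 (q + 1) * e2 (a * (q - ρ) - k * ρ + a + k) * (e2 (-a - k - 1) * volume (Tak n E a k)) := by
        rw [← mul_assoc, ← e2_add, ← e2_add]; congr 2; ring
    _ ≤ _ := by gcongr

end

section

def NN (n : ℕ) : ℝ := (n:ℝ) * (n + 1) / 2
/-- scaling exponent -/
def sx (n : ℕ) (a : ℤ) (k : ℕ) : ℝ := a * (1 + 2 / n) + k / NN n

lemma NN_pos {n : ℕ} (hn : 2 ≤ n) : 0 < NN n := by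
  have : (2:ℝ) ≤ n := by exact_mod_cast hn
  unfold NN; positivity

lemma sx_mul {n : ℕ} (hn : 2 ≤ n) (a : ℤ) (k : ℕ) : sx n a k * NN n = a * NN n + a * (n + 1) + k := by
  have : (2:ℝ) ≤ n := by exact_mod_cast hn
  have h := (NN_pos hn).ne'
  unfold sx; rw [add_mul, div_mul_cancel₀ _ h]; unfold NN; field_simp

lemma core_const {n : ℕ} (hn : 2 ≤ n) (C c V e : ℝ) (hc : 0 < c) (hV : 0 < V) (he : 0 < e) (a : ℤ) (k : ℕ) :
    C * 2 ^ (-(a:ℝ) - k) * (c * 2 ^ (a:ℝ)) ^ (-((n:ℝ) - 1)) * (c * 2 ^ (a:ℝ) * V / e) ^ (-((n:ℝ) * (n + 1) / 2)) =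
      C * c ^ (-((n:ℝ) - 1) - NN n) * 2 ^ (a:ℝ) * (2 ^ sx n a k * V / e) ^ (-NN n) := by
  have h2 : (0:ℝ) < 2 := by norm_num
  have e1 : c * 2 ^ (a:ℝ) * V / e = c * (2 ^ (a:ℝ) * (V / e)) := by ring
  have e2 : 2 ^ sx n a k * V / e = 2 ^ sx n a k * (V / e) := by ring
  have hVe : 0 < V / e := by positivity
  rw [e1, e2]
  change _ * (c * (2 ^ (a:ℝ) * (V / e))) ^ (-NN n) = _
  rw [Real.mul_rpow hc.le (by positivity), Real.mul_rpow hc.le (by positivity), Real.mul_rpow (by positivity) hVe.le,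
    Real.mul_rpow (by positivity) hVe.le, ← Real.rpow_mul h2.le, ← Real.rpow_mul h2.le, ← Real.rpow_mul h2.le,
    mul_neg (sx n a k), sx_mul hn, sub_eq_add_neg (-((n:ℝ) - 1)), Real.rpow_add hc]
  have e3 : (2:ℝ) ^ (-(a:ℝ) - k) * 2 ^ ((a:ℝ) * -((n:ℝ) - 1)) * 2 ^ ((a:ℝ) * -NN n) =
    2 ^ (a:ℝ) * 2 ^ (-((a:ℝ) * NN n + a * (n + 1) + k)) := by
    rw [← Real.rpow_add h2, ← Real.rpow_add h2, ← Real.rpow_add h2]; congr 1; ring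
  linear_combination (C * c ^ (-((n:ℝ) - 1)) * c ^ (-NN n) * (V / e) ^ (-NN n)) * e3

lemma core' {n : ℕ} (hn : 2 ≤ n) {c : ℝ} (hc : 0 < c) :
    ∃ C : ℝ, 0 < C ∧ ∀ (E F : Set (Pt n)), MeasurableSet E → MeasurableSet F →
    ∀ (e V : ℝ) (a : ℤ) (k : ℕ), 0 < e → 0 < V → volume E ≤ ENNReal.ofReal e →
    (∀ t, volume {y | (t, y) ∈ F} ≤ e2 (-a - k)) → volume F ≤ ENNReal.ofReal V →
    ENNReal.ofReal (c * 2 ^ (a:ℝ) * V) ≤ volume (inc n E F) →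
    ∃ E' ⊆ E, MeasurableSet E' ∧ ENNReal.ofReal (c * 2 ^ (a:ℝ) * V / 2) ≤ volume (inc n E' F) ∧
      ∀ x, XI n E' x ≤ ENNReal.ofReal (C * 2 ^ (a:ℝ) * (2 ^ sx n a k * V / e) ^ (-NN n)) := by
  obtain ⟨C, hC, h⟩ := core n hn
  refine ⟨C * c ^ (-((n:ℝ) - 1) - NN n), by positivity, ?_⟩
  intro E F hE hF e V a k he hV h1 h2 h3 h4
  obtain ⟨E', g1, g2, g3, g4⟩ := h E F hE hF e (2 ^ (-(a:ℝ) - k)) (c * 2 ^ (a:ℝ)) V he (by positivity) (by positivity) hV h1 h2 h3 h4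
  refine ⟨E', g1, g2, g3, fun x => ?_⟩
  rw [← core_const hn C c V e hc hV he]; exact g4 x

lemma psi_core {n : ℕ} (hn : 2 ≤ n) {c : ℝ} (hc : 0 < c) :
    ∃ C : ℝ, 0 < C ∧ ∀ (E F : Set (Pt n)), MeasurableSet E → MeasurableSet F →
    ∀ (e V : ℝ) (a : ℤ) (k : ℕ), 0 < e → 0 < V → volume E ≤ ENNReal.ofReal e →
    (∀ t, volume {y | (t, y) ∈ F} ≤ e2 (-a - k)) → volume F ≤ ENNReal.ofReal V →
    ENNReal.ofReal (c * 2 ^ (a:ℝ) * V) ≤ volume (inc n E F) → 2 ^ sx n a k * V ≤ C * e := by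
  obtain ⟨C, hC, h⟩ := core' hn hc
  have hN := NN_pos hn
  refine ⟨(2 * C / c) ^ (NN n)⁻¹, by positivity, ?_⟩
  intro E F hE hF e V a k he hV h1 h2 h3 h4
  obtain ⟨E', g1, g2, g3, g4⟩ := h E F hE hF e V a k he hV h1 h2 h3 h4
  set ψ := 2 ^ sx n a k * V / e with hψ
  have hψ0 : 0 < ψ := by positivity
  have h5 : volume (inc n E' F) ≤ ENNReal.ofReal (C * 2 ^ (a:ℝ) * ψ ^ (-NN n) * V) := by
    rw [vol_inc g2 hF]
    calc _ ≤ ∫⁻ x in F, ENNReal.ofReal (C * 2 ^ (a:ℝ) * ψ ^ (-NN n)) := lintegral_mono g4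
      _ ≤ _ := by
        rw [setLIntegral_const, ENNReal.ofReal_mul (p := C * 2 ^ (a:ℝ) * ψ ^ (-NN n)) (by positivity)]; gcongr
  have h6 := (ENNReal.ofReal_le_ofReal_iff (by positivity)).1 (g3.trans h5)
  have h7 : ψ ^ NN n ≤ 2 * C / c := by
    rw [Real.rpow_neg hψ0.le] at h6
    have p1 : 0 < ψ ^ NN n := by positivity
    have p2 : (0:ℝ) < 2 ^ (a:ℝ) := by positivity
    rw [le_div_iff₀ hc]
    have h8 : C * 2 ^ (a:ℝ) * (ψ ^ NN n)⁻¹ * V = (2 ^ (a:ℝ) * V) * (C / ψ ^ NN n) := by ring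
    have h9 : c * 2 ^ (a:ℝ) * V / 2 = (2 ^ (a:ℝ) * V) * (c / 2) := by ring
    rw [h8, h9] at h6
    have h10 := le_of_mul_le_mul_left h6 (by positivity)
    rw [le_div_iff₀ p1] at h10
    linarith
  have h8 : ψ ≤ (2 * C / c) ^ (NN n)⁻¹ := (Real.le_rpow_inv_iff_of_pos hψ0.le (by positivity) hN).2 h7
  rw [hψ, div_le_iff₀ he] at h8; exact h8

def Psi (n : ℕ) (E : Set (Pt n)) (a : ℤ) (k : ℕ) : ℝ≥0∞ := e2 (sx n a k) * volume (Pak n E a k)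

lemma inc_ge {n : ℕ} {E F : Set (Pt n)} (hE : MeasurableSet E) (hF : MeasurableSet F) {a : ℤ}
    (h : F ⊆ Fa n E a) : e2 a * volume F ≤ volume (inc n E F) := by
  rw [vol_inc hE hF, ← setLIntegral_const]
  exact setLIntegral_mono (measurable_XI hE) fun x hx => (h hx).1

lemma psi_bd {n : ℕ} (hn : 2 ≤ n) : ∃ C : ℝ, 0 < C ∧ ∀ E : Set (Pt n), MeasurableSet E → volume E ≤ 1 →
    ∀ a k, Psi n E a k ≤ ENNReal.ofReal C := by
  obtain ⟨C, hC, h⟩ := psi_core hn one_pos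
  refine ⟨C, hC, fun E hE hE1 a k => ?_⟩
  have hun : Pak n E a k = ⋃ j : ℕ, (Pak n E a k ∩ Prod.fst ⁻¹' (Icc (-(j:ℝ)) j)) := by
    rw [← inter_iUnion, ← preimage_iUnion]
    have : ⋃ j : ℕ, Icc (-(j:ℝ)) j = univ := by
      rw [eq_univ_iff_forall]; intro x
      obtain ⟨j, hj⟩ := exists_nat_ge |x|
      exact mem_iUnion.2 ⟨j, abs_le.1 hj⟩
    rw [this]; simp
  have hmono : Monotone (fun j : ℕ => Pak n E a k ∩ Prod.fst ⁻¹' (Icc (-(j:ℝ)) j)) := by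
    intro i j hij
    have : (i:ℝ) ≤ j := by exact_mod_cast hij
    refine inter_subset_inter_right _ (preimage_mono (Icc_subset_Icc (by linarith) this))
  unfold Psi
  rw [hun, hmono.measure_iUnion, ENNReal.mul_iSup]
  refine iSup_le fun j => ?_
  set F := Pak n E a k ∩ Prod.fst ⁻¹' (Icc (-(j:ℝ)) j)
  have hF : MeasurableSet F := (measurableSet_Pak hE a k).inter (measurable_fst measurableSet_Icc)
  have hsl : ∀ t, volume {y | (t, y) ∈ F} ≤ e2 (-a - k) := fun t =>
    (measure_mono (fun y hy => hy.1)).trans (Pak_slice_le (E := E) a k t)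
  have hfin : volume F ≠ ∞ := by
    have : volume F ≤ e2 (-a - k) * volume (Icc (-(j:ℝ)) j) := by
      rw [Measure.volume_eq_prod, Measure.prod_apply hF, ← setLIntegral_const, ← lintegral_indicator measurableSet_Icc]
      refine lintegral_mono fun t => ?_
      by_cases ht : t ∈ Icc (-(j:ℝ)) j
      · rw [indicator_of_mem ht]; exact hsl t
      · have : Prod.mk t ⁻¹' F = ∅ := by ext y; simp only [F, mem_preimage, mem_inter_iff]; simp only [ht]; simp
        rw [this]; simp
    refine (this.trans_lt ?_).ne
    rw [Real.volume_Icc]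
    exact ENNReal.mul_lt_top (e2_ne_top _).lt_top ENNReal.ofReal_lt_top
  by_cases h0 : volume F = 0
  · rw [h0, mul_zero]; exact zero_le
  have hV : 0 < (volume F).toReal := ENNReal.toReal_pos h0 hfin
  have h1 := h E F hE hF 1 (volume F).toReal a k one_pos hV (by simpa using hE1) hsl (by rw [ENNReal.ofReal_toReal hfin]) (by
    rw [one_mul, ENNReal.ofReal_mul (by positivity), ENNReal.ofReal_toReal hfin]
    exact inc_ge hE hF (fun x hx => hx.1.1))
  have h2 : e2 (sx n a k) * volume F = ENNReal.ofReal (2 ^ sx n a k * (volume F).toReal) := by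
    rw [ENNReal.ofReal_mul (by positivity), ENNReal.ofReal_toReal hfin]; rfl
  rw [h2]; exact ENNReal.ofReal_le_ofReal (by linarith)

lemma sum_two_zpow (s : Finset ℤ) (B : ℤ) (h : ∀ b ∈ s, b ≤ B) : ∑ b ∈ s, (2:ℝ) ^ (b:ℝ) ≤ 2 * 2 ^ (B:ℝ) := by
  have h1 : ∑ b ∈ s, (2:ℝ) ^ (b:ℝ) = ∑ i ∈ s.image (fun b => (B - b).toNat), (2:ℝ) ^ (B:ℝ) * (1/2) ^ i := by
    rw [Finset.sum_image]
    · refine Finset.sum_congr rfl fun b hb => ?_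
      have h3 : (((B - b).toNat : ℤ)) = B - b := Int.toNat_of_nonneg (by have := h b hb; omega)
      have h2 : (((B - b).toNat : ℝ)) = B - b := by
        have h4 : (((B - b).toNat : ℤ) : ℝ) = ((B - b : ℤ) : ℝ) := by rw [h3]
        push_cast at h4; exact h4
      rw [one_div, inv_pow, ← Real.rpow_natCast, h2, ← Real.rpow_neg (by norm_num), ← Real.rpow_add (by norm_num)]
      congr 1; ring
    · intro x hx y hy hxy
      have := h x hx; have := h y hy
      simp only at hxy; omega
  rw [h1, ← Finset.mul_sum, mul_comm (2:ℝ)]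
  gcongr
  exact (summable_geometric_two.sum_le_tsum _ (fun i _ => by positivity)).trans tsum_geometric_two.le

end

section

lemma inc_union_le {n : ℕ} {ι : Type*} (s : Finset ι) (E0 : Set (Pt n)) (B : ι → Set (Pt n)) (F : Set (Pt n)) :
    volume (inc n E0 F) ≤ volume (inc n (E0 \ ⋃ i ∈ s, B i) F) + ∑ i ∈ s, volume (inc n (B i) F) := by
  refine (measure_mono (?_ : _ ⊆ inc n (E0 \ ⋃ i ∈ s, B i) F ∪ ⋃ i ∈ s, inc n (B i) F)).trans
    ((measure_union_le _ _).trans (by gcongr; exact measure_biUnion_finset_le _ _))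
  intro x hx
  by_cases h : x.2 ∈ ⋃ i ∈ s, B i
  · right
    simp only [mem_iUnion] at h ⊢
    obtain ⟨i, hi, h⟩ := h
    exact ⟨i, hi, h, hx.2⟩
  · left; exact ⟨⟨hx.1, h⟩, hx.2⟩

lemma count_gap {n : ℕ} (hn : 2 ≤ n) {C₁ : ℝ} (hC₁ : 0 < C₁)
    (hpsi : ∀ E : Set (Pt n), MeasurableSet E → volume E ≤ 1 → ∀ a k, Psi n E a k ≤ ENNReal.ofReal C₁) :
    ∃ (c : ℝ) (K₀ : ℕ), 0 < c ∧ 0 < K₀ ∧ ∀ E : Set (Pt n), MeasurableSet E → volume E ≤ 1 → ∀ k m : ℕ,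
      ∀ s : Finset ℤ, (∀ a ∈ s, ENNReal.ofReal (C₁ * 2 ^ (-(m:ℝ) - 1)) < Psi n E a k) →
        (∀ a ∈ s, ∀ b ∈ s, b < a → b + (K₀ * (m + 1) : ℕ) ≤ a) →
        s.card * (c * 2 ^ (-(m:ℝ))) ≤ 1 ∧ s.card * (c * 2 ^ (-(k:ℝ))) ≤ 1 := by
  obtain ⟨C₂, hC₂, hcore⟩ := core' hn one_pos
  obtain ⟨C₃, hC₃, hpc⟩ := psi_core hn (c := 1/4) (by norm_num)
  have hN := NN_pos hn
  set Y : ℝ := max 1 (8 * C₂ * C₁ ^ (-NN n)) * 2 ^ NN n with hY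
  have hmax : (1:ℝ) ≤ max 1 (8 * C₂ * C₁ ^ (-NN n)) := le_max_left _ _
  obtain ⟨K₀, hK₀⟩ := pow_unbounded_of_one_lt Y (by norm_num : (1:ℝ) < 2)
  have hKpos : 0 < K₀ := by
    rcases Nat.eq_zero_or_pos K₀ with h | h
    · rw [h, pow_zero, hY] at hK₀
      have : (1:ℝ) ≤ 2 ^ NN n := Real.one_le_rpow (by norm_num) hN.le
      nlinarith
    · exact h
  refine ⟨min (C₁ / (4 * C₃)) (1/8), K₀, by positivity, hKpos, ?_⟩
  intro E hE hE1 k m s hs hgap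
  set θ₁ : ℝ := C₁ * 2 ^ (-(m:ℝ) - 1) with hθ₁
  have hθ₁0 : 0 < θ₁ := by positivity
  -- key constant inequality
  have hkey : 8 * C₂ * θ₁ ^ (-NN n) ≤ 2 ^ (K₀ * (m+1)) := by
    have h1 : θ₁ ^ (-NN n) = C₁ ^ (-NN n) * (2 ^ NN n) ^ (m+1) := by
      rw [hθ₁, Real.mul_rpow hC₁.le (by positivity), ← Real.rpow_mul (by norm_num), ← Real.rpow_natCast, ← Real.rpow_mul (by norm_num)]
      congr 2; push_cast; ring
    rw [h1, pow_mul]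
    calc 8 * C₂ * (C₁ ^ (-NN n) * (2 ^ NN n) ^ (m+1)) = (8 * C₂ * C₁ ^ (-NN n)) * (2 ^ NN n) ^ (m+1) := by ring
      _ ≤ (max 1 (8 * C₂ * C₁ ^ (-NN n))) ^ (m+1) * (2 ^ NN n) ^ (m+1) := by
        gcongr
        exact (le_max_right 1 _).trans (le_self_pow₀ hmax (by omega))
      _ = Y ^ (m+1) := by rw [hY, mul_pow]
      _ ≤ _ := by gcongr
  -- data
  set V : ℤ → ℝ := fun a => (volume (Pak n E a k)).toReal with hVdef
  have hfin : ∀ a, volume (Pak n E a k) ≠ ∞ := by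
    intro a h
    have := hpsi E hE hE1 a k
    rw [Psi, h, ENNReal.mul_top (e2_ne_zero _)] at this
    exact ENNReal.ofReal_ne_top (top_le_iff.1 this)
  have hPsi : ∀ a, Psi n E a k = ENNReal.ofReal (2 ^ sx n a k * V a) := by
    intro a; rw [ENNReal.ofReal_mul (by positivity), hVdef, ENNReal.ofReal_toReal (hfin a)]; rfl
  have hVeq : ∀ a, volume (Pak n E a k) = ENNReal.ofReal (V a) := fun a => (ENNReal.ofReal_toReal (hfin a)).symm
  have hps : ∀ a ∈ s, θ₁ < 2 ^ sx n a k * V a := by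
    intro a ha
    have := hs a ha
    rw [hPsi] at this
    exact (ENNReal.ofReal_lt_ofReal_iff' .. |>.1 this).1
  have hVpos : ∀ a ∈ s, 0 < V a := by
    intro a ha
    have h1 : 0 < 2 ^ sx n a k * V a := hθ₁0.trans (hps a ha)
    exact (pos_iff_pos_of_mul_pos h1).1 (by positivity)
  have hPm : ∀ a, MeasurableSet (Pak n E a k) := fun a => measurableSet_Pak hE a k
  have hex : ∀ a : ℤ, ∃ E' ⊆ E, MeasurableSet E' ∧ (a ∈ s →
      ENNReal.ofReal (2 ^ (a:ℝ) * V a / 2) ≤ volume (inc n E' (Pak n E a k)) ∧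
      ∀ x, XI n E' x ≤ ENNReal.ofReal (C₂ * 2 ^ (a:ℝ) * θ₁ ^ (-NN n))) := by
    intro a
    by_cases ha : a ∈ s
    · obtain ⟨E', g1, g2, g3, g4⟩ := hcore E (Pak n E a k) hE (hPm a) 1 (V a) a k one_pos (hVpos a ha) (by simpa using hE1)
        (Pak_slice_le a k) (hVeq a).le (by
          rw [one_mul, ENNReal.ofReal_mul (by positivity), ← hVeq]
          exact inc_ge hE (hPm a) (fun x hx => hx.1))
      refine ⟨E', g1, g2, fun _ => ⟨by rwa [one_mul] at g3, fun x => (g4 x).trans (ENNReal.ofReal_le_ofReal ?_)⟩⟩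
      gcongr C₂ * 2 ^ (a:ℝ) * ?_
      rw [div_one]
      exact Real.rpow_le_rpow_of_nonpos hθ₁0 (hps a ha).le (by linarith)
    · exact ⟨∅, empty_subset _, MeasurableSet.empty, fun h => (ha h).elim⟩
  choose Ec hEcE hEcm hEc using hex
  set Et : ℤ → Set (Pt n) := fun a => Ec a \ ⋃ b ∈ s.filter (· < a), Ec b with hEt
  have hEtm : ∀ a, MeasurableSet (Et a) := fun a =>
    (hEcm a).diff (Finset.measurableSet_biUnion _ fun b _ => hEcm b)
  have hinc : ∀ a ∈ s, ENNReal.ofReal (1/4 * 2 ^ (a:ℝ) * V a) ≤ volume (inc n (Et a) (Pak n E a k)) := by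
    intro a ha
    have hV := hVpos a ha
    have h1 := (hEc a ha).1.trans (inc_union_le (s.filter (· < a)) (Ec a) Ec (Pak n E a k))
    have h2 : ∑ b ∈ s.filter (· < a), volume (inc n (Ec b) (Pak n E a k)) ≤ ENNReal.ofReal (1/4 * 2 ^ (a:ℝ) * V a) := by
      calc _ ≤ ∑ b ∈ s.filter (· < a), ENNReal.ofReal (C₂ * 2 ^ (b:ℝ) * θ₁ ^ (-NN n) * V a) := by
            refine Finset.sum_le_sum fun b hb => ?_
            have hb' := (Finset.mem_filter.1 hb).1
            rw [vol_inc (hEcm b) (hPm a), ENNReal.ofReal_mul (by positivity), ← hVeq, ← setLIntegral_const]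
            exact lintegral_mono ((hEc b hb').2)
        _ = ENNReal.ofReal (∑ b ∈ s.filter (· < a), C₂ * 2 ^ (b:ℝ) * θ₁ ^ (-NN n) * V a) := by
            rw [ENNReal.ofReal_sum_of_nonneg]; intro b _; positivity
        _ ≤ _ := by
            apply ENNReal.ofReal_le_ofReal
            have h3 : ∑ b ∈ s.filter (· < a), C₂ * 2 ^ (b:ℝ) * θ₁ ^ (-NN n) * V a =
              (∑ b ∈ s.filter (· < a), (2:ℝ) ^ (b:ℝ)) * (C₂ * θ₁ ^ (-NN n) * V a) := by
              rw [Finset.sum_mul]; refine Finset.sum_congr rfl fun b _ => by ring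
            have h4 := sum_two_zpow (s.filter (· < a)) (a - (K₀ * (m+1) : ℕ)) (by
              intro b hb
              have := hgap a ha b (Finset.mem_filter.1 hb).1 (Finset.mem_filter.1 hb).2
              omega)
            have h5 : (2:ℝ) ^ ((a - (K₀ * (m+1) : ℕ) : ℤ) : ℝ) = 2 ^ (a:ℝ) / 2 ^ (K₀ * (m+1)) := by
              rw [Int.cast_sub, Real.rpow_sub (by norm_num)]; congr 1
              rw [Int.cast_natCast, Real.rpow_natCast]
            rw [h5] at h4
            rw [h3]
            have p1 : (0:ℝ) < 2 ^ (K₀ * (m+1)) := by positivity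
            have p2 : (0:ℝ) < 2 ^ (a:ℝ) := by positivity
            calc _ ≤ (2 * (2 ^ (a:ℝ) / 2 ^ (K₀ * (m+1)))) * (C₂ * θ₁ ^ (-NN n) * V a) := by gcongr
              _ = (8 * C₂ * θ₁ ^ (-NN n)) / 2 ^ (K₀ * (m+1)) * (1/4 * 2 ^ (a:ℝ) * V a) := by ring
              _ ≤ 1 * (1/4 * 2 ^ (a:ℝ) * V a) := by gcongr; rwa [div_le_one p1]
              _ = _ := one_mul _
    have h3 : ENNReal.ofReal (2 ^ (a:ℝ) * V a / 2) = ENNReal.ofReal (1/4 * 2 ^ (a:ℝ) * V a) + ENNReal.ofReal (1/4 * 2 ^ (a:ℝ) * V a) := by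
      rw [← ENNReal.ofReal_add (by positivity) (by positivity)]; congr 1; ring
    rw [h3] at h1
    exact (ENNReal.add_le_add_iff_right ENNReal.ofReal_ne_top).1 (h1.trans (by gcongr))
  -- lower bounds for the measure of `Et a`
  have hlow1 : ∀ a ∈ s, ENNReal.ofReal (C₁ / (4 * C₃) * 2 ^ (-(m:ℝ))) ≤ volume (Et a) := by
    intro a ha
    by_contra hlt
    push Not at hlt
    have h1 := hpc (Et a) (Pak n E a k) (hEtm a) (hPm a) (C₁ / (4 * C₃) * 2 ^ (-(m:ℝ))) (V a) a k (by positivity)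
      (hVpos a ha) hlt.le (Pak_slice_le a k) (hVeq a).le (hinc a ha)
    have h2 := hps a ha
    have h3 : C₃ * (C₁ / (4 * C₃) * 2 ^ (-(m:ℝ))) = θ₁ / 2 := by
      rw [hθ₁, sub_eq_add_neg, Real.rpow_add (by norm_num), Real.rpow_neg_one]; field_simp; norm_num
    linarith
  have hlow2 : ∀ a ∈ s, ENNReal.ofReal (1/8 * 2 ^ (-(k:ℝ))) ≤ volume (Et a) := by
    intro a ha
    have hV := hVpos a ha
    have h1 : volume (inc n (Et a) (Pak n E a k)) ≤ volume (Tak n E a k) * volume (Et a) := by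
      rw [← Measure.prod_prod, ← Measure.volume_eq_prod]
      refine measure_mono fun x hx => ⟨hx.2.2, hx.1⟩
    have h2 := vol_Pak_ge hE a k univ MeasurableSet.univ
    simp only [inter_univ, preimage_univ] at h2
    have h3 : ENNReal.ofReal (1/8 * 2 ^ (-(k:ℝ))) * volume (Pak n E a k) ≤ volume (Et a) * volume (Pak n E a k) := by
      calc _ = e2 (-a - k - 1) * ENNReal.ofReal (1/4 * 2 ^ (a:ℝ) * V a) := by
            rw [hVeq, ← ENNReal.ofReal_mul (by positivity), e2, ← ENNReal.ofReal_mul (by positivity)]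
            congr 1
            have : (2:ℝ) ^ (-(a:ℝ) - k - 1) * 2 ^ (a:ℝ) = 2 ^ (-(k:ℝ)) / 2 := by
              rw [← Real.rpow_add (by norm_num), show -(a:ℝ) - k - 1 + a = -k - 1 by ring, Real.rpow_sub (by norm_num), Real.rpow_one]
            linear_combination (-1/4 * V a) * this
        _ ≤ e2 (-a - k - 1) * (volume (Tak n E a k) * volume (Et a)) := by
            gcongr; exact (hinc a ha).trans h1
        _ = (e2 (-a - k - 1) * volume (Tak n E a k)) * volume (Et a) := by ring
        _ ≤ volume (Pak n E a k) * volume (Et a) := by gcongr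
        _ = _ := mul_comm _ _
    refine (ENNReal.mul_le_mul_iff_left ?_ (hfin a)).1 h3
    rw [hVeq]; simpa using hV
  have hdisj : ∑ a ∈ s, volume (Et a) ≤ 1 := by
    rw [← measure_biUnion_finset]
    · refine (measure_mono ?_).trans hE1
      exact iUnion₂_subset fun a _ => sdiff_subset.trans (hEcE a)
    · intro a ha b hb hab
      wlog hlt : a < b generalizing a b
      · exact (this hb ha hab.symm (lt_of_le_of_ne (not_lt.1 hlt) hab.symm)).symm
      refine Set.disjoint_left.2 fun x hx hx' => hx'.2 ?_
      simp only [mem_iUnion]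
      exact ⟨a, Finset.mem_filter.2 ⟨ha, hlt⟩, hx.1⟩
    · exact fun a _ => hEtm a
  have fin : ∀ c' : ℝ, 0 < c' → (∀ a ∈ s, ENNReal.ofReal c' ≤ volume (Et a)) → (s.card : ℝ) * c' ≤ 1 := by
    intro c' hc' h
    have h1 := (Finset.sum_le_sum h).trans hdisj
    rw [Finset.sum_const, nsmul_eq_mul, ← ENNReal.ofReal_natCast, ← ENNReal.ofReal_mul (Nat.cast_nonneg _)] at h1
    exact ENNReal.ofReal_le_one.1 h1
  constructor
  · refine fin _ (by positivity) fun a ha => (ENNReal.ofReal_le_ofReal ?_).trans (hlow1 a ha)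
    gcongr; exact min_le_left _ _
  · refine fin _ (by positivity) fun a ha => (ENNReal.ofReal_le_ofReal ?_).trans (hlow2 a ha)
    gcongr; exact min_le_right _ _

end

section

lemma count_all {n : ℕ} (hn : 2 ≤ n) {C₁ : ℝ} (hC₁ : 0 < C₁)
    (hpsi : ∀ E : Set (Pt n), MeasurableSet E → volume E ≤ 1 → ∀ a k, Psi n E a k ≤ ENNReal.ofReal C₁) :
    ∃ L : ℝ, 0 < L ∧ ∀ E : Set (Pt n), MeasurableSet E → volume E ≤ 1 → ∀ k m : ℕ, ∀ δ : ℝ, 0 ≤ δ → δ ≤ 1 → 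
      ∀ s : Finset ℤ, (∀ a ∈ s, ENNReal.ofReal (C₁ * 2 ^ (-(m:ℝ) - 1)) < Psi n E a k) →
        (s.card : ℝ) ≤ L * (m + 1) * 2 ^ (δ * k + (1 - δ) * m) := by
  obtain ⟨c, K₀, hc, hK₀, h⟩ := count_gap hn hC₁ hpsi
  have hK : (0:ℝ) < K₀ := by exact_mod_cast hK₀
  refine ⟨K₀ / c, by positivity, ?_⟩
  intro E hE hE1 k m δ hδ0 hδ1 s hs
  set K : ℕ := K₀ * (m + 1) with hKdef
  have hKp : 0 < K := by positivity
  have h1 : s.card = ∑ b ∈ Finset.range K, (s.filter (fun a => (a % (K:ℤ)).toNat = b)).card := by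
    apply Finset.card_eq_sum_card_fiberwise
    intro a _
    have h1 := Int.emod_lt_of_pos a (by exact_mod_cast hKp : (0:ℤ) < K)
    have h2 := Int.emod_nonneg a (by exact_mod_cast hKp.ne' : (K:ℤ) ≠ 0)
    simp only [Finset.coe_range, mem_Iio]; omega
  have h2 : ∀ b ∈ Finset.range K, ((s.filter (fun a => (a % (K:ℤ)).toNat = b)).card : ℝ) ≤ c⁻¹ * 2 ^ (δ * k + (1 - δ) * m) := by
    intro b _
    obtain ⟨g1, g2⟩ := h E hE hE1 k m (s.filter (fun a => (a % (K:ℤ)).toNat = b)) (fun a ha => hs a (Finset.mem_filter.1 ha).1) (by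
      intro a ha a' ha' hlt
      have e1 := (Finset.mem_filter.1 ha).2
      have e2 := (Finset.mem_filter.1 ha').2
      have h3 := Int.emod_nonneg a (by exact_mod_cast hKp.ne' : (K:ℤ) ≠ 0)
      have h4 := Int.emod_nonneg a' (by exact_mod_cast hKp.ne' : (K:ℤ) ≠ 0)
      have e3 : a % (K:ℤ) = a' % (K:ℤ) := by omega
      have hd : (K:ℤ) ∣ a - a' := Int.ModEq.dvd e3.symm
      have := Int.le_of_dvd (by omega) hd
      rw [← hKdef]; omega)
    set x := ((s.filter (fun a => (a % (K:ℤ)).toNat = b)).card : ℝ)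
    have hx : 0 ≤ x := Nat.cast_nonneg _
    have q1 : x ≤ c⁻¹ * 2 ^ (m:ℝ) := by
      rw [Real.rpow_neg (by norm_num)] at g1
      have : x = (x * (c * (2 ^ (m:ℝ))⁻¹)) * (c⁻¹ * 2 ^ (m:ℝ)) := by field_simp
      rw [this]; exact mul_le_of_le_one_left (by positivity) g1
    have q2 : x ≤ c⁻¹ * 2 ^ (k:ℝ) := by
      rw [Real.rpow_neg (by norm_num)] at g2
      have : x = (x * (c * (2 ^ (k:ℝ))⁻¹)) * (c⁻¹ * 2 ^ (k:ℝ)) := by field_simp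
      rw [this]; exact mul_le_of_le_one_left (by positivity) g2
    refine (le_min q1 q2).trans ?_
    rcases le_total (m:ℝ) k with hmk | hmk
    · refine (min_le_left _ _).trans ?_
      gcongr
      · norm_num
      · nlinarith
    · refine (min_le_right _ _).trans ?_
      gcongr
      · norm_num
      · nlinarith
  rw [h1]
  push_cast
  refine (Finset.sum_le_sum h2).trans ?_
  rw [Finset.sum_const, Finset.card_range, nsmul_eq_mul, hKdef]
  push_cast
  apply le_of_eq; field_simp

open Classical in
lemma total {n : ℕ} (hn : 2 ≤ n) {ρ q r : ℝ} (hρ0 : 0 < ρ) (hρ1 : ρ ≤ 1) (hρ : 1 - 1 / NN n < ρ)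
    (hq : q = 2 / n + ρ) (hr : r = q / ρ) :
    ∃ C₁ : ℝ, 0 < C₁ ∧ (∀ E : Set (Pt n), MeasurableSet E → volume E ≤ 1 → ∀ a k, Psi n E a k ≤ ENNReal.ofReal C₁) ∧ 
    ∃ w : ℕ × ℕ → ℝ≥0∞, ∑' x, w x ≠ ∞ ∧ ∀ E : Set (Pt n), MeasurableSet E → volume E ≤ 1 →
      ∫⁻ t, (∫⁻ y, XI n E (t, y) ^ r) ^ ρ ≤
        ∑' x : ℕ × ℕ, if ∃ a, ENNReal.ofReal (C₁ * 2 ^ (-(x.2:ℝ) - 1)) < Psi n E a x.1 then w x else 0 := by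
  obtain ⟨C₁, hC₁, hpsi⟩ := psi_bd hn
  obtain ⟨L, hL, hcount⟩ := count_all hn hC₁ hpsi
  have hN := NN_pos hn
  have hn' : (2:ℝ) ≤ n := by exact_mod_cast hn
  have hN1 : 1 ≤ NN n := by unfold NN; nlinarith
  set ε := ρ - 1 + 1 / NN n with hε
  have hε0 : 0 < ε := by rw [hε]; linarith
  have hε1 : ε ≤ 1 := by
    have : 1 / NN n ≤ 1 := by rw [div_le_one hN]; exact hN1
    rw [hε]; linarith
  have hq0 : 0 < q := by rw [hq]; positivity
  have hr0 : 0 < r := by rw [hr]; positivity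
  set δ := ε / 2 with hδ
  set w1 : ℕ → ℝ := fun k => 2 ^ (-(k:ℝ) * δ)
  set w2 : ℕ → ℝ := fun m => C₁ * L * (m + 1) * 2 ^ (-(m:ℝ) * δ)
  have hxlt : (2:ℝ) ^ (-δ) < 1 := Real.rpow_lt_one_of_one_lt_of_neg (by norm_num) (by linarith)
  have hpw : ∀ k : ℕ, (2:ℝ) ^ (-(k:ℝ) * δ) = ((2:ℝ) ^ (-δ)) ^ k := by
    intro k; rw [← Real.rpow_natCast, ← Real.rpow_mul (by norm_num)]; congr 1; ring
  have hs1 : Summable w1 := by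
    simp only [w1, hpw]; exact summable_geometric_of_lt_one (by positivity) hxlt
  have hs2 : Summable w2 := by
    simp only [w2, hpw]
    have hnx : ‖(2:ℝ) ^ (-δ)‖ < 1 := by rwa [Real.norm_of_nonneg (by positivity)]
    have h1 := summable_pow_mul_geometric_of_norm_lt_one 1 hnx
    have h2 := summable_pow_mul_geometric_of_norm_lt_one 0 hnx
    refine ((h1.add h2).mul_left (C₁ * L)).congr fun m => ?_
    simp; ring
  refine ⟨C₁, hC₁, hpsi, fun x => e2 (q + 1) * (ENNReal.ofReal (w1 x.1) * ENNReal.ofReal (w2 x.2)), ?_, ?_⟩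
  · rw [ENNReal.tsum_mul_left, ENNReal.tsum_prod (f := fun a b => ENNReal.ofReal (w1 a) * ENNReal.ofReal (w2 b))]
    simp_rw [ENNReal.tsum_mul_left, ENNReal.tsum_mul_right]
    exact ENNReal.mul_ne_top (e2_ne_top _) (ENNReal.mul_ne_top hs1.tsum_ofReal_ne_top hs2.tsum_ofReal_ne_top)
  intro E hE hE1
  have hqr : q = r * ρ := by rw [hr]; field_simp
  refine (J_le hE hE1 hr0 hρ0 hρ1 hqr).trans ?_
  rw [ENNReal.tsum_prod (f := fun (k m : ℕ) => if ∃ a, ENNReal.ofReal (C₁ * 2 ^ (-(m:ℝ) - 1)) < Psi n E a k then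
    e2 (q + 1) * (ENNReal.ofReal (w1 k) * ENNReal.ofReal (w2 m)) else 0)]
  refine ENNReal.tsum_le_tsum fun k => ?_
  have h1 : ∀ a : ℤ, e2 (q + 1) * e2 (a * (q - ρ) - k * ρ + a + k) * volume (Pak n E a k) =
      e2 (q + 1) * e2 (-k * ε) * Psi n E a k := by
    intro a
    have : e2 (a * (q - ρ) - k * ρ + a + k) = e2 (-k * ε) * e2 (sx n a k) := by
      rw [← e2_add]; congr 1; rw [hq, hε, sx]; ring
    rw [Psi, this]; ring
  simp_rw [h1]
  rw [ENNReal.tsum_mul_left]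
  have h2 : ∀ a : ℤ, Psi n E a k ≤ ∑' m : ℕ, ENNReal.ofReal (C₁ * 2 ^ (-(m:ℝ))) *
      (if ENNReal.ofReal (C₁ * 2 ^ (-(m:ℝ) - 1)) < Psi n E a k then 1 else 0) := by
    intro a
    by_cases h0 : Psi n E a k = 0
    · rw [h0]; exact zero_le
    have hC0 : ENNReal.ofReal C₁ ≠ 0 := by simpa using hC₁
    have hle : Psi n E a k / ENNReal.ofReal C₁ ≤ e2 ((0:ℤ):ℝ) := by
      rw [Int.cast_zero, e2_zero]
      exact ENNReal.div_le_of_le_mul (by rw [one_mul]; exact hpsi E hE hE1 a k)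
    obtain ⟨m, hm1, hm2⟩ := exists_e2' (by
      rw [Ne, ENNReal.div_eq_zero_iff]; push Not; exact ⟨h0, ENNReal.ofReal_ne_top⟩) hle
    refine le_trans ?_ (ENNReal.le_tsum m)
    simp only [Int.cast_zero, zero_sub] at hm1 hm2
    rw [ENNReal.lt_div_iff_mul_lt (Or.inl hC0) (Or.inl ENNReal.ofReal_ne_top), e2,
      ← ENNReal.ofReal_mul (by positivity), mul_comm] at hm1
    rw [if_pos hm1, mul_one]
    rw [ENNReal.div_le_iff hC0 ENNReal.ofReal_ne_top, e2, ← ENNReal.ofReal_mul (by positivity), mul_comm] at hm2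
    exact hm2
  calc _ ≤ e2 (q + 1) * e2 (-k * ε) * ∑' (a : ℤ) (m : ℕ), ENNReal.ofReal (C₁ * 2 ^ (-(m:ℝ))) *
      (if ENNReal.ofReal (C₁ * 2 ^ (-(m:ℝ) - 1)) < Psi n E a k then 1 else 0) := by
        gcongr with a; exact h2 a
    _ = ∑' m : ℕ, e2 (q + 1) * e2 (-k * ε) * (ENNReal.ofReal (C₁ * 2 ^ (-(m:ℝ))) * 
          ∑' a : ℤ, (if ENNReal.ofReal (C₁ * 2 ^ (-(m:ℝ) - 1)) < Psi n E a k then 1 else 0)) := by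
        rw [ENNReal.tsum_comm, ← ENNReal.tsum_mul_left]
        simp_rw [ENNReal.tsum_mul_left]
    _ ≤ _ := by
        refine ENNReal.tsum_le_tsum fun m => ?_
        by_cases hex : ∃ a, ENNReal.ofReal (C₁ * 2 ^ (-(m:ℝ) - 1)) < Psi n E a k
        · rw [if_pos hex]
          have h3 : ∑' a : ℤ, (if ENNReal.ofReal (C₁ * 2 ^ (-(m:ℝ) - 1)) < Psi n E a k then (1:ℝ≥0∞) else 0) ≤
              ENNReal.ofReal (L * (m + 1) * 2 ^ (δ * k + (1 - δ) * m)) := by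
            rw [ENNReal.tsum_eq_iSup_sum]
            refine iSup_le fun s => ?_
            rw [← Finset.sum_filter, Finset.sum_const, nsmul_eq_mul, mul_one, ← ENNReal.ofReal_natCast]
            exact ENNReal.ofReal_le_ofReal (hcount E hE hE1 k m δ (by linarith) (by linarith) _ (fun a ha => (Finset.mem_filter.1 ha).2))
          refine (mul_le_mul_right (mul_le_mul_right h3 _) _).trans (le_of_eq ?_)
          rw [mul_assoc]
          congr 1
          rw [e2, ← ENNReal.ofReal_mul (by positivity), ← ENNReal.ofReal_mul (by positivity), ← ENNReal.ofReal_mul (by positivity)]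
          congr 1
          have : (2:ℝ) ^ (-(k:ℝ) * ε) * 2 ^ (-(m:ℝ)) * 2 ^ (δ * k + (1 - δ) * m) = 2 ^ (-(k:ℝ) * δ) * 2 ^ (-(m:ℝ) * δ) := by
            rw [← Real.rpow_add (by norm_num), ← Real.rpow_add (by norm_num), ← Real.rpow_add (by norm_num)]
            congr 1; rw [hδ]; ring
          simp only [w1, w2]
          linear_combination (C₁ * L * (m + 1)) * this
        · rw [if_neg hex]
          push Not at hex
          have : ∑' a : ℤ, (if ENNReal.ofReal (C₁ * 2 ^ (-(m:ℝ) - 1)) < Psi n E a k then (1:ℝ≥0∞) else 0) = 0 := by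
            rw [ENNReal.tsum_eq_zero]; intro a; rw [if_neg (not_lt.2 (hex a))]
          rw [this]; simp

lemma propA1 {n : ℕ} (hn : 2 ≤ n) {ρ q r : ℝ} (hρ0 : 0 < ρ) (hρ1 : ρ ≤ 1) (hρ : 1 - 1 / NN n < ρ)
    (hq : q = 2 / n + ρ) (hr : r = q / ρ) :
    ∃ C : ℝ≥0∞, C ≠ ∞ ∧ ∀ E : Set (Pt n), MeasurableSet E → volume E ≤ 1 →
      ∫⁻ t, (∫⁻ y, XI n E (t, y) ^ r) ^ ρ ≤ C := by
  obtain ⟨C₁, hC₁, hpsi, w, hw, h⟩ := total hn hρ0 hρ1 hρ hq hr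
  refine ⟨_, hw, fun E hE hE1 => (h E hE hE1).trans (ENNReal.tsum_le_tsum fun x => ?_)⟩
  split_ifs
  · exact le_rfl
  · exact zero_le

lemma propA2 {n : ℕ} (hn : 2 ≤ n) {ρ q r : ℝ} (hρ0 : 0 < ρ) (hρ1 : ρ ≤ 1) (hρ : 1 - 1 / NN n < ρ)
    (hq : q = 2 / n + ρ) (hr : r = q / ρ) {η : ℝ≥0∞} (hη : η ≠ 0) :
    ∃ c C : ℝ, 0 < c ∧ 0 < C ∧ ∀ E : Set (Pt n), MeasurableSet E → volume E ≤ 1 →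
      η ≤ ∫⁻ t, (∫⁻ y, XI n E (t, y) ^ r) ^ ρ → ∃ (a : ℤ) (F : Set (Pt n)) (D : Set ℝ),
        MeasurableSet F ∧ MeasurableSet D ∧ F ⊆ Fa n E a ∧ F ⊆ Prod.fst ⁻¹' D ∧
        volume D ≤ ENNReal.ofReal C * e2 (-(2 / n) * a) ∧ (∀ t, volume {y | (t, y) ∈ F} ≤ e2 (-a)) ∧
        ENNReal.ofReal c * e2 (-(1 + 2 / n) * a) ≤ volume F := by
  classical
  obtain ⟨C₁, hC₁, hpsi, w, hw, h⟩ := total hn hρ0 hρ1 hρ hq hr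
  have ht := ENNReal.tendsto_tsum_compl_atTop_zero hw
  obtain ⟨s, hs⟩ := (ht.eventually (gt_mem_nhds (pos_iff_ne_zero.2 hη))).exists
  obtain ⟨M, hM⟩ : ∃ M : ℕ, ∀ x ∈ s, x.1 ≤ M ∧ x.2 ≤ M := by
    refine ⟨s.sup (fun x => max x.1 x.2), fun x hx => ?_⟩
    have := Finset.le_sup (f := fun x : ℕ × ℕ => max x.1 x.2) hx
    exact ⟨(le_max_left _ _).trans this, (le_max_right _ _).trans this⟩
  have hN := NN_pos hn
  refine ⟨C₁ * 2 ^ (-(M:ℝ) - 1) * 2 ^ (-(M:ℝ)/ NN n), C₁ * 2 ^ ((M:ℝ) + 1), by positivity, by positivity, ?_⟩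
  intro E hE hE1 hJ
  have hex : ∃ x ∈ s, ∃ a, ENNReal.ofReal (C₁ * 2 ^ (-(x.2:ℝ) - 1)) < Psi n E a x.1 := by
    by_contra hcon
    push Not at hcon
    refine absurd (hJ.trans (h E hE hE1)) (not_le.2 (lt_of_le_of_lt ?_ hs))
    rw [← ENNReal.sum_add_tsum_compl s]
    have : ∑ x ∈ s, (if ∃ a, ENNReal.ofReal (C₁ * 2 ^ (-(x.2:ℝ) - 1)) < Psi n E a x.1 then w x else 0) = 0 := by
      refine Finset.sum_eq_zero fun x hx => if_neg ?_
      push Not; exact hcon x hx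
    rw [this, zero_add]
    refine ENNReal.tsum_le_tsum fun x => ?_
    split_ifs
    · exact le_rfl
    · exact zero_le
  obtain ⟨⟨k, m⟩, hx, a, ha⟩ := hex
  obtain ⟨hkM, hmM⟩ := hM _ hx
  simp only at ha hkM hmM
  have hkM' : (k:ℝ) ≤ M := by exact_mod_cast hkM
  have hmM' : (m:ℝ) ≤ M := by exact_mod_cast hmM
  have hkN : (k:ℝ) / NN n ≤ M / NN n := by gcongr
  refine ⟨a, Pak n E a k, Tak n E a k, measurableSet_Pak hE a k, measurableSet_Tak hE a k, fun x hx => hx.1,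
    fun x hx => hx.2, ?_, ?_, ?_⟩
  · have h2 := vol_Pak_ge hE a k univ MeasurableSet.univ
    simp only [inter_univ, preimage_univ] at h2
    calc volume (Tak n E a k) = e2 (a + k + 1) * (e2 (-a - k - 1) * volume (Tak n E a k)) := by
          rw [← mul_assoc, ← e2_add, show (a:ℝ) + k + 1 + (-a - k - 1) = 0 by ring, e2_zero, one_mul]
      _ ≤ e2 (a + k + 1) * volume (Pak n E a k) := by gcongr
      _ = e2 (a + k + 1 - sx n a k) * Psi n E a k := by
          rw [Psi, ← mul_assoc, ← e2_add]; congr 2; ring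
      _ ≤ e2 ((M + 1) + -(2 / n) * a) * ENNReal.ofReal C₁ := by
          gcongr
          · apply e2_mono
            have : 0 ≤ (k:ℝ) / NN n := by positivity
            unfold sx; linarith
          · exact hpsi E hE hE1 a k
      _ = _ := by rw [e2_add, ENNReal.ofReal_mul hC₁.le]; simp only [e2]; ring
  · intro t
    refine (Pak_slice_le a k t).trans (e2_mono ?_)
    have : (0:ℝ) ≤ k := Nat.cast_nonneg _
    linarith
  · calc _ = e2 (-(M:ℝ)/ NN n + -(1 + 2 / n) * a) * ENNReal.ofReal (C₁ * 2 ^ (-(M:ℝ) - 1)) := by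
          rw [e2_add, ENNReal.ofReal_mul (p := C₁ * 2 ^ (-(M:ℝ) - 1)) (by positivity)]; simp only [e2]; ring
      _ ≤ e2 (-sx n a k) * Psi n E a k := by
          gcongr
          · apply e2_mono
            unfold sx; rw [neg_div]; linarith
          · refine le_trans (ENNReal.ofReal_le_ofReal ?_) ha.le
            gcongr
            norm_num
      _ = _ := by rw [Psi, ← mul_assoc, ← e2_add]; simp [e2_zero]

end

section

/-! extension of propA to all exponents -/

lemma interpA {n : ℕ} {ρ q r ρ' q' r' : ℝ} (hn : 2 ≤ n) (hρ0 : 0 < ρ') (hle : ρ' ≤ ρ)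
    (hq : q = 2 / n + ρ) (hr : r = q / ρ) (hq' : q' = 2 / n + ρ') (hr' : r' = q' / ρ')
    {E : Set (Pt n)} (hE : MeasurableSet E) (hE1 : volume E ≤ 1) :
    ∫⁻ t, (∫⁻ y, XI n E (t, y) ^ r) ^ ρ ≤ ∫⁻ t, (∫⁻ y, XI n E (t, y) ^ r') ^ ρ' := by
  have hn' : (0:ℝ) < n := by exact_mod_cast (by omega : 0 < n)
  have hρ : 0 < ρ := hρ0.trans_le hle
  have hr0 : 0 < r' := by rw [hr', hq']; positivity
  have hs1 : 0 ≤ 1 - ρ' / ρ := by rw [sub_nonneg, div_le_one hρ]; exact hle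
  have hs2 : 0 ≤ ρ' / ρ := by positivity
  apply lintegral_mono
  intro t
  have h := ENNReal.lintegral_mul_norm_pow_le (μ := volume) (f := fun y => XI n E (t, y))
    (g := fun y => XI n E (t, y) ^ r') (measurable_XI_right hE t).aemeasurable
    ((measurable_XI_right hE t).pow_const _).aemeasurable hs1 hs2 (by ring)
  rw [lintegral_XI hE] at h
  have e : ∀ y, XI n E (t, y) ^ (1 - ρ' / ρ) * (XI n E (t, y) ^ r') ^ (ρ' / ρ) = XI n E (t, y) ^ r := by
    intro y
    rw [← ENNReal.rpow_mul, ← ENNReal.rpow_add_of_nonneg _ _ hs1 (by positivity)]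
    congr 1
    subst hr hr' hq hq'
    field_simp
    ring
  simp_rw [e] at h
  calc (∫⁻ y, XI n E (t, y) ^ r) ^ ρ ≤ ((1:ℝ≥0∞) ^ (1 - ρ' / ρ) * (∫⁻ y, XI n E (t, y) ^ r') ^ (ρ' / ρ)) ^ ρ := by
        gcongr
        refine h.trans ?_
        gcongr
    _ = _ := by
        rw [ENNReal.one_rpow, one_mul, ← ENNReal.rpow_mul]
        congr 1
        field_simp

def qK (n : ℕ) (κ : ℝ) : ℝ := 2 / ((n + 1) * κ)
def rK (n : ℕ) (κ : ℝ) : ℝ := (1 - κ * (n + 1) / n)⁻¹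

structure Adm (n : ℕ) (κ : ℝ) : Prop where
  hn : 2 ≤ n
  pos : 0 < κ
  lt : κ < 2 / (n + 3)

namespace Adm

lemma n2 {n : ℕ} {κ : ℝ} (h : Adm n κ) : (2:ℝ) ≤ n := by exact_mod_cast h.hn

lemma lt1 {n : ℕ} {κ : ℝ} (h : Adm n κ) : κ * (n + 3) < 2 := by
  have := h.lt; have := h.n2; rwa [lt_div_iff₀ (by linarith)] at *

lemma half {n : ℕ} {κ : ℝ} (h : Adm n κ) : κ < 1/2 := by nlinarith [h.lt1, h.n2, h.pos]

lemma qpos {n : ℕ} {κ : ℝ} (h : Adm n κ) : 0 < qK n κ := by have := h.n2; have := h.pos; unfold qK; positivity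

lemma rden {n : ℕ} {κ : ℝ} (h : Adm n κ) : 0 < 1 - κ * (n + 1) / n := by
  have := h.n2; have := h.pos; have := h.lt1
  rw [sub_pos, div_lt_one (by linarith)]
  nlinarith

lemma rpos {n : ℕ} {κ : ℝ} (h : Adm n κ) : 0 < rK n κ := by unfold rK; exact inv_pos.2 h.rden

lemma qr {n : ℕ} {κ : ℝ} (h : Adm n κ) : qK n κ / rK n κ = qK n κ - 2 / n := by
  have := h.n2; have := h.pos
  unfold qK rK; rw [div_inv_eq_mul]; field_simp

lemma rhopos {n : ℕ} {κ : ℝ} (h : Adm n κ) : 0 < qK n κ - 2 / n := by rw [← h.qr]; exact div_pos h.qpos h.rpos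

lemma rho_lt {n : ℕ} {κ : ℝ} (h : Adm n κ) : 1 - 1 / NN n < qK n κ - 2 / n := by
  have h1 := h.n2; have h2 := h.pos; have h3 := h.lt1
  unfold qK NN
  have e : 1 - 1 / ((n:ℝ) * (n+1) / 2) + 2 / n = ((n:ℝ) + 3) / (n + 1) := by field_simp; ring
  have : ((n:ℝ) + 3) / (n + 1) < 2 / ((n+1) * κ) := by
    rw [div_lt_div_iff₀ (by linarith) (by positivity)]
    nlinarith
  linarith

lemma req {n : ℕ} {κ : ℝ} (h : Adm n κ) : rK n κ = qK n κ / (qK n κ - 2 / n) := by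
  rw [← h.qr]; have := h.qpos.ne'; have := h.rpos.ne'; field_simp

lemma p_lt_q {n : ℕ} {κ : ℝ} (h : Adm n κ) : (1 - κ)⁻¹ < qK n κ := by
  have h1 := h.n2; have h2 := h.pos; have h3 := h.lt1; have h4 := h.half
  unfold qK
  rw [inv_eq_one_div, div_lt_div_iff₀ (by linarith) (by positivity)]
  nlinarith

lemma p_lt_r {n : ℕ} {κ : ℝ} (h : Adm n κ) : (1 - κ)⁻¹ < rK n κ := by
  have h1 := h.n2; have h2 := h.pos
  unfold rK
  apply inv_strictAnti₀ h.rden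
  have : κ < κ * (n+1) / n := by
    rw [lt_div_iff₀ (by linarith)]; nlinarith
  linarith

lemma one_lt_p {n : ℕ} {κ : ℝ} (h : Adm n κ) : 1 < (1 - κ)⁻¹ := by
  have h2 := h.pos; have := h.half
  rw [one_lt_inv₀ (by linarith)]; linarith

lemma p_lt_two {n : ℕ} {κ : ℝ} (h : Adm n κ) : (1 - κ)⁻¹ < 2 := by
  have h2 := h.pos; have := h.half
  rw [inv_lt_comm₀ (by linarith) (by norm_num)]; linarith

lemma q1 {n : ℕ} {κ : ℝ} (h : Adm n κ) : 1 < qK n κ := h.one_lt_p.trans h.p_lt_q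
lemma r1 {n : ℕ} {κ : ℝ} (h : Adm n κ) : 1 < rK n κ := h.one_lt_p.trans h.p_lt_r
end Adm

lemma propB1 {n : ℕ} {κ : ℝ} (h : Adm n κ) :
    ∃ C : ℝ≥0∞, C ≠ ∞ ∧ ∀ E : Set (Pt n), MeasurableSet E → volume E ≤ 1 →
      ∫⁻ t, (∫⁻ y, XI n E (t, y) ^ rK n κ) ^ (qK n κ / rK n κ) ≤ C := by
  have hN := NN_pos h.hn
  have hρ' : 0 < min (qK n κ - 2 / n) 1 := lt_min h.rhopos one_pos
  obtain ⟨C, hC, hh⟩ := propA1 h.hn hρ' (min_le_right _ _)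
    (lt_min h.rho_lt (by simpa using hN)) rfl rfl
  refine ⟨C, hC, fun E hE hE1 => ?_⟩
  rw [h.qr]
  exact (interpA h.hn hρ' (min_le_left _ _) (by ring) h.req rfl rfl hE hE1).trans (hh E hE hE1)

lemma propB2 {n : ℕ} {κ : ℝ} (h : Adm n κ) {η : ℝ≥0∞} (hη : η ≠ 0) :
    ∃ c C : ℝ, 0 < c ∧ 0 < C ∧ ∀ E : Set (Pt n), MeasurableSet E → volume E ≤ 1 →
      η ≤ ∫⁻ t, (∫⁻ y, XI n E (t, y) ^ rK n κ) ^ (qK n κ / rK n κ) → ∃ (a : ℤ) (F : Set (Pt n)) (D : Set ℝ),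
        MeasurableSet F ∧ MeasurableSet D ∧ F ⊆ Fa n E a ∧ F ⊆ Prod.fst ⁻¹' D ∧
        volume D ≤ ENNReal.ofReal C * e2 (-(2 / n) * a) ∧ (∀ t, volume {y | (t, y) ∈ F} ≤ e2 (-a)) ∧
        ENNReal.ofReal c * e2 (-(1 + 2 / n) * a) ≤ volume F := by
  have hN := NN_pos h.hn
  have hρ' : 0 < min (qK n κ - 2 / n) 1 := lt_min h.rhopos one_pos
  obtain ⟨c, C, hc, hC, hh⟩ := propA2 h.hn hρ' (min_le_right _ _)
    (lt_min h.rho_lt (by simpa using hN)) rfl rfl hη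
  refine ⟨c, C, hc, hC, fun E hE hE1 hJ => hh E hE hE1 (hJ.trans ?_)⟩
  rw [h.qr]
  exact interpA h.hn hρ' (min_le_left _ _) (by ring) h.req rfl rfl hE hE1

end

section

/-! Lebesgue norms of extended nonnegative functions -/

def LL {α : Type*} [MeasurableSpace α] (μ : Measure α) (p : ℝ) (g : α → ℝ≥0∞) : ℝ≥0∞ :=
  (∫⁻ x, g x ^ p ∂μ) ^ (1 / p)

lemma measurable_fsum {α ι : Type*} [MeasurableSpace α] (s : Finset ι) {g : ι → α → ℝ≥0∞}
    (hg : ∀ i, Measurable (g i)) : Measurable (∑ i ∈ s, g i) := by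
  have := Finset.measurable_sum s fun j _ => hg j
  convert this using 1
  ext x; simp

section LL
variable {α : Type*} [MeasurableSpace α] {μ : Measure α} {p : ℝ}

lemma LL_mono_ae (hp : 0 < p) {g h : α → ℝ≥0∞} (hgh : ∀ᵐ x ∂μ, g x ≤ h x) : LL μ p g ≤ LL μ p h := by
  unfold LL
  apply ENNReal.rpow_le_rpow _ (by positivity)
  apply lintegral_mono_ae
  filter_upwards [hgh] with x hx
  exact ENNReal.rpow_le_rpow hx hp.le

lemma LL_mono (hp : 0 < p) {g h : α → ℝ≥0∞} (hgh : g ≤ h) : LL μ p g ≤ LL μ p h :=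
  LL_mono_ae hp (Eventually.of_forall hgh)

lemma LL_const_mul (hp : 0 < p) {g : α → ℝ≥0∞} (hg : Measurable g) (c : ℝ≥0∞) :
    LL μ p (fun x => c * g x) = c * LL μ p g := by
  unfold LL
  simp_rw [ENNReal.mul_rpow_of_nonneg _ _ hp.le]
  rw [lintegral_const_mul _ (hg.pow_const _), ENNReal.mul_rpow_of_nonneg _ _ (by positivity),
    ← ENNReal.rpow_mul, mul_one_div_cancel hp.ne', ENNReal.rpow_one]

lemma LL_add_le (hp : 1 ≤ p) {g h : α → ℝ≥0∞} (hg : Measurable g) (hh : Measurable h) :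
    LL μ p (g + h) ≤ LL μ p g + LL μ p h :=
  ENNReal.lintegral_Lp_add_le hg.aemeasurable hh.aemeasurable hp

lemma LL_zero (hp : 0 < p) : LL μ p (0 : α → ℝ≥0∞) = 0 := by
  unfold LL; simp [hp]

lemma LL_sum_le (hp : 1 ≤ p) {ι : Type*} (s : Finset ι) {g : ι → α → ℝ≥0∞} (hg : ∀ i, Measurable (g i)) :
    LL μ p (∑ i ∈ s, g i) ≤ ∑ i ∈ s, LL μ p (g i) := by
  classical
  induction s using Finset.induction_on with
  | empty => simp [LL_zero (by linarith : 0 < p)]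
  | insert i s his ih =>
    rw [Finset.sum_insert his, Finset.sum_insert his]
    exact (LL_add_le hp (hg i) (measurable_fsum s hg)).trans (add_le_add_right ih _)

lemma rpow_iSup {ι : Sort*} (hp : 0 < p) (f : ι → ℝ≥0∞) : (⨆ i, f i) ^ p = ⨆ i, f i ^ p := by
  have := (ENNReal.orderIsoRpow p hp).map_iSup f
  exact this

lemma LL_iSup_nat (hp : 0 < p) {g : ℕ → α → ℝ≥0∞} (hg : ∀ i, Measurable (g i)) (hm : Monotone g) :
    LL μ p (fun x => ⨆ i, g i x) = ⨆ i, LL μ p (g i) := by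
  unfold LL
  simp_rw [rpow_iSup hp]
  rw [lintegral_iSup (fun i => (hg i).pow_const _), rpow_iSup (by positivity)]
  intro i j hij x
  exact ENNReal.rpow_le_rpow (hm hij x) hp.le

lemma LL_rpow {s : ℝ} (hs : 0 < s) (hp : 0 < p) (g : α → ℝ≥0∞) :
    LL μ p (fun x => g x ^ s) = LL μ (p * s) g ^ s := by
  unfold LL
  simp_rw [← ENNReal.rpow_mul]
  rw [mul_comm s p]
  congr 1
  field_simp

lemma LL_mul_le {q r : ℝ} (hp : 0 < p) (hpq : p < q) (hpqr : 1 / p = 1 / q + 1 / r) {f g : α → ℝ≥0∞}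
    (hf : Measurable f) (hg : Measurable g) : LL μ p (fun x => f x * g x) ≤ LL μ q f * LL μ r g :=
  ENNReal.lintegral_Lp_mul_le_Lq_mul_Lr hp hpq hpqr μ hf.aemeasurable hg.aemeasurable

end LL

section MN
variable {n : ℕ} {q r : ℝ}

lemma mN_eq (hq : 0 < q) (hr : 0 < r) (g : Pt n → ℝ≥0∞) :
    mixedNorm n q r g = LL volume q (fun t => LL volume r (fun y => g (t, y))) := by
  unfold mixedNorm mixedNormG LL
  simp_rw [← ENNReal.rpow_mul]
  congr 2
  ext t
  congr 1
  field_simp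

lemma measurable_slice {g : Pt n → ℝ≥0∞} (hg : Measurable g) (t : ℝ) : Measurable (fun y => g (t, y)) :=
  hg.comp measurable_prodMk_left

lemma measurable_LLs {g : Pt n → ℝ≥0∞} (hg : Measurable g) :
    Measurable (fun t => LL volume r (fun y => g (t, y))) := by
  unfold LL
  exact ((hg.pow_const r).lintegral_prod_right').pow_const _

lemma mN_mono_ae (hq : 0 < q) (hr : 0 < r) {g h : Pt n → ℝ≥0∞}
    (hgh : ∀ᵐ t : ℝ, ∀ᵐ y : Fin n → ℝ, g (t, y) ≤ h (t, y)) :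
    mixedNorm n q r g ≤ mixedNorm n q r h := by
  rw [mN_eq hq hr, mN_eq hq hr]
  apply LL_mono_ae hq
  filter_upwards [hgh] with t ht
  exact LL_mono_ae hr ht

lemma mN_mono (hq : 0 < q) (hr : 0 < r) {g h : Pt n → ℝ≥0∞} (hgh : g ≤ h) :
    mixedNorm n q r g ≤ mixedNorm n q r h :=
  mN_mono_ae hq hr (Eventually.of_forall fun _ => Eventually.of_forall fun _ => hgh _)

lemma mN_const_mul (hq : 0 < q) (hr : 0 < r) {g : Pt n → ℝ≥0∞} (hg : Measurable g) (c : ℝ≥0∞) :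
    mixedNorm n q r (fun x => c * g x) = c * mixedNorm n q r g := by
  rw [mN_eq hq hr, mN_eq hq hr]
  simp_rw [LL_const_mul hr (measurable_slice hg _)]
  exact LL_const_mul hq (measurable_LLs hg) c

lemma mN_zero (hq : 0 < q) (hr : 0 < r) : mixedNorm n q r (0 : Pt n → ℝ≥0∞) = 0 := by
  unfold mixedNorm mixedNormG
  simp [hq, hr, div_pos hq hr]

lemma mN_add_le (hq : 1 ≤ q) (hr : 1 ≤ r) {g h : Pt n → ℝ≥0∞} (hg : Measurable g) (hh : Measurable h) :
    mixedNorm n q r (g + h) ≤ mixedNorm n q r g + mixedNorm n q r h := by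
  have hq' : 0 < q := by linarith
  have hr' : 0 < r := by linarith
  rw [mN_eq hq' hr', mN_eq hq' hr', mN_eq hq' hr']
  refine le_trans (LL_mono hq' fun t => ?_) (LL_add_le hq (measurable_LLs hg) (measurable_LLs hh))
  exact LL_add_le hr (measurable_slice hg t) (measurable_slice hh t)

lemma mN_sum_le (hq : 1 ≤ q) (hr : 1 ≤ r) {ι : Type*} (s : Finset ι) {g : ι → Pt n → ℝ≥0∞}
    (hg : ∀ i, Measurable (g i)) :
    mixedNorm n q r (∑ i ∈ s, g i) ≤ ∑ i ∈ s, mixedNorm n q r (g i) := by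
  classical
  induction s using Finset.induction_on with
  | empty => simp [mN_zero (by linarith : 0 < q) (by linarith : 0 < r)]
  | insert i s his ih =>
    rw [Finset.sum_insert his, Finset.sum_insert his]
    exact (mN_add_le hq hr (hg i) (measurable_fsum s hg)).trans (add_le_add_right ih _)

lemma mN_iSup_nat (hq : 0 < q) (hr : 0 < r) {g : ℕ → Pt n → ℝ≥0∞} (hg : ∀ i, Measurable (g i))
    (hm : Monotone g) : mixedNorm n q r (fun x => ⨆ i, g i x) = ⨆ i, mixedNorm n q r (g i) := by
  simp_rw [mN_eq hq hr]
  have : ∀ t, LL volume r (fun y => ⨆ i, g i (t, y)) = ⨆ i, LL volume r (fun y => g i (t, y)) := fun t =>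
    LL_iSup_nat hr (fun i => measurable_slice (hg i) t) fun i j hij y => hm hij _
  simp_rw [this]
  exact LL_iSup_nat hq (fun i => measurable_LLs (hg i)) fun i j hij t => LL_mono hr fun y => hm hij _

lemma mN_tsum_le (hq : 1 ≤ q) (hr : 1 ≤ r) {ι : Type*} [Countable ι] {g : ι → Pt n → ℝ≥0∞}
    (hg : ∀ i, Measurable (g i)) :
    mixedNorm n q r (fun x => ∑' i, g i x) ≤ ∑' i, mixedNorm n q r (g i) := by
  classical
  have hq' : 0 < q := by linarith
  have hr' : 0 < r := by linarith
  cases nonempty_encodable ι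
  -- exhaust by finite sets
  let s : ℕ → Finset ι := fun k => (Finset.range k).biUnion fun i => (Encodable.decode (α := ι) i).toFinset
  have hs : Monotone s := fun i j hij => Finset.biUnion_subset_biUnion_of_subset_left _ (by
    intro x; simp only [Finset.mem_range]; omega)
  have hmem : ∀ i : ι, ∃ k, i ∈ s k := fun i => ⟨Encodable.encode i + 1, by
    simp only [s, Finset.mem_biUnion, Finset.mem_range]
    exact ⟨Encodable.encode i, by omega, by simp⟩⟩
  have hsup : ∀ f : ι → ℝ≥0∞, ∑' i, f i = ⨆ k, ∑ i ∈ s k, f i := by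
    intro f
    rw [ENNReal.tsum_eq_iSup_sum' s]
    intro t
    choose k hk using hmem
    refine ⟨t.sup k, fun i hi => hs (Finset.le_sup hi) (hk i)⟩
  simp_rw [hsup]
  have := mN_iSup_nat hq' hr' (g := fun k => ∑ i ∈ s k, g i)
    (fun k => measurable_fsum _ hg)
    (fun i j hij x => by
      simp only [Finset.sum_apply]
      exact Finset.sum_le_sum_of_subset (hs hij))
  simp only [Finset.sum_apply] at this
  rw [this]
  exact iSup_mono fun k => mN_sum_le hq hr _ hg

lemma mN_rpow {s : ℝ} (hs : 0 < s) (hq : 0 < q) (hr : 0 < r) (g : Pt n → ℝ≥0∞) :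
    mixedNorm n q r (fun x => g x ^ s) = mixedNorm n (q * s) (r * s) g ^ s := by
  rw [mN_eq hq hr, mN_eq (by positivity) (by positivity)]
  simp_rw [LL_rpow hs hr]
  exact LL_rpow hs hq _

/-- master subadditivity -/
lemma mN_master {s : ℝ} (hs : 0 < s) (hq : s ≤ q) (hr : s ≤ r) {ι : Type*} [Countable ι]
    {g : Pt n → ℝ≥0∞} {G : ι → Pt n → ℝ≥0∞} (hG : ∀ i, Measurable (G i))
    (h : ∀ x, g x ^ s ≤ ∑' i, G i x ^ s) :
    mixedNorm n q r g ^ s ≤ ∑' i, mixedNorm n q r (G i) ^ s := by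
  have e : ∀ k : Pt n → ℝ≥0∞, mixedNorm n q r k ^ s = mixedNorm n (q / s) (r / s) (fun x => k x ^ s) := by
    intro k
    rw [mN_rpow hs (div_pos (by linarith) hs) (div_pos (by linarith) hs), div_mul_cancel₀ _ hs.ne', div_mul_cancel₀ _ hs.ne']
  simp_rw [e]
  have h1 : 1 ≤ q / s := by rwa [one_le_div hs]
  have h2 : 1 ≤ r / s := by rwa [one_le_div hs]
  exact (mN_mono (by linarith) (by linarith) h).trans (mN_tsum_le h1 h2 fun i => (hG i).pow_const _)

lemma mN_mul_le {q₁ r₁ q₂ r₂ : ℝ} (hq : 0 < q) (hr : 0 < r) (hq₁ : q < q₁) (hr₁ : r < r₁)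
    (hqq : 1 / q = 1 / q₁ + 1 / q₂) (hrr : 1 / r = 1 / r₁ + 1 / r₂) (hq₂ : 0 < q₂) (hr₂ : 0 < r₂)
    {g h : Pt n → ℝ≥0∞} (hg : Measurable g) (hh : Measurable h) :
    mixedNorm n q r (fun x => g x * h x) ≤ mixedNorm n q₁ r₁ g * mixedNorm n q₂ r₂ h := by
  rw [mN_eq hq hr, mN_eq (by linarith) (by linarith), mN_eq hq₂ hr₂]
  refine le_trans (LL_mono hq fun t => ?_) (LL_mul_le hq hq₁ hqq (measurable_LLs hg) (measurable_LLs hh))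
  exact LL_mul_le hr hr₁ hrr (measurable_slice hg t) (measurable_slice hh t)

end MN

end

section

/-! symmetries -/

lemma lint_mat {n : ℕ} (M : Matrix (Fin n) (Fin n) ℝ) (hM : 0 < M.det) {G : (Fin n → ℝ) → ℝ≥0∞}
    (hG : Measurable G) (c : Fin n → ℝ) :
    ∫⁻ y, G (M.mulVec y + c) = ENNReal.ofReal (M.det)⁻¹ * ∫⁻ y, G y := by
  have h := Real.map_matrix_volume_pi_eq_smul_volume_pi hM.ne'
  have hm : Measurable (Matrix.toLin' M) := (LinearMap.continuous_of_finiteDimensional _).measurable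
  have h2 : ∫⁻ y, G (M.mulVec y + c) = ∫⁻ y, G (y + c) ∂(Measure.map (Matrix.toLin' M) volume) := by
    rw [lintegral_map (by fun_prop) hm]; rfl
  rw [h2, h, lintegral_smul_measure, lintegral_add_right_eq_self, abs_of_pos (by positivity)]
  rfl

lemma lint_scale {a : ℝ} (ha : 0 < a) {G : ℝ → ℝ≥0∞} (hG : Measurable G) (c : ℝ) :
    ∫⁻ s, G (a * s + c) = ENNReal.ofReal a⁻¹ * ∫⁻ s, G s := by
  have h := Real.map_volume_mul_left ha.ne'
  have h2 : ∫⁻ y, G (a * y + c) = ∫⁻ y, G (y + c) ∂(Measure.map (a * ·) volume) := by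
    rw [lintegral_map (by fun_prop) (by fun_prop)]
  rw [h2, h, lintegral_smul_measure, lintegral_add_right_eq_self, abs_of_pos (by positivity)]
  rfl

lemma mN_change {n : ℕ} {q r : ℝ} (hq : 0 < q) (hr : 0 < r) {g : Pt n → ℝ≥0∞} (hg : Measurable g)
    {β τ Jy : ℝ} (hβ : 0 < β) (hJ : 0 < Jy) (L : ℝ → (Fin n → ℝ) → (Fin n → ℝ))
    (hL : ∀ t, ∀ G : (Fin n → ℝ) → ℝ≥0∞, Measurable G → ∫⁻ y, G (L t y) = ENNReal.ofReal Jy⁻¹ * ∫⁻ y, G y) :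
    mixedNorm n q r (fun x => g (β * x.1 + τ, L x.1 x.2)) =
      ENNReal.ofReal (Jy ^ (-(1/r)) * β ^ (-(1/q))) * mixedNorm n q r g := by
  rw [mN_eq hq hr, mN_eq hq hr]
  have h1 : ∀ t, LL volume r (fun y => g (β * t + τ, L t y)) =
      ENNReal.ofReal (Jy ^ (-(1/r))) * LL volume r (fun y => g (β * t + τ, y)) := by
    intro t
    unfold LL
    rw [hL t (fun y => g (β * t + τ, y) ^ r) ((measurable_slice hg _).pow_const _),
      ENNReal.mul_rpow_of_nonneg _ _ (by positivity), ENNReal.ofReal_rpow_of_pos (by positivity),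
      Real.inv_rpow hJ.le, Real.rpow_neg hJ.le]
  simp only [h1]
  have hmt : Measurable (fun t => LL volume r (fun y => g (β * t + τ, y))) :=
    (measurable_LLs hg).comp (f := fun t => β * t + τ) (by fun_prop)
  rw [LL_const_mul hq hmt,
    ENNReal.ofReal_mul (by positivity), mul_assoc]
  congr 1
  unfold LL
  rw [lint_scale hβ (G := fun t => ((∫⁻ y, g (t, y) ^ r) ^ (1/r)) ^ q) ((measurable_LLs hg).pow_const _) τ,
    ENNReal.mul_rpow_of_nonneg _ _ (by positivity), ENNReal.ofReal_rpow_of_pos (by positivity),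
    Real.inv_rpow hβ.le, Real.rpow_neg hβ.le]

structure IsSy (n : ℕ) (κ : ℝ) (φ : Pt n → Pt n) (J : ℝ) : Prop where
  meas : Measurable φ
  pos : 0 < J
  lint : ∀ g : Pt n → ℝ≥0∞, Measurable g → ∫⁻ z, g (φ z) = ENNReal.ofReal J⁻¹ * ∫⁻ z, g z
  mn : ∀ f : Pt n → ℝ≥0∞, Measurable f → mixedNorm n (qK n κ) (rK n κ) (XE n (f ∘ φ)) =
    ENNReal.ofReal (J ^ (-(1-κ))) * mixedNorm n (qK n κ) (rK n κ) (XE n f)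

lemma IsSy.comp {n : ℕ} {κ : ℝ} {φ ψ : Pt n → Pt n} {J K : ℝ} (h : IsSy n κ φ J) (k : IsSy n κ ψ K) :
    IsSy n κ (φ ∘ ψ) (J * K) where
  meas := h.meas.comp k.meas
  pos := mul_pos h.pos k.pos
  lint := fun g hg => by
    simp only [Function.comp]
    rw [k.lint (fun z => g (φ z)) (hg.comp h.meas), h.lint g hg, ← mul_assoc, ← ENNReal.ofReal_mul (by have := k.pos; positivity),
      mul_inv, mul_comm J⁻¹]
  mn := fun f hf => by
    rw [← Function.comp_assoc, k.mn _ (hf.comp h.meas), h.mn f hf, ← mul_assoc,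
      ← ENNReal.ofReal_mul (by have := k.pos; positivity), Real.mul_rpow h.pos.le k.pos.le, mul_comm (J ^ _)]

lemma IsSy.translation {n : ℕ} {κ : ℝ} (ha : Adm n κ) (z₀ : Pt n) : IsSy n κ (fun z => z + z₀) 1 where
  meas := by fun_prop
  pos := one_pos
  lint := fun g hg => by
    have : (volume : Measure (Pt n)).IsAddRightInvariant := by
      rw [Measure.volume_eq_prod]; infer_instance
    rw [lintegral_add_right_eq_self]; simp
  mn := fun f hf => by
    have e : XE n (f ∘ fun z => z + z₀) = fun x => XE n f (1 * x.1 + 0, x.2 + (z₀.2 - z₀.1 • mom n x.1)) := by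
      ext x
      unfold XE
      rw [← lintegral_add_right_eq_self (fun s => f (s, _)) z₀.1]
      congr 1; ext s
      simp only [Function.comp]
      congr 1
      ext i
      · simp
      · simp; ring
    rw [e, mN_change ha.qpos ha.rpos (measurable_XE hf) one_pos one_pos (fun t y => y + (z₀.2 - z₀.1 • mom n t))]
    · simp
    · intro t G hG; rw [lintegral_add_right_eq_self]; simp

def GM (n : ℕ) (t : ℝ) : Matrix (Fin n) (Fin n) ℝ := fun m i =>
  if i ≤ m then ((Nat.choose (m.1+1) (i.1+1)) : ℝ) * t ^ (m.1 - i.1) else 0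

lemma GM_det (n : ℕ) (t : ℝ) : (GM n t).det = 1 := by
  rw [Matrix.det_of_isLowerTriangular]
  · simp [GM]
  · intro i j hij
    have : ¬ j ≤ i := by simpa using hij
    simp [GM, this]

lemma GM_mom (n : ℕ) (t₁ t : ℝ) : (GM n t₁).mulVec (mom n t) + mom n t₁ = mom n (t + t₁) := by
  ext m
  simp only [Matrix.mulVec, dotProduct, GM, mom, Pi.add_apply]
  have : ∑ i : Fin n, (if i ≤ m then ((Nat.choose (m.1+1) (i.1+1)) : ℝ) * t₁ ^ (m.1 - i.1) else 0) * t ^ (i.1+1)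
      = ∑ i ∈ Finset.range n, (if i ≤ m.1 then ((Nat.choose (m.1+1) (i+1)) : ℝ) * t₁ ^ (m.1 - i) else 0) * t ^ (i+1) := by
    rw [Finset.sum_range]
    rfl
  rw [this, add_pow, Finset.sum_range_succ']
  simp only [pow_zero, Nat.choose_zero_right, Nat.sub_zero, Nat.cast_one, one_mul, mul_one]
  congr 1
  rw [← Finset.sum_subset (s₁ := Finset.range (m.1+1))]
  · apply Finset.sum_congr rfl
    intro i hi
    rw [Finset.mem_range] at hi
    rw [if_pos (by omega), show m.1 + 1 - (i+1) = m.1 - i by omega]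
    ring
  · intro i; have := m.2; simp only [Finset.mem_range]; omega
  · intro i _ hi
    rw [Finset.mem_range] at hi
    rw [if_neg (by omega)]; ring

@[fun_prop] lemma measurable_mulVec {n : ℕ} (M : Matrix (Fin n) (Fin n) ℝ) {α : Type*} [MeasurableSpace α]
    {f : α → Fin n → ℝ} (hf : Measurable f) : Measurable (fun x => M.mulVec (f x)) :=
  (LinearMap.continuous_of_finiteDimensional (Matrix.toLin' M)).measurable.comp hf

lemma IsSy.shift {n : ℕ} {κ : ℝ} (ha : Adm n κ) (t₁ : ℝ) :
    IsSy n κ (fun z => (z.1, (GM n t₁).mulVec z.2 + z.1 • mom n t₁)) 1 := by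
  have hdet : 0 < (GM n t₁).det := by rw [GM_det]; exact one_pos
  have hmeas : Measurable (fun z : Pt n => ((z.1, (GM n t₁).mulVec z.2 + z.1 • mom n t₁) : Pt n)) := by
    fun_prop
  refine ⟨hmeas, one_pos, fun g hg => ?_, fun f hf => ?_⟩
  · rw [Measure.volume_eq_prod, lintegral_prod _ (show Measurable _ from hg.fun_comp hmeas).aemeasurable, lintegral_prod _ hg.aemeasurable]
    simp only [lint_mat _ hdet (measurable_slice hg _), GM_det]
    simp
  · have e : XE n (f ∘ fun z => (z.1, (GM n t₁).mulVec z.2 + z.1 • mom n t₁)) =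
        fun x => XE n f (1 * x.1 + t₁, (GM n t₁).mulVec x.2 + 0) := by
      ext x
      unfold XE
      congr 1; ext s
      simp only [Function.comp]
      congr 2
      rw [Matrix.mulVec_add, Matrix.mulVec_smul, add_assoc, ← smul_add, GM_mom]
      simp
    rw [e, mN_change ha.qpos ha.rpos (measurable_XE hf) one_pos one_pos (fun t y => (GM n t₁).mulVec y + 0)]
    · simp
    · intro t G hG; rw [lint_mat _ hdet hG, GM_det]

lemma IsSy.scaling {n : ℕ} {κ : ℝ} (ha : Adm n κ) {α β : ℝ} (hα : 0 < α) (hβ : 0 < β) :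
    IsSy n κ (fun z => (α * z.1, fun i => α * β ^ (i.1+1) * z.2 i)) (α ^ (n+1:ℝ) * β ^ (NN n)) := by
  set M : Matrix (Fin n) (Fin n) ℝ := Matrix.diagonal (fun i => α * β ^ (i.1+1)) with hM
  have hd : M.det = α ^ (n:ℝ) * β ^ (NN n) := by
    rw [hM, Matrix.det_diagonal, Finset.prod_mul_distrib, Finset.prod_const, Finset.card_univ, Fintype.card_fin,
      Real.rpow_natCast, Finset.prod_pow_eq_pow_sum, ← Real.rpow_natCast β]
    have hs : ((∑ i : Fin n, (i.1+1) : ℕ) : ℝ) = NN n := by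
      push_cast
      unfold NN
      rw [← Finset.sum_range (fun i => (i:ℝ)+1)]
      clear hM M ha
      induction n with
      | zero => simp
      | succ n ih => rw [Finset.sum_range_succ, ih]; push_cast; ring
    rw [hs]
  have hdet : 0 < M.det := by rw [hd]; positivity
  have hmv : ∀ y, M.mulVec y = fun i => α * β ^ (i.1+1) * y i := by
    intro y; ext i; simp [hM, Matrix.mulVec_diagonal]
  have hmeas : Measurable (fun z : Pt n => ((α * z.1, fun i => α * β ^ (i.1+1) * z.2 i) : Pt n)) := by
    fun_prop
  refine ⟨hmeas, by positivity, fun g hg => ?_, fun f hf => ?_⟩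
  · rw [Measure.volume_eq_prod, lintegral_prod _ (show Measurable _ from hg.fun_comp hmeas).aemeasurable, lintegral_prod _ hg.aemeasurable]
    have : ∀ s, ∫⁻ y : Fin n → ℝ, g (α * s, fun i => α * β ^ (i.1+1) * y i) = ENNReal.ofReal M.det⁻¹ * ∫⁻ y, g (α * s, y) := by
      intro s
      rw [← lint_mat _ hdet (measurable_slice hg _) 0]
      simp [hmv]
    simp only [this]
    have hm2 : Measurable (fun s => ∫⁻ y, g (s, y)) := hg.lintegral_prod_right'
    rw [lintegral_const_mul _ (hm2.fun_comp (f := fun s => α * s) (by fun_prop))]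
    have := lint_scale hα hm2 0
    simp only [add_zero] at this
    rw [this, ← mul_assoc, ← ENNReal.ofReal_mul (by positivity), hd, Real.rpow_add_one hα.ne']
    congr 2
    field_simp
  · have e : XE n (f ∘ fun z => (α * z.1, fun i => α * β ^ (i.1+1) * z.2 i)) =
        fun x => ENNReal.ofReal α⁻¹ * (fun x => XE n f (β * x.1 + 0, M.mulVec x.2 + 0)) x := by
      ext x
      unfold XE
      have hm3 : Measurable (fun s => f (s, (M.mulVec x.2 + 0) + s • mom n (β * x.1 + 0))) := by fun_prop
      rw [← lint_scale hα hm3 0]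
      congr 1; ext s
      simp only [Function.comp, hmv]
      congr 2
      · ring
      · ext i; simp [mom]; ring
    have hm4 : Measurable (fun x : Pt n => XE n f (β * x.1 + 0, M.mulVec x.2 + 0)) := by
      apply (measurable_XE hf).comp
      fun_prop
    rw [e, mN_const_mul ha.qpos ha.rpos hm4,
      mN_change ha.qpos ha.rpos (measurable_XE hf) hβ hdet (fun t y => M.mulVec y + 0), ← mul_assoc,
      ← ENNReal.ofReal_mul (by positivity), hd]
    · congr 2
      have n2 := ha.n2
      have e1 : 1 / rK n κ = 1 - κ * (n+1) / n := by unfold rK; rw [one_div, inv_inv]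
      have e2 : 1 / qK n κ = (n+1) * κ / 2 := by unfold qK; rw [one_div_div]
      rw [e1, e2, Real.mul_rpow (by positivity) (by positivity), Real.mul_rpow (by positivity) (by positivity),
        ← Real.rpow_mul hα.le, ← Real.rpow_mul hβ.le, ← Real.rpow_mul hα.le, ← Real.rpow_mul hβ.le,
        ← Real.rpow_neg_one α, mul_assoc (α ^ _) (β ^ _), ← Real.rpow_add hβ, ← mul_assoc, ← Real.rpow_add hα]
      congr 2
      · field_simp; ring
      · unfold NN; field_simp; ring
    · intro t G hG; rw [lint_mat _ hdet hG]

end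

section

/-! restricted type and strong type -/

abbrev Nm (n : ℕ) (κ : ℝ) (g : Pt n → ℝ≥0∞) : ℝ≥0∞ := mixedNorm n (qK n κ) (rK n κ) g

lemma XI_comp {n : ℕ} (E : Set (Pt n)) (φ : Pt n → Pt n) :
    XE n ((E.indicator 1) ∘ φ) = XI n (φ ⁻¹' E) := by
  unfold XI
  congr 1

lemma IsSy.vol {n : ℕ} {κ : ℝ} {φ : Pt n → Pt n} {J : ℝ} (h : IsSy n κ φ J) {E : Set (Pt n)} (hE : MeasurableSet E) :
    volume (φ ⁻¹' E) = ENNReal.ofReal J⁻¹ * volume E := by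
  have := h.lint (E.indicator 1) (measurable_one.indicator hE)
  rw [lintegral_indicator_one hE] at this
  rw [← this, ← lintegral_indicator_one (h.meas hE)]
  rfl

lemma IsSy.XI {n : ℕ} {κ : ℝ} {φ : Pt n → Pt n} {J : ℝ} (h : IsSy n κ φ J) {E : Set (Pt n)} (hE : MeasurableSet E) :
    Nm n κ (XI n (φ ⁻¹' E)) = ENNReal.ofReal (J ^ (-(1-κ))) * Nm n κ (XI n E) := by
  rw [← XI_comp]
  exact h.mn _ (measurable_one.indicator hE)

/-- scaling to unit volume -/
lemma exists_sy_J {n : ℕ} {κ : ℝ} (ha : Adm n κ) {V : ℝ} (hV : 0 < V) : ∃ φ, IsSy n κ φ V := by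
  have := IsSy.scaling ha (α := V ^ (1 / (n+1:ℝ))) (β := 1) (by positivity) one_pos
  rw [← Real.rpow_mul hV.le, Real.one_rpow, one_div_mul_cancel (by positivity), Real.rpow_one, mul_one] at this
  exact ⟨_, this⟩

lemma rst {n : ℕ} {κ : ℝ} (h : Adm n κ) : ∃ C : ℝ≥0∞, C ≠ ∞ ∧ ∀ E : Set (Pt n), MeasurableSet E →
    Nm n κ (XI n E) ≤ C * volume E ^ (1 - κ) := by
  obtain ⟨C, hC, hh⟩ := propB1 h
  have hk : 0 < 1 - κ := by linarith [h.half]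
  have hC' : C ^ (1 / qK n κ) + 1 ≠ ∞ := by
    simp only [ne_eq, add_eq_top, one_ne_top, or_false]
    exact ENNReal.rpow_ne_top_of_nonneg (by have := h.qpos; positivity) hC
  refine ⟨C ^ (1 / qK n κ) + 1, hC', fun E hE => ?_⟩
  by_cases h0 : volume E = 0
  · have : Nm n κ (XI n E) ≤ mixedNorm n (qK n κ) (rK n κ) (0 : Pt n → ℝ≥0∞) := by
      apply mN_mono_ae h.qpos h.rpos
      refine Eventually.of_forall fun t => ?_
      have := lintegral_XI hE t
      rw [h0, lintegral_eq_zero_iff (measurable_XI_right hE t)] at this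
      filter_upwards [this] with y hy
      exact hy.le
    rw [mN_zero h.qpos h.rpos] at this
    exact this.trans zero_le
  by_cases h1 : volume E = ∞
  · rw [h1, ENNReal.top_rpow_of_pos hk, ENNReal.mul_top (by positivity)]
    exact le_top
  have hV : 0 < (volume E).toReal := ENNReal.toReal_pos h0 h1
  obtain ⟨φ, hφ⟩ := exists_sy_J h hV
  have hv := hφ.vol hE
  have hvE : volume E = ENNReal.ofReal (volume E).toReal := (ENNReal.ofReal_toReal h1).symm
  have hv1 : volume (φ ⁻¹' E) = 1 := by
    rw [hv]
    nth_rewrite 2 [hvE]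
    rw [← ENNReal.ofReal_mul (by positivity), inv_mul_cancel₀ hV.ne', ENNReal.ofReal_one]
  have hx := hφ.XI hE
  have hb : Nm n κ (XI n (φ ⁻¹' E)) ≤ C ^ (1 / qK n κ) := by
    unfold Nm mixedNorm mixedNormG
    exact ENNReal.rpow_le_rpow (hh _ (hφ.meas hE) hv1.le) (by have := h.qpos; positivity)
  calc Nm n κ (XI n E) = ENNReal.ofReal ((volume E).toReal ^ (1-κ)) *
        (ENNReal.ofReal ((volume E).toReal ^ (-(1-κ))) * Nm n κ (XI n E)) := by
        rw [← mul_assoc, ← ENNReal.ofReal_mul (by positivity), ← Real.rpow_add hV]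
        simp
    _ ≤ ENNReal.ofReal ((volume E).toReal ^ (1-κ)) * (C ^ (1 / qK n κ) + 1) := by
        rw [← hx]; gcongr; exact hb.trans le_self_add
    _ = _ := by
        rw [mul_comm, ← ENNReal.ofReal_rpow_of_pos hV, ← hvE]

def El {n : ℕ} (f : Pt n → ℝ≥0∞) (j : ℤ) : Set (Pt n) := {z | e2 j ≤ f z ∧ f z < e2 (j + 1)}

lemma measurableSet_El {n : ℕ} {f : Pt n → ℝ≥0∞} (hf : Measurable f) (j : ℤ) : MeasurableSet (El f j) :=
  ms_and (measurableSet_le measurable_const hf) (measurableSet_lt hf measurable_const)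

lemma El_disj {n : ℕ} (f : Pt n → ℝ≥0∞) : Pairwise (Function.onFun Disjoint (El f)) := by
  intro i j hij
  rw [Function.onFun, Set.disjoint_left]
  rintro z ⟨h1, h2⟩ ⟨h3, h4⟩
  apply hij
  have key : ∀ a b : ℤ, e2 a < e2 (b + 1) → a ≤ b := by
    intro a b hab
    by_contra hlt
    push Not at hlt
    have : (b:ℝ) + 1 ≤ a := by exact_mod_cast hlt
    exact absurd (e2_mono this) (not_le.2 hab)
  exact le_antisymm (key _ _ (h1.trans_lt h4)) (key _ _ (h3.trans_lt h2))

lemma sum_mass {n : ℕ} {f : Pt n → ℝ≥0∞} (hf : Measurable f) {p : ℝ} (hp : 0 < p) :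
    ∑' j : ℤ, e2 (j * p) * volume (El f j) ≤ ∫⁻ z, f z ^ p := by
  calc ∑' j : ℤ, e2 (j * p) * volume (El f j) ≤ ∑' j : ℤ, ∫⁻ z in El f j, f z ^ p := by
        refine ENNReal.tsum_le_tsum fun j => ?_
        rw [← setLIntegral_const]
        refine setLIntegral_mono (hf.pow_const _) fun z hz => ?_
        rw [← e2_rpow]
        exact ENNReal.rpow_le_rpow hz.1 hp.le
    _ = ∫⁻ z in ⋃ j, El f j, f z ^ p :=
        (lintegral_iUnion (fun j => measurableSet_El hf j) (El_disj f) _).symm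
    _ ≤ _ := setLIntegral_le_lintegral _ _

lemma le_levels {n : ℕ} {f : Pt n → ℝ≥0∞} (hf : ∀ z, f z ≠ ∞) (z : Pt n) :
    f z ≤ ∑' j : ℤ, e2 (j+1) * (El f j).indicator 1 z := by
  by_cases h0 : f z = 0
  · rw [h0]; exact zero_le
  obtain ⟨a, h1, h2⟩ := exists_e2 h0 (hf z)
  refine le_trans ?_ (ENNReal.le_tsum a)
  have hz : z ∈ El f a := ⟨h1, h2⟩
  simp only [hz, indicator_of_mem, Pi.one_apply, mul_one]
  exact h2.le

lemma XE_levels {n : ℕ} {f : Pt n → ℝ≥0∞} (hm : Measurable f) (hf : ∀ z, f z ≠ ∞) (x : Pt n) :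
    XE n f x ≤ ∑' j : ℤ, e2 (j+1) * XI n (El f j) x := by
  have hmi : ∀ j : ℤ, Measurable (fun s : ℝ => (El f j).indicator (1 : Pt n → ℝ≥0∞) (s, x.2 + s • mom n x.1)) := by
    intro j
    exact (measurable_one.indicator (measurableSet_El hm j)).fun_comp (by fun_prop)
  calc XE n f x ≤ ∫⁻ s : ℝ, ∑' j : ℤ, e2 (j+1) * (El f j).indicator 1 (s, x.2 + s • mom n x.1) :=
        lintegral_mono fun s => le_levels hf _
    _ = _ := by
        rw [lintegral_tsum (fun j => ((hmi j).const_mul _).aemeasurable)]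
        congr 1; ext j
        rw [lintegral_const_mul _ (hmi j)]
        rfl

lemma tsum_geo {ε : ℝ} (hε : 0 < ε) : ∑' k : ℤ, e2 (-ε * |(k:ℝ)|) ≠ ∞ := by
  have hs : Summable (fun k : ℕ => (2:ℝ) ^ (-ε * (k:ℝ))) := by
    have : ∀ k : ℕ, (2:ℝ) ^ (-ε * (k:ℝ)) = ((2:ℝ) ^ (-ε)) ^ k := fun k => by
      rw [Real.rpow_mul (by norm_num), Real.rpow_natCast]
    simp_rw [this]
    exact summable_geometric_of_lt_one (by positivity) (Real.rpow_lt_one_of_one_lt_of_neg (by norm_num) (by linarith))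
  have hz : Summable (fun k : ℤ => (2:ℝ) ^ (-ε * |(k:ℝ)|)) := by
    apply Summable.of_nat_of_neg
    · simpa using hs
    · simpa using hs
  exact hz.tsum_ofReal_ne_top

lemma tsum_pairs {ε : ℝ} (m : ℤ → ℝ≥0∞) (hm : ∑' j, m j ≤ 1) :
    ∑' x : ℤ × ℤ, (m x.1 * m x.2) ^ (1/2:ℝ) * e2 (-ε * |(x.1:ℝ) - x.2|) ≤ 2 * ∑' k : ℤ, e2 (-ε * |(k:ℝ)|) := by
  have h1 : ∀ a b : ℝ≥0∞, (a * b) ^ (1/2:ℝ) ≤ a + b := by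
    intro a b
    wlog hab : a ≤ b generalizing a b
    · rw [mul_comm, add_comm]; exact this b a (le_of_not_ge hab)
    calc (a * b) ^ (1/2:ℝ) ≤ (b * b) ^ (1/2:ℝ) := by gcongr
      _ = b := by
        rw [← pow_two, ← ENNReal.rpow_natCast, ← ENNReal.rpow_mul]; norm_num
      _ ≤ _ := le_add_self
  set S := ∑' k : ℤ, e2 (-ε * |(k:ℝ)|) with hS
  have h2 : ∀ j : ℤ, ∑' l : ℤ, e2 (-ε * |(j:ℝ) - l|) = S := by
    intro j
    rw [hS, ← (Equiv.subLeft j).tsum_eq (fun k : ℤ => e2 (-ε * |(k:ℝ)|))]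
    simp
  have h3 : ∀ j : ℤ, ∑' l : ℤ, e2 (-ε * |(l:ℝ) - j|) = S := by
    intro j; rw [← h2 j]; simp_rw [abs_sub_comm]
  calc _ ≤ ∑' x : ℤ × ℤ, (m x.1 * e2 (-ε * |(x.1:ℝ) - x.2|) + m x.2 * e2 (-ε * |(x.1:ℝ) - x.2|)) := by
        refine ENNReal.tsum_le_tsum fun x => ?_
        rw [← add_mul]; gcongr; exact h1 _ _
    _ = (∑' j, m j) * S + (∑' j, m j) * S := by
        rw [ENNReal.tsum_add]
        congr 1
        · rw [ENNReal.tsum_prod (f := fun j l : ℤ => m j * e2 (-ε * |(j:ℝ) - l|))]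
          simp_rw [ENNReal.tsum_mul_left, h2, ENNReal.tsum_mul_right]
        · rw [ENNReal.tsum_prod (f := fun j l : ℤ => m l * e2 (-ε * |(j:ℝ) - l|)), ENNReal.tsum_comm]
          simp_rw [ENNReal.tsum_mul_left, h3, ENNReal.tsum_mul_right]
    _ ≤ 2 * S := by
        rw [← two_mul]; gcongr
        calc _ ≤ 1 * S := by gcongr
          _ = S := one_mul S

end

section

lemma level_est {n : ℕ} {κ δ : ℝ} {C : ℝ≥0∞} (hκ : κ < 1)
    (hC : ∀ E : Set (Pt n), MeasurableSet E → Nm n (κ + δ) (XI n E) ≤ C * volume E ^ (1 - (κ + δ)))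
    (ha : Adm n (κ + δ)) {E : Set (Pt n)} (hE : MeasurableSet E) (j : ℤ) :
    Nm n (κ + δ) (fun x => e2 (j+1) * XI n E x) ≤
      2 * C * (e2 (j * (1-κ)⁻¹) * volume E) ^ (1 - κ - δ) * e2 (j * (1-κ)⁻¹ * δ) := by
  have h1 : 0 ≤ 1 - κ - δ := by linarith [ha.half]
  have e0 : Nm n (κ + δ) (fun x => e2 (j+1) * XI n E x) = e2 (j+1) * Nm n (κ+δ) (XI n E) := mN_const_mul ha.qpos ha.rpos (measurable_XI hE) _
  rw [e0, ENNReal.mul_rpow_of_nonneg _ _ h1]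
  calc e2 (j+1) * Nm n (κ + δ) (XI n E) ≤ e2 (j+1) * (C * volume E ^ (1 - (κ + δ))) := by gcongr; exact hC E hE
    _ = 2 * C * volume E ^ (1 - κ - δ) * (e2 j) := by
        rw [e2_add, e2_one, sub_sub]; ring
    _ = 2 * C * volume E ^ (1 - κ - δ) * (e2 (j * (1-κ)⁻¹ * (1 - κ - δ)) * e2 (j * (1-κ)⁻¹ * δ)) := by
        rw [← e2_add]; congr 2
        have : 1 - κ ≠ 0 := by linarith
        field_simp; ring
    _ = _ := by rw [e2_rpow]; ring

set_option maxHeartbeats 1000000 in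
lemma strong {n : ℕ} {κ : ℝ} (h : Adm n κ) : ∃ C : ℝ≥0∞, C ≠ ∞ ∧ ∃ τ : ℝ, 0 < τ ∧
    ∀ f : Pt n → ℝ≥0∞, Measurable f → (∀ z, f z ≠ ∞) → ∫⁻ z, f z ^ (1-κ)⁻¹ ≤ 1 →
    ∀ B : ℝ≥0∞, (∀ j : ℤ, e2 j * Nm n κ (XI n (El f j)) ≤ B) → Nm n κ (XE n f) ≤ C * B ^ τ := by
  have hk1 : κ < 1 := by linarith [h.half]
  set p := (1-κ)⁻¹ with hp
  have hp1 : 1 < p := h.one_lt_p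
  have hp0 : 0 < p := by linarith
  set σ := min (min (qK n κ) (rK n κ)) 2 with hσ
  have hσp : p < σ := lt_min (lt_min h.p_lt_q h.p_lt_r) h.p_lt_two
  have hσ0 : 0 < σ := by linarith
  have hσq : σ ≤ qK n κ := (min_le_left _ _).trans (min_le_left _ _)
  have hσr : σ ≤ rK n κ := (min_le_left _ _).trans (min_le_right _ _)
  have hσ2 : σ ≤ 2 := min_le_right _ _
  have hgap : 0 < (1 - κ) - 1/σ := by
    have : 1/σ < 1/p := by apply one_div_lt_one_div_of_lt <;> linarith
    have : 1/p = 1 - κ := by rw [hp, one_div, inv_inv]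
    linarith
  obtain ⟨δ, hδ0, hδ1, hδ2, hδ3⟩ : ∃ δ : ℝ, 0 < δ ∧ δ < (1-κ) - 1/σ ∧ δ < κ ∧ δ < 2/(n+3) - κ := by
    obtain ⟨δ, h1, h2⟩ := exists_between (lt_min (lt_min hgap h.pos) (sub_pos.2 h.lt))
    refine ⟨δ, h1, ?_, ?_, h2.trans_le (min_le_right _ _)⟩
    · exact h2.trans_le ((min_le_left _ _).trans (min_le_left _ _))
    · exact h2.trans_le ((min_le_left _ _).trans (min_le_right _ _))
  have ha1 : Adm n (κ + δ) := ⟨h.hn, by linarith [h.pos], by linarith⟩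
  have ha2 : Adm n (κ + -δ) := ⟨h.hn, by linarith [h.pos], by linarith [h.lt]⟩
  obtain ⟨C₁, hC₁, hR₁⟩ := rst ha1
  obtain ⟨C₂, hC₂, hR₂⟩ := rst ha2
  set μ := 1 - κ - δ with hμ
  have hμσ : 1 < μ * σ := by
    have : 1/σ < μ := by linarith
    rwa [div_lt_iff₀ hσ0] at this
  have hμ0 : 0 < μ := by
    by_contra hh; push Not at hh; nlinarith
  set τ := 1 - 1/(μ * σ) with hτ
  have hτ0 : 0 < τ := by
    rw [hτ, sub_pos, div_lt_one (by linarith)]; exact hμσ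
  have hτ1 : 0 < 1 - τ := by rw [hτ]; simp; positivity
  have hτμ : μ * (σ/2) * (1 - τ) = 1/2 := by rw [hτ]; field_simp; ring
  set K := (2 * C₁) * (2 * C₂) with hK
  have hKt : K ≠ ∞ := by
    apply ENNReal.mul_ne_top <;> apply ENNReal.mul_ne_top <;> simp [hC₁, hC₂]
  set ε := p * δ * (σ/2) * (1-τ) with hε
  have hε0 : 0 < ε := by positivity
  set S := ∑' k : ℤ, e2 (-ε * |(k:ℝ)|) with hS
  have hSt : S ≠ ∞ := tsum_geo hε0
  refine ⟨((2*2:ℝ≥0∞) ^ (σ/2*τ) * K ^ (σ/2*(1-τ)) * (2 * S)) ^ (1/σ), ?_, τ, hτ0, ?_⟩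
  · apply ENNReal.rpow_ne_top_of_nonneg (by positivity)
    refine ENNReal.mul_ne_top (ENNReal.mul_ne_top ?_ ?_) (ENNReal.mul_ne_top (by simp) hSt)
    · exact ENNReal.rpow_ne_top_of_nonneg (by positivity) (ENNReal.mul_ne_top (by simp) (by simp))
    · exact ENNReal.rpow_ne_top_of_nonneg (by positivity) hKt
  intro f hf hft hfp B hB
  have hEm := fun j => measurableSet_El hf j
  set H : ℤ → Pt n → ℝ≥0∞ := fun j x => e2 (j+1) * XI n (El f j) x with hH
  have hHm : ∀ j, Measurable (H j) := fun j => (measurable_XI (hEm j)).const_mul _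
  set m : ℤ → ℝ≥0∞ := fun j => e2 (j * p) * volume (El f j) with hm
  have hm1 : ∑' j, m j ≤ 1 := (sum_mass hf hp0).trans hfp
  have hmj : ∀ j, m j ≤ 1 := fun j => (ENNReal.le_tsum j).trans hm1
  have e1 : ∀ j, Nm n (κ + δ) (H j) ≤ 2 * C₁ * m j ^ μ * e2 (j * p * δ) := fun j =>
    level_est hk1 hR₁ ha1 (hEm j) j
  have e2' : ∀ j, Nm n (κ + -δ) (H j) ≤ 2 * C₂ * m j ^ μ * e2 (-(j * p * δ)) := fun j => by
    refine (level_est hk1 hR₂ ha2 (hEm j) j).trans ?_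
    rw [mul_neg]
    gcongr 2 * C₂ * ?_ * _
    exact ENNReal.rpow_le_rpow_of_exponent_ge (hmj j) (by rw [hμ]; linarith)
  have e0 : ∀ j, Nm n κ (H j) ≤ 2 * B := fun j => by
    have e0 : Nm n κ (H j) = e2 (j+1) * Nm n κ (XI n (El f j)) := mN_const_mul h.qpos h.rpos (measurable_XI (hEm j)) _
    rw [e0, e2_add, e2_one, mul_comm (e2 _), mul_assoc]
    gcongr; exact hB j
  -- bilinear quantity
  set c : ℤ → ℤ → ℝ≥0∞ := fun j l => mixedNorm n (qK n κ/2) (rK n κ/2) (fun x => H j x * H l x) with hc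
  have hq2 : 0 < qK n κ / 2 := half_pos h.qpos
  have hr2 : 0 < rK n κ / 2 := half_pos h.rpos
  have qinv : ∀ k, 1 / qK n k = (n+1) * k / 2 := fun k => by unfold qK; rw [one_div_div]
  have rinv : ∀ k, 1 / rK n k = 1 - k * (n+1) / n := fun k => by unfold rK; rw [one_div, inv_inv]
  have q2inv : 1 / (qK n κ/2) = (n+1) * κ := by rw [one_div_div]; have := qinv κ; rw [div_eq_mul_one_div, this]; ring
  have r2inv : 1 / (rK n κ/2) = 2 * (1 - κ * (n+1) / n) := by rw [one_div_div]; have := rinv κ; rw [div_eq_mul_one_div, this]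
  have c0 : ∀ j l, c j l ≤ (2 * B) * (2 * B) := fun j l => by
    refine (mN_mul_le (q₁ := qK n κ) (q₂ := qK n κ) (r₁ := rK n κ) (r₂ := rK n κ) hq2 hr2 (by linarith [h.qpos]) (by linarith [h.rpos]) ?_ ?_ h.qpos h.rpos (hHm j) (hHm l)).trans
      (mul_le_mul' (e0 j) (e0 l))
    · rw [q2inv, qinv]; ring
    · rw [r2inv, rinv]; ring
  have lt_of_inv : ∀ a b : ℝ, 0 < a → 0 < b → 1/b < 1/a → a < b := fun a b ha hb hab =>
    (one_div_lt_one_div hb ha).1 hab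
  have c1 : ∀ j l, c j l ≤ K * (m j * m l) ^ μ * e2 (p * δ * (j - l)) := fun j l => by
    have n2 := h.n2
    refine (mN_mul_le (q₁ := qK n (κ+δ)) (q₂ := qK n (κ+-δ)) (r₁ := rK n (κ+δ)) (r₂ := rK n (κ+-δ)) hq2 hr2 ?_ ?_ ?_ ?_ ha2.qpos ha2.rpos (hHm j) (hHm l)).trans
      ((mul_le_mul' (e1 j) (e2' l)).trans (le_of_eq ?_))
    · apply lt_of_inv _ _ hq2 ha1.qpos
      rw [q2inv, qinv]; nlinarith
    · apply lt_of_inv _ _ hr2 ha1.rpos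
      have := ha2.rpos
      have h3 : 0 < 1 / rK n (κ+-δ) := by positivity
      rw [rinv] at h3
      rw [r2inv, rinv]
      have e : 2 * (1 - κ * (n+1)/n) = (1 - (κ+δ) * (n+1)/n) + (1 - (κ+-δ) * (n+1)/n) := by ring
      linarith
    · rw [q2inv, qinv, qinv]; ring
    · rw [r2inv, rinv, rinv]; ring
    · rw [show p * δ * ((j:ℝ) - l) = j * p * δ + -(l * p * δ) by ring, e2_add, ENNReal.mul_rpow_of_nonneg (m j) (m l) hμ0.le, hK]
      ring
  have csymm : ∀ j l, c j l = c l j := fun j l => by simp only [hc, mul_comm]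
  have c2 : ∀ j l, c j l ≤ K * (m j * m l) ^ μ * e2 (-(p * δ * |(j:ℝ) - l|)) := fun j l => by
    rcases le_total (j:ℝ) l with hjl | hjl
    · rw [abs_of_nonpos (by linarith)]
      refine (c1 j l).trans (le_of_eq ?_); congr 2; ring
    · rw [abs_of_nonneg (by linarith), csymm, mul_comm (m j)]
      refine (c1 l j).trans (le_of_eq ?_); congr 2; ring
  have c3 : ∀ j l, c j l ^ (σ/2) ≤ ((2*B)*(2*B)) ^ (σ/2*τ) * K ^ (σ/2*(1-τ)) *
      ((m j * m l) ^ (1/2:ℝ) * e2 (-ε * |(j:ℝ) - l|)) := fun j l => by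
    have hst : 0 ≤ σ/2*τ := by positivity
    have hst' : 0 ≤ σ/2*(1-τ) := by positivity
    calc c j l ^ (σ/2) = c j l ^ (σ/2*τ) * c j l ^ (σ/2*(1-τ)) := by
          rw [← ENNReal.rpow_add_of_nonneg _ _ hst hst']; congr 1; ring
      _ ≤ ((2*B)*(2*B)) ^ (σ/2*τ) * (K * (m j * m l) ^ μ * e2 (-(p * δ * |(j:ℝ) - l|))) ^ (σ/2*(1-τ)) := by
          gcongr
          · exact c0 j l
          · exact c2 j l
      _ = _ := by
          rw [ENNReal.mul_rpow_of_nonneg _ _ hst', ENNReal.mul_rpow_of_nonneg _ _ hst', ← ENNReal.rpow_mul,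
            e2_rpow, ← mul_assoc μ, hτμ, show -(p * δ * |(j:ℝ) - l|) * (σ/2*(1-τ)) = -ε * |(j:ℝ) - l| by rw [hε]; ring]
          ring
  -- main
  set g : Pt n → ℝ≥0∞ := fun x => ∑' j, H j x with hg
  have hX : Nm n κ (XE n f) ≤ Nm n κ g := mN_mono h.qpos h.rpos (XE_levels hf hft)
  have hg2 : Nm n κ g ^ σ ≤ ∑' x : ℤ × ℤ, c x.1 x.2 ^ (σ/2) := by
    have e3 : Nm n κ g ^ σ = mixedNorm n (qK n κ/2) (rK n κ/2) (fun x => g x ^ (2:ℝ)) ^ (σ/2) := by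
      rw [mN_rpow (by norm_num) hq2 hr2, ← ENNReal.rpow_mul, div_mul_cancel₀ _ (by norm_num), div_mul_cancel₀ _ (by norm_num),
        mul_div_cancel₀ _ (by norm_num)]
    rw [e3]
    refine mN_master (by positivity) (by linarith) (by linarith) (G := fun x : ℤ × ℤ => fun y => H x.1 y * H x.2 y)
      (fun x => (hHm _).mul (hHm _)) fun y => ?_
    refine le_trans (le_of_eq ?_) (rpow_tsum_le _ (by positivity) (by linarith))
    congr 1
    rw [ENNReal.tsum_prod (f := fun j l => H j y * H l y)]
    simp_rw [ENNReal.tsum_mul_left, ENNReal.tsum_mul_right]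
    rw [hg, ENNReal.rpow_two, pow_two]
  have hfin : Nm n κ g ^ σ ≤ ((2*2:ℝ≥0∞) ^ (σ/2*τ) * K ^ (σ/2*(1-τ)) * (2 * S)) * B ^ (τ * σ) := by
    have hh : ∑' x : ℤ × ℤ, c x.1 x.2 ^ (σ/2) ≤ ∑' x : ℤ × ℤ, ((2*B)*(2*B)) ^ (σ/2*τ) * K ^ (σ/2*(1-τ)) *
      ((m x.1 * m x.2) ^ (1/2:ℝ) * e2 (-ε * |(x.1:ℝ) - x.2|)) := by
      clear_value c
      exact ENNReal.tsum_le_tsum fun x => c3 x.1 x.2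
    rw [ENNReal.tsum_mul_left] at hh
    refine hg2.trans (hh.trans ?_)
    clear_value c g K m
    calc _ ≤ ((2*B)*(2*B)) ^ (σ/2*τ) * K ^ (σ/2*(1-τ)) * (2 * S) := by
          gcongr; exact tsum_pairs m hm1
      _ = _ := by
          have : ((2*B)*(2*B)) ^ (σ/2*τ) = (2*2:ℝ≥0∞) ^ (σ/2*τ) * B ^ (τ * σ) := by
            rw [show (2*B)*(2*B) = (2*2) * B^(2:ℝ) by rw [ENNReal.rpow_two]; ring,
              ENNReal.mul_rpow_of_nonneg _ _ (by positivity), ← ENNReal.rpow_mul]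
            congr 2; ring
          rw [this]; ring
  refine hX.trans ?_
  have := ENNReal.rpow_le_rpow hfin (by positivity : 0 ≤ 1/σ)
  rw [← ENNReal.rpow_mul, mul_one_div_cancel hσ0.ne', ENNReal.rpow_one, ENNReal.mul_rpow_of_nonneg _ _ (by positivity),
    ← ENNReal.rpow_mul, mul_assoc τ, mul_one_div_cancel hσ0.ne', mul_one] at this
  exact this

end

section

lemma strong_bdd {n : ℕ} {κ : ℝ} (h : Adm n κ) : ∃ C : ℝ≥0∞, C ≠ ∞ ∧
    ∀ f : Pt n → ℝ≥0∞, Measurable f → (∀ z, f z ≠ ∞) → ∫⁻ z, f z ^ (1-κ)⁻¹ ≤ 1 → Nm n κ (XE n f) ≤ C := by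
  obtain ⟨C, hC, τ, hτ, hh⟩ := strong h
  obtain ⟨C', hC', hr⟩ := rst h
  have hk1 : 0 < 1 - κ := by linarith [h.half]
  refine ⟨C * C' ^ τ, ENNReal.mul_ne_top hC (ENNReal.rpow_ne_top_of_nonneg hτ.le hC'), fun f hf hft hfp => ?_⟩
  refine hh f hf hft hfp C' fun j => ?_
  have hm : e2 (j * (1-κ)⁻¹) * volume (El f j) ≤ 1 :=
    (ENNReal.le_tsum (f := fun j : ℤ => e2 (j * (1-κ)⁻¹) * volume (El f j)) j).trans ((sum_mass hf (by positivity)).trans hfp)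
  calc e2 j * Nm n κ (XI n (El f j)) ≤ e2 j * (C' * volume (El f j) ^ (1-κ)) := by
        gcongr; exact hr _ (measurableSet_El hf j)
    _ = C' * (e2 (j * (1-κ)⁻¹) * volume (El f j)) ^ (1-κ) := by
        rw [ENNReal.mul_rpow_of_nonneg _ _ hk1.le, e2_rpow, inv_mul_cancel_right₀ hk1.ne']; ring
    _ ≤ C' * 1 ^ (1-κ) := by gcongr
    _ = C' := by simp

lemma level_exists {n : ℕ} {κ : ℝ} (h : Adm n κ) {c : ℝ≥0∞} (hc : c ≠ 0) : ∃ c' : ℝ≥0∞, c' ≠ 0 ∧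
    ∀ f : Pt n → ℝ≥0∞, Measurable f → (∀ z, f z ≠ ∞) → ∫⁻ z, f z ^ (1-κ)⁻¹ ≤ 1 → c ≤ Nm n κ (XE n f) →
      ∃ j : ℤ, c' ≤ e2 j * Nm n κ (XI n (El f j)) := by
  obtain ⟨C, hC, τ, hτ, hh⟩ := strong h
  obtain ⟨B, hB0, hB⟩ : ∃ B : ℝ≥0∞, B ≠ 0 ∧ C * B ^ τ < c := by
    have ht : Tendsto (fun B : ℝ≥0∞ => C * B ^ τ) (nhdsWithin 0 (Ioi 0)) (nhds 0) := by
      have h1 : Tendsto (fun B : ℝ≥0∞ => B ^ τ) (nhds 0) (nhds 0) := by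
        have := (ENNReal.continuous_rpow_const (y := τ)).tendsto 0
        rwa [ENNReal.zero_rpow_of_pos hτ] at this
      have h2 := ENNReal.Tendsto.const_mul (a := C) h1 (Or.inr hC)
      rw [mul_zero] at h2
      exact h2.mono_left nhdsWithin_le_nhds
    have h3 := ht.eventually (gt_mem_nhds (pos_iff_ne_zero.2 hc))
    obtain ⟨B, h4, h5⟩ := (h3.and self_mem_nhdsWithin).exists
    exact ⟨B, (ne_of_gt h5), h4⟩
  refine ⟨B, hB0, fun f hf hft hfp hcf => ?_⟩
  by_contra hcon
  push Not at hcon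
  exact absurd (hcf.trans (hh f hf hft hfp B fun j => (hcon j).le)) (not_le.2 hB)

lemma diag_det {n : ℕ} {α β : ℝ} (hα : 0 < α) (hβ : 0 < β) :
    (Matrix.diagonal (fun i : Fin n => α * β ^ (i.1+1))).det = α ^ (n:ℝ) * β ^ (NN n) := by
  rw [Matrix.det_diagonal, Finset.prod_mul_distrib, Finset.prod_const, Finset.card_univ, Fintype.card_fin,
      Real.rpow_natCast, Finset.prod_pow_eq_pow_sum, ← Real.rpow_natCast β]
  have hs : ((∑ i : Fin n, (i.1+1) : ℕ) : ℝ) = NN n := by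
    push_cast
    unfold NN
    rw [← Finset.sum_range (fun i => (i:ℝ)+1)]
    induction n with
    | zero => simp
    | succ n ih => rw [Finset.sum_range_succ, ih]; push_cast; ring
  rw [hs]

lemma XE_scaling {n : ℕ} {α β : ℝ} (hα : 0 < α) {f : Pt n → ℝ≥0∞} (hf : Measurable f) (x : Pt n) :
    XE n (f ∘ fun z => (α * z.1, fun i => α * β ^ (i.1+1) * z.2 i)) x =
      ENNReal.ofReal α⁻¹ * XE n f (β * x.1, fun i => α * β ^ (i.1+1) * x.2 i) := by
  unfold XE
  have hm3 : Measurable (fun s => f (s, (fun i => α * β ^ (i.1+1) * x.2 i) + s • mom n (β * x.1))) := by fun_prop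
  rw [← lint_scale hα hm3 0]
  congr 1; ext s
  simp only [Function.comp]
  congr 2
  · ring
  · ext i; simp [mom]; ring

lemma propC0 {n : ℕ} {κ : ℝ} (h : Adm n κ) {η : ℝ≥0∞} (hη : η ≠ 0) :
    ∃ c C : ℝ, 0 < c ∧ 0 < C ∧ ∀ E : Set (Pt n), MeasurableSet E → volume E ≤ 1 →
      η ≤ ∫⁻ t, (∫⁻ y, XI n E (t, y) ^ rK n κ) ^ (qK n κ / rK n κ) → ∃ (φ : Pt n → Pt n) (F : Set (Pt n)) (D : Set ℝ),
        IsSy n κ φ 1 ∧ MeasurableSet F ∧ MeasurableSet D ∧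
        (∀ x ∈ F, 1 ≤ XI n (φ ⁻¹' E) x ∧ XI n (φ ⁻¹' E) x ≤ 2) ∧ F ⊆ Prod.fst ⁻¹' D ∧
        volume D ≤ ENNReal.ofReal C ∧ (∀ t, volume {y | (t, y) ∈ F} ≤ 1) ∧
        ENNReal.ofReal c ≤ volume F := by
  obtain ⟨c, C, hc, hC, hh⟩ := propB2 h hη
  refine ⟨c, C, hc, hC, fun E hE hE1 hJ => ?_⟩
  obtain ⟨a, F, D, hF, hD, hFa, hFD, hDv, hsl, hFv⟩ := hh E hE hE1 hJ
  have n2 := h.n2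
  set α : ℝ := 2 ^ (a:ℝ) with hα'
  set β : ℝ := 2 ^ (-(2/n) * a : ℝ) with hβ'
  have hα : 0 < α := by positivity
  have hβ : 0 < β := by positivity
  have hαi : ENNReal.ofReal α⁻¹ = e2 (-a) := by
    unfold e2; rw [hα', Real.rpow_neg (by norm_num)]
  have hβi : ENNReal.ofReal β⁻¹ = e2 (2/n*a) := by
    unfold e2; rw [hβ', ← Real.rpow_neg (by norm_num)]; congr 2; ring
  set M : Matrix (Fin n) (Fin n) ℝ := Matrix.diagonal (fun i => α * β ^ (i.1+1)) with hM
  have hd : M.det = 2 ^ (-a : ℝ) := by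
    rw [hM, diag_det hα hβ, hα', hβ', ← Real.rpow_mul (by norm_num), ← Real.rpow_mul (by norm_num), ← Real.rpow_add (by norm_num)]
    congr 1; unfold NN; field_simp; ring
  have hdet : 0 < M.det := by rw [hd]; positivity
  have hdi : ENNReal.ofReal M.det⁻¹ = e2 a := by
    unfold e2; rw [hd, ← Real.rpow_neg (by norm_num)]; simp
  have hmv : ∀ y, M.mulVec y + 0 = fun i => α * β ^ (i.1+1) * y i := by
    intro y; ext i; simp [hM, Matrix.mulVec_diagonal]
  set Ψ : Pt n → Pt n := fun x => (β * x.1, fun i => α * β ^ (i.1+1) * x.2 i) with hΨ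
  have hΨm : Measurable Ψ := by rw [hΨ]; fun_prop
  have hsy := IsSy.scaling h hα hβ
  have hJ1 : α ^ (n+1:ℝ) * β ^ (NN n) = 1 := by
    rw [hα', hβ', ← Real.rpow_mul (by norm_num), ← Real.rpow_mul (by norm_num), ← Real.rpow_add (by norm_num)]
    rw [show (a:ℝ) * (n+1) + -(2/n) * a * NN n = 0 by unfold NN; field_simp; ring, Real.rpow_zero]
  rw [hJ1] at hsy
  have hslice : ∀ t, volume {y | (t, y) ∈ Ψ ⁻¹' F} = e2 a * volume {y | (β * t, y) ∈ F} := by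
    intro t
    have m1 : MeasurableSet {y | (β * t, y) ∈ F} := measurable_prodMk_left hF
    have m2 : MeasurableSet {y | (t, y) ∈ Ψ ⁻¹' F} := measurable_prodMk_left (hΨm hF)
    rw [← lintegral_indicator_one m1, ← lintegral_indicator_one m2, ← hdi,
      ← lint_mat M hdet (measurable_one.indicator m1) 0]
    congr 1; ext y
    rw [hmv]; rfl
  refine ⟨_, Ψ ⁻¹' F, (fun t => β * t) ⁻¹' D, hsy, hΨm hF, (show Measurable fun t => β * t by fun_prop) hD, ?_, ?_, ?_, ?_, ?_⟩
  · intro x hx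
    have h1 := hFa hx
    have h2 : XI n ((fun z : Pt n => ((α * z.1, fun i => α * β ^ (i.1+1) * z.2 i) : Pt n)) ⁻¹' E) x = e2 (-a) * XI n E (Ψ x) := by
      rw [← hαi]
      exact XE_scaling hα (measurable_one.indicator hE) x
    rw [h2]
    have h3 : e2 (-(a:ℝ)) * e2 a = 1 := by rw [← e2_add]; simp [e2_zero]
    constructor
    · rw [← h3]; gcongr; exact h1.1
    · calc _ ≤ e2 (-(a:ℝ)) * e2 (a+1) := by gcongr; exact h1.2.le
        _ = 2 := by rw [e2_add, ← mul_assoc, h3, e2_one, one_mul]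
  · intro x hx; exact hFD hx
  · have e := lint_scale hβ (measurable_one.indicator hD : Measurable (D.indicator (1 : ℝ → ℝ≥0∞))) 0
    rw [lintegral_indicator_one hD] at e
    rw [← lintegral_indicator_one ((show Measurable fun t => β * t by fun_prop) hD)]
    calc _ = ∫⁻ s, D.indicator (1 : ℝ → ℝ≥0∞) (β * s + 0) := by simp only [add_zero]; rfl
      _ ≤ e2 (2/n*a) * (ENNReal.ofReal C * e2 (-(2/n)*a)) := by rw [e, hβi]; gcongr
      _ = ENNReal.ofReal C * (e2 (2/n*a) * e2 (-(2/n)*a)) := by ring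
      _ = _ := by rw [← e2_add, show 2/(n:ℝ)*a + -(2/n)*a = 0 by ring, e2_zero, mul_one]
  · intro t
    rw [hslice]
    calc _ ≤ e2 a * e2 (-a) := by gcongr; exact hsl _
      _ = 1 := by rw [← e2_add]; simp [e2_zero]
  · have e1 : volume (Ψ ⁻¹' F) = e2 (2/n*a) * e2 a * volume F := by
      have m0 : Measurable (fun t : ℝ => volume {y : Fin n → ℝ | (t, y) ∈ F}) := measurable_measure_prodMk_left hF
      rw [Measure.volume_eq_prod, Measure.prod_apply (hΨm hF), Measure.prod_apply hF]
      change ∫⁻ t, volume {y | (t, y) ∈ Ψ ⁻¹' F} = _ * ∫⁻ t, volume {y | (t, y) ∈ F}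
      simp_rw [hslice]
      rw [lintegral_const_mul _ (m0.fun_comp (f := fun t => β * t) (by fun_prop))]
      have := lint_scale hβ m0 0
      simp only [add_zero] at this
      rw [this, hβi]; ring
    rw [e1]
    calc ENNReal.ofReal c = e2 (2/n*a) * e2 a * (ENNReal.ofReal c * e2 (-(1+2/n)*a)) := by
          rw [show e2 (2/n*a) * e2 a * (ENNReal.ofReal c * e2 (-(1+2/n)*a)) = ENNReal.ofReal c * (e2 (2/n*a) * e2 a * e2 (-(1+2/n)*a)) by ring,
            ← e2_add, ← e2_add, show 2/(n:ℝ)*a + a + -(1+2/n)*a = 0 by ring, e2_zero, mul_one]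
      _ ≤ _ := by gcongr

end

section

lemma MVlin {n : ℕ} (z : Pt n) (c : Fin (n+1) → Pt n)
    (hx : (Matrix.of fun k i : Fin (n+1) => toFin n (c i) k).det ≠ 0) {A : Set (Pt n)}
    (hA : MeasurableSet A) :
    volume {w : Fin (n+1) → ℝ | z + ∑ i, w i • c i ∈ A} =
      ENNReal.ofReal |(Matrix.of fun k i : Fin (n+1) => toFin n (c i) k).det|⁻¹ * volume A := by
  set M := (Matrix.of fun k i : Fin (n+1) => toFin n (c i) k) with hM
  have hmap := Real.map_matrix_volume_pi_eq_smul_volume_pi hx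
  set A' : Set (Fin (n+1) → ℝ) := (fun c => toFin n z + c) ⁻¹' ((toFin n).symm ⁻¹' A) with hA'
  have hm1 : MeasurableSet ((toFin n).symm ⁻¹' A) := (toFin n).symm.measurable hA
  have hm2 : MeasurableSet A' := (measurable_const_add _) hm1
  have hlin : ∀ w : Fin (n+1) → ℝ, toFin n (z + ∑ i, w i • c i) = toFin n z + M.mulVec w := by
    intro w
    funext k
    simp only [toFin_apply, Pi.add_apply, hM, Matrix.mulVec, dotProduct, Matrix.of_apply]
    refine Fin.cases ?_ (fun j => ?_) k
    · simp [Prod.fst_sum, mul_comm]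
    · simp [Prod.snd_sum, mul_comm]
  have h1 : {w : Fin (n+1) → ℝ | z + ∑ i, w i • c i ∈ A} = (Matrix.toLin' M) ⁻¹' A' := by
    ext w
    simp only [mem_ofPred_eq, hA', mem_preimage, Matrix.toLin'_apply]
    rw [← hlin, MeasurableEquiv.symm_apply_apply]
  have hml : Measurable (Matrix.toLin' M) := (LinearMap.continuous_of_finiteDimensional _).measurable
  rw [h1, ← Measure.map_apply hml hm2, hmap, Measure.smul_apply, hA', measure_preimage_add,
    (toFin_mp n).symm.measure_preimage hA.nullMeasurableSet, abs_inv]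
  rfl

lemma det_last {k : ℕ} (M : Matrix (Fin (k+1)) (Fin (k+1)) ℝ)
    (h : ∀ i, M i (Fin.last k) = if i = Fin.last k then 1 else 0) :
    M.det = (M.submatrix Fin.castSucc Fin.castSucc).det := by
  rw [Matrix.det_succ_column M (Fin.last k), Finset.sum_eq_single (Fin.last k)]
  · rw [h]
    simp only [Fin.val_last, if_true, mul_one, Even.neg_pow (Even.add_self k), one_pow, one_mul]
    congr 1
    ext i j; simp [Fin.succAbove_last]
  · intro i _ hi
    rw [h, if_neg hi]; simp
  · simp

/-- standard vector -/
def ev (n : ℕ) (k : Fin (n+1)) : Pt n := (toFin n).symm (Pi.single k 1)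

lemma toFin_ev (n : ℕ) (k : Fin (n+1)) : toFin n (ev n k) = Pi.single k 1 := by simp [ev]

open Polynomial in
lemma interp {m : ℕ} (x : Fin m → ℝ) (hx : Function.Injective x) :
    ∃ σ : ℝ, ∀ t : ℝ, ∃ L : Fin m → ℝ, vv (m+1) t = ∑ j, L j • vv (m+1) (x j) +
      ((∏ j, (t - x j)) • ev (m+1) (Fin.last m).castSucc +
       ((∏ j, (t - x j)) * (t + σ)) • ev (m+1) (Fin.last (m+1))) := by
  set ω : ℝ[X] := ∏ j, (X - C (x j)) with hω
  have hmon : ω.Monic := monic_prod_of_monic _ _ fun j _ => monic_X_sub_C _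
  have hdeg : ω.natDegree = m := by
    rw [hω, natDegree_prod_of_monic _ _ fun j _ => monic_X_sub_C _]; simp
  have hωx : ∀ j, ω.eval (x j) = 0 := by
    intro j; rw [hω, eval_prod]; exact Finset.prod_eq_zero (Finset.mem_univ j) (by simp)
  have hωt : ∀ t, ω.eval t = ∏ j, (t - x j) := by intro t; rw [hω, eval_prod]; simp
  have hq : ∀ k, m ≤ k → ((X:ℝ[X])^k /ₘ ω).Monic ∧ ((X:ℝ[X])^k /ₘ ω).natDegree = k - m := by
    intro k hk
    constructor
    · unfold Monic
      rw [leadingCoeff_divByMonic_of_monic hmon]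
      · simp
      · rw [degree_X_pow, degree_eq_natDegree hmon.ne_zero, hdeg]; exact_mod_cast hk
    · rw [natDegree_divByMonic _ hmon, natDegree_X_pow, hdeg]
  have hq0 : ∀ k, k < m → (X:ℝ[X])^k /ₘ ω = 0 := by
    intro k hk
    rw [divByMonic_eq_zero_iff hmon, degree_X_pow, degree_eq_natDegree hmon.ne_zero, hdeg]; exact_mod_cast hk
  have hqm : (X:ℝ[X])^m /ₘ ω = 1 := by
    have := hq m le_rfl
    exact (Polynomial.Monic.natDegree_eq_zero this.1).1 (by rw [this.2]; simp)
  have hqm1 := (hq (m+1) (by omega)).1.eq_X_add_C (by rw [(hq (m+1) (by omega)).2]; simp)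
  set σ := ((X:ℝ[X])^(m+1) /ₘ ω).coeff 0 with hσ
  refine ⟨σ, fun t => ⟨fun j => (Lagrange.basis Finset.univ x j).eval t, ?_⟩⟩
  have key : ∀ k, t ^ k = ∑ j, (Lagrange.basis Finset.univ x j).eval t * x j ^ k + (∏ j, (t - x j)) * ((X:ℝ[X])^k /ₘ ω).eval t := by
    intro k
    have h1 := modByMonic_add_div ((X:ℝ[X])^k) ω
    set R := (X:ℝ[X])^k %ₘ ω with hR
    have hRx : ∀ j, R.eval (x j) = x j ^ k := by
      intro j
      have := congrArg (eval (x j)) h1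
      simpa [hωx] using this
    have hRd : R.degree < (Finset.univ : Finset (Fin m)).card := by
      have := degree_modByMonic_lt ((X:ℝ[X])^k) hmon
      rw [degree_eq_natDegree hmon.ne_zero, hdeg] at this
      simpa using this
    have h2 := Lagrange.eq_interpolate (s := Finset.univ) (v := x) hx.injOn hRd
    have h3 := congrArg (eval t) h1
    simp only [eval_add, eval_mul, eval_pow, eval_X, hωt] at h3
    rw [← h3]
    congr 1
    conv_lhs => rw [h2]
    rw [Lagrange.interpolate_apply, eval_finsetSum]
    refine Finset.sum_congr rfl fun j _ => ?_
    rw [eval_mul, eval_C, hRx, mul_comm]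
  apply (toFin (m+1)).injective
  have e := toFin_comb (n := m+1) (((∏ j, (t - x j)) • ev (m+1) (Fin.last m).castSucc +
       ((∏ j, (t - x j)) * (t + σ)) • ev (m+1) (Fin.last (m+1)))) x (fun j => (Lagrange.basis Finset.univ x j).eval t)
  rw [add_comm (∑ j, _) (_ + _), e]
  have lin : ∀ (a b : ℝ) (u v : Pt (m+1)), toFin (m+1) (a • u + b • v) = a • toFin (m+1) u + b • toFin (m+1) v := by
    intro a b u v
    funext k
    simp only [toFin_apply, Pi.add_apply, Pi.smul_apply]
    refine Fin.cases ?_ (fun j => ?_) k <;> simp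
  rw [lin, toFin_ev, toFin_ev]
  funext k
  have hv : toFin (m+1) (vv (m+1) t) k = t ^ (k:ℕ) := by
    rw [toFin_apply]
    refine Fin.cases ?_ (fun j => ?_) k <;> simp [vv, mom]
  rw [hv, key]
  simp only [Pi.add_apply, Pi.smul_apply, smul_eq_mul, Pi.single_apply]
  rw [add_comm]
  congr 1
  rcases Fin.eq_castSucc_or_eq_last k with ⟨k, rfl⟩ | rfl
  · rcases Fin.eq_castSucc_or_eq_last k with ⟨k, rfl⟩ | rfl
    · have e1 : (k.castSucc.castSucc : Fin (m+2)) ≠ (Fin.last m).castSucc := by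
        intro h; have := congrArg Fin.val h; simp at this; omega
      have e2 : (k.castSucc.castSucc : Fin (m+2)) ≠ Fin.last (m+1) := by
        intro h; have := congrArg Fin.val h; simp at this; omega
      rw [if_neg e1, if_neg e2]
      simp [hq0 k k.2]
    · have e2 : ((Fin.last m).castSucc : Fin (m+2)) ≠ Fin.last (m+1) := by
        intro h; have := congrArg Fin.val h; simp at this
      rw [if_pos rfl, if_neg e2]
      simp [hqm]
  · have e2 : Fin.last (m+1) ≠ ((Fin.last m).castSucc : Fin (m+2)) := by
        intro h; have := congrArg Fin.val h; simp at this
    rw [if_pos rfl, if_neg e2]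
    simp only [Fin.val_last]
    rw [hqm1]; simp

end

section

lemma lint_scale' {a : ℝ} (ha : a ≠ 0) {G : ℝ → ℝ≥0∞} (hG : Measurable G) (c : ℝ) :
    ∫⁻ s, G (a * s + c) = ENNReal.ofReal |a|⁻¹ * ∫⁻ s, G s := by
  have h := Real.map_volume_mul_left ha
  have h2 : ∫⁻ y, G (a * y + c) = ∫⁻ y, G (y + c) ∂(Measure.map (a * ·) volume) := by
    rw [lintegral_map (by fun_prop) (by fun_prop)]
  rw [h2, h, lintegral_smul_measure, lintegral_add_right_eq_self, abs_inv]
  rfl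

def hPQ {m : ℕ} (x : Fin m → ℝ) (z : Pt (m+1)) (A : Set (Pt (m+1))) (y : ℝ × ℝ) : ℝ≥0∞ :=
  ∫⁻ w : Fin m → ℝ, A.indicator 1 (z + ∑ j, w j • vv (m+1) (x j) +
    (y.1 • ev (m+1) (Fin.last m).castSucc + y.2 • ev (m+1) (Fin.last (m+1))))

lemma measurable_hPQ {m : ℕ} (x : Fin m → ℝ) (z : Pt (m+1)) {A : Set (Pt (m+1))} (hA : MeasurableSet A) :
    Measurable (hPQ x z A) := by
  unfold hPQ
  apply Measurable.lintegral_prod_right' (f := fun p : (ℝ × ℝ) × (Fin m → ℝ) => A.indicator 1 (z + ∑ j, p.2 j • vv (m+1) (x j) +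
    (p.1.1 • ev (m+1) (Fin.last m).castSucc + p.1.2 • ev (m+1) (Fin.last (m+1)))))
  exact (measurable_one.indicator hA).comp (by fun_prop)

lemma lint_hPQ {m : ℕ} (x : Fin m → ℝ) (hx : VV x ≠ 0) (z : Pt (m+1)) {A : Set (Pt (m+1))} (hA : MeasurableSet A) :
    ∫⁻ P, ∫⁻ Q, hPQ x z A (P, Q) = ENNReal.ofReal (VV x)⁻¹ * volume A := by
  set c : Fin (m+2) → Pt (m+1) := Fin.snoc (Fin.snoc (fun j => vv (m+1) (x j)) (ev (m+1) (Fin.last m).castSucc)) (ev (m+1) (Fin.last (m+1))) with hc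
  have hdet : |(Matrix.of fun k i : Fin (m+2) => toFin (m+1) (c i) k).det| = VV x := by
    rw [det_last, det_last]
    · unfold VV
      rw [← Matrix.det_transpose (Matrix.vandermonde x)]
      congr 2
      ext k i
      simp only [Matrix.submatrix_apply, Matrix.of_apply, hc, Fin.snoc_castSucc, Matrix.transpose_apply, Matrix.vandermonde_apply]
      rw [toFin_apply]
      have : ∀ k : Fin (m+2), (Fin.cons (vv (m+1) (x i)).1 (vv (m+1) (x i)).2 : Fin (m+2) → ℝ) k = x i ^ (k:ℕ) := by
        intro k
        refine Fin.cases ?_ (fun j => ?_) k <;> simp [vv, mom]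
      rw [this]; simp
    · intro i
      simp only [Matrix.submatrix_apply, Matrix.of_apply, hc, Fin.snoc_castSucc, Fin.snoc_last, toFin_ev, Pi.single_apply,
        Fin.castSucc_inj]
    · intro i
      simp only [Matrix.of_apply, hc, Fin.snoc_last, toFin_ev, Pi.single_apply]
  have h1 := MVlin z c (by intro h; rw [h] at hdet; simp at hdet; exact hx hdet.symm) hA
  rw [hdet] at h1
  rw [← h1]
  have hm : Measurable (fun w : Fin (m+2) → ℝ => z + ∑ i, w i • c i) := by fun_prop
  have hms : MeasurableSet {w : Fin (m+2) → ℝ | z + ∑ i, w i • c i ∈ A} := hm hA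
  rw [← lintegral_indicator_one hms]
  have hi : ∀ w : Fin (m+2) → ℝ, ({w : Fin (m+2) → ℝ | z + ∑ i, w i • c i ∈ A}).indicator (1 : (Fin (m+2) → ℝ) → ℝ≥0∞) w
     = A.indicator 1 (z + ∑ i, w i • c i) := fun w => rfl
  have hmi : Measurable (fun w : Fin (m+2) → ℝ => A.indicator (1 : Pt (m+1) → ℝ≥0∞) (z + ∑ i, w i • c i)) :=
    (measurable_one.indicator hA).comp hm
  have hmt : Measurable (fun p : ℝ × ℝ => hPQ x z A (p.2, p.1)) := (measurable_hPQ x z hA).comp (by fun_prop)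
  rw [lintegral_lintegral_swap (f := fun P Q => hPQ x z A (P, Q)) (measurable_hPQ x z hA).aemeasurable]
  refine Eq.trans ?_ (lintegral_congr fun w => (hi w).symm)
  rw [lintegral_fin_insertNth (Fin.last (m+1)) hmi]
  refine lintegral_congr fun Q => ?_
  rw [lintegral_fin_insertNth (Fin.last m)]
  · refine lintegral_congr fun P => ?_
    unfold hPQ
    refine lintegral_congr fun w => ?_
    congr 1
    rw [Fin.sum_univ_castSucc, Fin.sum_univ_castSucc]
    simp only [Fin.insertNth_last', hc, Fin.snoc_castSucc, Fin.snoc_last, add_assoc]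
  · refine hmi.comp (?_ : Measurable fun u : Fin (m+1) → ℝ => ((Fin.last (m+1)).insertNth Q u : Fin (m+2) → ℝ))
    have := (MeasurableEquiv.piFinSuccAbove (fun _ : Fin (m+2) => ℝ) (Fin.last (m+1))).symm.measurable
    exact this.comp (measurable_prodMk_left (x := Q))

lemma P2 {m : ℕ} {b S : ℝ} (hb : 0 < b) (hS : 0 < S) (x : Fin m → ℝ) (hx : VV x ≠ 0) (z : Pt (m+1))
    {A : Set (Pt (m+1))} (hA : MeasurableSet A) :
    ∫⁻ t', {t : ℝ | ∀ j, b ≤ |t - x j|}.indicator (fun t' =>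
      ∫⁻ w' in {w : ℝ | S ≤ |w|}, ∫⁻ w : Fin m → ℝ, A.indicator 1 (z + ∑ j, w j • vv (m+1) (x j) + w' • vv (m+1) t')) t'
      ≤ ENNReal.ofReal (b^m)⁻¹ * (ENNReal.ofReal (S * b^m)⁻¹ * (ENNReal.ofReal (VV x)⁻¹ * volume A)) := by
  have hinj : Function.Injective x := by
    intro i j hij
    by_contra hne
    apply hx
    unfold VV
    rw [abs_eq_zero, Matrix.det_vandermonde_eq_zero_iff]
    exact ⟨i, j, hij, hne⟩
  obtain ⟨σ, hσ⟩ := interp x hinj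
  set ω : ℝ → ℝ := fun t => ∏ j, (t - x j) with hω
  have hωm : Measurable ω := by rw [hω]; fun_prop
  have hin : ∀ t' w', ∫⁻ w : Fin m → ℝ, A.indicator 1 (z + ∑ j, w j • vv (m+1) (x j) + w' • vv (m+1) t') =
      hPQ x z A (ω t' * w', (t' + σ) * (ω t' * w')) := by
    intro t' w'
    obtain ⟨L, hL⟩ := hσ t'
    unfold hPQ
    conv_rhs => rw [← lintegral_add_right_eq_self _ (w' • L)]
    refine lintegral_congr fun w => ?_
    congr 1
    rw [hL]
    simp only [Pi.add_apply, add_smul, Finset.sum_add_distrib, smul_add, Finset.smul_sum, smul_smul, Pi.smul_apply, smul_eq_mul]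
    rw [hω]
    simp only []
    rw [mul_comm w' (∏ j, _), show w' * ((∏ j, (t' - x j)) * (t' + σ)) = (t' + σ) * ((∏ j, (t' - x j)) * w') by ring]
    abel
  simp only [hin]
  set G : ℝ × ℝ → ℝ≥0∞ := hPQ x z A with hG
  have hGm : Measurable G := measurable_hPQ x z hA
  have hT : MeasurableSet {w : ℝ | S * b^m ≤ |w|} := measurableSet_le (by fun_prop) (by fun_prop)
  have hSm : MeasurableSet {w : ℝ | S ≤ |w|} := measurableSet_le (by fun_prop) (by fun_prop)
  set K : ℝ → ℝ → ℝ≥0∞ := fun t P => {w : ℝ | S * b^m ≤ |w|}.indicator (fun P => G (P, (t + σ) * P)) P with hK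
  have hKm : Measurable (fun p : ℝ × ℝ => K p.1 p.2) := by
    have : (fun p : ℝ × ℝ => K p.1 p.2) = {p : ℝ × ℝ | S * b^m ≤ |p.2|}.indicator (fun p => G (p.2, (p.1 + σ) * p.2)) := by
      ext p; simp only [hK, indicator]; rfl
    rw [this]
    exact (hGm.comp (by fun_prop)).indicator (measurableSet_le (by fun_prop) (by fun_prop))
  have hKm2 : ∀ t, Measurable (K t) := fun t => hKm.comp measurable_prodMk_left
  have step1 : ∀ t', {t : ℝ | ∀ j, b ≤ |t - x j|}.indicator (fun t' =>
      ∫⁻ w' in {w : ℝ | S ≤ |w|}, G (ω t' * w', (t' + σ) * (ω t' * w'))) t' ≤ ENNReal.ofReal (b^m)⁻¹ * ∫⁻ P, K t' P := by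
    intro t'
    by_cases ht : t' ∈ {t : ℝ | ∀ j, b ≤ |t - x j|}
    · rw [indicator_of_mem ht]
      have hω1 : b^m ≤ |ω t'| := by
        rw [hω]; simp only []
        rw [Finset.abs_prod]
        calc b^m = ∏ _j : Fin m, b := by simp
          _ ≤ _ := Finset.prod_le_prod (fun _ _ => hb.le) fun j _ => ht j
      have hbm : 0 < b^m := by positivity
      have hω0 : ω t' ≠ 0 := by
        intro h; rw [h] at hω1; simp at hω1; linarith
      calc _ ≤ ∫⁻ w', K t' (ω t' * w' + 0) := by
            rw [← lintegral_indicator hSm]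
            refine lintegral_mono fun w' => ?_
            by_cases hw : w' ∈ {w : ℝ | S ≤ |w|}
            · rw [indicator_of_mem hw, hK]; simp only [add_zero]
              rw [indicator_of_mem]
              have h5 : S ≤ |w'| := hw
              show S * b^m ≤ |ω t' * w'|
              rw [abs_mul, mul_comm]; gcongr
            · rw [indicator_of_notMem hw]; exact zero_le
        _ = ENNReal.ofReal |ω t'|⁻¹ * ∫⁻ P, K t' P := lint_scale' hω0 (hKm2 t') 0
        _ ≤ _ := by gcongr
    · rw [indicator_of_notMem ht]; exact zero_le
  refine (lintegral_mono step1).trans ?_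
  rw [lintegral_const_mul _ hKm.lintegral_prod_right']
  gcongr
  rw [lintegral_lintegral_swap hKm.aemeasurable, ← lint_hPQ x hx z hA, ← lintegral_const_mul _ hGm.lintegral_prod_right']
  refine lintegral_mono fun P => ?_
  by_cases hP : P ∈ {w : ℝ | S * b^m ≤ |w|}
  · simp only [hK, indicator_of_mem hP]
    have h5 : S * b^m ≤ |P| := hP
    have h6 : 0 < S * b^m := by positivity
    have hP0 : P ≠ 0 := by intro h; rw [h] at h5; simp at h5; linarith
    have := lint_scale' hP0 (G := fun Q => G (P, Q)) (hGm.comp measurable_prodMk_left) (P * σ)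
    calc _ = ∫⁻ s, G (P, P * s + P * σ) := by congr 1; ext s; congr 2; ring
      _ = _ := this
      _ ≤ _ := by gcongr
  · simp only [hK, indicator_of_notMem hP]; simp

end

section

def vE (m : ℕ) : ℕ := ∑ i : Fin m, (Finset.Ioi i).card

lemma VV_ge {m : ℕ} {x : Fin m → ℝ} {b : ℝ} (hb : 0 < b)
    (hsep : ∀ i j, i ≠ j → b ≤ |x i - x j|) : b ^ vE m ≤ VV x := by
  rw [VV_eq, vE, ← Finset.prod_pow_eq_pow_sum]
  refine Finset.prod_le_prod (fun _ _ => by positivity) fun i _ => ?_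
  rw [← Finset.prod_const]
  exact Finset.prod_le_prod (fun _ _ => hb.le) fun j hj => hsep _ _ (Finset.mem_Ioi.1 hj).ne'

lemma measurable_nodes_right {m : ℕ} (t : ℝ) (i : Fin (m+1)) :
    Measurable (fun u : Fin m → ℝ × ℝ => nodes t u i) :=
  (measurable_nodes_apply i).comp measurable_prodMk_left

lemma measurable_endpt_right {n m : ℕ} (t : ℝ) (z : Pt n) :
    Measurable (fun u : Fin m → ℝ × ℝ => endpt n t z u) :=
    (measurable_endpt n m).comp (measurable_prodMk_left (x := ((t,z) : ℝ × Pt n)))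

lemma measurableSet_sep {m : ℕ} {b ts : ℝ} {D : Set ℝ} (hD : MeasurableSet D) (t : ℝ) :
    MeasurableSet {u : Fin m → ℝ × ℝ | SepC b ts D t u} := by
  unfold SepC
  rw [ofPred_forall]
  refine MeasurableSet.iInter fun i => ?_
  refine ms_and (measurableSet_le ((measurable_nodes_right t _).add_const b) (by fun_prop))
      (ms_and (measurableSet_le (by fun_prop) (by fun_prop)) ?_)
  exact (show Measurable (fun p : (Fin m → ℝ × ℝ) => (p i).2) by fun_prop) hD

lemma far_upper {k : ℕ} {b S : ℝ} (hb : 0 < b) (hS : 0 < S) {D : Set ℝ} (hD : MeasurableSet D)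
    {E : Set (Pt (k+2))} (hE : MeasurableSet E) (t : ℝ) (z : Pt (k+2)) :
    ∫⁻ u : Fin (k+1) → ℝ × ℝ, {u | SepC b t D t u}.indicator (fun u => ∫⁻ w' in {w : ℝ | S ≤ |w|},
      E.indicator 1 (endpt (k+2) t z u + w' • vv (k+2) (nodes t u (Fin.last (k+1))))) u ≤
    volume D ^ k * (ENNReal.ofReal (b^(k+1))⁻¹ * (ENNReal.ofReal (S * b^(k+1))⁻¹ *
      (ENNReal.ofReal (b ^ vE (k+1))⁻¹ * volume E))) := by
  have hSm : MeasurableSet {w : ℝ | S ≤ |w|} := measurableSet_le (by fun_prop) (by fun_prop)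
  have hin : Measurable (fun p : (Fin (k+1) → ℝ × ℝ) × ℝ => E.indicator (1 : Pt (k+2) → ℝ≥0∞)
      (endpt (k+2) t z p.1 + p.2 • vv (k+2) (nodes t p.1 (Fin.last (k+1))))) := by
    refine (measurable_one.indicator hE).comp ?_
    exact ((measurable_endpt_right t z).comp measurable_fst).add (measurable_snd.smul
      ((measurable_vv _).comp ((measurable_nodes_right t _).comp measurable_fst)))
  have hH : Measurable (fun u : Fin (k+1) → ℝ × ℝ => ∫⁻ w' in {w : ℝ | S ≤ |w|},
      E.indicator (1 : Pt (k+2) → ℝ≥0∞) (endpt (k+2) t z u + w' • vv (k+2) (nodes t u (Fin.last (k+1))))) :=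
    hin.lintegral_prod_right'
  have hHm := hH.indicator (measurableSet_sep (b := b) (ts := t) hD t)
  rw [lintegral_pairs hHm, lintegral_fin_insertNth' (Fin.last k)]
  swap
  · refine Measurable.lintegral_prod_right' (f := fun p : (Fin (k+1) → ℝ) × (Fin (k+1) → ℝ) =>
      {u | SepC b t D t u}.indicator (fun u => ∫⁻ w' in {w : ℝ | S ≤ |w|},
      E.indicator (1 : Pt (k+2) → ℝ≥0∞) (endpt (k+2) t z u + w' • vv (k+2) (nodes t u (Fin.last (k+1))))) (fun i => (p.2 i, p.1 i))) ?_
    exact hHm.comp (by fun_prop)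
  set C : ℝ≥0∞ := (ENNReal.ofReal (b^(k+1))⁻¹ * (ENNReal.ofReal (S * b^(k+1))⁻¹ *
      (ENNReal.ofReal (b ^ vE (k+1))⁻¹ * volume E))) with hC
  have hpiD : MeasurableSet (Set.pi univ fun _ : Fin k => D) := MeasurableSet.univ_pi fun _ => hD
  have key : ∀ τ : Fin k → ℝ, ∫⁻ t' : ℝ, ∫⁻ w : Fin (k+1) → ℝ, {u | SepC b t D t u}.indicator (fun u => ∫⁻ w' in {w : ℝ | S ≤ |w|},
      E.indicator (1 : Pt (k+2) → ℝ≥0∞) (endpt (k+2) t z u + w' • vv (k+2) (nodes t u (Fin.last (k+1))))) 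
        (fun i => (w i, ((Fin.last k).insertNth t' τ : Fin (k+1) → ℝ) i)) ≤ (Set.pi univ fun _ : Fin k => D).indicator (fun _ => C) τ := by
    intro τ
    set x : Fin (k+1) → ℝ := Fin.cons t τ with hx
    have hnc : ∀ (t' : ℝ) (w : Fin (k+1) → ℝ) (i : Fin (k+1)),
        nodes t (fun i => (w i, ((Fin.last k).insertNth t' τ : Fin (k+1) → ℝ) i)) i.castSucc = x i := by
      intro t' w i
      refine Fin.cases rfl (fun j => ?_) i
      rw [nodes, ← Fin.succ_castSucc, Fin.cons_succ, hx, Fin.cons_succ, Fin.insertNth_last', Fin.snoc_castSucc]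
    have hnl : ∀ (t' : ℝ) (w : Fin (k+1) → ℝ),
        nodes t (fun i => (w i, ((Fin.last k).insertNth t' τ : Fin (k+1) → ℝ) i)) (Fin.last (k+1)) = t' := by
      intro t' w
      rw [nodes, ← Fin.succ_last, Fin.cons_succ, Fin.insertNth_last', Fin.snoc_last]
    by_cases hgood : (∀ i, τ i ∈ D) ∧ (∀ i j, i ≠ j → b ≤ |x i - x j|)
    · rw [indicator_of_mem (by intro i _; exact hgood.1 i)]
      have hV := VV_ne_zero hb hgood.2
      have hP2 := P2 hb hS x hV z hE
      refine le_trans (lintegral_mono fun t' => ?_) (hP2.trans ?_)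
      · by_cases ht : t' ∈ {t : ℝ | ∀ j, b ≤ |t - x j|}
        · rw [indicator_of_mem ht]
          have hmm : Measurable (fun p : ℝ × (Fin (k+1) → ℝ) => E.indicator (1 : Pt (k+2) → ℝ≥0∞)
             (z + ∑ j, p.2 j • vv (k+2) (x j) + p.1 • vv (k+2) t')) :=
            (measurable_one.indicator hE).comp (by fun_prop)
          rw [lintegral_lintegral_swap (f := fun w' (w : Fin (k+1) → ℝ) => E.indicator (1 : Pt (k+2) → ℝ≥0∞)
             (z + ∑ j, w j • vv (k+2) (x j) + w' • vv (k+2) t')) hmm.aemeasurable]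
          refine lintegral_mono fun w => ?_
          refine (indicator_le_self _ _ _).trans ?_
          rw [hnl]
          simp only [endpt, hnc]
          exact le_rfl
        · rw [indicator_of_notMem ht]
          refine le_of_eq ?_
          rw [lintegral_eq_zero_iff' ]
          · refine Eventually.of_forall fun w => ?_
            apply indicator_of_notMem
            intro hs
            apply ht
            intro j
            have := nodes_sep hb hs (i := Fin.last (k+1)) (j := j.castSucc) (Fin.castSucc_lt_last j).ne'
            rwa [hnl, hnc] at this
          · exact (hHm.comp (by fun_prop : Measurable fun w : Fin (k+1) → ℝ => fun i => (w i, ((Fin.last k).insertNth t' τ : Fin (k+1) → ℝ) i))).aemeasurable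
      · rw [hC]
        gcongr
        exact VV_ge hb hgood.2
    · refine le_trans (le_of_eq ?_) zero_le
      have : ∀ (t' : ℝ) (w : Fin (k+1) → ℝ), (fun i => (w i, ((Fin.last k).insertNth t' τ : Fin (k+1) → ℝ) i)) ∉ {u | SepC b t D t u} := by
        intro t' w hs
        apply hgood
        constructor
        · intro i
          have := (hs i.castSucc).2.2
          simpa only [Fin.insertNth_last', Fin.snoc_castSucc] using this
        · intro i j hij
          have := nodes_sep hb hs (i := i.castSucc) (j := j.castSucc) (by simpa using hij)
          rwa [hnc, hnc] at this
      simp only [indicator_of_notMem (this _ _)]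
      simp
  refine (lintegral_mono key).trans (le_of_eq ?_)
  rw [lintegral_indicator_const hpiD, volume_pi, Measure.pi_pi, Finset.prod_const, Finset.card_univ, Fintype.card_fin, mul_comm]

end

section

def near (n : ℕ) (S : ℝ) (E : Set (Pt n)) (x : ℝ × Pt n) : ℝ≥0∞ :=
  ∫⁻ w in {w : ℝ | |w| ≤ S}, E.indicator 1 (x.2 + w • vv n x.1)

lemma measurable_line {n : ℕ} {E : Set (Pt n)} (hE : MeasurableSet E) :
    Measurable (fun p : (ℝ × Pt n) × ℝ => E.indicator (1 : Pt n → ℝ≥0∞) (p.1.2 + p.2 • vv n p.1.1)) := by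
  refine (measurable_one.indicator hE).comp ?_
  exact Measurable.add (by fun_prop) (measurable_snd.smul ((measurable_vv _).comp (by fun_prop)))

lemma measurable_near {n : ℕ} {S : ℝ} {E : Set (Pt n)} (hE : MeasurableSet E) :
    Measurable (near n S E) := by
  unfold near
  exact (measurable_line hE).lintegral_prod_right'

lemma near_lemma {k : ℕ} {c C : ℝ} (hc : 0 < c) (hC : 0 < C) :
    ∃ S : ℝ, 0 < S ∧ ∀ (E F : Set (Pt (k+2))) (D : Set ℝ), MeasurableSet E → MeasurableSet F → MeasurableSet D →
      volume E ≤ 1 → (∀ x ∈ F, 1 ≤ XI (k+2) E x) → F ⊆ Prod.fst ⁻¹' D → volume D ≤ ENNReal.ofReal C →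
      volume F ≤ ENNReal.ofReal C → ENNReal.ofReal c ≤ volume F →
      ENNReal.ofReal (c/2) ≤ volume {x | x ∈ inc (k+2) E F ∧ 1/2 ≤ near (k+2) S E x} := by
  set m : ℝ := ((k+1 : ℕ) : ℝ) with hm
  have hm0 : 0 < m := by rw [hm]; positivity
  set a : ℝ := c / (16*m*C) with ha'
  set b : ℝ := c / (64 * m) with hb'
  have ha : 0 < a := by positivity
  have hb : 0 < b := by positivity
  set S : ℝ := 4 * C^k / (b^(k+1) * b^(k+1) * b^(vE (k+1)) * (a*b)^(k+1)) with hS'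
  have hS : 0 < S := by positivity
  refine ⟨S, hS, fun E F D hE hF hD hE1 hX hFD hDC hFC hcF => ?_⟩
  by_contra hlt
  rw [not_le] at hlt
  set I := inc (k+2) E F with hI
  have hIm : MeasurableSet I := measurableSet_inc hE hF
  set good : Set (ℝ × Pt (k+2)) := {x | x ∈ I ∧ 1/2 ≤ near (k+2) S E x} with hgood
  set bad : Set (ℝ × Pt (k+2)) := {x | x ∈ I ∧ near (k+2) S E x < 1/2} with hbad
  have hbm : MeasurableSet bad := ms_and hIm (measurableSet_lt (measurable_near hE) measurable_const)
  have hIc : ENNReal.ofReal c ≤ volume I := by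
    rw [hI, vol_inc hE hF]
    refine hcF.trans ?_
    rw [← setLIntegral_one]
    exact setLIntegral_mono' hF hX
  have hb2 : ENNReal.ofReal (c/2) ≤ volume bad := by
    have h1 : volume I ≤ volume good + volume bad := by
      refine (measure_mono ?_).trans (measure_union_le _ _)
      intro x hx
      by_cases h : 1/2 ≤ near (k+2) S E x
      · exact Or.inl ⟨hx, h⟩
      · exact Or.inr ⟨hx, not_le.1 h⟩
    by_contra hcon
    rw [not_le] at hcon
    have h2 := hIc.trans h1
    have h3 : volume good + volume bad < ENNReal.ofReal (c/2) + ENNReal.ofReal (c/2) := ENNReal.add_lt_add hlt hcon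
    rw [← ENNReal.ofReal_add (by positivity) (by positivity), add_halves] at h3
    exact absurd h3 (not_lt.2 h2)
  have hpr := vol_prnIt (a := a) hb hbm hE hF (fun x hx => hx.1.1) (fun x hx => hx.1.2) (2*(k+1))
  have hne : ((prn (k+2) a b)^[2*(k+1)] bad).Nonempty := by
    by_contra hemp
    rw [not_nonempty_iff_eq_empty] at hemp
    rw [hemp, measure_empty, zero_add] at hpr
    have h1 : ((2*(k+1) : ℕ) : ℝ≥0∞) * (ENNReal.ofReal a * volume F + ENNReal.ofReal (4*b) * volume E) ≤ ENNReal.ofReal (c/4) := by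
      have e : ((2*(k+1) : ℕ) : ℝ≥0∞) = ENNReal.ofReal (2*m) := by
        rw [hm, ← ENNReal.ofReal_natCast]; push_cast; rfl
      calc _ ≤ ENNReal.ofReal (2*m) * (ENNReal.ofReal a * ENNReal.ofReal C + ENNReal.ofReal (4*b) * 1) := by
            rw [e]; gcongr
        _ = ENNReal.ofReal (2*m*(a*C+4*b)) := by
            rw [mul_one, ← ENNReal.ofReal_mul ha.le, ← ENNReal.ofReal_add (by positivity) (by positivity), ← ENNReal.ofReal_mul (by positivity)]
        _ = _ := by congr 1; rw [ha', hb']; field_simp; ring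
    have h2 := (hb2.trans hpr).trans h1
    rw [ENNReal.ofReal_le_ofReal_iff (by positivity)] at h2
    linarith
  obtain ⟨⟨t, z⟩, htz⟩ := hne
  have hID : ∀ x ∈ bad, x.1 ∈ D := fun x hx => hFD hx.1.2
  have hlow := chain_lower (ts := t) hb hD hbm hID (k+1) t z htz
  have hup := far_upper hb hS hD hE t z
  set cs := chainSet (k+2) (k+1) b t D bad t z with hcs
  have hcsm : MeasurableSet cs :=
    measurable_prodMk_left (x := ((t, z) : ℝ × Pt (k+2))) (measurableSet_chain hD hbm)
  have hmid : (1/2 : ℝ≥0∞) * volume cs ≤ ∫⁻ u : Fin (k+1) → ℝ × ℝ, {u | SepC b t D t u}.indicator (fun u => ∫⁻ w' in {w : ℝ | S ≤ |w|},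
      E.indicator 1 (endpt (k+2) t z u + w' • vv (k+2) (nodes t u (Fin.last (k+1))))) u := by
    rw [← lintegral_indicator_const hcsm]
    refine lintegral_mono fun u => ?_
    by_cases hu : u ∈ cs
    · rw [indicator_of_mem hu, indicator_of_mem (by exact hu.1)]
      set y : ℝ × Pt (k+2) := (nodes t u (Fin.last (k+1)), endpt (k+2) t z u) with hy
      have hyb : y ∈ bad := hu.2
      have h1 := hX _ hyb.1.2
      have hli : Measurable (fun w : ℝ => E.indicator (1 : Pt (k+2) → ℝ≥0∞) (y.2 + w • vv (k+2) y.1)) :=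
        (measurable_line hE).comp (measurable_prodMk_left (x := y))
      have hSm : MeasurableSet {w : ℝ | S ≤ |w|} := measurableSet_le (by fun_prop) (by fun_prop)
      have hSm' : MeasurableSet {w : ℝ | |w| ≤ S} := measurableSet_le (by fun_prop) (by fun_prop)
      unfold XI at h1
      rw [XE_pr] at h1
      have h2 : ∫⁻ w : ℝ, E.indicator (1 : Pt (k+2) → ℝ≥0∞) (y.2 + w • vv (k+2) y.1) ≤ near (k+2) S E y +
          ∫⁻ w' in {w : ℝ | S ≤ |w|}, E.indicator 1 (y.2 + w' • vv (k+2) y.1) := by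
        unfold near
        refine le_trans ?_ (lintegral_union_le _ _ _)
        rw [show {w : ℝ | |w| ≤ S} ∪ {w : ℝ | S ≤ |w|} = univ from ?_, Measure.restrict_univ]
        ext w; simp [le_total]
      have h3 := h1.trans h2
      by_contra hcon
      rw [not_le] at hcon
      have h4 := ENNReal.add_lt_add hyb.2 hcon
      rw [show (1/2:ℝ≥0∞) + 1/2 = 1 by rw [one_div, ENNReal.inv_two_add_inv_two]] at h4
      exact absurd h4 (not_lt.2 h3)
    · rw [indicator_of_notMem hu]; exact zero_le
  have hfin : (1/2 : ℝ≥0∞) * (ENNReal.ofReal a * ENNReal.ofReal b)^(k+1) ≤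
     ENNReal.ofReal C ^ k * (ENNReal.ofReal (b^(k+1))⁻¹ * (ENNReal.ofReal (S * b^(k+1))⁻¹ *
      (ENNReal.ofReal (b ^ vE (k+1))⁻¹ * 1))) := by
    refine le_trans (by gcongr) (hmid.trans (hup.trans ?_))
    gcongr
  rw [show (1/2 : ℝ≥0∞) = ENNReal.ofReal (1/2) by rw [ENNReal.ofReal_div_of_pos (by norm_num)]; simp, mul_one,
    ← ENNReal.ofReal_mul ha.le, ← ENNReal.ofReal_pow (by positivity), ← ENNReal.ofReal_mul (by positivity),
    ← ENNReal.ofReal_mul (by positivity), ← ENNReal.ofReal_mul (by positivity), ← ENNReal.ofReal_pow (by positivity), ← ENNReal.ofReal_mul (by positivity),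
    ENNReal.ofReal_le_ofReal_iff (by positivity)] at hfin
  have e : C ^ k * ((b^(k+1))⁻¹ * ((S * b^(k+1))⁻¹ * (b ^ vE (k+1))⁻¹)) = 1/4 * (a*b)^(k+1) := by
    clear_value a b
    rw [hS']
    field_simp
  rw [e] at hfin
  have : 0 < (a*b)^(k+1) := by positivity
  linarith

end

section

lemma slab3 {α : Type*} [MeasurableSpace α] (μ : Measure α) {fl : α → ℤ} (hfl : Measurable fl) {A : Set α}
    (hA : MeasurableSet A) : ∑' k : ℤ, μ (A ∩ {x | k - 1 ≤ fl x ∧ fl x ≤ k + 1}) ≤ 3 * μ A := by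
  set ν : ℤ → ℝ≥0∞ := fun k => μ (A ∩ fl ⁻¹' {k}) with hν
  have h0 : ∑' k, ν k ≤ μ A := by
    rw [hν, ← measure_iUnion]
    · exact measure_mono (iUnion_subset fun k => inter_subset_left)
    · intro i j hij
      refine Set.disjoint_left.2 fun x hx hx' => hij ?_
      rw [← hx.2, ← hx'.2]
    · intro k; exact hA.inter (hfl (measurableSet_singleton k))
  have h1 : ∀ k : ℤ, μ (A ∩ {x | k - 1 ≤ fl x ∧ fl x ≤ k + 1}) ≤ ν (k-1) + ν k + ν (k+1) := by
    intro k
    refine (measure_mono ?_).trans ((measure_union_le _ _).trans (add_le_add (measure_union_le _ _) le_rfl))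
    rintro x ⟨hx, h2, h3⟩
    have : fl x = k-1 ∨ fl x = k ∨ fl x = k+1 := by omega
    rcases this with h | h | h
    · exact Or.inl (Or.inl ⟨hx, h⟩)
    · exact Or.inl (Or.inr ⟨hx, h⟩)
    · exact Or.inr ⟨hx, h⟩
  refine (ENNReal.tsum_le_tsum h1).trans ?_
  rw [ENNReal.tsum_add, ENNReal.tsum_add]
  have e1 : ∑' k, ν (k-1) = ∑' k, ν k := (Equiv.subRight (1:ℤ)).tsum_eq ν
  have e2 : ∑' k, ν (k+1) = ∑' k, ν k := (Equiv.addRight (1:ℤ)).tsum_eq ν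
  rw [e1, e2]
  calc _ = 3 * ∑' k, ν k := by ring
    _ ≤ _ := by gcongr

lemma slab_lemma {k : ℕ} {c C : ℝ} (hc : 0 < c) (hC : 0 < C) :
    ∃ S c' : ℝ, 0 < S ∧ 0 < c' ∧ ∀ (E F : Set (Pt (k+2))) (D : Set ℝ), MeasurableSet E → MeasurableSet F → MeasurableSet D →
      volume E ≤ 1 → (∀ x ∈ F, 1 ≤ XI (k+2) E x ∧ XI (k+2) E x ≤ 2) → F ⊆ Prod.fst ⁻¹' D → volume D ≤ ENNReal.ofReal C →
      volume F ≤ ENNReal.ofReal C → ENNReal.ofReal c ≤ volume F →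
      ∃ E' F' : Set (Pt (k+2)), MeasurableSet E' ∧ MeasurableSet F' ∧ E' ⊆ E ∧ F' ⊆ F ∧
        (∀ z ∈ E', ∀ z' ∈ E', |z.1 - z'.1| ≤ 3 * S) ∧ 0 < volume (inc (k+2) E' F') ∧
        ENNReal.ofReal c' * volume E' ≤ volume (inc (k+2) E' F') ∧
        ENNReal.ofReal c' * volume F' ≤ volume (inc (k+2) E' F') := by
  obtain ⟨S, hS, hnear⟩ := near_lemma (k := k) hc hC
  generalize hn : k + 2 = n at *
  set c' : ℝ := c/(48*C) with hc'
  have hc'0 : 0 < c' := by positivity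
  refine ⟨S, min c' (c/96), hS, by positivity, fun E F D hE hF hD hE1 hX hFD hDC hFC hcF => ?_⟩
  have hgood := hnear E F D hE hF hD hE1 (fun x hx => (hX x hx).1) hFD hDC hFC hcF
  set fl : Pt n → ℤ := fun z => ⌊z.1 / S⌋ with hfl
  have hflm : Measurable fl := by
    rw [hfl]; exact Int.measurable_floor.comp (by fun_prop)
  set I := inc n E F with hI
  have hIm : MeasurableSet I := measurableSet_inc hE hF
  set Ek : ℤ → Set (Pt n) := fun j => E ∩ {x | j - 1 ≤ fl x ∧ fl x ≤ j + 1} with hEk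
  have hEkm : ∀ j, MeasurableSet (Ek j) := fun j => hE.inter (ms_and (measurableSet_le measurable_const hflm)
    (measurableSet_le hflm measurable_const))
  set Fk : ℤ → Set (Pt n) := fun j => F ∩ {x | ENNReal.ofReal c' ≤ XI n (Ek j) x} with hFk
  have hFkm : ∀ j, MeasurableSet (Fk j) := fun j => hF.inter (measurableSet_le measurable_const (measurable_XI (hEkm j)))
  have hIk : ∀ j, inc n (Ek j) F = I ∩ {x | j - 1 ≤ fl x.2 ∧ fl x.2 ≤ j + 1} := by
    intro j; ext x; simp only [inc, hI, hEk, mem_ofPred_eq, mem_inter_iff]; tauto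
  have hI2 : volume I ≤ 2 * ENNReal.ofReal C := by
    rw [hI, vol_inc hE hF]
    calc _ ≤ ∫⁻ x in F, 2 := setLIntegral_mono' hF fun x hx => (hX x hx).2
      _ = 2 * volume F := by rw [setLIntegral_const]
      _ ≤ _ := by gcongr
  -- pointwise
  have hpt : ∀ j, ∀ x ∈ I ∩ (fun x : ℝ × Pt n => fl x.2) ⁻¹' {j}, near n S E x ≤
      (inc n (Ek j) F).indicator (fun _ => ENNReal.ofReal c') x + (inc n (Ek j) (Fk j)).indicator (fun _ => 2) x := by
    rintro j x ⟨hx, hxj⟩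
    have hxj : fl x.2 = j := hxj
    have hxE : x.2 ∈ Ek j := ⟨hx.1, by simp only [mem_ofPred_eq, hxj]; omega⟩
    rw [indicator_of_mem (show x ∈ inc n (Ek j) F from ⟨hxE, hx.2⟩)]
    have h1 : near n S E x ≤ XI n (Ek j) (x.1, pr n x.1 x.2) := by
      unfold XI near
      rw [XE_pr, ← lintegral_indicator (measurableSet_le (by fun_prop) (by fun_prop))]
      refine lintegral_mono fun w => ?_
      by_cases hw : w ∈ {w : ℝ | |w| ≤ S}
      · rw [indicator_of_mem hw]
        by_cases hz : x.2 + w • vv n x.1 ∈ E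
        · rw [indicator_of_mem hz, indicator_of_mem]
          refine ⟨hz, ?_⟩
          have hw' := abs_le.1 (show |w| ≤ S from hw)
          have e : fl (x.2 + w • vv n x.1) = ⌊x.2.1/S + w/S⌋ := by
            simp only [hfl, vv]; congr 1; simp; ring
          have h5 : -1 ≤ w/S := by rw [le_div_iff₀ hS]; linarith
          have h6 : w/S ≤ 1 := by rw [div_le_one hS]; linarith
          rw [← hxj]
          simp only [mem_ofPred_eq, e]
          constructor
          · rw [hfl, ← Int.floor_sub_one]; exact Int.floor_mono (by linarith)
          · rw [hfl, ← Int.floor_add_one]; exact Int.floor_mono (by linarith)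
        · rw [indicator_of_notMem hz]; exact zero_le
      · rw [indicator_of_notMem hw]; exact zero_le
    by_cases h2 : ENNReal.ofReal c' ≤ XI n (Ek j) (x.1, pr n x.1 x.2)
    · rw [indicator_of_mem (show x ∈ inc n (Ek j) (Fk j) from ⟨hxE, hx.2, h2⟩)]
      refine h1.trans (le_trans ?_ le_add_self)
      refine le_trans ?_ (hX _ hx.2).2
      exact XE_mono (fun z => indicator_le_indicator_of_subset inter_subset_left (fun _ => zero_le) z) _
    · exact (h1.trans (not_le.1 h2).le).trans le_self_add
  have hintk : ∀ j, ∫⁻ x in I ∩ (fun x : ℝ × Pt n => fl x.2) ⁻¹' {j}, near n S E x ≤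
      ENNReal.ofReal c' * volume (inc n (Ek j) F) + 2 * volume (inc n (Ek j) (Fk j)) := by
    intro j
    have hm1 := measurableSet_inc (hEkm j) hF
    have hm2 := measurableSet_inc (hEkm j) (hFkm j)
    have hm0 : MeasurableSet (I ∩ (fun x : ℝ × Pt n => fl x.2) ⁻¹' {j}) :=
      hIm.inter ((hflm.comp measurable_snd) (measurableSet_singleton j))
    refine (setLIntegral_mono' hm0 (hpt j)).trans ((setLIntegral_le_lintegral _ _).trans (le_of_eq ?_))
    rw [lintegral_add_left (measurable_const.indicator hm1), lintegral_indicator_const hm1, lintegral_indicator_const hm2]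
  have hex : ∃ j, ENNReal.ofReal (c/96) * volume (Ek j) < volume (inc n (Ek j) (Fk j)) := by
    by_contra hno
    push Not at hno
    have h1 : ENNReal.ofReal (c/4) ≤ ∫⁻ x in I, near n S E x := by
      have h2 : MeasurableSet {x | x ∈ I ∧ 1/2 ≤ near n S E x} := ms_and hIm (measurableSet_le measurable_const (measurable_near hE))
      calc ENNReal.ofReal (c/4) = (1/2) * ENNReal.ofReal (c/2) := by
            rw [show (1/2 : ℝ≥0∞) = ENNReal.ofReal (1/2) by rw [ENNReal.ofReal_div_of_pos (by norm_num)]; simp, ← ENNReal.ofReal_mul (by norm_num)]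
            congr 1; ring
        _ ≤ (1/2) * volume {x | x ∈ I ∧ 1/2 ≤ near n S E x} := by gcongr
        _ = ∫⁻ x in {x | x ∈ I ∧ 1/2 ≤ near n S E x}, 1/2 := by rw [setLIntegral_const]
        _ ≤ ∫⁻ x in {x | x ∈ I ∧ 1/2 ≤ near n S E x}, near n S E x := setLIntegral_mono' h2 fun x hx => hx.2
        _ ≤ _ := lintegral_mono_set fun x hx => hx.1
    have h2 : ∫⁻ x in I, near n S E x ≤ ∑' j : ℤ, ∫⁻ x in I ∩ (fun x : ℝ × Pt n => fl x.2) ⁻¹' {j}, near n S E x := by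
      refine le_trans (lintegral_mono_set ?_) (lintegral_iUnion_le _ _)
      intro x hx
      exact mem_iUnion.2 ⟨fl x.2, hx, rfl⟩
    have h3 : ∑' j : ℤ, ∫⁻ x in I ∩ (fun x : ℝ × Pt n => fl x.2) ⁻¹' {j}, near n S E x ≤
        ENNReal.ofReal c' * (3 * volume I) + 2 * (ENNReal.ofReal (c/96) * (3 * volume E)) := by
      calc _ ≤ ∑' j, (ENNReal.ofReal c' * volume (inc n (Ek j) F) + 2 * (ENNReal.ofReal (c/96) * volume (Ek j))) :=
            ENNReal.tsum_le_tsum fun j => (hintk j).trans (by gcongr; exact hno j)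
        _ = ENNReal.ofReal c' * ∑' j, volume (inc n (Ek j) F) + 2 * (ENNReal.ofReal (c/96) * ∑' j, volume (Ek j)) := by
            rw [ENNReal.tsum_add, ENNReal.tsum_mul_left, ENNReal.tsum_mul_left, ENNReal.tsum_mul_left]
        _ ≤ _ := by
            gcongr
            · simp_rw [hIk]
              exact slab3 volume (fl := fun x : ℝ × Pt n => fl x.2) (hflm.comp measurable_snd) hIm
            · exact slab3 volume hflm hE
    have h4 : ENNReal.ofReal (c/4) ≤ ENNReal.ofReal c' * (3 * (2 * ENNReal.ofReal C)) + 2 * (ENNReal.ofReal (c/96) * (3 * 1)) := by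
      refine (h1.trans (h2.trans h3)).trans ?_
      gcongr
    rw [show (3 : ℝ≥0∞) = ENNReal.ofReal 3 by simp, show (2 : ℝ≥0∞) = ENNReal.ofReal 2 by simp, mul_one,
      ← ENNReal.ofReal_mul (by positivity), ← ENNReal.ofReal_mul (by positivity), ← ENNReal.ofReal_mul (by positivity),
      ← ENNReal.ofReal_mul (by positivity), ← ENNReal.ofReal_mul (by positivity), ← ENNReal.ofReal_add (by positivity) (by positivity),
      ENNReal.ofReal_le_ofReal_iff (by positivity)] at h4
    have e : c' * (3 * (2 * C)) = c/8 := by rw [hc']; field_simp; norm_num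
    rw [e] at h4
    linarith
  obtain ⟨j, hj⟩ := hex
  refine ⟨Ek j, Fk j, hEkm j, hFkm j, inter_subset_left, inter_subset_left, ?_, lt_of_le_of_lt zero_le hj, ?_, ?_⟩
  · rintro z ⟨_, hz1, hz2⟩ z' ⟨_, hz'1, hz'2⟩
    have key : ∀ z z' : Pt n, (j - 1 ≤ fl z) → (fl z' ≤ j + 1) → z'.1 - z.1 ≤ 3 * S := by
      intro z z' h1 h2
      have h3 : ((j:ℝ) - 1) ≤ z.1/S := by
        have := Int.le_floor.1 h1; push_cast at this; exact this
      have h4 : z'.1/S < j + 2 := by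
        have h5 : fl z' < j + 2 := by omega
        have := Int.floor_lt.1 h5; push_cast at this; exact this
      rw [le_div_iff₀ hS] at h3
      rw [div_lt_iff₀ hS] at h4
      linarith
    rw [abs_le]
    constructor
    · have := key z z' hz1 hz'2; linarith
    · exact key z' z hz'1 hz2
  · exact le_trans (by gcongr; exact min_le_right _ _) hj.le
  · rw [vol_inc (hEkm j) (hFkm j)]
    calc _ ≤ ENNReal.ofReal c' * volume (Fk j) := by gcongr; exact min_le_left _ _
      _ = ∫⁻ x in Fk j, ENNReal.ofReal c' := by rw [setLIntegral_const]
      _ ≤ _ := setLIntegral_mono' (hFkm j) fun x hx => hx.2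

end

section

def chainB (n : ℕ) (m : ℕ) (b ts : ℝ) (D : Set ℝ) (I : Set (ℝ × Pt n)) (B : ℝ) (t : ℝ) (z : Pt n) :
    Set (Fin m → ℝ × ℝ) :=
  {u | u ∈ chainSet n m b ts D I t z ∧ ∀ i, |(u i).1| ≤ B}

lemma measurableSet_chainB {n m : ℕ} {b ts : ℝ} {D : Set ℝ} (hD : MeasurableSet D)
    {I : Set (ℝ × Pt n)} (hI : MeasurableSet I) {B : ℝ} :
    MeasurableSet {p : (ℝ × Pt n) × (Fin m → ℝ × ℝ) | p.2 ∈ chainB n m b ts D I B p.1.1 p.1.2} := by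
  refine ms_and (measurableSet_chain hD hI) ?_
  rw [ofPred_forall]
  exact MeasurableSet.iInter fun i => measurableSet_le (by fun_prop) (by fun_prop)

lemma mem_chainB_cons {n m : ℕ} {b ts : ℝ} {D : Set ℝ} {I : Set (ℝ × Pt n)} {B : ℝ} {t : ℝ} {z : Pt n}
    {p : ℝ × ℝ} {u : Fin m → ℝ × ℝ} :
    (Fin.cons p u : Fin (m+1) → ℝ × ℝ) ∈ chainB n (m+1) b ts D I B t z ↔
      (t + b ≤ p.2 ∧ b ≤ |p.2 - ts| ∧ p.2 ∈ D) ∧ |p.1| ≤ B ∧ u ∈ chainB n m b ts D I B p.2 (z + p.1 • vv n t) := by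
  unfold chainB
  simp only [mem_ofPred_eq, mem_chain_cons, Fin.forall_fin_succ, Fin.cons_zero, Fin.cons_succ]
  tauto

lemma chain_lowerB {n : ℕ} {a b ts B : ℝ} (hb : 0 < b) {D : Set ℝ} (hD : MeasurableSet D)
    {I : Set (ℝ × Pt n)} (hI : MeasurableSet I) (hID : ∀ x ∈ I, x.1 ∈ D)
    (hIB : ∀ x ∈ I, ∀ x' ∈ I, |x.2.1 - x'.2.1| ≤ B) (m : ℕ) :
    ∀ t z, (t, z) ∈ (prn n a b)^[2*m] I →
      (ENNReal.ofReal a * ENNReal.ofReal b) ^ m ≤ volume (chainB n m b ts D I B t z) := by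
  induction m with
  | zero =>
    intro t z h
    simp only [mul_zero, Function.iterate_zero, id] at h
    have : chainB n 0 b ts D I B t z = univ := by
      ext u; simp [chainB, chainSet, SepC, nodes, endpt, h]
    rw [this, volume_pi, Measure.pi_of_empty]
    simp
  | succ m ih =>
    intro t z h
    rw [show 2*(m+1) = (2*m+1)+1 by ring, Function.iterate_succ_apply', Function.iterate_succ_apply'] at h
    set K := (prn n a b)^[2*m] I with hK
    have hKm : MeasurableSet K := measurableSet_prnIt hI _
    set J := prn n a b K with hJ
    have hJm : MeasurableSet J := measurableSet_prn hKm
    have hS : MeasurableSet (chainB n (m+1) b ts D I B t z) :=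
      measurable_prodMk_left (x := ((t, z) : ℝ × Pt n)) (measurableSet_chainB hD hI)
    rw [← lintegral_indicator_one hS, lintegral_fin_succ (measurable_one.indicator hS)]
    -- lower bound
    set P : Set (ℝ × ℝ) := {p | (t, z + p.1 • vv n t) ∈ J ∧
      (t + b ≤ p.2 ∧ b ≤ |p.2 - ts| ∧ (p.2, z + p.1 • vv n t) ∈ K)} with hP
    have hPm : MeasurableSet P := by
      refine ms_and ((show Measurable (fun p : ℝ × ℝ => (t, z + p.1 • vv n t)) by fun_prop) hJm) ?_
      refine ms_and (measurableSet_le (by fun_prop) (by fun_prop))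
       (ms_and (measurableSet_le (by fun_prop) (by fun_prop)) ?_)
      exact (show Measurable (fun p : ℝ × ℝ => (p.2, z + p.1 • vv n t)) by fun_prop) hKm
    have hpB : ∀ {p : ℝ × ℝ}, p ∈ P → |p.1| ≤ B := by
      intro p hp
      have h1 : (t, z + p.1 • vv n t) ∈ I := prnIt_subset _ (prn_subset hp.1)
      have h2 : (t, z) ∈ I := prnIt_subset _ (prn_subset (prn_subset h))
      have := hIB _ h1 _ h2
      simpa [vv] using this
    have h1 : ∀ p : ℝ × ℝ, P.indicator (fun _ => (ENNReal.ofReal a * ENNReal.ofReal b)^m) p ≤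
        ∫⁻ u : Fin m → ℝ × ℝ, (chainB n (m+1) b ts D I B t z).indicator 1 (Fin.cons p u : Fin (m+1) → ℝ × ℝ) := by
      intro p
      by_cases hp : p ∈ P
      · rw [indicator_of_mem hp]
        refine (ih p.2 _ hp.2.2.2).trans ?_
        have hm1 : MeasurableSet (chainB n m b ts D I B p.2 (z + p.1 • vv n t)) :=
          measurable_prodMk_left (x := ((p.2, z + p.1 • vv n t) : ℝ × Pt n)) (measurableSet_chainB hD hI)
        rw [← lintegral_indicator_one hm1]
        refine lintegral_mono fun u => ?_
        by_cases hu : u ∈ chainB n m b ts D I B p.2 (z + p.1 • vv n t)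
        · rw [indicator_of_mem hu, indicator_of_mem (mem_chainB_cons.2 ⟨⟨hp.2.1, hp.2.2.1, hID _ (prnIt_subset _ hp.2.2.2)⟩, hpB hp, hu⟩)]
          exact le_rfl
        · rw [indicator_of_notMem hu]; exact zero_le
      · rw [indicator_of_notMem hp]; exact zero_le
    refine le_trans ?_ (lintegral_mono h1)
    rw [lintegral_indicator_const hPm, pow_succ]
    gcongr
    rw [Measure.volume_eq_prod, Measure.prod_apply hPm]
    have hW : MeasurableSet {w : ℝ | (t, z + w • vv n t) ∈ J} :=
      (show Measurable (fun w : ℝ => (t, z + w • vv n t)) by fun_prop) hJm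
    have h2 : ∀ w : ℝ, {w : ℝ | (t, z + w • vv n t) ∈ J}.indicator (fun _ => ENNReal.ofReal b) w ≤
        volume (Prod.mk w ⁻¹' P) := by
      intro w
      by_cases hw : w ∈ {w : ℝ | (t, z + w • vv n t) ∈ J}
      · rw [indicator_of_mem hw]
        have h3 := hw.2.2
        unfold fT at h3
        simp only at h3
        have hsub : {t' | t + b ≤ t' ∧ (t', z + w • vv n t) ∈ K} ⊆ Ioo (ts - b) (ts + b) ∪ (Prod.mk w ⁻¹' P) := by
          rintro t' ⟨h4, h5⟩
          by_cases h6 : b ≤ |t' - ts|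
          · right; exact ⟨hw, h4, h6, h5⟩
          · left; rw [not_le, abs_lt] at h6; constructor <;> linarith
        have h4 := h3.trans ((measure_mono hsub).trans (measure_union_le _ _))
        rw [Real.volume_Ioo, show ts + b - (ts - b) = 2*b by ring, show 3*b = 2*b+b by ring,
          ENNReal.ofReal_add (by linarith) hb.le] at h4
        exact (ENNReal.add_le_add_iff_left ENNReal.ofReal_ne_top).1 h4
      · rw [indicator_of_notMem hw]; exact zero_le
    refine le_trans ?_ (lintegral_mono h2)
    rw [lintegral_indicator_const hW, mul_comm]
    gcongr
    exact h.2.1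

end

section

lemma VV_ge' {m : ℕ} {x : Fin m → ℝ} {b : ℝ} (hb : 0 < b)
    (hsep : ∀ i j, i ≠ j → b ≤ |x i - x j|) {i₀ j₀ : Fin m} (h0 : i₀ < j₀) :
    |x j₀ - x i₀| * b ^ ((Finset.univ.sigma fun i : Fin m => Finset.Ioi i).card - 1) ≤ VV x := by
  rw [VV_eq, Finset.prod_sigma']
  have hmem : (⟨i₀, j₀⟩ : (_ : Fin m) × Fin m) ∈ Finset.univ.sigma fun i : Fin m => Finset.Ioi i := by simp [h0]
  rw [← Finset.mul_prod_erase _ _ hmem, ← Finset.card_erase_of_mem hmem, ← Finset.prod_const]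
  refine mul_le_mul_of_nonneg_left ?_ (abs_nonneg _)
  refine Finset.prod_le_prod (fun _ _ => hb.le) fun p hp => hsep _ _ ?_
  have := (Finset.mem_sigma.1 (Finset.mem_of_mem_erase hp)).2
  exact (Finset.mem_Ioi.1 this).ne'

lemma norm_vv_le {n : ℕ} {τ R : ℝ} (hR : 0 ≤ R) (h : |τ| ≤ R) : ‖vv n τ‖ ≤ (1+R)^n := by
  have h1 : (1:ℝ) ≤ (1+R)^n := one_le_pow₀ (by linarith)
  unfold vv
  rw [Prod.norm_def]
  refine max_le (by simpa using h1) ?_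
  rw [pi_norm_le_iff_of_nonneg (by linarith)]
  intro i
  simp only [mom, norm_pow, Real.norm_eq_abs]
  calc |τ|^(i.1+1) ≤ (1+R)^(i.1+1) := by gcongr; linarith
    _ ≤ _ := pow_le_pow_right₀ (by linarith) (by omega)

def shf (n : ℕ) (t₁ : ℝ) (z : Pt n) : Pt n := (z.1, (GM n t₁).mulVec z.2 + z.1 • mom n t₁)

lemma shf_sum {n m : ℕ} (t₁ : ℝ) (w : Fin m → ℝ) (x : Fin m → ℝ) :
    shf n t₁ (∑ i, w i • vv n (x i - t₁)) = ∑ i, w i • vv n (x i) := by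
  have hlin : shf n t₁ (∑ i, w i • vv n (x i - t₁)) = ∑ i, w i • shf n t₁ (vv n (x i - t₁)) := by
    unfold shf
    ext1
    · simp [Prod.fst_sum]
    · simp only [Prod.snd_sum, Prod.fst_sum, Prod.smul_fst, Prod.smul_snd, Matrix.mulVec_sum, Matrix.mulVec_smul, smul_add,
        Finset.sum_add_distrib, Finset.sum_smul, smul_smul, smul_eq_mul]
  rw [hlin]
  refine Finset.sum_congr rfl fun i _ => ?_
  congr 1
  unfold shf vv
  simp only [one_smul]
  rw [GM_mom, sub_add_cancel]

lemma conc {k : ℕ} {κ : ℝ} (h : Adm (k+2) κ) {c C : ℝ} (hc : 0 < c) (hC : 0 < C) :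
    ∃ ρ c₁ : ℝ, 0 < ρ ∧ 0 < c₁ ∧ ∀ (E F : Set (Pt (k+2))) (D : Set ℝ), MeasurableSet E → MeasurableSet F → MeasurableSet D →
      volume E ≤ 1 → (∀ x ∈ F, 1 ≤ XI (k+2) E x ∧ XI (k+2) E x ≤ 2) → F ⊆ Prod.fst ⁻¹' D → volume D ≤ ENNReal.ofReal C →
      volume F ≤ ENNReal.ofReal C → ENNReal.ofReal c ≤ volume F →
      ∃ φ : Pt (k+2) → Pt (k+2), IsSy (k+2) κ φ 1 ∧ ENNReal.ofReal c₁ ≤ volume (φ ⁻¹' E ∩ Metric.closedBall 0 ρ) := by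
  obtain ⟨S, c', hS, hc', hsl⟩ := slab_lemma (k := k) hc hC
  generalize hn : k + 2 = n at *
  set m : ℕ := n + 1 with hm
  set a : ℝ := c' / (8*m) with ha'
  set b : ℝ := c' / (32*m) with hb'
  have hm0 : (0:ℝ) < m := by rw [hm]; positivity
  have ha : 0 < a := by positivity
  have hb : 0 < b := by positivity
  set ε : ℝ := (a*b)^m / (2*C^m) with hε'
  have hε : 0 < ε := by positivity
  set M : ℕ := (Finset.univ.sigma fun i : Fin (n+1) => Finset.Ioi i).card - 1 with hM
  set R : ℝ := 1 / (ε * b^M) with hR'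
  have hR : 0 < R := by positivity
  set ρ : ℝ := m * (3*S * (1+R)^n) with hρ
  refine ⟨ρ, ε * b ^ vE (n+1), by positivity, by positivity, fun E F D hE hF hD hE1 hX hFD hDC hFC hcF => ?_⟩
  obtain ⟨E', F', hE', hF', hEE, hFF, hslab, hIpos, hIE, hIF⟩ := hsl E F D hE hF hD hE1 hX hFD hDC hFC hcF
  set I := inc n E' F' with hI
  have hIm : MeasurableSet I := measurableSet_inc hE' hF'
  have hItop : volume I ≠ ∞ := by
    rw [hI, vol_inc hE' hF']
    refine ne_top_of_le_ne_top (b := 2 * ENNReal.ofReal C) (by finiteness) ?_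
    calc _ ≤ ∫⁻ x in F', 2 := setLIntegral_mono' hF' fun x hx => le_trans
            (XE_mono (fun z => indicator_le_indicator_of_subset hEE (fun _ => zero_le) z) _) (hX x (hFF hx)).2
      _ = 2 * volume F' := by rw [setLIntegral_const]
      _ ≤ _ := by gcongr; exact (measure_mono hFF).trans hFC
  have hpr := vol_prnIt (a := a) hb hIm hE' hF' (fun x hx => hx.1) (fun x hx => hx.2) (2*m)
  have hne : ((prn n a b)^[2*m] I).Nonempty := by
    by_contra hemp
    rw [not_nonempty_iff_eq_empty] at hemp
    rw [hemp, measure_empty, zero_add] at hpr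
    have hsplit1 : ENNReal.ofReal a * volume F' = ENNReal.ofReal (1/(8*m)) * (ENNReal.ofReal c' * volume F') := by
      rw [← mul_assoc, ← ENNReal.ofReal_mul (by positivity)]; congr 2; rw [ha']; ring
    have hsplit2 : ENNReal.ofReal (4*b) * volume E' = ENNReal.ofReal (1/(8*m)) * (ENNReal.ofReal c' * volume E') := by
      rw [← mul_assoc, ← ENNReal.ofReal_mul (by positivity)]; congr 2; rw [hb']; ring
    have h1 : volume I ≤ ENNReal.ofReal (1/2) * volume I := by
      calc volume I ≤ _ := hpr
        _ ≤ ENNReal.ofReal (2*m) * (ENNReal.ofReal (1/(8*m)) * volume I + ENNReal.ofReal (1/(8*m)) * volume I) := by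
            rw [hsplit1, hsplit2, ← ENNReal.ofReal_natCast]; push_cast
            gcongr
        _ = _ := by
            rw [← add_mul, ← mul_assoc, ← ENNReal.ofReal_add (by positivity) (by positivity), ← ENNReal.ofReal_mul (by positivity)]
            congr 2; field_simp; norm_num
    have h2 : volume I < volume I := by
      refine h1.trans_lt ?_
      calc _ < 1 * volume I := (ENNReal.mul_lt_mul_iff_left hIpos.ne' hItop).2 (by
            rw [← ENNReal.ofReal_one, ENNReal.ofReal_lt_ofReal_iff one_pos]; norm_num)
        _ = _ := one_mul _
    exact lt_irrefl _ h2
  obtain ⟨⟨t, z⟩, htz⟩ := hne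
  have hID : ∀ x ∈ I, x.1 ∈ D := fun x hx => hFD (hFF hx.2)
  have hlow := chain_lowerB (ts := t) (B := 3*S) hb hD hIm hID (fun x hx x' hx' => hslab _ hx.1 _ hx'.1) m t z htz
  have hcm : MeasurableSet (chainB n m b t D I (3*S) t z) :=
    measurable_prodMk_left (x := ((t, z) : ℝ × Pt n)) (measurableSet_chainB hD hIm)
  rw [← lintegral_indicator_one hcm, lintegral_pairs (measurable_one.indicator hcm)] at hlow
  -- choose τ
  set W : (Fin m → ℝ) → Set (Fin m → ℝ) := fun τ => {w | (fun i => (w i, τ i)) ∈ chainB n m b t D I (3*S) t z} with hW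
  have hWm : ∀ τ, MeasurableSet (W τ) := fun τ =>
    (show Measurable (fun w : Fin m → ℝ => fun i => (w i, τ i)) by fun_prop) hcm
  have hWi : ∀ τ, ∫⁻ w : Fin m → ℝ, (chainB n m b t D I (3*S) t z).indicator (1 : (Fin m → ℝ × ℝ) → ℝ≥0∞) (fun i => (w i, τ i)) = volume (W τ) := by
    intro τ
    rw [← lintegral_indicator_one (hWm τ)]; rfl
  simp_rw [hWi] at hlow
  obtain ⟨τ, hτ⟩ : ∃ τ, ENNReal.ofReal ε < volume (W τ) := by
    by_contra hno
    push Not at hno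
    have hpiD : MeasurableSet (Set.pi univ fun _ : Fin m => D) := MeasurableSet.univ_pi fun _ => hD
    have h1 : ∀ τ, volume (W τ) ≤ (Set.pi univ fun _ : Fin m => D).indicator (fun _ => ENNReal.ofReal ε) τ := by
      intro τ
      by_cases hτ : τ ∈ Set.pi univ fun _ : Fin m => D
      · rw [indicator_of_mem hτ]; exact hno τ
      · have : W τ = ∅ := by
          rw [← not_nonempty_iff_eq_empty]
          rintro ⟨w, hw⟩
          exact hτ fun i _ => (hw.1.1 i).2.2
        rw [this]; simp
    have h2 := hlow.trans (lintegral_mono h1)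
    rw [lintegral_indicator_const hpiD, volume_pi, Measure.pi_pi, Finset.prod_const, Finset.card_univ, Fintype.card_fin] at h2
    have h3 : (ENNReal.ofReal a * ENNReal.ofReal b)^m ≤ ENNReal.ofReal ε * ENNReal.ofReal C ^ m := h2.trans (by gcongr)
    rw [← ENNReal.ofReal_mul ha.le, ← ENNReal.ofReal_pow (by positivity), ← ENNReal.ofReal_pow (by positivity), ← ENNReal.ofReal_mul (by positivity),
      ENNReal.ofReal_le_ofReal_iff (by positivity)] at h3
    have e : ε * C^m = (a*b)^m / 2 := by
      clear_value a b
      rw [hε']; field_simp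
    rw [e] at h3
    have : 0 < (a*b)^m := by positivity
    linarith
  have hWne : (W τ).Nonempty := by
    rw [nonempty_iff_ne_empty]; intro h0; rw [h0] at hτ; simp at hτ
  obtain ⟨w₀, hw₀⟩ := hWne
  set x : Fin (n+1) → ℝ := fun i => nodes t (fun i => (w₀ i, τ i)) i.castSucc with hx
  have hsep : ∀ i j, i ≠ j → b ≤ |x i - x j| := fun i j hij => nodes_sep hb hw₀.1.1 (by simpa using hij)
  have hx0 : x 0 = t := rfl
  set x' : Fin (n+1) → ℝ := fun i => x i - t with hx'
  have hsep' : ∀ i j, i ≠ j → b ≤ |x' i - x' j| := fun i j hij => by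
    have := hsep i j hij; simp only [hx']; rwa [sub_sub_sub_cancel_right]
  have hV := VV_ne_zero hb hsep'
  have hV0 : 0 < VV x' := lt_of_le_of_ne (abs_nonneg _) hV.symm
  set φ : Pt n → Pt n := (fun ζ => ζ + z) ∘ shf n t with hφ
  have hφS : IsSy n κ φ 1 := by
    have := (IsSy.translation h z).comp (IsSy.shift h t)
    rw [one_mul] at this; exact this
  have hφw : ∀ w : Fin (n+1) → ℝ, φ (0 + ∑ i, w i • vv n (x' i)) = z + ∑ i, w i • vv n (x i) := by
    intro w
    simp only [hφ, Function.comp, zero_add, hx', shf_sum]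
    rw [add_comm]
  have hWE : ∀ w ∈ W τ, φ (0 + ∑ i, w i • vv n (x' i)) ∈ E' := by
    intro w hw
    rw [hφw]
    exact hw.1.2.1
  have hVle : VV x' ≤ 1/ε := by
    have h1 := MV2 0 x' hV (hφS.meas hE')
    rw [hφS.vol hE'] at h1
    have h2 : ENNReal.ofReal ε ≤ ENNReal.ofReal (VV x')⁻¹ := by
      calc _ ≤ volume (W τ) := hτ.le
        _ ≤ _ := measure_mono hWE
        _ = _ := h1
        _ ≤ ENNReal.ofReal (VV x')⁻¹ * 1 := by
            gcongr; simp only [inv_one, ENNReal.ofReal_one, one_mul]; exact (measure_mono hEE).trans hE1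
        _ = _ := mul_one _
    rw [ENNReal.ofReal_le_ofReal_iff (by positivity)] at h2
    rw [le_div_iff₀ hε]
    calc VV x' * ε ≤ VV x' * (VV x')⁻¹ := by gcongr
      _ = 1 := mul_inv_cancel₀ hV
  have hxR : ∀ i, |x' i| ≤ R := by
    intro i
    by_cases hi : i = 0
    · rw [hi]; simp only [hx', hx0]; simp; exact hR.le
    · have h1 := VV_ge' hb hsep' (Fin.pos_of_ne_zero hi)
      have h2 : x' 0 = 0 := by simp [hx', hx0]
      rw [h2, sub_zero] at h1
      rw [hR', le_div_iff₀ (by positivity)]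
      calc |x' i| * (ε * b^M) = (|x' i| * b^M) * ε := by ring
        _ ≤ (1/ε) * ε := by gcongr; exact h1.trans hVle
        _ = 1 := by field_simp
  refine ⟨φ, hφS, ?_⟩
  set A : Set (Pt n) := φ ⁻¹' E ∩ Metric.closedBall 0 ρ with hA
  have hAm : MeasurableSet A := (hφS.meas hE).inter measurableSet_closedBall
  have h1 := MV2 0 x' hV hAm
  have h2 : ENNReal.ofReal ε ≤ ENNReal.ofReal (VV x')⁻¹ * volume A := by
    rw [← h1]
    refine hτ.le.trans (measure_mono fun w hw => ⟨hEE (hWE w hw), ?_⟩)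
    rw [mem_closedBall_zero_iff, zero_add]
    refine (norm_sum_le _ _).trans ?_
    calc _ ≤ ∑ _i : Fin (n+1), (3*S * (1+R)^n) := Finset.sum_le_sum fun i _ => by
            rw [norm_smul]
            exact mul_le_mul (hw.2 i) (norm_vv_le hR.le (hxR i)) (norm_nonneg _) (by positivity)
      _ = ρ := by rw [Finset.sum_const, Finset.card_univ, Fintype.card_fin, nsmul_eq_mul]
  calc ENNReal.ofReal (ε * b ^ vE (n+1)) ≤ ENNReal.ofReal (ε * VV x') := by
        gcongr; exact VV_ge hb hsep'
    _ = ENNReal.ofReal ε * ENNReal.ofReal (VV x') := ENNReal.ofReal_mul hε.le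
    _ ≤ (ENNReal.ofReal (VV x')⁻¹ * volume A) * ENNReal.ofReal (VV x') := by gcongr
    _ = volume A := by
        rw [mul_right_comm, ← ENNReal.ofReal_mul (by positivity), inv_mul_cancel₀ hV, ENNReal.ofReal_one, one_mul]

/-- Prop C. -/
lemma propC {n : ℕ} {κ : ℝ} (h : Adm n κ) {η : ℝ≥0∞} (hη : η ≠ 0) :
    ∃ ρ c₁ : ℝ, 0 < ρ ∧ 0 < c₁ ∧ ∀ E : Set (Pt n), MeasurableSet E → volume E ≤ 1 →
      η ≤ ∫⁻ t, (∫⁻ y, XI n E (t, y) ^ rK n κ) ^ (qK n κ / rK n κ) → ∃ φ : Pt n → Pt n,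
        IsSy n κ φ 1 ∧ ENNReal.ofReal c₁ ≤ volume (φ ⁻¹' E ∩ Metric.closedBall 0 ρ) := by
  obtain ⟨k, rfl⟩ : ∃ k, n = k + 2 := ⟨n - 2, by have := h.hn; omega⟩
  obtain ⟨c, C, hc, hC, h0⟩ := propC0 h hη
  obtain ⟨ρ, c₁, hρ, hc₁, h1⟩ := conc h hc hC
  refine ⟨ρ, c₁, hρ, hc₁, fun E hE hE1 hJ => ?_⟩
  obtain ⟨φ, F, D, hφ, hF, hD, hX, hFD, hDC, hsl, hFc⟩ := h0 E hE hE1 hJ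
  have hFC : volume F ≤ ENNReal.ofReal C := by
    rw [Measure.volume_eq_prod, Measure.prod_apply hF]
    calc _ ≤ ∫⁻ t, D.indicator 1 t := by
          refine lintegral_mono fun t => ?_
          by_cases ht : t ∈ D
          · rw [indicator_of_mem ht]; exact hsl t
          · rw [indicator_of_notMem ht]
            refine le_of_eq ?_
            rw [show Prod.mk t ⁻¹' F = ∅ from ?_, measure_empty]
            rw [← not_nonempty_iff_eq_empty]
            rintro ⟨y, hy⟩
            exact ht (hFD hy)
      _ = volume D := lintegral_indicator_one hD
      _ ≤ _ := hDC
  obtain ⟨ψ, hψ, hv⟩ := h1 (φ ⁻¹' E) F D (hφ.meas hE) hF hD (by rw [hφ.vol hE]; simpa using hE1) hX hFD hDC hFC hFc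
  refine ⟨φ ∘ ψ, by simpa using hφ.comp hψ, hv⟩

end

section

lemma XE_const_mul {n : ℕ} (c : ℝ≥0∞) {f : Pt n → ℝ≥0∞} (hf : Measurable f) :
    XE n (fun z => c * f z) = fun x => c * XE n f x := by
  ext x
  unfold XE
  rw [lintegral_const_mul _ (by fun_prop)]

lemma norm_rescale {n : ℕ} {κ : ℝ} (h : Adm n κ) {φ : Pt n → Pt n} {J : ℝ} (hφ : IsSy n κ φ J) {f : Pt n → ℝ≥0∞} (hf : Measurable f) :
    Nm n κ (XE n (fun z => ENNReal.ofReal (J^(1-κ)) * f (φ z))) = Nm n κ (XE n f) ∧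
    ∫⁻ z, (ENNReal.ofReal (J^(1-κ)) * f (φ z)) ^ (1-κ)⁻¹ = ∫⁻ z, f z ^ (1-κ)⁻¹ := by
  have hk : 0 < 1 - κ := by linarith [h.half]
  have hJ := hφ.pos
  constructor
  · have hm : Measurable (f ∘ φ) := hf.comp hφ.meas
    have e := XE_const_mul (ENNReal.ofReal (J^(1-κ))) hm
    simp only [Function.comp] at e
    rw [e]
    have e0 : Nm n κ (fun x => ENNReal.ofReal (J^(1-κ)) * XE n (f ∘ φ) x) = ENNReal.ofReal (J^(1-κ)) * Nm n κ (XE n (f ∘ φ)) :=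
      mN_const_mul h.qpos h.rpos (measurable_XE hm) _
    refine e0.trans ?_
    have e1 : Nm n κ (XE n (f ∘ φ)) = _ := hφ.mn f hf
    rw [e1, ← mul_assoc, ← ENNReal.ofReal_mul (by positivity), ← Real.rpow_add hJ]
    simp
  · have : ∀ z, (ENNReal.ofReal (J^(1-κ)) * f (φ z)) ^ (1-κ)⁻¹ = ENNReal.ofReal J * (f (φ z)) ^ (1-κ)⁻¹ := by
      intro z
      rw [ENNReal.mul_rpow_of_nonneg _ _ (by positivity), ENNReal.ofReal_rpow_of_pos (by positivity), ← Real.rpow_mul hJ.le,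
        mul_inv_cancel₀ hk.ne', Real.rpow_one]
    simp_rw [this]
    have hm : Measurable (fun z => f z ^ (1-κ)⁻¹) := hf.pow_const _
    rw [lintegral_const_mul _ (hm.fun_comp hφ.meas), hφ.lint _ hm, ← mul_assoc, ← ENNReal.ofReal_mul hJ.le, mul_inv_cancel₀ hJ.ne']
    simp

lemma propN {n : ℕ} {κ : ℝ} (h : Adm n κ) {c : ℝ≥0∞} (hc : c ≠ 0) : ∃ ρ c₁ : ℝ, 0 < ρ ∧ 0 < c₁ ∧
    ∀ f : Pt n → ℝ≥0∞, Measurable f → (∀ z, f z ≠ ∞) → ∫⁻ z, f z ^ (1-κ)⁻¹ ≤ 1 → c ≤ Nm n κ (XE n f) →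
      ∃ g : Pt n → ℝ≥0∞, Measurable g ∧ (∀ z, g z ≠ ∞) ∧ ∫⁻ z, g z ^ (1-κ)⁻¹ = ∫⁻ z, f z ^ (1-κ)⁻¹ ∧
        Nm n κ (XE n g) = Nm n κ (XE n f) ∧
        ENNReal.ofReal c₁ ≤ volume ({z | 1 ≤ g z ∧ g z ≤ 2} ∩ Metric.closedBall 0 ρ) := by
  have hk : 0 < 1 - κ := by linarith [h.half]
  obtain ⟨c', hc', hlev⟩ := level_exists h hc
  have hη : c' ^ qK n κ ≠ 0 := by
    intro h0; rcases ENNReal.rpow_eq_zero_iff.1 h0 with h1 | h1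
    · exact hc' h1.1
    · linarith [h.qpos]
  obtain ⟨ρ, c₁, hρ, hc₁, hC⟩ := propC h hη
  refine ⟨ρ, c₁, hρ, hc₁, fun f hf hft hf1 hcf => ?_⟩
  obtain ⟨j, hj⟩ := hlev f hf hft hf1 hcf
  set J : ℝ := 2 ^ (-(j:ℝ) * (1-κ)⁻¹) with hJ'
  have hJ : 0 < J := by positivity
  have hJk : J ^ (1-κ) = 2 ^ (-(j:ℝ)) := by
    rw [hJ', ← Real.rpow_mul (by norm_num), mul_assoc, inv_mul_cancel₀ hk.ne', mul_one]
  obtain ⟨φ, hφ⟩ := exists_sy_J h hJ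
  have hEm := measurableSet_El hf j
  have hJi : ENNReal.ofReal J⁻¹ = e2 (j * (1-κ)⁻¹) := by
    unfold e2; rw [hJ', ← Real.rpow_neg (by norm_num)]; congr 2; ring
  have hJi2 : ENNReal.ofReal (J ^ (-(1-κ))) = e2 j := by
    unfold e2; rw [Real.rpow_neg hJ.le, hJk, ← Real.rpow_neg (by norm_num), neg_neg]
  have hv : volume (φ ⁻¹' El f j) ≤ 1 := by
    rw [hφ.vol hEm, hJi]
    exact (ENNReal.le_tsum (f := fun j : ℤ => e2 (j * (1-κ)⁻¹) * volume (El f j)) j).trans ((sum_mass hf (by positivity)).trans hf1)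
  have hN : c' ≤ Nm n κ (XI n (φ ⁻¹' El f j)) := by
    rw [hφ.XI hEm, hJi2]; exact hj
  have hIntg : c' ^ qK n κ ≤ ∫⁻ t, (∫⁻ y, XI n (φ ⁻¹' El f j) (t, y) ^ rK n κ) ^ (qK n κ / rK n κ) := by
    have h1 := ENNReal.rpow_le_rpow hN h.qpos.le
    refine h1.trans (le_of_eq ?_)
    unfold Nm mixedNorm mixedNormG
    rw [← ENNReal.rpow_mul, one_div_mul_cancel h.qpos.ne', ENNReal.rpow_one]
  obtain ⟨ψ, hψ, hvol⟩ := hC _ (hφ.meas hEm) hv hIntg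
  have hφψ := hφ.comp hψ
  rw [mul_one] at hφψ
  obtain ⟨r1, r2⟩ := norm_rescale h hφψ hf
  refine ⟨fun z => ENNReal.ofReal (J^(1-κ)) * f ((φ ∘ ψ) z), ?_, ?_, r2, r1, ?_⟩
  · exact (hf.comp hφψ.meas).const_mul _
  · intro z; exact ENNReal.mul_ne_top ENNReal.ofReal_ne_top (hft _)
  · refine hvol.trans (measure_mono (inter_subset_inter_left _ ?_))
    intro z hz
    have hz : e2 j ≤ f (φ (ψ z)) ∧ f (φ (ψ z)) < e2 (j+1) := hz
    have e : ENNReal.ofReal (J^(1-κ)) = e2 (-j) := by rw [hJk]; rfl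
    have e3 : e2 (-(j:ℝ)) * e2 j = 1 := by rw [← e2_add]; simp [e2_zero]
    have e4 : e2 (-(j:ℝ)) * e2 (j+1) = 2 := by rw [← e2_add]; simp [e2_one]
    simp only [mem_ofPred_eq, e, Function.comp]
    constructor
    · rw [← e3]; gcongr; exact hz.1
    · rw [← e4]; gcongr; exact hz.2.le

end

section

lemma Nm_congr_ae {n : ℕ} {κ : ℝ} (h : Adm n κ) {f g : Pt n → ℝ≥0∞} (hf : Measurable f) (hg : Measurable g)
    (hfg : f =ᵐ[volume] g) : Nm n κ (XE n f) = Nm n κ (XE n g) := by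
  apply le_antisymm
  · refine mN_mono_ae h.qpos h.rpos (Eventually.of_forall fun t => ?_)
    filter_upwards [XE_congr_ae hf hg hfg t] with y hy using hy.le
  · refine mN_mono_ae h.qpos h.rpos (Eventually.of_forall fun t => ?_)
    filter_upwards [XE_congr_ae hf hg hfg t] with y hy using hy.ge

lemma XE_zero {n : ℕ} : XE n (fun _ => 0) = 0 := by
  ext x; simp [XE]

lemma hom_bound {n : ℕ} {κ : ℝ} (h : Adm n κ) {A : ℝ≥0∞}
    (hA : ∀ f : Pt n → ℝ≥0∞, Measurable f → (∀ z, f z ≠ ∞) → ∫⁻ z, f z ^ (1-κ)⁻¹ ≤ 1 → Nm n κ (XE n f) ≤ A)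
    {f : Pt n → ℝ≥0∞} (hf : Measurable f) (hft : ∀ z, f z ≠ ∞) (hI : ∫⁻ z, f z ^ (1-κ)⁻¹ ≠ ∞) :
    Nm n κ (XE n f) ≤ A * (∫⁻ z, f z ^ (1-κ)⁻¹) ^ (1-κ) := by
  have hk : 0 < 1 - κ := by linarith [h.half]
  by_cases h0 : ∫⁻ z, f z ^ (1-κ)⁻¹ = 0
  · have : f =ᵐ[volume] fun _ => 0 := by
      rw [lintegral_eq_zero_iff (hf.pow_const _)] at h0
      filter_upwards [h0] with z hz
      have hp : 0 < (1-κ)⁻¹ := by positivity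
      simpa [hp.le, hk, not_lt.2 hk.le] using hz
    rw [Nm_congr_ae h hf measurable_const this, XE_zero]
    have : Nm n κ (0 : Pt n → ℝ≥0∞) = 0 := mN_zero h.qpos h.rpos
    rw [this]; exact zero_le
  set I := ∫⁻ z, f z ^ (1-κ)⁻¹ with hIdef
  set c := I ^ (1-κ) with hc
  have hc0 : c ≠ 0 := by rw [hc]; simp [ENNReal.rpow_eq_zero_iff, h0, hk, hI]
  have hct : c ≠ ∞ := ENNReal.rpow_ne_top_of_nonneg hk.le hI
  have h1 := hA (fun z => c⁻¹ * f z) (by fun_prop) (fun z => ENNReal.mul_ne_top (by simp [hc0]) (hft z)) (by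
    simp_rw [ENNReal.mul_rpow_of_nonneg _ _ (inv_nonneg.2 hk.le)]
    rw [lintegral_const_mul _ (hf.pow_const _), ENNReal.inv_rpow, hc, ← ENNReal.rpow_mul, mul_inv_cancel₀ hk.ne',
      ENNReal.rpow_one, ENNReal.inv_mul_cancel h0 hI])
  rw [XE_const_mul _ hf] at h1
  have e0 : Nm n κ (fun x => c⁻¹ * XE n f x) = c⁻¹ * Nm n κ (XE n f) := mN_const_mul h.qpos h.rpos (measurable_XE hf) _
  rw [e0] at h1
  calc Nm n κ (XE n f) = c * (c⁻¹ * Nm n κ (XE n f)) := by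
        rw [← mul_assoc, ENNReal.mul_inv_cancel hc0 hct, one_mul]
    _ ≤ c * A := by gcongr
    _ = A * c := mul_comm _ _

open Topology in
lemma dctmix {n : ℕ} {q r : ℝ} (hq : 0 < q) (hr : 0 < r) {h : ℕ → Pt n → ℝ≥0∞} {G : Pt n → ℝ≥0∞}
    (hm : ∀ j, Measurable (h j)) (hG : Measurable G) (hle : ∀ j, h j ≤ G) (hGt : mixedNorm n q r G ≠ ∞)
    (hae : ∀ᵐ x : Pt n, Tendsto (fun j => h j x) atTop (𝓝 0)) :
    Tendsto (fun j => mixedNorm n q r (h j)) atTop (𝓝 0) := by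
  have hae' : ∀ᵐ t : ℝ, ∀ᵐ y : Fin n → ℝ, Tendsto (fun j => h j (t,y)) atTop (𝓝 0) :=
    Measure.ae_ae_of_ae_prod (by rw [Measure.volume_eq_prod] at hae; exact hae)
  unfold mixedNorm mixedNormG at *
  have hfin : ∫⁻ t, (∫⁻ y, G (t,y) ^ r) ^ (q/r) ≠ ∞ := by
    intro h0; rw [h0] at hGt; simp [hq] at hGt
  have hmi : ∀ {g : Pt n → ℝ≥0∞}, Measurable g → Measurable (fun t => (∫⁻ y, g (t,y) ^ r) ^ (q/r)) := fun hg =>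
    ((hg.pow_const r).lintegral_prod_right').pow_const _
  have hqr : 0 < q / r := by positivity
  have key : Tendsto (fun j => ∫⁻ t, (∫⁻ y, h j (t,y) ^ r) ^ (q/r)) atTop (𝓝 (∫⁻ t : ℝ, 0)) := by
    apply tendsto_lintegral_of_dominated_convergence (fun t => (∫⁻ y, G (t,y) ^ r) ^ (q/r)) (fun j => hmi (hm j)) ?_ hfin
    · filter_upwards [hae', ae_lt_top (hmi hG) hfin] with t ht hft
      have h1 : ∫⁻ y, G (t,y) ^ r ≠ ∞ := by
        intro h0; rw [h0] at hft; simp [hqr] at hft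
      have h2 : Tendsto (fun j => ∫⁻ y, h j (t,y) ^ r) atTop (𝓝 (∫⁻ y : Fin n → ℝ, 0)) := by
        apply tendsto_lintegral_of_dominated_convergence (fun y => G (t,y) ^ r)
          (fun j => (measurable_slice (hm j) t).pow_const _) ?_ h1
        · filter_upwards [ht] with y hy
          have := (ENNReal.continuous_rpow_const (y := r)).tendsto 0 |>.comp hy
          simpa [hr, Function.comp_def] using this
        · exact fun j => Eventually.of_forall fun y => ENNReal.rpow_le_rpow (hle j _) hr.le
      have := (ENNReal.continuous_rpow_const (y := q/r)).tendsto _ |>.comp h2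
      simpa [hqr, Function.comp_def] using this
    · exact fun j => Eventually.of_forall fun t => ENNReal.rpow_le_rpow
        (lintegral_mono fun y => ENNReal.rpow_le_rpow (hle j _) hr.le) hqr.le
  have := (ENNReal.continuous_rpow_const (y := 1/q)).tendsto _ |>.comp key
  simpa [hq, Function.comp_def] using this

open Topology in
lemma DM {n : ℕ} {q r : ℝ} (hq : 0 < q) (hr : 0 < r) {h : ℕ → Pt n → ℝ≥0∞} {G : Pt n → ℝ≥0∞}
    (hm : ∀ j, Measurable (h j)) (hG : Measurable G) (hle : ∀ j, h j ≤ G) (hGt : mixedNorm n q r G ≠ ∞)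
    {W : Pt n → ℝ≥0∞} (hW : Measurable W) (hW0 : ∀ x, W x ≠ 0) {e : ℝ} (he : 0 < e)
    (hlim : Tendsto (fun j => ∫⁻ x, h j x ^ e * W x) atTop (𝓝 0)) :
    Tendsto (fun j => mixedNorm n q r (h j)) atTop (𝓝 0) := by
  apply tendsto_of_subseq_tendsto
  intro ns hns
  have h1 : ∀ k : ℕ, ∃ m : ℕ, k ≤ m ∧ ∫⁻ x, h (ns m) x ^ e * W x ≤ (2⁻¹ : ℝ≥0∞) ^ k := fun k => by
    have h2 : ∀ᶠ m in atTop, ∫⁻ x, h (ns m) x ^ e * W x ≤ (2⁻¹ : ℝ≥0∞) ^ k :=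
      (hlim.comp hns).eventually (ge_mem_nhds (by simp [ENNReal.pow_pos]))
    obtain ⟨m, hm1, hm2⟩ := (h2.and (eventually_ge_atTop k)).exists
    exact ⟨m, hm2, hm1⟩
  choose ms hms1 hms2 using h1
  refine ⟨ms, dctmix hq hr (fun j => hm _) hG (fun j => hle _) hGt ?_⟩
  have h3 : ∫⁻ x, ∑' k, h (ns (ms k)) x ^ e * W x ≠ ∞ := by
    rw [lintegral_tsum (fun k => by have := hm (ns (ms k)); fun_prop)]
    refine ne_top_of_le_ne_top ?_ (ENNReal.tsum_le_tsum hms2)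
    simp
  filter_upwards [ae_lt_top (Measurable.ennreal_tsum fun k => by have := hm (ns (ms k)); fun_prop) h3] with x hx
  have h4 := ENNReal.tendsto_atTop_zero_of_tsum_ne_top hx.ne
  have h5 : Tendsto (fun k => h (ns (ms k)) x ^ e) atTop (𝓝 0) := by
    rw [ENNReal.tendsto_atTop_zero] at h4 ⊢
    intro ε hε
    by_cases hWt : W x = ∞
    · obtain ⟨N, hN⟩ := h4 1 one_pos
      refine ⟨N, fun m hm => ?_⟩
      by_contra hcon
      have hne : h (ns (ms m)) x ^ e ≠ 0 := fun h0 => hcon (by rw [h0]; exact zero_le)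
      have := hN m hm
      rw [hWt, ENNReal.mul_top hne] at this
      simp at this
    · obtain ⟨N, hN⟩ := h4 (ε * W x) (ENNReal.mul_pos hε.ne' (hW0 x))
      exact ⟨N, fun m hm => (ENNReal.mul_le_mul_iff_left (hW0 x) hWt).1 (hN m hm)⟩
  have := (ENNReal.continuous_rpow_const (y := e⁻¹)).tendsto _ |>.comp h5
  have he' : 0 < e⁻¹ := by positivity
  simpa [he', Function.comp_def, ← ENNReal.rpow_mul, he.ne'] using this

end

section

def wt (u : ℝ) : ℝ≥0∞ := ENNReal.ofReal ((1 + u^2)⁻¹)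
def WW (n : ℕ) (x : Pt n) : ℝ≥0∞ := wt x.1 * ∏ i, wt (x.2 i)
def HH (n : ℕ) (z : Pt n) : ℝ≥0∞ := ∫⁻ t, WW n (t, pr n t z)

@[fun_prop] lemma measurable_wt : Measurable wt := by unfold wt; fun_prop
lemma wt_ne_zero (u : ℝ) : wt u ≠ 0 := by
  unfold wt; simp only [ne_eq, ENNReal.ofReal_eq_zero, not_le]; positivity
lemma wt_le_one (u : ℝ) : wt u ≤ 1 := by
  unfold wt; rw [ENNReal.ofReal_le_one]; apply inv_le_one_of_one_le₀; nlinarith [sq_nonneg u]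
lemma wt_neg (u : ℝ) : wt (-u) = wt u := by simp [wt]
lemma lintegral_wt : ∫⁻ u, wt u ≠ ∞ := by
  unfold wt
  exact integrable_inv_one_add_sq.lintegral_lt_top.ne
@[fun_prop] lemma measurable_WW (n : ℕ) : Measurable (WW n) := by unfold WW; fun_prop
lemma WW_ne_zero (n : ℕ) (x : Pt n) : WW n x ≠ 0 := by
  unfold WW
  exact mul_ne_zero (wt_ne_zero _) (Finset.prod_ne_zero_iff.2 fun i _ => wt_ne_zero _)

lemma measurable_WWpr (n : ℕ) : Measurable (fun p : Pt n × ℝ => WW n (p.2, pr n p.2 p.1)) := by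
  apply (measurable_WW n).comp; unfold pr; fun_prop
lemma measurable_WWt (n : ℕ) (z : Pt n) : Measurable (fun t : ℝ => WW n (t, pr n t z)) := by
  apply (measurable_WW n).comp; unfold pr; fun_prop
lemma measurable_WWz (n : ℕ) (t : ℝ) : Measurable (fun z : Pt n => WW n (t, pr n t z)) := by
  apply (measurable_WW n).comp; unfold pr; fun_prop
lemma measurable_WWxt (n : ℕ) (s : ℝ) : Measurable (fun p : (Fin n → ℝ) × ℝ => WW n (p.2, pr n p.2 (s, p.1))) := by
  apply (measurable_WW n).comp; unfold pr; fun_prop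
@[fun_prop] lemma measurable_HH (n : ℕ) : Measurable (HH n) :=
  (measurable_WWpr n).lintegral_prod_right'

lemma XE_WW {n : ℕ} {f : Pt n → ℝ≥0∞} (hf : Measurable f) :
    ∫⁻ x, XE n f x * WW n x = ∫⁻ z, f z * HH n z := by
  have hm := measurable_WWpr n
  have e1 : ∀ z, f z * HH n z = ∫⁻ t, f z * WW n (t, pr n t z) := fun z => by
    rw [HH, lintegral_const_mul _ (measurable_WWt n z)]
  simp_rw [e1]
  rw [lintegral_lintegral_swap (f := fun z t => f z * WW n (t, pr n t z))
    (((hf.comp measurable_fst).mul hm).aemeasurable)]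
  rw [Measure.volume_eq_prod, lintegral_prod _ (by fun_prop)]
  congr 1; ext t
  have hmt : Measurable (fun z => WW n (t, pr n t z)) := measurable_WWz n t
  rw [← Measure.volume_eq_prod, lintegral_lines (f := fun z => f z * WW n (t, pr n t z)) (hf.mul hmt) t]
  congr 1; ext y
  unfold XE
  rw [← lintegral_mul_const _ (by fun_prop)]
  congr 1; ext s
  simp [pr]

lemma HH_le {n : ℕ} (hn : 2 ≤ n) (z : Pt n) : HH n z ≤ (2 * ∫⁻ u, wt u) * ENNReal.ofReal ((1 + ‖z.1‖)⁻¹) := by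
  set C := ∫⁻ u, wt u with hC
  have h1 : HH n z ≤ C := lintegral_mono fun t => by
    unfold WW
    calc wt t * ∏ i, wt (pr n t z i) ≤ wt t * 1 := by gcongr; exact Finset.prod_le_one' fun i _ => wt_le_one _
      _ = wt t := mul_one _
  have h2 : ENNReal.ofReal ‖z.1‖ * HH n z ≤ C := by
    by_cases hz : z.1 = 0
    · simp [hz]
    have h3 : HH n z ≤ ∫⁻ t, wt (z.2 ⟨0, by omega⟩ - z.1 * t) := lintegral_mono fun t => by
      unfold WW
      have h4 : ∏ i, wt (pr n t z i) ≤ wt (pr n t z ⟨0, by omega⟩) := by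
        rw [← Finset.mul_prod_erase _ _ (Finset.mem_univ (⟨0, by omega⟩ : Fin n))]
        calc _ ≤ wt (pr n t z ⟨0, by omega⟩) * 1 := by gcongr; exact Finset.prod_le_one' fun i _ => wt_le_one _
          _ = _ := mul_one _
      calc wt t * ∏ i, wt (pr n t z i) ≤ 1 * wt (pr n t z ⟨0, by omega⟩) := mul_le_mul' (wt_le_one _) h4
        _ = _ := by simp [pr, mom]
    have hp : 0 < ‖z.1‖ := by positivity
    have h5 : ∫⁻ t, wt (z.2 ⟨0, by omega⟩ - z.1 * t) = ENNReal.ofReal ‖z.1‖⁻¹ * C := by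
      rcases lt_or_gt_of_ne hz with hs | hs
      · rw [hC, ← lint_scale hp measurable_wt (z.2 ⟨0, by omega⟩)]
        congr 1; ext t; rw [Real.norm_of_nonpos hs.le]; congr 1; ring
      · rw [hC, ← lint_scale hp measurable_wt (-z.2 ⟨0, by omega⟩)]
        congr 1; ext t; rw [Real.norm_of_nonneg hs.le, ← wt_neg]; congr 1; ring
    calc ENNReal.ofReal ‖z.1‖ * HH n z ≤ ENNReal.ofReal ‖z.1‖ * (ENNReal.ofReal ‖z.1‖⁻¹ * C) := by
          gcongr; exact h3.trans h5.le
      _ = C := by rw [← mul_assoc, ← ENNReal.ofReal_mul hp.le, mul_inv_cancel₀ hp.ne']; simp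
  have h6 : (0:ℝ) < 1 + ‖z.1‖ := by positivity
  calc HH n z = (ENNReal.ofReal (1 + ‖z.1‖) * HH n z) * ENNReal.ofReal ((1 + ‖z.1‖)⁻¹) := by
        rw [mul_comm, ← mul_assoc, ← ENNReal.ofReal_mul (by positivity), inv_mul_cancel₀ h6.ne']; simp
    _ ≤ (2 * C) * ENNReal.ofReal ((1 + ‖z.1‖)⁻¹) := by
        refine mul_le_mul_left ?_ _
        rw [ENNReal.ofReal_add zero_le_one (norm_nonneg _), add_mul, two_mul]
        exact add_le_add (by simpa using h1) h2

lemma HH_slice {n : ℕ} (s : ℝ) : ∫⁻ x, HH n (s, x) = (∫⁻ u, wt u) * (∫⁻ u, wt u) ^ n := by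
  unfold HH
  have hm := measurable_WWpr n
  rw [lintegral_lintegral_swap (f := fun x t => WW n (t, pr n t (s, x)))  (measurable_WWxt n s).aemeasurable]
  have : ∀ t, ∫⁻ x : Fin n → ℝ, WW n (t, pr n t (s, x)) = wt t * (∫⁻ u, wt u) ^ n := fun t => by
    unfold WW pr
    simp only
    rw [lintegral_const_mul _ (by fun_prop), lintegral_sub_right_eq_self (fun y : Fin n → ℝ => ∏ i, wt (y i)),
      lintegral_prod_fin measurable_wt]
  simp_rw [this]
  rw [lintegral_mul_const _ measurable_wt]

lemma HH_Lp {n : ℕ} {κ : ℝ} (h : Adm n κ) : ∫⁻ z, HH n z ^ κ⁻¹ ≠ ∞ := by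
  have hk := h.pos
  have he : 2 < κ⁻¹ := by rw [lt_inv_comm₀ (by norm_num) hk]; linarith [h.half]
  set C := ∫⁻ u, wt u with hC
  have hCt : C ≠ ∞ := lintegral_wt
  have h1 : ∀ z, HH n z ^ κ⁻¹ ≤ (2 * C) ^ (κ⁻¹ - 1) * ENNReal.ofReal ((1 + ‖z.1‖) ^ (-(κ⁻¹ - 1))) * HH n z := fun z => by
    have e : HH n z ^ κ⁻¹ = HH n z ^ (κ⁻¹ - 1) * HH n z := by
      conv_rhs => rw [← ENNReal.rpow_one (HH n z), ← ENNReal.rpow_mul, ← ENNReal.rpow_add_of_nonneg _ _ (by linarith) (by norm_num)]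
      congr 1; ring
    rw [e]
    gcongr
    refine (ENNReal.rpow_le_rpow (HH_le h.hn z) (by linarith)).trans ?_
    rw [ENNReal.mul_rpow_of_nonneg _ _ (by linarith), ENNReal.ofReal_rpow_of_pos (by positivity), Real.inv_rpow (by positivity), Real.rpow_neg (by positivity)]
  refine ne_top_of_le_ne_top ?_ (lintegral_mono h1)
  rw [Measure.volume_eq_prod, lintegral_prod _ (by fun_prop)]
  simp only
  have h2 : ∀ s : ℝ, ∫⁻ x : Fin n → ℝ, (2 * C) ^ (κ⁻¹ - 1) * ENNReal.ofReal ((1 + ‖s‖) ^ (-(κ⁻¹ - 1))) * HH n (s, x) =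
      (2 * C) ^ (κ⁻¹ - 1) * (C * C ^ n) * ENNReal.ofReal ((1 + ‖s‖) ^ (-(κ⁻¹ - 1))) := fun s => by
    rw [lintegral_const_mul _ (by fun_prop), HH_slice]; ring
  simp_rw [h2]
  rw [lintegral_const_mul _ (by fun_prop)]
  refine ENNReal.mul_ne_top (ENNReal.mul_ne_top (ENNReal.rpow_ne_top_of_nonneg (by linarith) (ENNReal.mul_ne_top (by simp) hCt))
    (ENNReal.mul_ne_top hCt (ENNReal.pow_ne_top hCt))) ?_
  exact (finite_integral_one_add_norm (by simp; linarith)).ne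

end

section

def inn {n : ℕ} (ρ : ℕ) (f : Pt n → ℝ≥0∞) : Set (Pt n) := {z | ‖z‖ ≤ ρ ∧ f z ≤ ρ}
def tr {n : ℕ} (ρ : ℕ) (f : Pt n → ℝ≥0∞) : Pt n → ℝ≥0∞ := (inn ρ f).indicator f
def tl {n : ℕ} (ρ : ℕ) (f : Pt n → ℝ≥0∞) : Pt n → ℝ≥0∞ := (inn ρ f)ᶜ.indicator f
def Gf (n : ℕ) (ρ : ℕ) : Pt n → ℝ≥0∞ := XE n ((Metric.closedBall 0 (ρ:ℝ)).indicator (fun _ => (ρ:ℝ≥0∞)))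

lemma ms_inn {n : ℕ} (ρ : ℕ) {f : Pt n → ℝ≥0∞} (hf : Measurable f) : MeasurableSet (inn ρ f) :=
  ms_and (measurableSet_le (by fun_prop) (by fun_prop)) (measurableSet_le hf (by fun_prop))
@[fun_prop] lemma measurable_tr {n : ℕ} (ρ : ℕ) {f : Pt n → ℝ≥0∞} (hf : Measurable f) : Measurable (tr ρ f) :=
  hf.indicator (ms_inn ρ hf)
@[fun_prop] lemma measurable_tl {n : ℕ} (ρ : ℕ) {f : Pt n → ℝ≥0∞} (hf : Measurable f) : Measurable (tl ρ f) :=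
  hf.indicator (ms_inn ρ hf).compl
@[fun_prop] lemma measurable_Gf (n : ℕ) (ρ : ℕ) : Measurable (Gf n ρ) :=
  measurable_XE (measurable_const.indicator Metric.isClosed_closedBall.measurableSet)
lemma tr_le {n : ℕ} (ρ : ℕ) (f : Pt n → ℝ≥0∞) : tr ρ f ≤ (Metric.closedBall 0 (ρ:ℝ)).indicator (fun _ => (ρ:ℝ≥0∞)) := by
  intro z
  unfold tr
  by_cases hz : z ∈ inn ρ f
  · rw [indicator_of_mem hz, indicator_of_mem (by simpa using hz.1)]; exact hz.2
  · rw [indicator_of_notMem hz]; exact zero_le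
lemma XE_tr_le {n : ℕ} (ρ : ℕ) (f : Pt n → ℝ≥0∞) : XE n (tr ρ f) ≤ Gf n ρ := XE_mono (tr_le ρ f)

open Topology in
lemma tl_HH {n : ℕ} {κ : ℝ} (h : Adm n κ) {f : ℕ → Pt n → ℝ≥0∞} (hf : ∀ j, Measurable (f j))
    (hI : ∀ j, ∫⁻ z, f j z ^ (1-κ)⁻¹ ≤ 1) {m : ℕ → ℕ} (hm : ∀ j, j ≤ m j) :
    Tendsto (fun j => ∫⁻ z, tl (m j) (f j) z * HH n z) atTop (𝓝 0) := by
  have hk := h.pos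
  have hk1 : 0 < 1 - κ := by linarith [h.half]
  have hp : 0 < (1-κ)⁻¹ := by positivity
  have hH := HH_Lp h
  have hconj : ((1-κ)⁻¹).HolderConjugate κ⁻¹ := by
    refine ⟨?_, hp, by positivity⟩; simp
  have hmH : Measurable (fun z => HH n z ^ κ⁻¹) := by fun_prop
  -- the tail part
  have t1 : Tendsto (fun j : ℕ => ∫⁻ z in {z : Pt n | (j:ℝ) < ‖z‖}, HH n z ^ κ⁻¹) atTop (𝓝 0) := by
    have hms : ∀ j : ℕ, MeasurableSet {z : Pt n | (j:ℝ) < ‖z‖} := fun j => measurableSet_lt (by fun_prop) (by fun_prop)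
    simp_rw [← lintegral_indicator (hms _)]
    rw [← lintegral_zero (μ := (volume : Measure (Pt n)))]
    apply tendsto_lintegral_of_dominated_convergence _ (fun j => hmH.indicator (hms j)) _ hH
    · refine Eventually.of_forall fun z => ?_
      obtain ⟨N, hN⟩ := exists_nat_ge ‖z‖
      apply tendsto_const_nhds.congr'
      filter_upwards [eventually_ge_atTop N] with j hj
      rw [indicator_of_notMem]
      simp only [mem_ofPred_eq, not_lt]
      exact hN.trans (by exact_mod_cast hj)
    · exact fun j => Eventually.of_forall fun z => indicator_le_self _ _ _
  have t2 : Tendsto (fun j : ℕ => ∫⁻ z in {z : Pt n | (m j : ℝ≥0∞) ≤ f j z}, HH n z ^ κ⁻¹) atTop (𝓝 0) := by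
    apply tendsto_setLIntegral_zero hH
    have hb : ∀ j : ℕ, 1 ≤ j → volume {z : Pt n | (m j : ℝ≥0∞) ≤ f j z} ≤ ((j : ℝ≥0∞) ^ (1-κ)⁻¹)⁻¹ := by
      intro j hj
      have hj0 : (m j : ℝ≥0∞) ≠ 0 := by have := hm j; simp; omega
      have h1 : volume {z : Pt n | (m j : ℝ≥0∞) ≤ f j z} ≤ volume {z : Pt n | (m j : ℝ≥0∞) ^ (1-κ)⁻¹ ≤ f j z ^ (1-κ)⁻¹} :=
        measure_mono fun z hz => ENNReal.rpow_le_rpow hz hp.le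
      have h2 := mul_meas_ge_le_lintegral (μ := volume) ((hf j).pow_const (1-κ)⁻¹) ((m j : ℝ≥0∞) ^ (1-κ)⁻¹)
      have h3 : (m j : ℝ≥0∞) ^ (1-κ)⁻¹ ≠ 0 := by simp [ENNReal.rpow_eq_zero_iff, hj0, hk1]
      have h4 : (m j : ℝ≥0∞) ^ (1-κ)⁻¹ ≠ ∞ := ENNReal.rpow_ne_top_of_nonneg hp.le (by simp)
      refine h1.trans ?_
      calc _ ≤ ((m j : ℝ≥0∞) ^ (1-κ)⁻¹)⁻¹ := by
            rw [ENNReal.le_inv_iff_mul_le, mul_comm]; exact h2.trans (hI j)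
        _ ≤ _ := by gcongr; exact hm j
    have hl : Tendsto (fun j : ℕ => ((j : ℝ≥0∞) ^ (1-κ)⁻¹)⁻¹) atTop (𝓝 0) := by
      have := ENNReal.tendsto_rpow_at_top hp |>.comp ENNReal.tendsto_nat_nhds_top
      simpa [Function.comp_def] using tendsto_inv_iff.2 this
    refine tendsto_of_tendsto_of_tendsto_of_le_of_le' tendsto_const_nhds hl (Eventually.of_forall fun _ => zero_le) ?_
    filter_upwards [eventually_ge_atTop 1] with j hj using hb j hj
  have hbound : ∀ j, ∫⁻ z, tl (m j) (f j) z * HH n z ≤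
      ((∫⁻ z in {z : Pt n | (j:ℝ) < ‖z‖}, HH n z ^ κ⁻¹) + ∫⁻ z in {z : Pt n | (m j : ℝ≥0∞) ≤ f j z}, HH n z ^ κ⁻¹) ^ κ := by
    intro j
    have e : ∀ z, tl (m j) (f j) z * HH n z = f j z * (inn (m j) (f j))ᶜ.indicator (HH n) z := fun z => by
      unfold tl; by_cases hz : z ∈ (inn (m j) (f j))ᶜ <;> simp [hz]
    simp_rw [e]
    have hmi : Measurable ((inn (m j) (f j))ᶜ.indicator (HH n)) := (measurable_HH n).indicator (ms_inn _ (hf j)).compl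
    refine (ENNReal.lintegral_mul_le_Lp_mul_Lq volume hconj (hf j).aemeasurable hmi.aemeasurable).trans ?_
    simp only [one_div, inv_inv]
    calc _ ≤ 1 * (∫⁻ z, (inn (m j) (f j))ᶜ.indicator (HH n) z ^ κ⁻¹) ^ κ := by
          gcongr; exact ENNReal.rpow_le_one (hI j) hk1.le
      _ ≤ _ := by
          rw [one_mul]
          gcongr
          have : ∀ z, (inn (m j) (f j))ᶜ.indicator (HH n) z ^ κ⁻¹ = (inn (m j) (f j))ᶜ.indicator (fun z => HH n z ^ κ⁻¹) z := fun z => by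
            by_cases hz : z ∈ (inn (m j) (f j))ᶜ <;> simp [hz, hk]
          simp_rw [this]
          rw [lintegral_indicator (ms_inn _ (hf j)).compl]
          refine (lintegral_mono_set (t := {z : Pt n | (j:ℝ) < ‖z‖} ∪ {z : Pt n | (m j : ℝ≥0∞) ≤ f j z}) ?_).trans (lintegral_union_le _ _ _)
          intro z hz
          simp only [inn, mem_compl_iff, mem_ofPred_eq, not_and_or, not_le] at hz
          rcases hz with hz | hz
          · left; exact lt_of_le_of_lt (by exact_mod_cast hm j) hz
          · right; exact hz.le
  refine tendsto_of_tendsto_of_tendsto_of_le_of_le tendsto_const_nhds ?_ (fun _ => zero_le) hbound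
  have := (ENNReal.continuous_rpow_const (y := κ)).tendsto _ |>.comp (t1.add t2)
  simpa [hk, Function.comp_def] using this

lemma Nm_Gf {n : ℕ} {κ : ℝ} (h : Adm n κ) (ρ : ℕ) : Nm n κ (Gf n ρ) ≠ ∞ := by
  obtain ⟨C, hC, hb⟩ := strong_bdd h
  have hk1 : 0 < 1 - κ := by linarith [h.half]
  have hI : ∫⁻ z : Pt n, ((Metric.closedBall 0 (ρ:ℝ)).indicator (fun _ => (ρ:ℝ≥0∞)) z) ^ (1-κ)⁻¹ ≠ ∞ := by
    have : ∀ z : Pt n, ((Metric.closedBall 0 (ρ:ℝ)).indicator (fun _ => (ρ:ℝ≥0∞)) z) ^ (1-κ)⁻¹ =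
        (Metric.closedBall 0 (ρ:ℝ)).indicator (fun _ => (ρ:ℝ≥0∞) ^ (1-κ)⁻¹) z := fun z => by
      by_cases hz : z ∈ Metric.closedBall (0 : Pt n) (ρ:ℝ)
      · simp only [indicator_of_mem hz]
      · simp only [indicator_of_notMem hz]; simp only [ENNReal.zero_rpow_of_pos (inv_pos.2 hk1)]
    simp_rw [this]
    rw [lintegral_indicator Metric.isClosed_closedBall.measurableSet, setLIntegral_const]
    exact ENNReal.mul_ne_top (ENNReal.rpow_ne_top_of_nonneg (by positivity) (by simp)) measure_closedBall_lt_top.ne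
  refine ne_top_of_le_ne_top ?_ (hom_bound h hb (measurable_const.indicator Metric.isClosed_closedBall.measurableSet) ?_ hI)
  · exact ENNReal.mul_ne_top hC (ENNReal.rpow_ne_top_of_nonneg hk1.le hI)
  · intro z; exact ne_top_of_le_ne_top (b := (ρ:ℝ≥0∞)) (by simp) (indicator_le_self _ _ z)

open Topology in
lemma VAN {n : ℕ} {κ : ℝ} (h : Adm n κ) (ρ : ℕ) {δ ε : ℝ≥0∞} (hδ : δ ≠ 0) (hε : ε ≠ 0) :
    ∃ j0 : ℕ, ∀ j ≥ j0, ∀ f : Pt n → ℝ≥0∞, Measurable f → ∫⁻ z, f z ^ (1-κ)⁻¹ ≤ 1 →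
      Nm n κ (fun x => min (Gf n ρ x) (δ⁻¹ * XE n (tl j f) x)) ≤ ε := by
  by_contra hcon
  push Not at hcon
  choose m hm f hf hI hbig using hcon
  have hlim : Tendsto (fun j => Nm n κ (fun x => min (Gf n ρ x) (δ⁻¹ * XE n (tl (m j) (f j)) x))) atTop (𝓝 0) := by
    refine DM h.qpos h.rpos (G := Gf n ρ) (W := WW n) (e := 1) (fun j => ?_) (measurable_Gf n ρ)
      (fun j x => min_le_left _ _) (Nm_Gf h ρ) (measurable_WW n) (WW_ne_zero n) one_pos ?_
    · have := measurable_XE (measurable_tl (m j) (hf j)); fun_prop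
    · have h1 := ENNReal.Tendsto.const_mul (a := δ⁻¹) (tl_HH h hf hI hm) (Or.inr (by simp [hδ]))
      rw [mul_zero] at h1
      refine tendsto_of_tendsto_of_tendsto_of_le_of_le tendsto_const_nhds h1 (fun _ => zero_le) fun j => ?_
      simp only
      rw [← XE_WW (measurable_tl (m j) (hf j)), ← lintegral_const_mul _ (by have := measurable_XE (measurable_tl (m j) (hf j)); fun_prop)]
      refine lintegral_mono fun x => ?_
      rw [ENNReal.rpow_one, ← mul_assoc]
      gcongr
      exact min_le_right _ _
  have := hlim.eventually (gt_mem_nhds (pos_iff_ne_zero.2 hε))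
  obtain ⟨j, hj⟩ := this.exists
  exact absurd hj (hbig j).not_gt

end

section

def Ip {n : ℕ} (κ : ℝ) (f : Pt n → ℝ≥0∞) : ℝ≥0∞ := ∫⁻ z, f z ^ (1-κ)⁻¹

lemma Ip_indicator {n : ℕ} {κ : ℝ} (hk : 0 < 1 - κ) (f : Pt n → ℝ≥0∞) {S : Set (Pt n)} (hS : MeasurableSet S) :
    Ip κ (S.indicator f) = ∫⁻ z in S, f z ^ (1-κ)⁻¹ := by
  unfold Ip
  rw [← lintegral_indicator hS]
  congr 1; ext z
  have hp : 0 < (1-κ)⁻¹ := by positivity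
  by_cases hz : z ∈ S
  · simp only [indicator_of_mem hz]
  · simp only [indicator_of_notMem hz, ENNReal.zero_rpow_of_pos hp]

lemma inn_mono {n : ℕ} {ρ ρ' : ℕ} (h : ρ ≤ ρ') (f : Pt n → ℝ≥0∞) : inn ρ f ⊆ inn ρ' f := fun z hz =>
  ⟨hz.1.trans (by exact_mod_cast h), hz.2.trans (by exact_mod_cast h)⟩

lemma XE_add {n : ℕ} {f g : Pt n → ℝ≥0∞} (hf : Measurable f) : XE n (f + g) = XE n f + XE n g := by
  ext x
  unfold XE
  simp only [Pi.add_apply]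
  rw [lintegral_add_left (by fun_prop)]

lemma Ip_le {n : ℕ} {κ : ℝ} (hk : 0 < 1 - κ) {f g : Pt n → ℝ≥0∞} (h : f ≤ g) : Ip κ f ≤ Ip κ g :=
  lintegral_mono fun z => ENNReal.rpow_le_rpow (h z) (by positivity)

lemma split_ineq {n : ℕ} {κ : ℝ} (h : Adm n κ) {A : ℝ≥0∞}
    (hA : ∀ f : Pt n → ℝ≥0∞, Measurable f → (∀ z, f z ≠ ∞) → ∫⁻ z, f z ^ (1-κ)⁻¹ ≤ 1 → Nm n κ (XE n f) ≤ A)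
    {σ : ℝ} (hσ0 : 0 < σ) (hσq : σ ≤ qK n κ) (hσr : σ ≤ rK n κ)
    {ρ ρ' : ℕ} (hρ : ρ ≤ ρ') {δ : ℝ≥0∞} (hδ : δ ≠ 0) (hδt : δ ≠ ∞)
    {f : Pt n → ℝ≥0∞} (hf : Measurable f) (hft : ∀ z, f z ≠ ∞) (hI : Ip κ f ≤ 1) :
    Nm n κ (XE n f) ≤ A * (Ip κ (tr ρ' f) - Ip κ (tr ρ f)) ^ (1-κ) +
      ((A * Ip κ (tr ρ f) ^ (1-κ)) ^ σ + (A * (1 - Ip κ (tr ρ' f)) ^ (1-κ)) ^ σ) ^ (1/σ) +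
      δ * Nm n κ (Gf n ρ) + Nm n κ (fun x => min (Gf n ρ x) (δ⁻¹ * XE n (tl ρ' f) x)) := by
  have hk : 0 < 1 - κ := by linarith [h.half]
  have hit : ∀ S : Set (Pt n), ∀ z, S.indicator f z ≠ ∞ := fun S z =>
    ne_top_of_le_ne_top (hft z) (indicator_le_self _ _ z)
  have hiI : ∀ S : Set (Pt n), Ip κ (S.indicator f) ≤ 1 := fun S => (Ip_le hk (indicator_le_self S f)).trans hI
  have hB : ∀ S : Set (Pt n), MeasurableSet S → Nm n κ (XE n (S.indicator f)) ≤ A * Ip κ (S.indicator f) ^ (1-κ) :=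
    fun S hS => hom_bound h hA (hf.indicator hS) (hit S) (ne_top_of_le_ne_top (by simp) (hiI S))
  have m1 := ms_inn ρ hf
  have m3 := ms_inn ρ' hf
  set S1 := inn ρ f with hS1
  set S3 := inn ρ' f with hS3
  have hsub : S1 ⊆ S3 := inn_mono hρ f
  have M2 : Ip κ ((S3 \ S1).indicator f) ≤ Ip κ (tr ρ' f) - Ip κ (tr ρ f) := by
    apply ENNReal.le_sub_of_add_le_right (ne_top_of_le_ne_top (by simp) (hiI S1))
    change Ip κ ((S3 \ S1).indicator f) + Ip κ (S1.indicator f) ≤ Ip κ (S3.indicator f)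
    rw [Ip_indicator hk f (m3.diff m1), Ip_indicator hk f m1, Ip_indicator hk f m3,
      ← lintegral_union m1 disjoint_sdiff_left, sdiff_union_of_subset hsub]
  have M3 : Ip κ (tl ρ' f) ≤ 1 - Ip κ (tr ρ' f) := by
    apply ENNReal.le_sub_of_add_le_right (ne_top_of_le_ne_top (by simp) (hiI S3))
    change Ip κ (S3ᶜ.indicator f) + Ip κ (S3.indicator f) ≤ 1
    rw [Ip_indicator hk f m3.compl, Ip_indicator hk f m3, add_comm, lintegral_add_compl _ m3]
    exact hI
  have hdec : f = (S3 \ S1).indicator f + (tr ρ f + tl ρ' f) := by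
    ext z
    unfold tr tl
    rw [← hS1, ← hS3]
    by_cases h1 : z ∈ S1
    · simp [h1, hsub h1]
    · by_cases h3 : z ∈ S3 <;> simp [h1, h3]
  have mX1 : Measurable (XE n (tr ρ f)) := measurable_XE (measurable_tr ρ hf)
  have mX3 : Measurable (XE n (tl ρ' f)) := measurable_XE (measurable_tl ρ' hf)
  have mG := measurable_Gf n ρ
  set S := {x : Pt n | XE n (tl ρ' f) x ≤ δ * Gf n ρ x} with hS
  have mS : MeasurableSet S := measurableSet_le mX3 (by fun_prop)
  set a := S.indicator (XE n (tr ρ f)) + Sᶜ.indicator (XE n (tl ρ' f)) with ha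
  have ma : Measurable a := (mX1.indicator mS).add (mX3.indicator mS.compl)
  have hpt : XE n f ≤ XE n ((S3 \ S1).indicator f) + a + (fun x => δ * Gf n ρ x) +
      (fun x => min (Gf n ρ x) (δ⁻¹ * XE n (tl ρ' f) x)) := by
    intro x
    conv_lhs => rw [hdec, XE_add (hf.indicator (m3.diff m1)), XE_add (measurable_tr ρ hf)]
    simp only [Pi.add_apply, ha]
    rw [add_assoc, add_assoc]
    refine add_le_add le_rfl ?_
    by_cases hx : x ∈ S
    · rw [indicator_of_mem hx, indicator_of_notMem (by simpa using hx), add_zero]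
      exact add_le_add le_rfl (le_add_right hx)
    · rw [indicator_of_notMem hx, indicator_of_mem (by simpa using hx), zero_add, add_comm]
      refine add_le_add le_rfl (le_add_left ?_)
      have h1 : XE n (tr ρ f) x ≤ Gf n ρ x := XE_tr_le ρ f x
      refine le_min h1 (h1.trans ?_)
      have h2 : δ * Gf n ρ x ≤ XE n (tl ρ' f) x := by
        have : ¬ (XE n (tl ρ' f) x ≤ δ * Gf n ρ x) := hx
        exact (not_le.1 this).le
      calc Gf n ρ x = δ⁻¹ * (δ * Gf n ρ x) := by rw [← mul_assoc, ENNReal.inv_mul_cancel hδ hδt, one_mul]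
        _ ≤ _ := by gcongr
  have hNa : Nm n κ a ≤ ((A * Ip κ (tr ρ f) ^ (1-κ)) ^ σ + (A * (1 - Ip κ (tr ρ' f)) ^ (1-κ)) ^ σ) ^ (1/σ) := by
    have := mN_master (q := qK n κ) (r := rK n κ) hσ0 hσq hσr (g := a)
      (G := fun b : Bool => if b then XE n (tr ρ f) else XE n (tl ρ' f)) (by intro b; cases b <;> simp [mX1, mX3]) (by
        intro x
        rw [tsum_bool, ha]
        simp only [Pi.add_apply]
        by_cases hx : x ∈ S <;> simp [hx])
    rw [tsum_bool] at this
    simp only [if_true, Bool.false_eq_true, if_false] at this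
    rw [one_div, ENNReal.le_rpow_inv_iff hσ0]
    refine this.trans ?_
    rw [add_comm]
    refine add_le_add (ENNReal.rpow_le_rpow (hB _ m1) hσ0.le) (ENNReal.rpow_le_rpow ?_ hσ0.le)
    refine (hB _ m3.compl).trans ?_
    gcongr
    exact M3
  have mMin : Measurable (fun x => min (Gf n ρ x) (δ⁻¹ * XE n (tl ρ' f) x)) := by fun_prop
  have mX2 : Measurable (XE n ((S3 \ S1).indicator f)) := measurable_XE (hf.indicator (m3.diff m1))
  have eG : Nm n κ (fun x => δ * Gf n ρ x) = δ * Nm n κ (Gf n ρ) := mN_const_mul h.qpos h.rpos mG _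
  have mdG : Measurable (fun x => δ * Gf n ρ x) := by fun_prop
  refine (mN_mono h.qpos h.rpos hpt).trans ?_
  refine (mN_add_le h.q1.le h.r1.le ((mX2.add ma).add mdG) mMin).trans (add_le_add ?_ le_rfl)
  refine (mN_add_le h.q1.le h.r1.le (mX2.add ma) mdG).trans (add_le_add ?_ eG.le)
  refine (mN_add_le h.q1.le h.r1.le mX2 ma).trans (add_le_add ?_ hNa)
  refine (hB _ (m3.diff m1)).trans ?_
  gcongr

end

section

lemma two_power {τ : ℝ} (hτ : 1 < τ) {μ : ℝ≥0∞} (h0 : μ ≠ 0) (h1 : μ ≤ 1)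
    (h : 1 ≤ μ ^ τ + (1 - μ) ^ τ) : μ = 1 := by
  by_contra hne
  have hlt : μ < 1 := lt_of_le_of_ne h1 hne
  have ht : μ ≠ ∞ := ne_top_of_lt hlt
  have a1 : μ ^ τ < μ := by
    conv_rhs => rw [← ENNReal.rpow_one μ]
    exact ENNReal.rpow_lt_rpow_of_exponent_gt (pos_iff_ne_zero.2 h0) hlt hτ
  have a2 : (1-μ) ^ τ ≤ 1 - μ := by
    conv_rhs => rw [← ENNReal.rpow_one (1-μ)]
    exact ENNReal.rpow_le_rpow_of_exponent_ge (by simp) hτ.le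
  have : μ ^ τ + (1 - μ) ^ τ < μ + (1 - μ) :=
    ENNReal.add_lt_add_of_lt_of_le (ne_top_of_le_ne_top (by simp) (a2.trans tsub_le_self)) a1 a2
  rw [add_tsub_cancel_of_le h1] at this
  exact absurd h this.not_ge

open Topology in
lemma tight {n : ℕ} {κ : ℝ} (h : Adm n κ) {A : ℝ≥0∞} (hA0 : A ≠ 0) (hAt : A ≠ ∞)
    (hA : ∀ f : Pt n → ℝ≥0∞, Measurable f → (∀ z, f z ≠ ∞) → ∫⁻ z, f z ^ (1-κ)⁻¹ ≤ 1 → Nm n κ (XE n f) ≤ A)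
    {f : ℕ → Pt n → ℝ≥0∞} (hf : ∀ j, Measurable (f j)) (hft : ∀ j z, f j z ≠ ∞) (hI : ∀ j, Ip κ (f j) ≤ 1)
    (hlim : Tendsto (fun j => Nm n κ (XE n (f j))) atTop (𝓝 A))
    {m : ℕ → ℝ≥0∞} (hm : ∀ ρ, Tendsto (fun j => Ip κ (tr ρ (f j))) atTop (𝓝 (m ρ)))
    (hpos : ∃ ρ, m ρ ≠ 0) : Tendsto m atTop (𝓝 1) := by
  have hk : 0 < 1 - κ := by linarith [h.half]
  obtain ⟨σ, hσ⟩ : ∃ σ, σ = min (qK n κ) (rK n κ) := ⟨_, rfl⟩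
  have hσp : (1-κ)⁻¹ < σ := by rw [hσ]; exact lt_min h.p_lt_q h.p_lt_r
  have hσ0 : 0 < σ := lt_trans (by positivity) hσp
  have hσq : σ ≤ qK n κ := by rw [hσ]; exact min_le_left _ _
  have hσr : σ ≤ rK n κ := by rw [hσ]; exact min_le_right _ _
  have hτ : 1 < (1-κ) * σ := by rw [inv_lt_iff_one_lt_mul₀ hk, mul_comm] at hσp; exact hσp
  have hmono : Monotone m := fun ρ ρ' hρ => le_of_tendsto_of_tendsto' (hm ρ) (hm ρ') fun j =>
    Ip_le hk (indicator_le_indicator_of_subset (inn_mono hρ _) (fun _ => zero_le))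
  have hm1 : ∀ ρ, m ρ ≤ 1 := fun ρ => le_of_tendsto' (hm ρ) fun j => (Ip_le hk (indicator_le_self _ _)).trans (hI j)
  obtain ⟨μ, hμ⟩ : ∃ μ, μ = ⨆ ρ, m ρ := ⟨_, rfl⟩
  have hmμ : Tendsto m atTop (𝓝 μ) := by rw [hμ]; exact tendsto_atTop_iSup hmono
  have hμ1 : μ ≤ 1 := by rw [hμ]; exact iSup_le hm1
  have hμ0 : μ ≠ 0 := by
    obtain ⟨ρ, hρ⟩ := hpos
    intro h0; rw [hμ] at h0; exact hρ (by simpa using ENNReal.iSup_eq_zero.1 h0 ρ)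
  suffices hs : μ = 1 by rw [← hs]; exact hmμ
  have cP : Continuous (fun x : ℝ≥0∞ => A * x ^ (1-κ)) :=
    (ENNReal.continuous_const_mul hAt).comp ENNReal.continuous_rpow_const
  have cS : Continuous (fun x : ℝ≥0∞ => (A * x ^ (1-κ)) ^ σ) := ENNReal.continuous_rpow_const.comp cP
  have cR : Continuous (fun x : ℝ≥0∞ => x ^ (1/σ)) := ENNReal.continuous_rpow_const
  -- inequality for the limits
  have s1 : ∀ ρ, ∀ ε : ℝ≥0∞, ε ≠ 0 → ε ≠ ∞ → A ≤ A * (μ - m ρ) ^ (1-κ) +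
      ((A * m ρ ^ (1-κ)) ^ σ + (A * (1 - μ) ^ (1-κ)) ^ σ) ^ (1/σ) + (ε + ε) := by
    intro ρ ε hε hεt
    obtain ⟨δ, hδ0, hδt, hδ⟩ : ∃ δ : ℝ≥0∞, δ ≠ 0 ∧ δ ≠ ∞ ∧ δ * Nm n κ (Gf n ρ) ≤ ε := by
      have hG := Nm_Gf h ρ
      refine ⟨ε / (Nm n κ (Gf n ρ) + 1), ?_, ?_, ?_⟩
      · rw [ENNReal.div_ne_zero]; exact ⟨hε, by simp [hG]⟩
      · exact (ENNReal.div_lt_top hεt (by simp)).ne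
      · refine (mul_le_mul_right (le_self_add (a := Nm n κ (Gf n ρ)) (b := 1)) _).trans ?_
        rw [ENNReal.div_mul_cancel (by simp) (by simp [hG])]
    obtain ⟨j0, hj0⟩ := VAN h ρ hδ0 hε
    have s2 : ∀ ρ' ≥ max ρ j0, A ≤ A * (m ρ' - m ρ) ^ (1-κ) +
        ((A * m ρ ^ (1-κ)) ^ σ + (A * (1 - m ρ') ^ (1-κ)) ^ σ) ^ (1/σ) + (ε + ε) := by
      intro ρ' hρ'
      have hρ1 : ρ ≤ ρ' := (le_max_left _ _).trans hρ'
      have hρ2 : j0 ≤ ρ' := (le_max_right _ _).trans hρ'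
      have hin : ∀ j, Nm n κ (XE n (f j)) ≤ A * (Ip κ (tr ρ' (f j)) - Ip κ (tr ρ (f j))) ^ (1-κ) +
        ((A * Ip κ (tr ρ (f j)) ^ (1-κ)) ^ σ + (A * (1 - Ip κ (tr ρ' (f j))) ^ (1-κ)) ^ σ) ^ (1/σ) + (ε + ε) := by
        intro j
        refine (split_ineq h hA hσ0 hσq hσr hρ1 hδ0 hδt (hf j) (hft j) (hI j)).trans ?_
        rw [add_assoc (_ + _) (δ * _) _]
        exact add_le_add le_rfl (add_le_add hδ (hj0 ρ' hρ2 (f j) (hf j) (hI j)))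
      refine le_of_tendsto_of_tendsto' hlim ?_ hin
      have l1 := ENNReal.Tendsto.sub (hm ρ') (hm ρ) (Or.inl (ne_top_of_le_ne_top (by simp) (hm1 ρ')))
      have l2 := ENNReal.Tendsto.sub (tendsto_const_nhds (x := (1:ℝ≥0∞))) (hm ρ') (Or.inl (by simp))
      exact ((cP.tendsto _ |>.comp l1).add (cR.tendsto _ |>.comp ((cS.tendsto _ |>.comp (hm ρ)).add (cS.tendsto _ |>.comp l2)))).add
        tendsto_const_nhds
    have l1 := ENNReal.Tendsto.sub hmμ (tendsto_const_nhds (x := m ρ)) (Or.inl (ne_top_of_le_ne_top (by simp) hμ1))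
    have l2 := ENNReal.Tendsto.sub (tendsto_const_nhds (x := (1:ℝ≥0∞))) hmμ (Or.inl (by simp))
    refine ge_of_tendsto (((cP.tendsto _ |>.comp l1).add (cR.tendsto _ |>.comp
      ((tendsto_const_nhds (x := (A * m ρ ^ (1-κ)) ^ σ)).add (cS.tendsto _ |>.comp l2)))).add
        (tendsto_const_nhds (x := ε + ε))) ?_
    filter_upwards [eventually_ge_atTop (max ρ j0)] with ρ' hρ' using s2 ρ' hρ'
  have s3 : ∀ ρ, A ≤ A * (μ - m ρ) ^ (1-κ) +
      ((A * m ρ ^ (1-κ)) ^ σ + (A * (1 - μ) ^ (1-κ)) ^ σ) ^ (1/σ) := by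
    intro ρ
    apply ENNReal.le_of_forall_pos_le_add
    intro ε hε _
    have := s1 ρ ((ε:ℝ≥0∞)/2) (by simp [hε.ne']) (by finiteness)
    rwa [ENNReal.add_halves] at this
  have s4 : A ≤ A * (μ - μ) ^ (1-κ) + ((A * μ ^ (1-κ)) ^ σ + (A * (1 - μ) ^ (1-κ)) ^ σ) ^ (1/σ) := by
    have l1 := ENNReal.Tendsto.sub (tendsto_const_nhds (x := μ)) hmμ (Or.inl (ne_top_of_le_ne_top (by simp) hμ1))
    exact ge_of_tendsto' ((cP.tendsto _ |>.comp l1).add (cR.tendsto _ |>.comp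
      ((cS.tendsto _ |>.comp hmμ).add tendsto_const_nhds))) s3
  rw [tsub_self, ENNReal.zero_rpow_of_pos hk, mul_zero, zero_add, one_div, ENNReal.le_rpow_inv_iff hσ0,
    ENNReal.mul_rpow_of_nonneg _ _ hσ0.le, ENNReal.mul_rpow_of_nonneg _ _ hσ0.le, ← mul_add, ← ENNReal.rpow_mul, ← ENNReal.rpow_mul] at s4
  refine two_power hτ hμ0 hμ1 ?_
  have hAs0 : A ^ σ ≠ 0 := by simp [ENNReal.rpow_eq_zero_iff, hA0, hσ0, hAt]
  have hAst : A ^ σ ≠ ∞ := ENNReal.rpow_ne_top_of_nonneg hσ0.le hAt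
  conv_lhs at s4 => rw [← mul_one (A ^ σ)]
  exact (ENNReal.mul_le_mul_iff_right hAs0 hAst).1 s4

end

section

open Topology in
lemma weak_seq {n : ℕ} {u : ℕ → ℕ → Pt n → ℝ} (hu : ∀ j ρ, MemLp (u j ρ) 2 volume) {R : ℕ → ℝ} (hR0 : ∀ ρ, 0 ≤ R ρ)
    (hR : ∀ j ρ, eLpNorm (u j ρ) 2 volume ≤ ENNReal.ofReal (R ρ)) :
    ∃ φ : ℕ → ℕ, StrictMono φ ∧ ∃ V : ℕ → Pt n → ℝ, (∀ ρ, Measurable (V ρ) ∧ MemLp (V ρ) 2 volume) ∧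
      ∀ ρ, ∀ g : Pt n → ℝ, MemLp g 2 volume →
        Tendsto (fun j => ∫ z, g z * u (φ j) ρ z) atTop (𝓝 (∫ z, g z * V ρ z)) := by
  have : Fact ((2:ℝ≥0∞) ≠ ∞) := ⟨by simp⟩
  let D := Lp ℝ 2 (volume : Measure (Pt n))
  let K : ℕ → Set (WeakDual ℝ D) := fun ρ => WeakDual.toStrongDual ⁻¹' Metric.closedBall 0 (R ρ)
  have hKc : ∀ ρ, IsCompact (K ρ) := fun ρ => WeakDual.isCompact_closedBall 0 (R ρ)
  have i1 : ∀ ρ, CompactSpace (K ρ) := fun ρ => isCompact_iff_compactSpace.1 (hKc ρ)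
  have i2 : ∀ ρ, TopologicalSpace.MetrizableSpace (K ρ) := fun ρ => WeakDual.metrizable_of_isCompact ℝ D (K ρ) (hKc ρ)
  let x : ℕ → ∀ ρ, K ρ := fun j ρ => ⟨StrongDual.toWeakDual (InnerProductSpace.toDual ℝ D ((hu j ρ).toLp (u j ρ))), by
    change InnerProductSpace.toDual ℝ D ((hu j ρ).toLp (u j ρ)) ∈ Metric.closedBall 0 (R ρ)
    rw [mem_closedBall_zero_iff, LinearIsometryEquiv.norm_map, Lp.norm_toLp]
    exact ENNReal.toReal_le_of_le_ofReal (hR0 ρ) (hR j ρ)⟩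
  obtain ⟨a, φ, hφ, hlim⟩ := CompactSpace.tendsto_subseq x
  let V : ℕ → D := fun ρ => (InnerProductSpace.toDual ℝ D).symm (WeakDual.toStrongDual (a ρ : WeakDual ℝ D))
  have hin : ∀ (v w : D), inner ℝ v w = ∫ z, w z * v z := fun v w => by
    rw [L2.inner_def]; rfl
  refine ⟨φ, hφ, fun ρ => (V ρ : Pt n → ℝ), fun ρ => ⟨(Lp.stronglyMeasurable (V ρ)).measurable, Lp.memLp (V ρ)⟩, fun ρ g hg => ?_⟩
  rw [tendsto_pi_nhds] at hlim
  have h1 : Tendsto (fun j => ((x (φ j) ρ : K ρ) : WeakDual ℝ D) (hg.toLp g)) atTop (𝓝 ((a ρ : WeakDual ℝ D) (hg.toLp g))) :=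
    ((WeakDual.eval_continuous (hg.toLp g)).comp continuous_subtype_val).tendsto _ |>.comp (hlim ρ)
  have e1 : ∀ j, ((x (φ j) ρ : K ρ) : WeakDual ℝ D) (hg.toLp g) = ∫ z, g z * u (φ j) ρ z := fun j => by
    have : ((x (φ j) ρ : K ρ) : WeakDual ℝ D) (hg.toLp g) = inner ℝ ((hu (φ j) ρ).toLp (u (φ j) ρ)) (hg.toLp g) := by
      rw [← InnerProductSpace.toDual_apply_apply]; rfl
    rw [this, hin]
    apply integral_congr_ae
    filter_upwards [hg.coeFn_toLp, (hu (φ j) ρ).coeFn_toLp] with z h1 h2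
    rw [h1, h2]
  have e2 : (a ρ : WeakDual ℝ D) (hg.toLp g) = ∫ z, g z * V ρ z := by
    have : (a ρ : WeakDual ℝ D) (hg.toLp g) = inner ℝ (V ρ) (hg.toLp g) := by
      rw [← InnerProductSpace.toDual_apply_apply]
      simp only [V, LinearIsometryEquiv.apply_symm_apply]; rfl
    rw [this, hin]
    apply integral_congr_ae
    filter_upwards [hg.coeFn_toLp] with z h1
    rw [h1]
  simp_rw [e1] at h1
  rw [e2] at h1
  exact h1

end

section

structure BI {n : ℕ} (g : Pt n → ℝ) : Prop where
  m : Measurable g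
  b : ∃ C, ∀ z, |g z| ≤ C
  i : Integrable g volume

def Tn {n : ℕ} (ν : Measure (Pt n)) (g : Pt n → ℝ) (z : Pt n) : ℝ := ∫ u, g (z + u) ∂ν

lemma pt_inv (n : ℕ) : (volume : Measure (Pt n)).IsAddRightInvariant := by
  rw [Measure.volume_eq_prod]; infer_instance

lemma Tn_bound {n : ℕ} (ν : Measure (Pt n)) [IsFiniteMeasure ν] {g : Pt n → ℝ} {C : ℝ} (h : ∀ z, |g z| ≤ C) (z : Pt n) :
    |Tn ν g z| ≤ C * ν.real univ := by
  unfold Tn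
  rw [← Real.norm_eq_abs]
  exact norm_integral_le_of_norm_le_const (Eventually.of_forall fun u => by rw [Real.norm_eq_abs]; exact h _)

lemma int_prod {n : ℕ} (ν : Measure (Pt n)) [IsFiniteMeasure ν] {g : Pt n → ℝ} (h : Integrable g volume) (hm : Measurable g) :
    Integrable (fun p : Pt n × Pt n => g (p.1 + p.2)) (volume.prod ν) := by
  have i1 := pt_inv n
  have hm2 : Measurable (fun p : Pt n × Pt n => g (p.1 + p.2)) := hm.comp measurable_add
  rw [integrable_prod_iff' hm2.aestronglyMeasurable]
  refine ⟨Eventually.of_forall fun u => h.comp_add_right u, ?_⟩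
  have : (fun y : Pt n => ∫ x : Pt n, ‖g (x + y)‖) = fun _ => ∫ x, ‖g x‖ := by
    ext y; exact integral_add_right_eq_self (fun x => ‖g x‖) y
  rw [this]; exact integrable_const _

lemma BI.T {n : ℕ} {g : Pt n → ℝ} (h : BI g) (ν : Measure (Pt n)) [IsFiniteMeasure ν] : BI (Tn ν g) := by
  have hm2 : Measurable (fun p : Pt n × Pt n => g (p.1 + p.2)) := h.m.comp measurable_add
  refine ⟨?_, ?_, ?_⟩
  · exact (StronglyMeasurable.integral_prod_right (f := fun z u => g (z + u)) hm2.stronglyMeasurable).measurable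
  · obtain ⟨C, hC⟩ := h.b
    exact ⟨_, Tn_bound ν hC⟩
  · exact (int_prod ν h.i h.m).integral_prod_left

lemma BI.mul {n : ℕ} {g l : Pt n → ℝ} (h : BI g) (h' : BI l) : BI (fun z => g z * l z) := by
  obtain ⟨C, hC⟩ := h.b
  obtain ⟨C', hC'⟩ := h'.b
  refine ⟨h.m.mul h'.m, ⟨C * C', fun z => ?_⟩, ?_⟩
  · rw [abs_mul]; exact mul_le_mul (hC z) (hC' z) (abs_nonneg _) ((abs_nonneg _).trans (hC z))
  · exact h'.i.bdd_mul h.m.aestronglyMeasurable (c := C) (Eventually.of_forall fun z => by rw [Real.norm_eq_abs]; exact hC z)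

lemma Tn_adj {n : ℕ} (ν : Measure (Pt n)) [IsFiniteMeasure ν] (hs : ∀ f : Pt n → ℝ, ∫ u, f (-u) ∂ν = ∫ u, f u ∂ν)
    {g l : Pt n → ℝ} (h : BI g) (h' : BI l) : ∫ z, Tn ν g z * l z = ∫ z, g z * Tn ν l z := by
  have i1 := pt_inv n
  have I1 : Integrable (fun p : Pt n × Pt n => g (p.1 + p.2) * l p.1) (volume.prod ν) := by
    obtain ⟨C, hC⟩ := h'.b
    exact (int_prod ν h.i h.m).mul_bdd (c := C) (h'.m.comp measurable_fst).aestronglyMeasurable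
      (Eventually.of_forall fun z => by rw [Real.norm_eq_abs]; exact hC _)
  have I2 : Integrable (fun p : Pt n × Pt n => g p.1 * l (p.1 + p.2)) (volume.prod ν) := by
    obtain ⟨C, hC⟩ := h.b
    exact (int_prod ν h'.i h'.m).bdd_mul (c := C) (h.m.comp measurable_fst).aestronglyMeasurable
      (Eventually.of_forall fun z => by rw [Real.norm_eq_abs]; exact hC _)
  calc ∫ z, Tn ν g z * l z = ∫ z, ∫ u, g (z + u) * l z ∂ν := by
        congr 1; ext z; rw [Tn, integral_mul_const]
    _ = ∫ u, ∫ z, g (z + u) * l z ∂volume ∂ν := integral_integral_swap (f := fun z u => g (z + u) * l z) I1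
    _ = ∫ u, ∫ z, g z * l (z + -u) ∂volume ∂ν := by
        congr 1; ext u
        rw [← integral_add_right_eq_self (fun z => g z * l (z + -u)) u]
        congr 1; ext z; simp
    _ = ∫ u, ∫ z, g z * l (z + u) ∂volume ∂ν := hs (fun u => ∫ z, g z * l (z + u) ∂volume)
    _ = ∫ z, ∫ u, g z * l (z + u) ∂ν := (integral_integral_swap (f := fun z u => g z * l (z + u)) I2).symm
    _ = _ := by congr 1; ext z; rw [Tn, integral_const_mul]

lemma BI.iter {n : ℕ} {g : Pt n → ℝ} (h : BI g) (ν : Measure (Pt n)) [IsFiniteMeasure ν] (m : ℕ) : BI ((Tn ν)^[m] g) := by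
  induction m with
  | zero => exact h
  | succ m ih => rw [Function.iterate_succ_apply']; exact ih.T ν

lemma Tn_adj_iter {n : ℕ} (ν : Measure (Pt n)) [IsFiniteMeasure ν] (hs : ∀ f : Pt n → ℝ, ∫ u, f (-u) ∂ν = ∫ u, f u ∂ν)
    (m : ℕ) {g l : Pt n → ℝ} (h : BI g) (h' : BI l) : ∫ z, (Tn ν)^[m] g z * l z = ∫ z, g z * (Tn ν)^[m] l z := by
  induction m generalizing l with
  | zero => rfl
  | succ m ih =>
    rw [Function.iterate_succ_apply', Tn_adj ν hs (h.iter ν m) h', ih (h'.T ν), ← Function.iterate_succ_apply]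

lemma Tn_sq {n : ℕ} (ν : Measure (Pt n)) [IsFiniteMeasure ν] (hs : ∀ f : Pt n → ℝ, ∫ u, f (-u) ∂ν = ∫ u, f u ∂ν)
    (m : ℕ) {g : Pt n → ℝ} (h : BI g) : ∫ z, (Tn ν)^[m] g z ^ 2 = ∫ z, g z * (Tn ν)^[2 * m] g z := by
  simp_rw [sq]
  rw [Tn_adj_iter ν hs m h (h.iter ν m), two_mul, Function.iterate_add_apply]

def nup {n : ℕ} (ν : Measure (Pt n)) : ℕ → Measure (Pt n)
  | 0 => Measure.dirac 0
  | m + 1 => ν.conv (nup ν m)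

lemma nup_fin {n : ℕ} (ν : Measure (Pt n)) [IsFiniteMeasure ν] (m : ℕ) : IsFiniteMeasure (nup ν m) := by
  induction m with
  | zero => unfold nup; infer_instance
  | succ m ih => unfold nup; infer_instance

lemma Tn_iter {n : ℕ} (ν : Measure (Pt n)) [IsFiniteMeasure ν] (m : ℕ) {g : Pt n → ℝ} (h : BI g) (z : Pt n) :
    (Tn ν)^[m] g z = ∫ u, g (z + u) ∂(nup ν m) := by
  induction m generalizing z with
  | zero => simp [nup]
  | succ m ih =>
    have := nup_fin ν m
    have := nup_fin ν (m+1)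
    have hI : Integrable (fun u => g (z + u)) (nup ν (m+1)) := by
      obtain ⟨C, hC⟩ := h.b
      exact Integrable.of_bound (h.m.comp (measurable_const_add z)).aestronglyMeasurable C
        (Eventually.of_forall fun z => by rw [Real.norm_eq_abs]; exact hC _)
    rw [Function.iterate_succ_apply', Tn]
    simp_rw [ih]
    change Integrable (fun u => g (z + u)) (ν.conv (nup ν m)) at hI
    change _ = ∫ u, g (z + u) ∂(ν.conv (nup ν m))
    rw [integral_conv hI]
    simp_rw [add_assoc]

lemma nup_ac_mono {n : ℕ} (ν : Measure (Pt n)) [IsFiniteMeasure ν] {m : ℕ} (h : nup ν m ≪ volume) {m' : ℕ} (hm : m ≤ m') :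
    nup ν m' ≪ volume := by
  induction m', hm using Nat.le_induction with
  | base => exact h
  | succ m' _ ih =>
    have := nup_fin ν m'
    have : (volume : Measure (Pt n)).IsAddLeftInvariant := by rw [Measure.volume_eq_prod]; infer_instance
    unfold nup
    exact Measure.conv_absolutelyContinuous ih

end

section

def lamR (ρ : ℝ) : Measure (ℝ × ℝ) := (volume.restrict (Icc (-(2*ρ)) (2*ρ))).prod (volume.withDensity wt)
def nuR (n : ℕ) (ρ : ℝ) : Measure (Pt n) := (lamR ρ).map (fun p => p.1 • vv n p.2)

lemma meas_smulvv (n : ℕ) : Measurable (fun p : ℝ × ℝ => p.1 • vv n p.2) := by fun_prop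

lemma wt_fin : IsFiniteMeasure ((volume : Measure ℝ).withDensity wt) := isFiniteMeasure_withDensity lintegral_wt
lemma lamR_fin (ρ : ℝ) : IsFiniteMeasure (lamR ρ) := by
  have := wt_fin
  unfold lamR; infer_instance
lemma nuR_fin (n : ℕ) (ρ : ℝ) : IsFiniteMeasure (nuR n ρ) := by
  have := lamR_fin ρ
  unfold nuR; infer_instance

lemma nuR_symm (n : ℕ) (ρ : ℝ) (f : Pt n → ℝ) : ∫ u, f (-u) ∂(nuR n ρ) = ∫ u, f u ∂(nuR n ρ) := by
  have := wt_fin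
  have m1 : MeasurePreserving (fun x : ℝ => -x) (volume.restrict (Icc (-(2*ρ)) (2*ρ))) (volume.restrict (Icc (-(2*ρ)) (2*ρ))) := by
    have := (Measure.measurePreserving_neg (volume : Measure ℝ)).restrict_preimage (s := Icc (-(2*ρ)) (2*ρ)) measurableSet_Icc
    have e : (Neg.neg ⁻¹' (Icc (-(2*ρ)) (2*ρ)) : Set ℝ) = Icc (-(2*ρ)) (2*ρ) := by ext x; simp [neg_le, and_comm]
    rwa [e] at this
  have m2 : MeasurePreserving (Prod.map (fun x : ℝ => -x) (id : ℝ → ℝ)) (lamR ρ) (lamR ρ) := m1.prod (MeasurePreserving.id _)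
  have e : (nuR n ρ).map Neg.neg = nuR n ρ := by
    unfold nuR
    rw [Measure.map_map measurable_neg (meas_smulvv n)]
    conv_rhs => rw [← m2.map_eq, Measure.map_map (meas_smulvv n) m2.measurable]
    congr 1; ext p <;> simp
  conv_rhs => rw [← e]
  exact (integral_map_equiv (MeasurableEquiv.neg (Pt n)) f).symm

lemma nuR_le {n : ℕ} (ρ : ℝ) {f : Pt n → ℝ≥0∞} (hf : Measurable f) :
    ∫⁻ u, f u ∂(nuR n ρ) ≤ ∫⁻ t : ℝ, ∫⁻ w : ℝ, f (w • vv n t) := by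
  have := wt_fin
  unfold nuR
  have hc : Measurable (fun p : ℝ × ℝ => f (p.1 • vv n p.2)) := hf.comp (meas_smulvv n)
  rw [lintegral_map hf (meas_smulvv n), lamR, lintegral_prod_symm _ hc.aemeasurable,
    lintegral_withDensity_eq_lintegral_mul _ measurable_wt]
  · refine lintegral_mono fun t => ?_
    simp only [Pi.mul_apply]
    calc _ ≤ 1 * ∫⁻ x : ℝ in Icc (-(2*ρ)) (2*ρ), f (x • vv n t) := by gcongr; exact wt_le_one t
      _ ≤ _ := by rw [one_mul]; exact setLIntegral_le_lintegral _ _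
  · exact (hf.comp (meas_smulvv n)).lintegral_prod_left'

def Jm (n : ℕ) (A : Set (Pt n)) (m : ℕ) (z : Pt n) : ℝ≥0∞ :=
  ∫⁻ τ : Fin m → ℝ, ∫⁻ ω : Fin m → ℝ, A.indicator 1 (z + ∑ i, ω i • vv n (τ i))

lemma meas_Jm {n : ℕ} {A : Set (Pt n)} (hA : MeasurableSet A) (m : ℕ) :
    Measurable (fun p : (Pt n × (Fin m → ℝ)) × (Fin m → ℝ) => A.indicator (1 : Pt n → ℝ≥0∞) (p.1.1 + ∑ i, p.2 i • vv n (p.1.2 i))) := by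
  have : Measurable (fun p : (Pt n × (Fin m → ℝ)) × (Fin m → ℝ) => p.1.1 + ∑ i, p.2 i • vv n (p.1.2 i)) := by fun_prop
  exact (measurable_one.indicator hA).comp this

lemma Jm_meas {n : ℕ} {A : Set (Pt n)} (hA : MeasurableSet A) (m : ℕ) : Measurable (Jm n A m) := by
  unfold Jm
  have h1 : Measurable (fun p : Pt n × (Fin m → ℝ) => ∫⁻ ω : Fin m → ℝ, A.indicator (1 : Pt n → ℝ≥0∞) (p.1 + ∑ i, ω i • vv n (p.2 i))) :=
    (meas_Jm hA m).lintegral_prod_right'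
  exact h1.lintegral_prod_right'

lemma Jm_succ {n : ℕ} {A : Set (Pt n)} (hA : MeasurableSet A) (m : ℕ) (z : Pt n) :
    Jm n A (m+1) z = ∫⁻ t : ℝ, ∫⁻ w : ℝ, Jm n A m (z + w • vv n t) := by
  unfold Jm
  have h1 : Measurable (fun p : (Fin (m+1) → ℝ) × (Fin (m+1) → ℝ) => A.indicator (1 : Pt n → ℝ≥0∞) (z + ∑ i, p.2 i • vv n (p.1 i))) := by
    have : Measurable (fun p : (Fin (m+1) → ℝ) × (Fin (m+1) → ℝ) => z + ∑ i, p.2 i • vv n (p.1 i)) := by fun_prop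
    exact (measurable_one.indicator hA).comp this
  rw [lintegral_fin_succ h1.lintegral_prod_right']
  congr 1; ext t
  have h2 : ∀ τ : Fin m → ℝ, (∫⁻ ω : Fin (m+1) → ℝ, A.indicator (1 : Pt n → ℝ≥0∞) (z + ∑ i, ω i • vv n ((Fin.cons t τ : Fin (m+1) → ℝ) i)))
      = ∫⁻ w : ℝ, ∫⁻ ω : Fin m → ℝ, A.indicator 1 (z + w • vv n t + ∑ i, ω i • vv n (τ i)) := fun τ => by
    rw [lintegral_fin_succ]
    · simp only [Fin.sum_univ_succ, Fin.cons_zero, Fin.cons_succ, add_assoc]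
    · have : Measurable (fun ω : Fin (m+1) → ℝ => z + ∑ i, ω i • vv n ((Fin.cons t τ : Fin (m+1) → ℝ) i)) := by fun_prop
      exact (measurable_one.indicator hA).comp this
  simp_rw [h2]
  rw [lintegral_lintegral_swap (f := fun (τ : Fin m → ℝ) (w : ℝ) => ∫⁻ ω : Fin m → ℝ, A.indicator 1 (z + w • vv n t + ∑ i, ω i • vv n (τ i)))]
  have h3 : Measurable (fun p : ((Fin m → ℝ) × ℝ) × (Fin m → ℝ) => A.indicator (1 : Pt n → ℝ≥0∞) (z + p.1.2 • vv n t + ∑ i, p.2 i • vv n (p.1.1 i))) := by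
    have : Measurable (fun p : ((Fin m → ℝ) × ℝ) × (Fin m → ℝ) => z + p.1.2 • vv n t + ∑ i, p.2 i • vv n (p.1.1 i)) := by fun_prop
    exact (measurable_one.indicator hA).comp this
  exact h3.lintegral_prod_right'.aemeasurable

lemma nup_le_Jm {n : ℕ} (ρ : ℝ) {A : Set (Pt n)} (hA : MeasurableSet A) (m : ℕ) (z : Pt n) :
    ∫⁻ u, A.indicator (1 : Pt n → ℝ≥0∞) (z + u) ∂(nup (nuR n ρ) m) ≤ Jm n A m z := by
  have := nuR_fin n ρ
  induction m generalizing z with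
  | zero => 
    simp only [nup, Jm, Finset.univ_eq_empty, Finset.sum_empty, lintegral_const]
    have hm : Measurable (fun u : Pt n => A.indicator (1 : Pt n → ℝ≥0∞) (z + u)) := (measurable_one.indicator hA).comp (measurable_const_add z)
    rw [lintegral_dirac' _ hm]
    simp [Measure.volume_pi_eq_dirac (0 : Fin 0 → ℝ)]
  | succ m ih =>
    have := nup_fin (nuR n ρ) m
    have hm : Measurable (fun u : Pt n => A.indicator (1 : Pt n → ℝ≥0∞) (z + u)) := (measurable_one.indicator hA).comp (measurable_const_add z)
    change ∫⁻ u, A.indicator (1 : Pt n → ℝ≥0∞) (z + u) ∂((nuR n ρ).conv (nup (nuR n ρ) m)) ≤ _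
    rw [Measure.lintegral_conv hm, Jm_succ hA]
    calc _ ≤ ∫⁻ u, Jm n A m (z + u) ∂(nuR n ρ) := lintegral_mono fun u => by
          simp_rw [← add_assoc]; exact ih (z + u)
      _ ≤ _ := nuR_le ρ ((Jm_meas hA m).comp (measurable_const_add z))

lemma VV_ae (m : ℕ) : ∀ᵐ x : Fin m → ℝ, VV x ≠ 0 := by
  have h : ∀ i j : Fin m, i ≠ j → ∀ᵐ x : Fin m → ℝ, x j - x i ≠ 0 := fun i j hij => by
    let L : (Fin m → ℝ) →ₗ[ℝ] ℝ := (LinearMap.proj j : (Fin m → ℝ) →ₗ[ℝ] ℝ) - (LinearMap.proj i : (Fin m → ℝ) →ₗ[ℝ] ℝ)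
    have hL : LinearMap.ker L ≠ ⊤ := fun h => by
      have : (Pi.single j 1 : Fin m → ℝ) ∈ LinearMap.ker L := by rw [h]; trivial
      simp [L, hij] at this
    have := Measure.addHaar_submodule volume (LinearMap.ker L) hL
    rw [ae_iff]
    convert this using 2
    ext x; simp [L]
  have h2 : ∀ᵐ x : Fin m → ℝ, ∀ i j : Fin m, i ≠ j → x j - x i ≠ 0 := by
    rw [ae_all_iff]; intro i; rw [ae_all_iff]; intro j
    by_cases hij : i = j
    · simp [hij]
    · filter_upwards [h i j hij] with x hx _ using hx
  filter_upwards [h2] with x hx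
  rw [VV_eq]
  refine Finset.prod_ne_zero_iff.2 fun i _ => Finset.prod_ne_zero_iff.2 fun j hj => ?_
  exact abs_ne_zero.2 (hx i j (Finset.mem_Ioi.1 hj).ne)

lemma nup_ac (n : ℕ) (ρ : ℝ) : nup (nuR n ρ) (n+1) ≪ volume := by
  refine Measure.AbsolutelyContinuous.mk fun A hA h0 => ?_
  have h1 := nup_le_Jm ρ hA (n+1) 0
  simp only [zero_add] at h1
  rw [lintegral_indicator_one hA] at h1
  refine le_antisymm (h1.trans ?_) zero_le
  rw [nonpos_iff_eq_zero]
  unfold Jm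
  rw [lintegral_eq_zero_iff']
  · filter_upwards [VV_ae (n+1)] with τ hτ
    have := MV2 0 τ hτ hA
    rw [h0, mul_zero] at this
    rw [← lintegral_indicator_one] at this
    · exact this
    · have hm : Measurable (fun ω : Fin (n+1) → ℝ => (0 : Pt n) + ∑ i, ω i • vv n (τ i)) := by fun_prop
      exact hm hA
  · have h3 : Measurable (fun p : (Fin (n+1) → ℝ) × (Fin (n+1) → ℝ) => A.indicator (1 : Pt n → ℝ≥0∞) (0 + ∑ i, p.2 i • vv n (p.1 i))) := by
      have : Measurable (fun p : (Fin (n+1) → ℝ) × (Fin (n+1) → ℝ) => (0 : Pt n) + ∑ i, p.2 i • vv n (p.1 i)) := by fun_prop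
      exact (measurable_one.indicator hA).comp this
    exact h3.lintegral_prod_right'.aemeasurable

end

section

open Topology in
lemma weakL1 {n : ℕ} {k : ℕ → Pt n → ℝ} (hk : ∀ j, Measurable (k j)) {C : ℝ} (hC : ∀ j z, |k j z| ≤ C)
    (hw : ∀ g : Pt n → ℝ, MemLp g 2 volume → Tendsto (fun j => ∫ z, g z * k j z) atTop (𝓝 0))
    {D : Pt n → ℝ} (hD : Integrable D volume) : Tendsto (fun j => ∫ z, D z * k j z) atTop (𝓝 0) := by
  have hC0 : 0 ≤ C := (abs_nonneg _).trans (hC 0 0)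
  rw [Metric.tendsto_atTop]
  intro ε hε
  obtain ⟨g, hg1, hg2, hg3, hg4⟩ := hD.exists_hasCompactSupport_integral_sub_le (ε := ε / (2 * (C + 1))) (by positivity)
  have h1 := Metric.tendsto_atTop.1 (hw g (hg3.memLp_of_hasCompactSupport hg1)) (ε / 2) (by positivity)
  obtain ⟨N, hN⟩ := h1
  refine ⟨N, fun j hj => ?_⟩
  have h2 := hN j hj
  rw [Real.dist_0_eq_abs] at h2 ⊢
  have bd : ∀ᵐ z, ‖k j z‖ ≤ C := Eventually.of_forall fun z => by rw [Real.norm_eq_abs]; exact hC j z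
  have i1 : Integrable (fun z => g z * k j z) volume := hg4.mul_bdd (hk j).aestronglyMeasurable bd
  have i2 : Integrable (fun z => D z * k j z) volume := hD.mul_bdd (hk j).aestronglyMeasurable bd
  have h3 : |∫ z, (D z * k j z - g z * k j z)| ≤ C * (ε / (2 * (C + 1))) := by
    calc _ ≤ ∫ z, |D z * k j z - g z * k j z| := abs_integral_le_integral_abs
      _ ≤ ∫ z, C * ‖D z - g z‖ := by
          refine integral_mono (i2.sub i1).abs ((hD.sub hg4).norm.const_mul C) fun z => ?_
          change |D z * k j z - g z * k j z| ≤ C * ‖D z - g z‖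
          rw [← sub_mul, abs_mul, mul_comm, Real.norm_eq_abs]
          gcongr; exact hC j z
      _ ≤ _ := by rw [integral_const_mul]; gcongr
  rw [integral_sub i2 i1] at h3
  have h4 : C * (ε / (2 * (C + 1))) < ε / 2 := by
    rw [show C * (ε / (2 * (C + 1))) = (ε/2) * (C / (C+1)) by field_simp]
    have : C / (C+1) < 1 := by rw [div_lt_one (by positivity)]; linarith
    nlinarith
  have h5 : |∫ z, D z * k j z| ≤ |∫ z, g z * k j z| + |(∫ z, D z * k j z) - ∫ z, g z * k j z| := by
    have := abs_add_le (∫ z, g z * k j z) ((∫ z, D z * k j z) - ∫ z, g z * k j z)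
    simpa using this
  linarith

open Topology in
lemma ac_ptwise {n : ℕ} {k : ℕ → Pt n → ℝ} (hk : ∀ j, Measurable (k j)) {C : ℝ} (hC : ∀ j z, |k j z| ≤ C)
    (hw : ∀ g : Pt n → ℝ, MemLp g 2 volume → Tendsto (fun j => ∫ z, g z * k j z) atTop (𝓝 0))
    {μ : Measure (Pt n)} [IsFiniteMeasure μ] (hμ : μ ≪ volume) (z : Pt n) :
    Tendsto (fun j => ∫ u, k j (z + u) ∂μ) atTop (𝓝 0) := by
  have i1 := pt_inv n
  have hD : Integrable (fun u => (μ.rnDeriv volume (u + -z)).toReal) volume :=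
    (Measure.integrable_toReal_rnDeriv (μ := μ) (ν := volume)).comp_add_right (-z)
  refine (weakL1 hk hC hw hD).congr fun j => ?_
  rw [← integral_rnDeriv_smul hμ]
  rw [← integral_add_right_eq_self _ z]
  congr 1; ext u
  simp [add_comm]

open Topology in
lemma amgm_lim {a b : ℕ → ℝ} {V : ℝ} (hV : 0 ≤ V) (ha : ∀ j, 0 ≤ a j) (h : ∀ j, ∀ δ > 0, a j ≤ δ * V + b j / δ)
    (hb : Tendsto b atTop (𝓝 0)) : Tendsto a atTop (𝓝 0) := by
  rw [Metric.tendsto_atTop]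
  intro ε hε
  have hδ : 0 < ε / (2 * (V + 1)) := by positivity
  set δ := ε / (2 * (V + 1)) with hd
  obtain ⟨N, hN⟩ := Metric.tendsto_atTop.1 hb (δ * (ε / 2)) (by positivity)
  refine ⟨N, fun j hj => ?_⟩
  have h1 := hN j hj
  rw [Real.dist_0_eq_abs] at h1 ⊢
  rw [abs_of_nonneg (ha j)]
  have h2 := h j δ hδ
  have h3 : b j / δ < ε / 2 := by rw [div_lt_iff₀ hδ]; linarith [le_abs_self (b j)]
  have h4 : δ * V ≤ ε / 2 := by
    have : δ * (2 * (V+1)) = ε := by rw [hd]; field_simp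
    nlinarith
  linarith

def XR (n : ℕ) (k : Pt n → ℝ) (x : Pt n) : ℝ := ∫ s : ℝ, k (s, x.2 + s • mom n x.1)

lemma measurable_XR {n : ℕ} {k : Pt n → ℝ} (hk : Measurable k) : Measurable (XR n k) := by
  unfold XR
  have : Measurable (fun p : Pt n × ℝ => k (p.2, p.1.2 + p.2 • mom n p.1.1)) := by fun_prop
  exact (StronglyMeasurable.integral_prod_right (f := fun (x : Pt n) (s : ℝ) => k (s, x.2 + s • mom n x.1)) this.stronglyMeasurable).measurable

lemma XR_pr {n : ℕ} (f : Pt n → ℝ) (t : ℝ) (z : Pt n) :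
    XR n f (t, pr n t z) = ∫ w : ℝ, f (z + w • vv n t) := by
  unfold XR
  rw [← integral_add_left_eq_self _ z.1]
  congr 1; ext s; congr 1
  ext i <;> simp [pr, vv]; ring

lemma int_lines {n : ℕ} {F : Pt n → ℝ} (hm : Measurable F) (hF : Integrable F volume) (t : ℝ) :
    Integrable (fun y => XR n F (t, y)) volume ∧ ∫ z, F z = ∫ y, XR n F (t, y) := by
  have hm2 : Measurable (fun p : (Fin n → ℝ) × ℝ => F (p.2, p.1 + p.2 • mom n t)) := by fun_prop
  have hI : Integrable (fun p : (Fin n → ℝ) × ℝ => F (p.2, p.1 + p.2 • mom n t)) (volume.prod volume) := by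
    refine ⟨hm2.aestronglyMeasurable, ?_⟩
    have := hF.2
    rw [hasFiniteIntegral_iff_enorm] at this ⊢
    rw [lintegral_prod _ hm2.enorm.aemeasurable]
    rw [lintegral_lines hm.enorm t] at this
    exact this
  refine ⟨hI.integral_prod_left, ?_⟩
  unfold XR
  rw [integral_integral_swap (f := fun (y : Fin n → ℝ) (s : ℝ) => F (s, y + s • mom n t)) hI]
  rw [Measure.volume_eq_prod] at hF ⊢
  rw [integral_prod _ hF]
  congr 1; ext s
  exact (integral_add_right_eq_self (fun y => F (s, y)) _).symm

end

section

lemma quad {n : ℕ} {k : Pt n → ℝ} (h : BI k) {ρ : ℝ} (hs : ∀ z, k z ≠ 0 → ‖z‖ ≤ ρ) :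
    ∫⁻ x, ‖XR n k x‖ₑ^2 * wt x.1 = ENNReal.ofReal (∫ z, k z * Tn (nuR n ρ) k z) := by
  obtain ⟨C, hC⟩ := h.b
  have f1 := wt_fin
  have f2 := lamR_fin ρ
  set wm := (volume : Measure ℝ).withDensity wt with hwm
  set Ir := (volume : Measure ℝ).restrict (Icc (-(2*ρ)) (2*ρ)) with hIr
  have hmk : Measurable (fun p : Pt n × (ℝ × ℝ) => k (p.1 + p.2.1 • vv n p.2.2)) := by
    have : Measurable (fun p : Pt n × (ℝ × ℝ) => p.1 + p.2.1 • vv n p.2.2) := by fun_prop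
    exact h.m.comp this
  have I0 : Integrable (fun p : Pt n × (ℝ × ℝ) => k p.1 * k (p.1 + p.2.1 • vv n p.2.2)) (volume.prod (lamR ρ)) :=
    (h.i.comp_fst (lamR ρ)).mul_bdd (c := C) hmk.aestronglyMeasurable
      (Eventually.of_forall fun z => by rw [Real.norm_eq_abs]; exact hC _)
  have It : ∀ t, Integrable (fun p : Pt n × ℝ => k p.1 * k (p.1 + p.2 • vv n t)) (volume.prod Ir) := fun t => by
    have : Measurable (fun p : Pt n × ℝ => p.1 + p.2 • vv n t) := by fun_prop
    exact (h.i.comp_fst Ir).mul_bdd (c := C) (h.m.comp this).aestronglyMeasurable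
      (Eventually.of_forall fun z => by rw [Real.norm_eq_abs]; exact hC _)
  have hIcc : ∀ t z, (∫ w : ℝ, k z * k (z + w • vv n t) ∂Ir) = k z * XR n k (t, pr n t z) := fun t z => by
    rw [XR_pr, integral_const_mul]
    by_cases hz : k z = 0
    · simp [hz]
    congr 1
    refine setIntegral_eq_integral_of_forall_compl_eq_zero fun w hw => ?_
    by_contra hne
    apply hw
    have h1 := (norm_fst_le _).trans (hs z hz)
    have h2 := (norm_fst_le _).trans (hs _ hne)
    simp only [vv, Prod.fst_add, Prod.smul_fst, smul_eq_mul, mul_one, Real.norm_eq_abs] at h1 h2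
    rw [abs_le] at h1 h2
    constructor <;> linarith
  let Q : ℝ → ℝ := fun t => ∫ z, k z * XR n k (t, pr n t z)
  have hQ : ∀ t, ∫ w : ℝ, ∫ z, k z * k (z + w • vv n t) ∂volume ∂Ir = Q t := fun t => by
    rw [← integral_integral_swap (f := fun (z : Pt n) (w : ℝ) => k z * k (z + w • vv n t)) (It t)]
    simp_rw [hIcc]; rfl
  have I1 : Integrable (fun p : ℝ × ℝ => ∫ z, k z * k (z + p.1 • vv n p.2)) (Ir.prod wm) := I0.integral_prod_right
  have I2 : Integrable Q wm := by
    have := I1.integral_prod_right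
    simp only [hQ] at this
    exact this
  have E1 : ∫ z, k z * Tn (nuR n ρ) k z = ∫ t, Q t ∂wm := by
    calc ∫ z, k z * Tn (nuR n ρ) k z = ∫ z, ∫ p, k z * k (z + p.1 • vv n p.2) ∂(lamR ρ) := by
          congr 1; ext z
          rw [integral_const_mul, Tn, nuR, integral_map (meas_smulvv n).aemeasurable]
          exact (h.m.comp (measurable_const_add z)).aestronglyMeasurable
      _ = ∫ p, ∫ z, k z * k (z + p.1 • vv n p.2) ∂volume ∂(lamR ρ) := integral_integral_swap (f := fun (z : Pt n) (p : ℝ × ℝ) => k z * k (z + p.1 • vv n p.2)) I0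
      _ = ∫ t, ∫ w : ℝ, ∫ z, k z * k (z + w • vv n t) ∂volume ∂Ir ∂wm := by
          rw [lamR, integral_prod_symm _ I1]
      _ = _ := by simp_rw [hQ]
  have hmX := measurable_XR (n := n) h.m
  have E2 : ∀ t, ∫⁻ y, ‖XR n k (t,y)‖ₑ^2 = ENNReal.ofReal (Q t) := fun t => by
    let F : Pt n → ℝ := fun z => k z * XR n k (t, pr n t z)
    have hFm : Measurable F := by
      have : Measurable (fun z : Pt n => XR n k (t, pr n t z)) := hmX.comp (by fun_prop)
      exact h.m.mul this
    have hFi : Integrable F volume := by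
      have := (It t).integral_prod_left
      simp only [hIcc] at this
      exact this
    have hF := int_lines hFm hFi t
    have e : ∀ y, XR n F (t, y) = XR n k (t,y)^2 := fun y => by
      conv_lhs => unfold XR
      simp only [F]
      have : ∀ s : ℝ, pr n t (s, y + s • mom n t) = y := fun s => by simp [pr]
      simp_rw [this]
      rw [integral_mul_const, sq]; rfl
    simp_rw [e] at hF
    change _ = ENNReal.ofReal (∫ z, F z)
    rw [hF.2, ofReal_integral_eq_lintegral_ofReal hF.1 (Eventually.of_forall fun y => sq_nonneg _)]
    congr 1; ext y
    rw [← sq_abs, ENNReal.ofReal_pow (abs_nonneg _), ← Real.enorm_eq_ofReal_abs]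
  have hQ0 : ∀ t, ENNReal.ofReal (Q t) = ENNReal.ofReal (Q t) := fun t => rfl
  have hQn : ∀ t, 0 ≤ Q t := fun t => by
    let F : Pt n → ℝ := fun z => k z * XR n k (t, pr n t z)
    have hFm : Measurable F := by
      have : Measurable (fun z : Pt n => XR n k (t, pr n t z)) := hmX.comp (by fun_prop)
      exact h.m.mul this
    have hFi : Integrable F volume := by
      have := (It t).integral_prod_left
      simp only [hIcc] at this
      exact this
    have hF := int_lines hFm hFi t
    have e : ∀ y, XR n F (t, y) = XR n k (t,y)^2 := fun y => by
      conv_lhs => unfold XR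
      simp only [F]
      have : ∀ s : ℝ, pr n t (s, y + s • mom n t) = y := fun s => by simp [pr]
      simp_rw [this]
      rw [integral_mul_const, sq]; rfl
    change 0 ≤ ∫ z, F z
    rw [hF.2]
    exact integral_nonneg fun y => by simp only [e]; exact sq_nonneg _
  rw [E1, ofReal_integral_eq_lintegral_ofReal I2 (Eventually.of_forall hQn)]
  have hm2 : Measurable (fun x : Pt n => ‖XR n k x‖ₑ^2) := by fun_prop
  have hm3 : Measurable (fun t : ℝ => ENNReal.ofReal (Q t)) := by
    simp_rw [← E2]
    exact hm2.lintegral_prod_right'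
  have hm4 : Measurable (fun x : Pt n => ‖XR n k x‖ₑ^2 * wt x.1) := hm2.mul (measurable_wt.comp measurable_fst)
  rw [lintegral_withDensity_eq_lintegral_mul _ measurable_wt hm3]
  rw [Measure.volume_eq_prod, lintegral_prod _ hm4.aemeasurable]
  congr 1; ext t
  simp only [Pi.mul_apply, ← E2]
  have hm5 : Measurable (fun y : Fin n → ℝ => ‖XR n k (t, y)‖ₑ^2) := by fun_prop
  rw [lintegral_mul_const _ hm5, mul_comm]

open Topology in
lemma LC {n : ℕ} {k : ℕ → Pt n → ℝ} (hk : ∀ j, Measurable (k j)) {C : ℝ} (hC : ∀ j z, |k j z| ≤ C)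
    {ρ : ℝ} (hs : ∀ j z, k j z ≠ 0 → ‖z‖ ≤ ρ)
    (hw : ∀ g : Pt n → ℝ, MemLp g 2 volume → Tendsto (fun j => ∫ z, g z * k j z) atTop (𝓝 0)) :
    Tendsto (fun j => ∫⁻ x, ‖XR n (k j) x‖ₑ^2 * wt x.1) atTop (𝓝 0) := by
  have hC0 : 0 ≤ C := (abs_nonneg _).trans (hC 0 0)
  have f1 := nuR_fin n ρ
  set ν := nuR n ρ with hν
  set B : Set (Pt n) := Metric.closedBall 0 ρ with hB
  have hBm : MeasurableSet B := Metric.isClosed_closedBall.measurableSet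
  have hBf : volume B ≠ ∞ := measure_closedBall_lt_top.ne
  have hout : ∀ j z, z ∉ B → k j z = 0 := fun j z hz => by
    by_contra h; exact hz (by simpa [hB] using hs j z h)
  have bi : ∀ j, BI (k j) := fun j => by
    refine ⟨hk j, ⟨C, hC j⟩, ?_⟩
    have : IntegrableOn (k j) B volume := Measure.integrableOn_of_bounded hBf (hk j).aestronglyMeasurable (M := C)
      (Eventually.of_forall fun z => by rw [Real.norm_eq_abs]; exact hC j z)
    exact this.integrable_of_forall_notMem_eq_zero (hout j)
  let P : ℕ → Prop := fun M => Tendsto (fun j => ∫ z in B, |(Tn ν)^[M] (k j) z|) atTop (𝓝 0)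
  have start : ∀ M, n + 1 ≤ M → P M := fun M hM => by
    have hac := nup_ac_mono ν (nup_ac n ρ) hM
    have f3 := nup_fin ν M
    have e0 : (0:ℝ) = ∫ z in B, (0:ℝ) := by simp
    change Tendsto _ _ _
    rw [e0]
    have f4 : IsFiniteMeasure (volume.restrict B) := ⟨by rw [Measure.restrict_apply_univ]; exact hBf.lt_top⟩
    refine tendsto_integral_of_dominated_convergence (fun _ => C * (nup ν M).real univ) ?_ ?_ ?_ ?_
    · intro j; exact ((bi j).iter ν M).m.abs.aestronglyMeasurable
    · exact integrable_const _
    · intro j; refine Eventually.of_forall fun z => ?_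
      rw [Real.norm_eq_abs, abs_abs, Tn_iter ν M (bi j), ← Real.norm_eq_abs]
      exact norm_integral_le_of_norm_le_const (Eventually.of_forall fun u => by rw [Real.norm_eq_abs]; exact hC _ _)
    · refine Eventually.of_forall fun z => ?_
      simp_rw [fun j => Tn_iter ν M (bi j)]
      have := (ac_ptwise hk hC hw hac z).abs
      simpa using this
  have kT : ∀ j M, |∫ z, k j z * (Tn ν)^[M] (k j) z| ≤ C * ∫ z in B, |(Tn ν)^[M] (k j) z| := fun j M => by
    have hT := (bi j).iter ν M
    have e : ∫ z, k j z * (Tn ν)^[M] (k j) z = ∫ z in B, k j z * (Tn ν)^[M] (k j) z :=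
      (setIntegral_eq_integral_of_forall_compl_eq_zero fun z hz => by rw [hout j z hz, zero_mul]).symm
    rw [e, ← integral_const_mul]
    refine abs_integral_le_integral_abs.trans (integral_mono ((bi j).mul hT).i.integrableOn.abs (hT.i.integrableOn.abs.const_mul C) fun z => ?_)
    simp only [abs_mul]
    gcongr; exact hC j z
  have desc : ∀ M, P (2 * M) → P M := fun M hM => by
    have hb : Tendsto (fun j => C * ∫ z in B, |(Tn ν)^[2*M] (k j) z|) atTop (𝓝 0) := by
      simpa using Tendsto.const_mul C hM
    refine amgm_lim (V := volume.real B) measureReal_nonneg (fun j => integral_nonneg fun z => abs_nonneg _) (fun j δ hδ => ?_) hb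
    have hT := (bi j).iter ν M
    have i2 : Integrable (fun z => (Tn ν)^[M] (k j) z ^ 2) volume := by simpa only [sq] using (hT.mul hT).i
    have f4 : IsFiniteMeasure (volume.restrict B) := ⟨by rw [Measure.restrict_apply_univ]; exact hBf.lt_top⟩
    calc ∫ z in B, |(Tn ν)^[M] (k j) z| ≤ ∫ z in B, (δ + (Tn ν)^[M] (k j) z ^ 2 / δ) := by
          refine integral_mono hT.i.integrableOn.abs ((integrable_const δ).add (i2.integrableOn.div_const δ)) fun z => ?_
          simp only
          set a := (Tn ν)^[M] (k j) z
          have : δ + a^2/δ - |a| = ((δ - |a|)^2 + δ * |a|) / δ := by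
            rw [← sq_abs a]; field_simp; ring
          have h0 : 0 ≤ ((δ - |a|)^2 + δ * |a|) / δ := by positivity
          linarith
      _ = δ * volume.real B + (∫ z in B, (Tn ν)^[M] (k j) z ^ 2) / δ := by
          rw [integral_add (integrable_const δ) (i2.integrableOn.div_const δ), integral_div]
          simp [mul_comm]
      _ ≤ δ * volume.real B + (C * ∫ z in B, |(Tn ν)^[2*M] (k j) z|) / δ := by
          gcongr
          calc _ ≤ ∫ z, (Tn ν)^[M] (k j) z ^ 2 := setIntegral_le_integral i2 (Eventually.of_forall fun z => sq_nonneg _)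
            _ = ∫ z, k j z * (Tn ν)^[2 * M] (k j) z := Tn_sq ν (nuR_symm n ρ) M (bi j)
            _ ≤ _ := (le_abs_self _).trans (kT j _)
  have all : ∀ I, P (2^I) → P 1 := fun I => by
    induction I with
    | zero => simp
    | succ I ih => intro h; exact ih (desc _ (by rwa [pow_succ, mul_comm] at h))
  have P1 : P 1 := all (n+1) (start _ Nat.lt_two_pow_self.le)
  have hfin : Tendsto (fun j => ENNReal.ofReal (C * ∫ z in B, |(Tn ν)^[1] (k j) z|)) atTop (𝓝 0) := by
    have := ENNReal.tendsto_ofReal (Tendsto.const_mul C P1)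
    simpa using this
  refine tendsto_of_tendsto_of_tendsto_of_le_of_le tendsto_const_nhds hfin (fun _ => zero_le) fun j => ?_
  simp only
  rw [quad (bi j) (hs j)]
  exact ENNReal.ofReal_le_ofReal ((le_abs_self _).trans (kT j 1))

end

section

lemma int_mul2 {n : ℕ} {g a : Pt n → ℝ} (hg : MemLp g 2 volume) (ha : MemLp a 2 volume) :
    Integrable (fun z => g z * a z) volume := hg.integrable_mul ha

open Topology in
lemma weak_mono {n : ℕ} {a b : ℕ → Pt n → ℝ} {a0 b0 : Pt n → ℝ} (ha : ∀ j, MemLp (a j) 2 volume) (hb : ∀ j, MemLp (b j) 2 volume)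
    (ha0 : MemLp a0 2 volume) (hb0 : MemLp b0 2 volume) (hab : ∀ j z, a j z ≤ b j z)
    (la : ∀ g : Pt n → ℝ, MemLp g 2 volume → Tendsto (fun j => ∫ z, g z * a j z) atTop (𝓝 (∫ z, g z * a0 z)))
    (lb : ∀ g : Pt n → ℝ, MemLp g 2 volume → Tendsto (fun j => ∫ z, g z * b j z) atTop (𝓝 (∫ z, g z * b0 z))) :
    a0 ≤ᵐ[volume] b0 := by
  let g : Pt n → ℝ := fun z => max (a0 z - b0 z) 0
  have hg : MemLp g 2 volume := (ha0.sub hb0).pos_part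
  have h1 : ∫ z, g z * a0 z ≤ ∫ z, g z * b0 z := le_of_tendsto_of_tendsto' (la g hg) (lb g hg) fun j => by
    refine integral_mono (hg.integrable_mul (ha j)) (hg.integrable_mul (hb j)) fun z => ?_
    exact mul_le_mul_of_nonneg_left (hab j z) (le_max_right _ _)
  have h2 : ∫ z, g z ^ 2 = 0 := by
    refine le_antisymm ?_ (integral_nonneg fun z => sq_nonneg _)
    have : ∫ z, g z ^ 2 = (∫ z, g z * a0 z) - ∫ z, g z * b0 z := by
      rw [← integral_sub (int_mul2 hg ha0) (int_mul2 hg hb0)]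
      congr 1; ext z
      simp only [g]
      rcases le_total (a0 z - b0 z) 0 with h | h
      · rw [max_eq_right h]; ring
      · rw [max_eq_left h]; ring
    linarith
  rw [integral_eq_zero_iff_of_nonneg (fun z => sq_nonneg _) hg.integrable_sq] at h2
  filter_upwards [h2] with z hz
  have hz' : g z = 0 := by simpa using hz
  have := le_max_left (a0 z - b0 z) 0
  simp only [g] at hz'
  linarith

structure Bd {n : ℕ} (ρ : ℕ) (F : Pt n → ℝ) : Prop where
  m : Measurable F
  n0 : ∀ z, 0 ≤ F z
  le : ∀ z, F z ≤ ρ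
  s : ∀ z, F z ≠ 0 → ‖z‖ ≤ ρ

lemma Bd.cle {n : ℕ} {ρ : ℕ} {F : Pt n → ℝ} (h : Bd ρ F) (z : Pt n) : F z ≤ (Metric.closedBall 0 (ρ:ℝ)).indicator (fun _ => (ρ:ℝ)) z := by
  by_cases hz : F z = 0
  · rw [hz]; exact indicator_nonneg (fun _ _ => by positivity) _
  · rw [indicator_of_mem (by simpa using h.s z hz)]; exact h.le z

lemma bdsupp_memLp {n : ℕ} {F : Pt n → ℝ} (hF : Measurable F) {C ρ : ℝ} (hC : ∀ z, |F z| ≤ C) (hs : ∀ z, F z ≠ 0 → ‖z‖ ≤ ρ) (p : ℝ≥0∞) :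
    MemLp F p volume := by
  have e : F = (Metric.closedBall 0 ρ).indicator F := by
    ext z
    by_cases hz : F z = 0
    · rw [hz]; by_cases h : z ∈ Metric.closedBall 0 ρ
      · rw [indicator_of_mem h, hz]
      · rw [indicator_of_notMem h]
    · rw [indicator_of_mem (by simpa using hs z hz)]
  rw [e, memLp_indicator_iff_restrict Metric.isClosed_closedBall.measurableSet]
  have : IsFiniteMeasure (volume.restrict (Metric.closedBall (0 : Pt n) ρ)) := ⟨by rw [Measure.restrict_apply_univ]; exact measure_closedBall_lt_top⟩
  exact MemLp.of_bound hF.aestronglyMeasurable C (Eventually.of_forall fun z => by rw [Real.norm_eq_abs]; exact hC z)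

lemma Bd.abs {n : ℕ} {ρ : ℕ} {F : Pt n → ℝ} (h : Bd ρ F) (z : Pt n) : |F z| ≤ ρ := by
  rw [abs_of_nonneg (h.n0 z)]; exact h.le z
lemma Bd.memLp {n : ℕ} {ρ : ℕ} {F : Pt n → ℝ} (h : Bd ρ F) (p : ℝ≥0∞) : MemLp F p volume :=
  bdsupp_memLp h.m h.abs h.s p

lemma Bd.line {n : ℕ} {ρ : ℕ} {F : Pt n → ℝ} (h : Bd ρ F) (x : Pt n) :
    Integrable (fun s : ℝ => F (s, x.2 + s • mom n x.1)) volume := by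
  have hm : Measurable (fun s : ℝ => F (s, x.2 + s • mom n x.1)) := h.m.comp (by fun_prop)
  have : IntegrableOn (fun s : ℝ => F (s, x.2 + s • mom n x.1)) (Metric.closedBall 0 (ρ:ℝ)) volume :=
    Measure.integrableOn_of_bounded measure_closedBall_lt_top.ne hm.aestronglyMeasurable (M := ρ)
      (Eventually.of_forall fun z => by rw [Real.norm_eq_abs]; exact h.abs _)
  refine this.integrable_of_forall_notMem_eq_zero fun s hs => ?_
  by_contra hne
  exact hs (by simpa using (norm_fst_le _).trans (h.s _ hne))

open Topology in
lemma local_conv {n : ℕ} {κ : ℝ} (h : Adm n κ) {ρ : ℕ} {u : ℕ → Pt n → ℝ} {V : Pt n → ℝ} (hu : ∀ j, Bd ρ (u j)) (hV : Bd ρ V)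
    (hw : ∀ g : Pt n → ℝ, MemLp g 2 volume → Tendsto (fun j => ∫ z, g z * u j z) atTop (𝓝 (∫ z, g z * V z))) :
    ∃ ε : ℕ → ℝ≥0∞, Tendsto ε atTop (𝓝 0) ∧ ∀ j, Nm n κ (XE n (fun z => ENNReal.ofReal (u j z))) ≤
      Nm n κ (XE n (fun z => ENNReal.ofReal (V z))) + ε j := by
  let k : ℕ → Pt n → ℝ := fun j z => u j z - V z
  have hk : ∀ j, Measurable (k j) := fun j => (hu j).m.sub hV.m
  have hkC : ∀ j z, |k j z| ≤ ρ := fun j z => by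
    rw [abs_le]
    constructor <;> simp only [k] <;> linarith [(hu j).n0 z, (hu j).le z, hV.n0 z, hV.le z]
  have hks : ∀ j z, k j z ≠ 0 → ‖z‖ ≤ (ρ:ℝ) := fun j z hz => by
    by_contra hc
    have h1 : u j z = 0 := by by_contra h'; exact hc ((hu j).s z h')
    have h2 : V z = 0 := by by_contra h'; exact hc (hV.s z h')
    simp [k, h1, h2] at hz
  have hkw : ∀ g : Pt n → ℝ, MemLp g 2 volume → Tendsto (fun j => ∫ z, g z * k j z) atTop (𝓝 0) := fun g hg => by
    have := (hw g hg).sub_const (∫ z, g z * V z)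
    rw [sub_self] at this
    refine this.congr fun j => ?_
    rw [← integral_sub (int_mul2 hg ((hu j).memLp 2)) (int_mul2 hg (hV.memLp 2))]
    simp only [k, mul_sub]
  have hLC := LC hk hkC hks hkw
  have hX := fun j => (measurable_XR (n := n) (hk j)).enorm
  refine ⟨fun j => Nm n κ (fun x => ‖XR n (k j) x‖ₑ), ?_, fun j => ?_⟩
  · refine DM h.qpos h.rpos hX (measurable_Gf n ρ) (fun j x => ?_) (Nm_Gf h ρ) (W := fun x => wt x.1) (measurable_wt.comp measurable_fst)
      (fun x => wt_ne_zero _) (e := 2) (by norm_num) ?_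
    · refine (enorm_integral_le_lintegral_enorm _).trans ?_
      unfold Gf XE
      refine lintegral_mono fun s => ?_
      set z : Pt n := (s, x.2 + s • mom n x.1)
      by_cases hz : k j z = 0
      · simp [hz]
      · rw [indicator_of_mem (by simpa using hks j z hz), Real.enorm_eq_ofReal_abs]
        exact (ENNReal.ofReal_le_ofReal (hkC j z)).trans (by simp)
    · simpa using hLC
  · have hVm : Measurable (fun z => ENNReal.ofReal (V z)) := hV.m.ennreal_ofReal
    refine le_trans (mN_mono h.qpos h.rpos (h := XE n (fun z => ENNReal.ofReal (V z)) + fun x => ‖XR n (k j) x‖ₑ) fun x => ?_)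
      (mN_add_le h.q1.le h.r1.le (measurable_XE hVm) (hX j))
    simp only [Pi.add_apply]
    unfold XE XR
    rw [← ofReal_integral_eq_lintegral_ofReal ((hu j).line x) (Eventually.of_forall fun s => (hu j).n0 _),
      ← ofReal_integral_eq_lintegral_ofReal (hV.line x) (Eventually.of_forall fun s => hV.n0 _), Real.enorm_eq_ofReal_abs,
      ← ENNReal.ofReal_add (integral_nonneg fun s => hV.n0 _) (abs_nonneg _)]
    apply ENNReal.ofReal_le_ofReal
    simp only [k]
    rw [integral_sub ((hu j).line x) (hV.line x)]
    linarith [le_abs_self ((∫ s : ℝ, u j (s, x.2 + s • mom n x.1)) - ∫ s : ℝ, V (s, x.2 + s • mom n x.1))]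

lemma Bd.rpow {n : ℕ} {ρ : ℕ} {F : Pt n → ℝ} (h : Bd ρ F) {e : ℝ} (he : 0 < e) (p : ℝ≥0∞) : MemLp (fun z => F z ^ e) p volume := by
  refine bdsupp_memLp (h.m.pow_const e) (C := (ρ:ℝ)^e) (ρ := ρ) (fun z => ?_) (fun z hz => h.s z ?_) p
  · rw [abs_of_nonneg (Real.rpow_nonneg (h.n0 z) e)]
    exact Real.rpow_le_rpow (h.n0 z) (h.le z) he.le
  · intro h0; rw [h0, Real.zero_rpow he.ne'] at hz; exact hz rfl

lemma Bd.lint {n : ℕ} {ρ : ℕ} {F : Pt n → ℝ} (h : Bd ρ F) {e : ℝ} (he : 0 < e) :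
    ∫⁻ z, ENNReal.ofReal (F z) ^ e = ENNReal.ofReal (∫ z, F z ^ e) := by
  rw [ofReal_integral_eq_lintegral_ofReal (memLp_one_iff_integrable.1 (h.rpow he 1)) (Eventually.of_forall fun z => Real.rpow_nonneg (h.n0 z) e)]
  congr 1; ext z
  exact ENNReal.ofReal_rpow_of_nonneg (h.n0 z) he.le

open Topology in
lemma weak_Lp {n : ℕ} {p : ℝ} (hp : 1 < p) {ρ : ℕ} {u : ℕ → Pt n → ℝ} {V : Pt n → ℝ} (hu : ∀ j, Bd ρ (u j)) (hV : Bd ρ V)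
    (hw : ∀ g : Pt n → ℝ, MemLp g 2 volume → Tendsto (fun j => ∫ z, g z * u j z) atTop (𝓝 (∫ z, g z * V z)))
    (h1 : ∀ j, ∫⁻ z, ENNReal.ofReal (u j z) ^ p ≤ 1) : ∫⁻ z, ENNReal.ofReal (V z) ^ p ≤ 1 := by
  have hp0 : 0 < p := by linarith
  rw [hV.lint hp0, ENNReal.ofReal_le_one]
  have h2 : ∀ j, ∫ z, u j z ^ p ≤ 1 := fun j => by
    have := h1 j
    rwa [(hu j).lint hp0, ENNReal.ofReal_le_one] at this
  have hq : p.HolderConjugate (p / (p-1)) := Real.HolderConjugate.conjExponent hp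
  have e1 : ∫ z, V z ^ p = ∫ z, V z ^ (p-1) * V z := by
    congr 1; ext z
    conv_lhs => rw [show p = (p-1)+1 by ring]
    rw [Real.rpow_add_of_nonneg (hV.n0 z) (by linarith) zero_le_one, Real.rpow_one]
  have hVp := memLp_one_iff_integrable.1 (hV.rpow hp0 1)
  have h3 : ∫ z, V z ^ p ≤ 1 / p + (∫ z, V z ^ p) / (p/(p-1)) := by
    conv_lhs => rw [e1]
    refine le_of_tendsto' (hw _ (hV.rpow (by linarith : 0 < p - 1) 2)) fun j => ?_
    have hup := memLp_one_iff_integrable.1 ((hu j).rpow hp0 1)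
    calc ∫ z, V z ^ (p-1) * u j z ≤ ∫ z, (u j z ^ p / p + V z ^ p / (p/(p-1))) := by
          refine integral_mono ((hV.rpow (by linarith : 0 < p - 1) 2).integrable_mul ((hu j).memLp 2))
            ((hup.div_const _).add (hVp.div_const _)) fun z => ?_
          have := Real.young_inequality_of_nonneg ((hu j).n0 z) (Real.rpow_nonneg (hV.n0 z) (p-1)) hq
          rw [← Real.rpow_mul (hV.n0 z), show (p-1) * (p/(p-1)) = p by field_simp [(by linarith : p - 1 ≠ 0)]] at this
          simp only
          linarith
      _ = (∫ z, u j z ^ p) / p + (∫ z, V z ^ p) / (p/(p-1)) := by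
          rw [integral_add (hup.div_const _) (hVp.div_const _), integral_div, integral_div]
      _ ≤ _ := by gcongr; exact h2 j
  set I := ∫ z, V z ^ p
  have h4 : I / (p/(p-1)) = I - I / p := by
    have : p - 1 ≠ 0 := by linarith
    field_simp
  rw [h4] at h3
  have h5 : I / p ≤ 1 / p := by linarith
  rwa [div_le_div_iff_of_pos_right hp0] at h5

end

section

def clampV {n : ℕ} (ρ : ℕ) (V : Pt n → ℝ) (z : Pt n) : ℝ := (Metric.closedBall (0 : Pt n) (ρ:ℝ)).indicator (fun z => max 0 (min (V z) ρ)) z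

lemma clampV_Bd {n : ℕ} (ρ : ℕ) {V : Pt n → ℝ} (hV : Measurable V) : Bd ρ (clampV ρ V) := by
  refine ⟨(measurable_const.max (hV.min measurable_const)).indicator Metric.isClosed_closedBall.measurableSet, fun z => ?_, fun z => ?_, fun z hz => ?_⟩
  · exact indicator_nonneg (fun _ _ => le_max_left _ _) _
  · unfold clampV
    refine indicator_le' (fun z _ => max_le (by positivity) (min_le_right _ _)) (fun _ _ => by simp) z
  · have := mem_of_indicator_ne_zero hz
    simpa using this

lemma tr_Bd {n : ℕ} (ρ : ℕ) {f : Pt n → ℝ≥0∞} (hf : Measurable f) : Bd ρ (fun z => (tr ρ f z).toReal) := by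
  refine ⟨(measurable_tr ρ hf).ennreal_toReal, fun z => ENNReal.toReal_nonneg, fun z => ?_, fun z hz => ?_⟩
  · refine ENNReal.toReal_le_of_le_ofReal (by positivity) ((tr_le ρ f z).trans ?_)
    refine (indicator_le_self' (fun _ _ => zero_le) z).trans (by simp)
  · by_contra hc
    have : tr ρ f z = 0 := indicator_of_notMem (fun h => hc h.1) _
    simp [this] at hz

lemma tr_ofReal {n : ℕ} (ρ : ℕ) {f : Pt n → ℝ≥0∞} (hft : ∀ z, f z ≠ ∞) : (fun z => ENNReal.ofReal (tr ρ f z).toReal) = tr ρ f := by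
  ext z
  apply ENNReal.ofReal_toReal
  unfold tr
  by_cases hz : z ∈ inn ρ f
  · rw [indicator_of_mem hz]; exact hft z
  · rw [indicator_of_notMem hz]; simp

lemma tr_mono_succ {n : ℕ} {ρ ρ' : ℕ} (h : ρ ≤ ρ') (f : Pt n → ℝ≥0∞) : tr ρ f ≤ tr ρ' f :=
  fun z => indicator_le_indicator_of_subset (inn_mono h f) (fun _ => zero_le) z

lemma tr_add_tl {n : ℕ} (ρ : ℕ) (f : Pt n → ℝ≥0∞) : tr ρ f + tl ρ f = f := indicator_self_add_compl _ _

lemma Ip_split {n : ℕ} {κ : ℝ} (hk : 0 < 1 - κ) (ρ : ℕ) {f : Pt n → ℝ≥0∞} (hf : Measurable f) :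
    Ip κ (tr ρ f) + Ip κ (tl ρ f) = Ip κ f := by
  unfold tr tl
  rw [Ip_indicator hk f (ms_inn ρ hf), Ip_indicator hk f (ms_inn ρ hf).compl]
  exact lintegral_add_compl _ (ms_inn ρ hf)

open Topology in
lemma extr_norm {n : ℕ} {κ : ℝ} (h : Adm n κ) {A : ℝ≥0∞} (hA0 : A ≠ 0) (hAt : A ≠ ∞)
    (hA : ∀ f : Pt n → ℝ≥0∞, Measurable f → (∀ z, f z ≠ ∞) → ∫⁻ z, f z ^ (1-κ)⁻¹ ≤ 1 → Nm n κ (XE n f) ≤ A)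
    {f : ℕ → Pt n → ℝ≥0∞} (hf : ∀ j, Measurable (f j)) (hft : ∀ j z, f j z ≠ ∞) (hI : ∀ j, Ip κ (f j) ≤ 1)
    (hlim : Tendsto (fun j => Nm n κ (XE n (f j))) atTop (𝓝 A))
    {m : ℕ → ℝ≥0∞} (hm : ∀ ρ, Tendsto (fun j => Ip κ (tr ρ (f j))) atTop (𝓝 (m ρ)))
    (hpos : ∃ ρ, m ρ ≠ 0) :
    ∃ F : Pt n → ℝ≥0∞, Measurable F ∧ (∀ z, F z ≠ ∞) ∧ Ip κ F = 1 ∧ Nm n κ (XE n F) = A := by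
  have hk : 0 < 1 - κ := by linarith [h.half]
  have hp : 1 < (1-κ)⁻¹ := h.one_lt_p
  have hp0 : 0 < (1-κ)⁻¹ := by linarith
  have hm1 := tight h hA0 hAt hA hf hft hI hlim hm hpos
  let u : ℕ → ℕ → Pt n → ℝ := fun j ρ z => (tr ρ (f j) z).toReal
  have huB : ∀ j ρ, Bd ρ (u j ρ) := fun j ρ => tr_Bd ρ (hf j)
  let b : ℕ → Pt n → ℝ := fun ρ => (Metric.closedBall (0 : Pt n) (ρ:ℝ)).indicator (fun _ => (ρ:ℝ))
  have hb : ∀ ρ, MemLp (b ρ) 2 volume := fun ρ => by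
    refine bdsupp_memLp (measurable_const.indicator Metric.isClosed_closedBall.measurableSet) (C := ρ) (ρ := ρ) (fun z => ?_) (fun z hz => ?_) 2
    · rw [abs_of_nonneg (indicator_nonneg (fun _ _ => by positivity) _)]
      exact indicator_le_self' (fun _ _ => by positivity) z
    · have := mem_of_indicator_ne_zero hz
      simpa using this
  obtain ⟨φ, hφ, V, hV, hw⟩ := weak_seq (u := u) (fun j ρ => (huB j ρ).memLp 2) (R := fun ρ => (eLpNorm (b ρ) 2 volume).toReal)
    (fun ρ => ENNReal.toReal_nonneg) (fun j ρ => by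
      rw [ENNReal.ofReal_toReal (hb ρ).2.ne]
      refine eLpNorm_mono_real fun z => ?_
      rw [Real.norm_eq_abs, abs_of_nonneg ((huB j ρ).n0 z)]
      exact (huB j ρ).cle z)
  have hVc : ∀ ρ, V ρ =ᵐ[volume] clampV ρ (V ρ) := fun ρ => by
    have l0 : (fun _ => (0:ℝ)) ≤ᵐ[volume] V ρ := weak_mono (a := fun _ _ => 0) (b := fun j => u (φ j) ρ) (fun j => by simp)
      (fun j => (huB _ ρ).memLp 2) (by simp) (hV ρ).2 (fun j z => (huB _ ρ).n0 z) (fun g hg => tendsto_const_nhds) (hw ρ)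
    have l1 : V ρ ≤ᵐ[volume] b ρ := weak_mono (b := fun _ => b ρ) (a := fun j => u (φ j) ρ) 
      (fun j => (huB _ ρ).memLp 2) (fun j => hb ρ) (hV ρ).2 (hb ρ) (fun j z => (huB _ ρ).cle z) (hw ρ) (fun g hg => tendsto_const_nhds)
    filter_upwards [l0, l1] with z h0 h1
    unfold clampV
    simp only [b] at h1
    by_cases hz : z ∈ Metric.closedBall (0 : Pt n) (ρ:ℝ)
    · rw [indicator_of_mem hz] at h1 ⊢
      rw [min_eq_left h1, max_eq_right h0]
    · rw [indicator_of_notMem hz] at h1 ⊢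
      exact le_antisymm h1 h0
  let W : ℕ → Pt n → ℝ := fun ρ => clampV ρ (V ρ)
  have hW : ∀ ρ, Bd ρ (W ρ) := fun ρ => clampV_Bd ρ (hV ρ).1
  have hwW : ∀ ρ, ∀ g : Pt n → ℝ, MemLp g 2 volume → Tendsto (fun j => ∫ z, g z * u (φ j) ρ z) atTop (𝓝 (∫ z, g z * W ρ z)) := fun ρ g hg => by
    have e : ∫ z, g z * W ρ z = ∫ z, g z * V ρ z := integral_congr_ae (by
      filter_upwards [hVc ρ] with z hz
      simp only [W]; rw [← hz])
    rw [e]; exact hw ρ g hg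
  have hWm : ∀ ρ, W ρ ≤ᵐ[volume] W (ρ+1) := fun ρ => by
    refine weak_mono (fun j => (huB (φ j) ρ).memLp 2) (fun j => (huB (φ j) (ρ+1)).memLp 2) ((hW ρ).memLp 2) ((hW _).memLp 2)
      (fun j z => ?_) (hwW ρ) (hwW (ρ+1))
    refine ENNReal.toReal_mono ?_ (tr_mono_succ (Nat.le_succ ρ) (f (φ j)) z)
    rw [← tr_ofReal (ρ+1) (hft (φ j))]; simp
  let E : ℕ → Pt n → ℝ≥0∞ := fun ρ z => ENNReal.ofReal (W ρ z)
  have hEm : ∀ ρ, Measurable (E ρ) := fun ρ => (hW ρ).m.ennreal_ofReal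
  have hEI : ∀ ρ, Ip κ (E ρ) ≤ 1 := fun ρ => by
    refine weak_Lp hp (fun j => huB (φ j) ρ) (hW ρ) (hwW ρ) fun j => ?_
    have : ∀ z, ENNReal.ofReal (u (φ j) ρ z) = tr ρ (f (φ j)) z := fun z => congrFun (tr_ofReal ρ (hft (φ j))) z
    simp_rw [this]
    exact (Ip_le hk (indicator_le_self' (fun _ _ => zero_le))).trans (hI (φ j))
  let F0 : Pt n → ℝ≥0∞ := fun z => ⨆ ρ, E ρ z
  have hF0 : Measurable F0 := Measurable.iSup hEm
  have hF0I : Ip κ F0 ≤ 1 := by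
    unfold Ip
    have e : ∀ z, F0 z ^ (1-κ)⁻¹ = ⨆ ρ, E ρ z ^ (1-κ)⁻¹ := fun z => (ENNReal.orderIsoRpow _ hp0).map_iSup _
    simp_rw [e]
    rw [lintegral_iSup_ae (fun ρ => (hEm ρ).pow_const _)]
    · exact iSup_le hEI
    · intro ρ
      filter_upwards [hWm ρ] with z hz
      exact ENNReal.rpow_le_rpow (ENNReal.ofReal_le_ofReal hz) hp0.le
  have hF0t : ∀ᵐ z, F0 z < ∞ := by
    have : ∀ᵐ z, F0 z ^ (1-κ)⁻¹ < ∞ := ae_lt_top (hF0.pow_const _) (hF0I.trans_lt one_lt_top).ne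
    filter_upwards [this] with z hz
    by_contra hc
    rw [not_lt, top_le_iff] at hc
    rw [hc, ENNReal.top_rpow_of_pos hp0] at hz
    exact lt_irrefl _ hz
  let F : Pt n → ℝ≥0∞ := {z | F0 z < ∞}.indicator F0
  have hF : Measurable F := hF0.indicator (measurableSet_lt hF0 measurable_const)
  have hFF : F =ᵐ[volume] F0 := by
    filter_upwards [hF0t] with z hz
    exact indicator_of_mem (s := {z | F0 z < ∞}) hz _
  have hFt : ∀ z, F z ≠ ∞ := fun z => by
    by_cases hz : F0 z < ∞
    · have : F z = F0 z := indicator_of_mem (s := {z | F0 z < ∞}) hz _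
      rw [this]; exact hz.ne
    · have : F z = 0 := indicator_of_notMem (s := {z | F0 z < ∞}) hz _
      rw [this]; simp
  have hFI : Ip κ F ≤ 1 := by
    refine le_trans (le_of_eq ?_) hF0I
    exact lintegral_congr_ae (by filter_upwards [hFF] with z hz; rw [hz])
  have hNF : Nm n κ (XE n F) = Nm n κ (XE n F0) := Nm_congr_ae h hF hF0 hFF
  have key : ∀ ρ, A ≤ Nm n κ (XE n F0) + A * (1 - m ρ) ^ (1-κ) := fun ρ => by
    obtain ⟨ε, hε, hεj⟩ := local_conv h (fun j => huB (φ j) ρ) (hW ρ) (hwW ρ)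
    have b1 : ∀ j, Nm n κ (XE n (f (φ j))) ≤ Nm n κ (XE n F0) + ε j + A * (1 - Ip κ (tr ρ (f (φ j)))) ^ (1-κ) := fun j => by
      have hs := Ip_split hk ρ (hf (φ j))
      have htr1 : Ip κ (tr ρ (f (φ j))) ≤ 1 := (le_self_add.trans hs.le).trans (hI _)
      have htl : Ip κ (tl ρ (f (φ j))) ≤ 1 - Ip κ (tr ρ (f (φ j))) := by
        refine ENNReal.le_sub_of_add_le_left (htr1.trans_lt one_lt_top).ne ?_
        rw [hs]; exact hI _
      have htlt : ∀ z, tl ρ (f (φ j)) z ≠ ∞ := fun z => by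
        have h1 : tl ρ (f (φ j)) z ≤ f (φ j) z := indicator_le_self' (fun _ _ => zero_le) z
        exact (h1.trans_lt (hft _ _).lt_top).ne
      have e1 : XE n (f (φ j)) = XE n (tr ρ (f (φ j))) + XE n (tl ρ (f (φ j))) := by
        rw [← XE_add (measurable_tr ρ (hf _)), tr_add_tl]
      have b2 : Nm n κ (XE n (f (φ j))) ≤ Nm n κ (XE n (tr ρ (f (φ j)))) + Nm n κ (XE n (tl ρ (f (φ j)))) := by
        rw [e1]
        exact mN_add_le h.q1.le h.r1.le (measurable_XE (measurable_tr ρ (hf _))) (measurable_XE (measurable_tl ρ (hf _)))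
      have b3 : Nm n κ (XE n (tr ρ (f (φ j)))) ≤ Nm n κ (XE n (E ρ)) + ε j := by
        have := hεj j
        rw [show (fun z => ENNReal.ofReal (u (φ j) ρ z)) = tr ρ (f (φ j)) from tr_ofReal ρ (hft (φ j))] at this
        exact this
      have b4 : Nm n κ (XE n (E ρ)) ≤ Nm n κ (XE n F0) :=
        mN_mono h.qpos h.rpos (XE_mono fun z => le_iSup (fun ρ => E ρ z) ρ)
      have b5 : Nm n κ (XE n (tl ρ (f (φ j)))) ≤ A * (Ip κ (tl ρ (f (φ j)))) ^ (1-κ) :=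
        hom_bound h hA (measurable_tl ρ (hf _)) htlt ((htl.trans tsub_le_self).trans_lt one_lt_top).ne
      refine b2.trans (add_le_add (b3.trans (by gcongr)) (b5.trans ?_))
      gcongr
    have l1 : Tendsto (fun j => Nm n κ (XE n F0) + ε j + A * (1 - Ip κ (tr ρ (f (φ j)))) ^ (1-κ)) atTop
        (𝓝 (Nm n κ (XE n F0) + 0 + A * (1 - m ρ) ^ (1-κ))) := by
      refine Tendsto.add (tendsto_const_nhds.add hε) ?_
      refine ENNReal.Tendsto.const_mul ?_ (Or.inr hAt)
      refine Filter.Tendsto.ennrpow_const _ ?_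
      exact ENNReal.Tendsto.sub tendsto_const_nhds ((hm ρ).comp hφ.tendsto_atTop) (Or.inl one_ne_top)
    have := le_of_tendsto_of_tendsto' (hlim.comp hφ.tendsto_atTop) l1 b1
    simpa using this
  have hge : A ≤ Nm n κ (XE n F0) := by
    have l2 : Tendsto (fun ρ => Nm n κ (XE n F0) + A * (1 - m ρ) ^ (1-κ)) atTop (𝓝 (Nm n κ (XE n F0) + A * (1 - 1) ^ (1-κ))) := by
      refine tendsto_const_nhds.add ?_
      refine ENNReal.Tendsto.const_mul ?_ (Or.inr hAt)
      refine Filter.Tendsto.ennrpow_const _ ?_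
      exact ENNReal.Tendsto.sub tendsto_const_nhds hm1 (Or.inl one_ne_top)
    have := ge_of_tendsto' l2 key
    simpa [hk] using this
  have hNA : Nm n κ (XE n F) = A := le_antisymm (hA F hF hFt hFI) (by rw [hNF]; exact hge)
  refine ⟨F, hF, hFt, le_antisymm hFI ?_, hNA⟩
  by_contra hc
  rw [not_le] at hc
  have h1 := hom_bound h hA hF hFt (hFI.trans_lt one_lt_top).ne
  rw [hNA] at h1
  have h2 : Ip κ F ^ (1-κ) < 1 := ENNReal.rpow_lt_one hc hk
  have h3 : A * Ip κ F ^ (1-κ) < A * 1 := ENNReal.mul_lt_mul_right hA0 hAt h2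
  rw [mul_one] at h3
  exact absurd (h1.trans_lt h3) (lt_irrefl _)

end

section

lemma Ip_tr_ge {n : ℕ} {κ : ℝ} (hk : 0 < 1 - κ) {g : Pt n → ℝ≥0∞} (hg : Measurable g) {ρ : ℝ} {R : ℕ}
    (hR : ρ ≤ R) (hR2 : 2 ≤ R) {c : ℝ≥0∞}
    (hc : c ≤ volume ({z | 1 ≤ g z ∧ g z ≤ 2} ∩ Metric.closedBall 0 ρ)) : c ≤ Ip κ (tr R g) := by
  refine hc.trans ?_
  have hS : MeasurableSet ({z | 1 ≤ g z ∧ g z ≤ 2} ∩ Metric.closedBall (0 : Pt n) ρ) :=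
    ((measurableSet_le measurable_const hg).inter (measurableSet_le hg measurable_const)).inter
      Metric.isClosed_closedBall.measurableSet
  rw [← lintegral_indicator_one hS]
  refine lintegral_mono fun z => ?_
  by_cases hz : z ∈ ({z | 1 ≤ g z ∧ g z ≤ 2} ∩ Metric.closedBall (0 : Pt n) ρ)
  · rw [indicator_of_mem hz]
    have h1 : 1 ≤ g z ∧ g z ≤ 2 := hz.1
    have h2 : ‖z‖ ≤ ρ := by simpa using hz.2
    have hin : z ∈ inn R g := by
      refine ⟨h2.trans hR, h1.2.trans ?_⟩
      exact_mod_cast hR2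
    have : tr R g z = g z := indicator_of_mem hin _
    simp only [this, Pi.one_apply]
    exact ENNReal.one_le_rpow h1.1 (inv_pos.2 hk)
  · rw [indicator_of_notMem hz]; exact zero_le

open Topology in
lemma extr_seq {n : ℕ} {κ : ℝ} (h : Adm n κ) {A : ℝ≥0∞} (hA0 : A ≠ 0) (hAt : A ≠ ∞)
    (hA : ∀ f : Pt n → ℝ≥0∞, Measurable f → (∀ z, f z ≠ ∞) → ∫⁻ z, f z ^ (1-κ)⁻¹ ≤ 1 → Nm n κ (XE n f) ≤ A)
    {f : ℕ → Pt n → ℝ≥0∞} (hf : ∀ j, Measurable (f j)) (hft : ∀ j z, f j z ≠ ∞) (hI : ∀ j, Ip κ (f j) ≤ 1)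
    (hlim : Tendsto (fun j => Nm n κ (XE n (f j))) atTop (𝓝 A)) :
    ∃ F : Pt n → ℝ≥0∞, Measurable F ∧ (∀ z, F z ≠ ∞) ∧ Ip κ F = 1 ∧ Nm n κ (XE n F) = A := by
  have hk : 0 < 1 - κ := by linarith [h.half]
  have hhalf : A / 2 < A := ENNReal.half_lt_self hA0 hAt
  have hev := (hlim.eventually (lt_mem_nhds hhalf))
  obtain ⟨N, hN⟩ := eventually_atTop.1 hev
  obtain ⟨ρ, c₁, hρ, hc₁, hp⟩ := propN h (c := A / 2) (by simp [hA0])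
  have hex := fun j : ℕ => hp (f (j + N)) (hf _) (hft _) (hI _) (hN (j + N) (by omega)).le
  choose g hg hgt hgI hgN hgv using hex
  obtain ⟨R, hR⟩ := exists_nat_ge (max ρ 2)
  have hR1 : ρ ≤ R := (le_max_left _ _).trans hR
  have hR2 : 2 ≤ R := by exact_mod_cast (le_max_right ρ 2).trans hR
  have hge : ∀ j, ENNReal.ofReal c₁ ≤ Ip κ (tr R (g j)) := fun j => Ip_tr_ge hk (hg j) hR1 hR2 (hgv j)
  obtain ⟨m, φ, hφ, hm⟩ := CompactSpace.tendsto_subseq (fun j => (fun ρ : ℕ => Ip κ (tr ρ (g j)) : ℕ → ℝ≥0∞))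
  have hm' := tendsto_pi_nhds.1 hm
  have hlim' : Tendsto (fun j => Nm n κ (XE n (g (φ j)))) atTop (𝓝 A) := by
    have h1 : Tendsto (fun j => Nm n κ (XE n (f (j + N)))) atTop (𝓝 A) := (tendsto_add_atTop_iff_nat N).2 hlim
    have h2 := h1.comp hφ.tendsto_atTop
    refine h2.congr fun j => ?_
    exact (hgN (φ j)).symm
  refine extr_norm h hA0 hAt hA (fun j => hg (φ j)) (fun j => hgt (φ j)) (fun j => ?_) hlim' (m := m) (fun ρ => hm' ρ) ⟨R, ?_⟩
  · exact (hgI (φ j)).le.trans (hI _)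
  · have : ENNReal.ofReal c₁ ≤ m R := ge_of_tendsto' (hm' R) fun j => hge (φ j)
    intro h0
    rw [h0] at this
    have := ENNReal.ofReal_eq_zero.1 (le_antisymm this zero_le)
    linarith

lemma exists_unit {n : ℕ} {κ : ℝ} (hk : 0 < 1 - κ) : ∃ F : Pt n → ℝ≥0∞, Measurable F ∧ (∀ z, F z ≠ ∞) ∧ Ip κ F = 1 := by
  have hS : MeasurableSet (Icc (0:ℝ) 1 ×ˢ Icc (0 : Fin n → ℝ) 1) := measurableSet_Icc.prod measurableSet_Icc
  refine ⟨(Icc (0:ℝ) 1 ×ˢ Icc (0 : Fin n → ℝ) 1).indicator 1, measurable_one.indicator hS, fun z => ?_, ?_⟩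
  · by_cases hz : z ∈ (Icc (0:ℝ) 1 ×ˢ Icc (0 : Fin n → ℝ) 1)
    · rw [indicator_of_mem hz]; simp
    · rw [indicator_of_notMem hz]; simp
  · have hv : volume (Icc (0:ℝ) 1 ×ˢ Icc (0 : Fin n → ℝ) 1) = 1 := by
      rw [Measure.volume_eq_prod, Measure.prod_prod, Real.volume_Icc, Real.volume_Icc_pi]
      simp
    rw [← hv, ← lintegral_indicator_one hS]
    refine lintegral_congr fun z => ?_
    by_cases hz : z ∈ (Icc (0:ℝ) 1 ×ˢ Icc (0 : Fin n → ℝ) 1)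
    · rw [indicator_of_mem hz]; simp
    · rw [indicator_of_notMem hz]; simp [ENNReal.zero_rpow_of_pos (inv_pos.2 hk), hk]

lemma extr_main {n : ℕ} {κ : ℝ} (h : Adm n κ) : ∃ F : Pt n → ℝ≥0∞, Measurable F ∧ (∀ z, F z ≠ ∞) ∧ Ip κ F = 1 ∧
    ∀ f : Pt n → ℝ≥0∞, Measurable f → (∀ z, f z ≠ ∞) → Ip κ f ≤ 1 → Nm n κ (XE n f) ≤ Nm n κ (XE n F) := by
  have hk : 0 < 1 - κ := by linarith [h.half]
  obtain ⟨C, hC, hb⟩ := strong_bdd h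
  obtain ⟨G, hG, hGt, hGI⟩ := exists_unit (n := n) hk
  set S : Set ℝ≥0∞ := (fun f : Pt n → ℝ≥0∞ => Nm n κ (XE n f)) ''
    {f | Measurable f ∧ (∀ z, f z ≠ ∞) ∧ Ip κ f ≤ 1} with hS
  have hA : ∀ f : Pt n → ℝ≥0∞, Measurable f → (∀ z, f z ≠ ∞) → Ip κ f ≤ 1 → Nm n κ (XE n f) ≤ sSup S :=
    fun f h1 h2 h3 => le_sSup ⟨f, ⟨h1, h2, h3⟩, rfl⟩
  have hAt : sSup S ≠ ∞ := by
    refine ne_top_of_le_ne_top hC (sSup_le ?_)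
    rintro _ ⟨f, ⟨h1, h2, h3⟩, rfl⟩
    exact hb f h1 h2 h3
  by_cases hA0 : sSup S = 0
  · exact ⟨G, hG, hGt, hGI, fun f h1 h2 h3 => (hA f h1 h2 h3).trans (by rw [hA0]; exact zero_le)⟩
  obtain ⟨u, -, hu, huS⟩ := exists_seq_tendsto_sSup (S := S) ⟨_, G, ⟨hG, hGt, hGI.le⟩, rfl⟩ (OrderTop.bddAbove S)
  choose f hf hfu using huS
  obtain ⟨F, h1, h2, h3, h4⟩ := extr_seq h hA0 hAt hA (f := f) (fun j => (hf j).1) (fun j => (hf j).2.1) (fun j => (hf j).2.2)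
    (hu.congr fun j => (hfu j).symm)
  exact ⟨F, h1, h2, h3, fun f a b c => (hA f a b c).trans h4.ge⟩

end

/-- existence of extremizers. -/
theorem extremizer_exists (d : ℕ) (hd : 3 ≤ d) (θ : ℝ) (hθ : θ ∈ Set.Ioo (0:ℝ) 1) :
    ∃ f : Pt (d-1) → ℝ, Measurable f ∧ 0 ≤ f ∧ srcNorm d θ f = 1 ∧
      XNorm d θ f = Aconst d θ := by
  obtain ⟨h0, h1⟩ := hθ
  have hd' : (3:ℝ) ≤ d := by exact_mod_cast hd
  have hn : ((d-1 : ℕ) : ℝ) = d - 1 := by rw [Nat.cast_sub (by omega)]; simp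
  have hd2 : (0:ℝ) < d + 2 := by linarith
  have hdm : (0:ℝ) < d - 1 := by linarith
  set κ : ℝ := 2 * θ / (d + 2) with hκ
  have h : Adm (d-1) κ := by
    refine ⟨by omega, by positivity, ?_⟩
    rw [hn, hκ, show (d:ℝ) - 1 + 3 = d + 2 by ring]
    exact (div_lt_div_iff_of_pos_right hd2).2 (by linarith)
  have hp : pExp d θ = (1-κ)⁻¹ := by
    unfold pExp; rw [hκ]; congr 1; field_simp; ring
  have hq : qExp d θ = qK (d-1) κ := by
    unfold qExp qK; rw [hκ, hn]; field_simp; ring_nf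
  have hr : rExp d θ = rK (d-1) κ := by
    unfold rExp rK; rw [hκ, hn, show (d:ℝ)^2 + d - 2 = (d+2)*(d-1) by ring]; congr 1; field_simp; ring
  have hk : 0 < 1 - κ := by linarith [h.half]
  have hsrc : ∀ f : Pt (d-1) → ℝ, 0 ≤ f → (srcNorm d θ f = 1 ↔ Ip κ (fun z => ENNReal.ofReal (f z)) = 1) := by
    intro f hf
    have e : srcNorm d θ f = (Ip κ (fun z => ENNReal.ofReal (f z))) ^ (1-κ) := by
      unfold srcNorm LpN Ip
      rw [hp, one_div, inv_inv]
      congr 1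
      refine lintegral_congr fun z => ?_
      rw [abs_of_nonneg (hf z)]
    rw [e]
    constructor
    · intro hh
      have := congrArg (fun x : ℝ≥0∞ => x ^ (1-κ)⁻¹) hh
      simpa [ENNReal.rpow_rpow_inv hk.ne'] using this
    · intro hh; rw [hh, ENNReal.one_rpow]
  have hX : ∀ f : Pt (d-1) → ℝ, XNorm d θ f = Nm (d-1) κ (XE (d-1) (fun z => ENNReal.ofReal (f z))) := by
    intro f
    unfold XNorm
    rw [hq, hr]
    rfl
  obtain ⟨F, hF, hFt, hFI, hmax⟩ := extr_main h
  have hFe : (fun z => ENNReal.ofReal ((F z).toReal)) = F := funext fun z => ENNReal.ofReal_toReal (hFt z)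
  have hF0 : (0 : Pt (d-1) → ℝ) ≤ fun z => (F z).toReal := fun z => ENNReal.toReal_nonneg
  have hFs : srcNorm d θ (fun z => (F z).toReal) = 1 := (hsrc _ hF0).2 (by rw [hFe]; exact hFI)
  refine ⟨fun z => (F z).toReal, hF.ennreal_toReal, hF0, hFs, le_antisymm ?_ ?_⟩
  · exact le_sSup ⟨_, hF.ennreal_toReal, hF0, hFs, rfl⟩
  · refine sSup_le ?_
    rintro _ ⟨f, hf, hf0, hfs, rfl⟩
    rw [hX, hX, hFe]
    exact hmax _ hf.ennreal_ofReal (fun z => ENNReal.ofReal_ne_top) ((hsrc f hf0).1 hfs).le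

end
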